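/- Let q ≥ 2 be an integer and let β > q. Set c(β,q) = (2·log(1/F′(a)))⁻¹, where a is the unique fixed point of the drift function F in (1/q, 1]. Then the Swendsen–Wang dynamics for the mean-field q-state ferromagnetic Potts model on n vertices exhibits cutoff at c(β,q)·log n with cutoff window Θ(1): for every ε ∈ (0,1) there exists a constant C(ε) > 0 such that for all sufficiently large n, c(β,q)·log n − C(ε) ≤ τ_mix(ε) ≤ c(β,q)·log n + C(ε). -/

import Mathlib

open scoped Classical
open Finset

/-- Spin configurations on `n` vertices with `q` spins. -/
abbrev Conf (n q : ℕ) := Fin n → Fin q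

/-- Number of vertices assigned spin `j`. -/
def cntN {n q : ℕ} (X : Conf n q) (j : Fin q) : ℕ :=
  (Finset.univ.filter (fun v => X v = j)).card

/-- Number of monochromatic pairs `{u,v}` (`u < v`, same spin). -/
def numMono {n q : ℕ} (σ : Conf n q) : ℕ :=
  (Finset.univ.filter (fun p : Fin n × Fin n => p.1 < p.2 ∧ σ p.1 = σ p.2)).card

/-- The mean-field `q`-state Potts measure: probability of `σ`. -/
noncomputable def pottsProb (n q : ℕ) (β : ℝ) (σ : Conf n q) : ℝ :=
  Real.exp (β / n * numMono σ) / ∑ τ : Conf n q, Real.exp (β / n * numMono τ)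

/-- The set of monochromatic pairs of a configuration. -/
def monoPairs {n q : ℕ} (σ : Conf n q) : Finset (Fin n × Fin n) :=
  Finset.univ.filter (fun p : Fin n × Fin n => p.1 < p.2 ∧ σ p.1 = σ p.2)

/-- The graph on `Fin n` whose edges are the pairs in `E`. -/
def graphOf {n : ℕ} (E : Finset (Fin n × Fin n)) : SimpleGraph (Fin n) :=
  SimpleGraph.fromRel (fun u v => (u, v) ∈ E)

/-- Number of connected components of the graph `(V, E)`. -/
noncomputable def numComps {n : ℕ} (E : Finset (Fin n × Fin n)) : ℕ :=
  Nat.card (graphOf E).ConnectedComponent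

/-- One-step transition probability of the Swendsen–Wang dynamics:
percolate on monochromatic pairs with probability `p = 1 - exp (-β/n)`,
then color each connected component uniformly at random. -/
noncomputable def swStep (n q : ℕ) (β : ℝ) (σ τ : Conf n q) : ℝ :=
  ∑ E ∈ (monoPairs σ).powerset,
    ((1 - Real.exp (-(β / n))) ^ E.card *
        Real.exp (-(β / n)) ^ ((monoPairs σ).card - E.card)) *
      (if ∀ u v : Fin n, (graphOf E).Reachable u v → τ u = τ v then
        ((q : ℝ))⁻¹ ^ numComps E else 0)

/-- `t`-step transition probability of the Swendsen–Wang dynamics. -/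
noncomputable def swProb (n q : ℕ) (β : ℝ) : ℕ → Conf n q → Conf n q → ℝ
  | 0, σ, τ => if σ = τ then 1 else 0
  | t + 1, σ, τ => ∑ η : Conf n q, swStep n q β σ η * swProb n q β t η τ

/-- Probability of observing the trajectory `ω 0, ω 1, …, ω (ℓ-1)` at times
`1, …, ℓ` for the SW dynamics started at `X₀`. -/
noncomputable def pathProb (n q : ℕ) (β : ℝ) (X₀ : Conf n q) (ℓ : ℕ)
    (ω : Fin ℓ → Conf n q) : ℝ :=
  ∏ i : Fin ℓ, swStep n q β
    (if _h : 0 < (i : ℕ) then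
        ω ⟨(i : ℕ) - 1, lt_of_le_of_lt (Nat.sub_le _ _) i.isLt⟩
      else X₀) (ω i)

/-- Total variation distance between two probability vectors on configurations. -/
noncomputable def tvDist {n q : ℕ} (f g : Conf n q → ℝ) : ℝ :=
  (∑ τ : Conf n q, |f τ - g τ|) / 2

/-- Mixing time `τ_mix(ε)` of the SW dynamics. -/
noncomputable def mixingTime (n q : ℕ) (β ε : ℝ) : ℕ :=
  sInf {t : ℕ | ∀ σ : Conf n q, tvDist (swProb n q β t σ) (pottsProb n q β) ≤ ε}

/-- `theta lam` is the unique root in `(0,1)` of `exp (-lam * x) = 1 - x`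
for `lam > 1`, and `0` for `lam ≤ 1`. -/
noncomputable def theta (lam : ℝ) : ℝ :=
  if lam ≤ 1 then 0
  else sSup {x : ℝ | x ∈ Set.Ioo (0 : ℝ) 1 ∧ Real.exp (-lam * x) = 1 - x}

/-- The drift function `F`. -/
noncomputable def F (q : ℕ) (β : ℝ) (x : ℝ) : ℝ :=
  1 / q + (1 - 1 / q) * theta (β * x) * x

/-- The unique fixed point of `F` in `(1/q, 1]` (for `β > q`). -/
noncomputable def aFix (q : ℕ) (β : ℝ) : ℝ :=
  sSup {x : ℝ | x ∈ Set.Ioc (1 / (q : ℝ)) 1 ∧ F q β x = x}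

/-- The cutoff constant `c(β,q) = (2 log (1 / F'(a)))⁻¹`. -/
noncomputable def cConst (q : ℕ) (β : ℝ) : ℝ :=
  (2 * Real.log (1 / deriv (F q β) (aFix q β)))⁻¹

/-- Fraction of vertices assigned spin `j`. -/
noncomputable def cntFrac {n q : ℕ} (X : Conf n q) : Fin q → ℝ :=
  fun j => (cntN X j : ℝ) / n

/-- The proportions vector `α(X)`: fractions of vertices of each spin,
sorted in nonincreasing order. -/
noncomputable def alphaVec {n q : ℕ} (X : Conf n q) : Fin q → ℝ :=
  fun i => cntFrac X (Tuple.sort (cntFrac X) i.rev)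

/-- `ℓ∞` distance between two vectors indexed by `Fin q`. -/
noncomputable def linf {q : ℕ} (f g : Fin q → ℝ) : ℝ :=
  ⨆ i : Fin q, |f i - g i|

/-- The vector `κ(b) = (b, (1-b)/(q-1), …, (1-b)/(q-1))`. -/
noncomputable def kappaVec (q : ℕ) (b : ℝ) : Fin q → ℝ :=
  fun i => if (i : ℕ) = 0 then b else (1 - b) / ((q : ℝ) - 1)

/-- The majority vector `m = (a, (1-a)/(q-1), …, (1-a)/(q-1))`. -/
noncomputable def mVec (q : ℕ) (β : ℝ) : Fin q → ℝ :=
  kappaVec q (aFix q β)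

/-- Index of the most common spin of `X` (least such index on ties). -/
noncomputable def domIdx {n q : ℕ} (X : Conf n q) : ℕ :=
  sInf {j : ℕ | ∃ hj : j < q, ∀ j' : Fin q, cntN X j' ≤ cntN X ⟨j, hj⟩}

/-- `α₁(X)`: fraction of vertices carrying the most common spin of `X`. -/
noncomputable def alpha1 {n q : ℕ} (X : Conf n q) : ℝ :=
  ((Finset.univ.filter (fun v : Fin n => (X v : ℕ) = domIdx X)).card : ℝ) / n

/-- `α_{1,k}(X)`: fraction of vertices of `Vk` carrying the most common spin of `X`. -/
noncomputable def alpha1In {n q : ℕ} (X : Conf n q) (Vk : Finset (Fin n)) : ℝ :=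
  ((Vk.filter (fun v => (X v : ℕ) = domIdx X)).card : ℝ) / Vk.card

/-- `P` is a partition of the vertex set into `q` classes. -/
def IsPartition {n q : ℕ} (P : Fin q → Finset (Fin n)) : Prop :=
  (∀ i j, i ≠ j → Disjoint (P i) (P j)) ∧ ∀ v : Fin n, ∃ i, v ∈ P i

/-- A `λ`-partition: a partition with all classes of size at least `λ n`. -/
def IsLamPartition {n q : ℕ} (lam : ℝ) (P : Fin q → Finset (Fin n)) : Prop :=
  IsPartition P ∧ ∀ i, lam * n ≤ ((P i).card : ℝ)

/-- Projection: `projCnt P X i j` is the number of vertices of `P i`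
assigned spin `j` in `X`. -/
def projCnt {n q : ℕ} (P : Fin q → Finset (Fin n)) (X : Conf n q) :
    Fin q → Fin q → ℕ :=
  fun i j => ((P i).filter (fun v => X v = j)).card

/-- All potential edges of the complete graph on `Fin n`. -/
def allPairs (n : ℕ) : Finset (Fin n × Fin n) :=
  Finset.univ.filter (fun p : Fin n × Fin n => p.1 < p.2)

/-- Probability of the edge set `E` under the Erdős–Rényi measure `G(n,p)`. -/
noncomputable def erProb (n : ℕ) (p : ℝ) (E : Finset (Fin n × Fin n)) : ℝ :=
  p ^ E.card * (1 - p) ^ ((allPairs n).card - E.card)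

/-- Size of the connected component of `v` in the graph `(V, E)`. -/
noncomputable def compCard {n : ℕ} (E : Finset (Fin n × Fin n)) (v : Fin n) : ℕ :=
  (Finset.univ.filter (fun u => (graphOf E).Reachable v u)).card

/-- `L₁`: size of the largest connected component. -/
noncomputable def L1 {n : ℕ} (E : Finset (Fin n × Fin n)) : ℕ :=
  Finset.univ.sup (fun v => compCard E v)

/-- Sum of the squares of the component sizes, `Σ_j L_j²`
(computed as `Σ_v |C(v)|`). -/
noncomputable def sumCompSq {n : ℕ} (E : Finset (Fin n × Fin n)) : ℕ :=
  ∑ v : Fin n, compCard E v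

/-- Expectation of `f` under the Erdős–Rényi measure `G(n,p)`. -/
noncomputable def erExp (n : ℕ) (p : ℝ) (f : Finset (Fin n × Fin n) → ℝ) : ℝ :=
  ∑ E ∈ (allPairs n).powerset, erProb n p E * f E

/-- Random-cluster weight of an edge set with parameters `q`, `p = 1 - exp (-β/n)`. -/
noncomputable def rcWeight (n q : ℕ) (β : ℝ) (E : Finset (Fin n × Fin n)) : ℝ :=
  (1 - Real.exp (-(β / n))) ^ E.card *
    Real.exp (-(β / n)) ^ ((allPairs n).card - E.card) * (q : ℝ) ^ numComps E

/-- The mean-field random-cluster measure: probability of the edge set `E`. -/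
noncomputable def rcProb (n q : ℕ) (β : ℝ) (E : Finset (Fin n × Fin n)) : ℝ :=
  rcWeight n q β E / ∑ B ∈ (allPairs n).powerset, rcWeight n q β B

namespace SW

/-! ### Positive normalized functionals -/

/-- A positive normalized linear functional on real functions which only sees the set `S`. -/
structure IsExp {Ω : Type*} (S : Set Ω) (L : (Ω → ℝ) → ℝ) : Prop where
  add : ∀ f g, L (fun x => f x + g x) = L f + L g
  smul : ∀ (c : ℝ) f, L (fun x => c * f x) = c * L f
  mono : ∀ f g, (∀ x ∈ S, f x ≤ g x) → L f ≤ L g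
  one : L (fun _ => 1) = 1

/-- Indicator of a proposition, as a real number. -/
noncomputable def ind (P : Prop) : ℝ := if P then 1 else 0

lemma ind_nonneg (P : Prop) : 0 ≤ ind P := by unfold ind; split_ifs <;> norm_num
lemma ind_le_one (P : Prop) : ind P ≤ 1 := by unfold ind; split_ifs <;> norm_num
lemma ind_true {P : Prop} (h : P) : ind P = 1 := by simp [ind, h]
lemma ind_false {P : Prop} (h : ¬P) : ind P = 0 := by simp [ind, h]
lemma ind_not (P : Prop) : ind (¬P) = 1 - ind P := by by_cases h : P <;> simp [ind, h]
lemma ind_mono {P Q : Prop} (h : P → Q) : ind P ≤ ind Q := by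
  by_cases hP : P
  · rw [ind_true hP, ind_true (h hP)]
  · rw [ind_false hP]; exact ind_nonneg _
lemma ind_or_le (P Q : Prop) : ind (P ∨ Q) ≤ ind P + ind Q := by
  by_cases hP : P <;> by_cases hQ : Q <;> simp [ind, hP, hQ]
lemma ind_le_div {a x : ℝ} (ha : 0 < a) (hx : 0 ≤ x) : ind (a ≤ x) ≤ x / a := by
  by_cases h : a ≤ x
  · rw [ind_true h, le_div_iff₀ ha]; linarith
  · rw [ind_false h]; positivity

namespace IsExp

variable {Ω : Type*} {S : Set Ω} {L : (Ω → ℝ) → ℝ}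

lemma congr (h : IsExp S L) {f g : Ω → ℝ} (hfg : ∀ x ∈ S, f x = g x) : L f = L g :=
  le_antisymm (h.mono _ _ fun x hx => (hfg x hx).le) (h.mono _ _ fun x hx => (hfg x hx).ge)

lemma const (h : IsExp S L) (c : ℝ) : L (fun _ => c) = c := by
  have := h.smul c (fun _ => 1)
  simpa [h.one] using this

lemma sub (h : IsExp S L) (f g : Ω → ℝ) : L (fun x => f x - g x) = L f - L g := by
  have h1 := h.add (fun x => f x - g x) g
  simp only [sub_add_cancel] at h1
  linarith [show L f = L (fun x => f x) from rfl]

lemma mul_const (h : IsExp S L) (f : Ω → ℝ) (c : ℝ) : L (fun x => f x * c) = L f * c := by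
  rw [mul_comm (L f), ← h.smul]; simp only [mul_comm]

lemma add_const (h : IsExp S L) (f : Ω → ℝ) (c : ℝ) : L (fun x => f x + c) = L f + c := by
  rw [h.add, h.const]

lemma sum (h : IsExp S L) {ι : Type*} (s : Finset ι) (f : ι → Ω → ℝ) :
    L (fun x => ∑ i ∈ s, f i x) = ∑ i ∈ s, L (f i) := by
  induction s using Finset.induction_on with
  | empty => simpa using h.const 0
  | insert a s ha ih => simp only [Finset.sum_insert ha]; rw [h.add, ih]

lemma nonneg (h : IsExp S L) {f : Ω → ℝ} (hf : ∀ x ∈ S, 0 ≤ f x) : 0 ≤ L f := by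
  have := h.mono (fun _ => 0) f hf
  rwa [h.const] at this

lemma le_const (h : IsExp S L) {f : Ω → ℝ} {c : ℝ} (hf : ∀ x ∈ S, f x ≤ c) : L f ≤ c := by
  have := h.mono f (fun _ => c) hf
  rwa [h.const] at this

lemma const_le (h : IsExp S L) {f : Ω → ℝ} {c : ℝ} (hf : ∀ x ∈ S, c ≤ f x) : c ≤ L f := by
  have := h.mono (fun _ => c) f hf
  rwa [h.const] at this

lemma abs_le (h : IsExp S L) (f : Ω → ℝ) : |L f| ≤ L (fun x => |f x|) := by
  rw [_root_.abs_le]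
  refine ⟨?_, h.mono _ _ fun x _ => le_abs_self _⟩
  have := h.mono (fun x => (-1) * |f x|) f fun x _ => by linarith [neg_abs_le (f x)]
  rw [h.smul] at this
  linarith

lemma markov (h : IsExp S L) {X : Ω → ℝ} (hX : ∀ x ∈ S, 0 ≤ X x) {a : ℝ} (ha : 0 < a) :
    L (fun x => ind (a ≤ X x)) ≤ L X / a := by
  have := h.mono (fun x => ind (a ≤ X x)) (fun x => X x * a⁻¹)
    fun x hx => by rw [← div_eq_mul_inv]; exact ind_le_div ha (hX x hx)
  rwa [h.mul_const, ← div_eq_mul_inv] at this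

lemma chebyshev (h : IsExp S L) (X : Ω → ℝ) {a : ℝ} (ha : 0 < a) :
    L (fun x => ind (a ≤ |X x|)) ≤ L (fun x => X x ^ 2) / a ^ 2 := by
  refine le_trans (h.mono _ (fun x => ind (a ^ 2 ≤ X x ^ 2)) fun x _ => ind_mono fun hx => ?_)
    (h.markov (fun x _ => sq_nonneg _) (by positivity))
  rw [← sq_abs (X x)]
  gcongr

/-- The first absolute moment is controlled by the second moment. -/
lemma abs_le_of_sq (h : IsExp S L) (X : Ω → ℝ) {s : ℝ} (hs : 0 < s)
    (hX : L (fun x => X x ^ 2) ≤ s ^ 2) : L (fun x => |X x|) ≤ s := by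
  have h1 : L (fun x => |X x|) ≤ L (fun x => (1 / (2 * s)) * X x ^ 2 + s / 2) := by
    refine h.mono _ _ fun x _ => ?_
    rw [← sq_abs (X x)]
    have : (1 / (2 * s)) * |X x| ^ 2 + s / 2 - |X x| = (|X x| - s) ^ 2 / (2 * s) := by
      field_simp; ring
    have h2 : 0 ≤ (|X x| - s) ^ 2 / (2 * s) := by positivity
    linarith
  rw [h.add_const, h.smul] at h1
  have h3 : (1 / (2 * s)) * L (fun x => X x ^ 2) ≤ (1 / (2 * s)) * s ^ 2 := by gcongr
  have h4 : (1 / (2 * s)) * s ^ 2 = s / 2 := by field_simp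
  linarith

end IsExp

/-! ### Bernoulli random subsets -/

section bern

variable {α : Type*} [DecidableEq α] {p : ℝ}

/-- Expectation of `f E` when `E ⊆ s` contains each element independently with probability `p`. -/
noncomputable def bern (p : ℝ) (s : Finset α) (f : Finset α → ℝ) : ℝ :=
  ∑ E ∈ s.powerset, p ^ #E * (1 - p) ^ (#s - #E) * f E

lemma bern_empty (f : Finset α → ℝ) : bern p ∅ f = f ∅ := by simp [bern]

lemma bern_insert {a : α} {s : Finset α} (ha : a ∉ s) (f : Finset α → ℝ) :
    bern p (insert a s) f = (1 - p) * bern p s f + p * bern p s (fun E => f (insert a E)) := by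
  unfold bern
  rw [Finset.sum_powerset_insert ha, mul_sum, mul_sum]
  congr 1
  · refine sum_congr rfl fun E hE => ?_
    have hE' := card_le_card (mem_powerset.1 hE)
    rw [card_insert_of_notMem ha, Nat.sub_add_comm hE', pow_succ]; ring
  · refine sum_congr rfl fun E hE => ?_
    have : a ∉ E := fun h => ha (mem_powerset.1 hE h)
    rw [card_insert_of_notMem ha, card_insert_of_notMem this, Nat.add_sub_add_right, pow_succ]
    ring

lemma bern_isExp (hp : 0 ≤ p) (hp1 : p ≤ 1) (s : Finset α) :
    IsExp {E | E ⊆ s} (bern p s) where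
  add f g := by unfold bern; rw [← sum_add_distrib]; exact sum_congr rfl fun _ _ => by ring
  smul c f := by unfold bern; rw [mul_sum]; exact sum_congr rfl fun _ _ => by ring
  mono f g h := by
    unfold bern
    refine sum_le_sum fun E hE => ?_
    have := h E (mem_powerset.1 hE)
    have : 0 ≤ 1 - p := by linarith
    gcongr
  one := by
    induction s using Finset.induction_on with
    | empty => simp [bern_empty]
    | insert a s ha ih => rw [bern_insert ha, ih]; ring

lemma bern_union {s t : Finset α} (hst : Disjoint s t) (f : Finset α → ℝ) :
    bern p (s ∪ t) f = bern p s (fun A => bern p t (fun B => f (A ∪ B))) := by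
  induction s using Finset.induction_on generalizing f with
  | empty => simp [bern_empty]
  | insert a s ha ih =>
    rw [disjoint_insert_left] at hst
    rw [insert_union, bern_insert (by simp [ha, hst.1]), bern_insert ha, ih hst.2, ih hst.2]
    simp only [insert_union]

lemma bern_image {γ : Type*} [DecidableEq γ] {s : Finset α} {ι : α → γ}
    (hι : Set.InjOn ι s) (f : Finset γ → ℝ) :
    bern p (s.image ι) f = bern p s (fun E => f (E.image ι)) := by
  induction s using Finset.induction_on generalizing f with
  | empty => simp [bern_empty]
  | insert a s ha ih =>
    have h1 : Set.InjOn ι s := hι.mono (by simp)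
    have h2 : ι a ∉ s.image ι := by
      intro h
      obtain ⟨b, hb, hba⟩ := mem_image.1 h
      exact ha ((hι (by simp [hb]) (by simp) hba) ▸ hb)
    rw [image_insert, bern_insert h2, bern_insert ha, ih h1, ih h1]
    simp only [image_insert]

lemma bern_prod (s : Finset α) (w : α → ℝ) :
    bern p s (fun E => ∏ e ∈ E, w e) = ∏ e ∈ s, (1 - p + p * w e) := by
  induction s using Finset.induction_on with
  | empty => simp [bern_empty]
  | insert a s ha ih =>
    rw [bern_insert ha, prod_insert ha, ← ih]
    have : bern p s (fun E => ∏ e ∈ insert a E, w e)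
        = bern p s (fun E => w a * ∏ e ∈ E, w e) := by
      unfold bern
      refine sum_congr rfl fun E hE => ?_
      simp only [prod_insert fun h => ha (mem_powerset.1 hE h)]
    rw [this]
    have h2 : bern p s (fun E => w a * ∏ e ∈ E, w e)
        = w a * bern p s (fun E => ∏ e ∈ E, w e) := by
      unfold bern; rw [mul_sum]; exact sum_congr rfl fun _ _ => by ring
    rw [h2]; ring

/-- The probability that a Bernoulli subset avoids `Q ⊆ s`. -/
lemma bern_avoid {s Q : Finset α} (hQ : Q ⊆ s) :
    bern p s (fun E => ind (Disjoint E Q)) = (1 - p) ^ #Q := by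
  have h := bern_prod (p := p) s (fun e => if e ∈ Q then (0 : ℝ) else 1)
  have h1 : (fun E : Finset α => ind (Disjoint E Q))
      = fun E => ∏ e ∈ E, (if e ∈ Q then (0 : ℝ) else 1) := by
    funext E
    by_cases hd : Disjoint E Q
    · rw [ind_true hd, prod_eq_one]
      intro e he
      rw [if_neg (Finset.disjoint_left.1 hd he)]
    · rw [ind_false hd]
      obtain ⟨e, he, heQ⟩ := Finset.not_disjoint_iff.1 hd
      exact (prod_eq_zero (f := fun e => if e ∈ Q then (0 : ℝ) else 1) he (if_pos heQ)).symm
  rw [h1, h, ← prod_sdiff hQ]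
  rw [prod_eq_one (s := s \ Q) fun e he => by simp [(mem_sdiff.1 he).2], one_mul]
  rw [prod_congr rfl fun e he => by rw [if_pos he], prod_const]
  ring

lemma bern_card (hp : 0 ≤ p) (hp1 : p ≤ 1) (s : Finset α) :
    bern p s (fun E => (#E : ℝ)) = p * #s := by
  induction s using Finset.induction_on with
  | empty => simp [bern_empty]
  | insert a s ha ih =>
    rw [bern_insert ha, ih, card_insert_of_notMem ha]
    have : bern p s (fun E => (#(insert a E) : ℝ)) = bern p s (fun E => (#E : ℝ) + 1) :=
      (bern_isExp hp hp1 s).congr fun E hE => by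
        rw [card_insert_of_notMem fun h => ha (hE h)]; push_cast; ring
    rw [this, (bern_isExp hp hp1 s).add_const, ih]
    push_cast; ring

end bern

/-! ### Uniform averages -/

section avg

/-- Average over a finite type. -/
noncomputable def avg {Ω : Type*} [Fintype Ω] (f : Ω → ℝ) : ℝ :=
  (∑ x, f x) / Fintype.card Ω

variable {Ω : Type*} [Fintype Ω]

lemma avg_isExp [Nonempty Ω] : IsExp Set.univ (avg (Ω := Ω)) where
  add f g := by unfold avg; rw [sum_add_distrib, add_div]
  smul c f := by unfold avg; rw [← mul_sum, mul_div_assoc]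
  mono f g h := by
    unfold avg
    gcongr with x
    exact h x (Set.mem_univ _)
  one := by
    unfold avg
    simp

lemma avg_equiv {Ω' : Type*} [Fintype Ω'] (e : Ω ≃ Ω') (f : Ω' → ℝ) :
    avg (fun x => f (e x)) = avg f := by
  unfold avg
  rw [Fintype.card_congr e, e.sum_comp]

lemma avg_comm {Ω' : Type*} [Fintype Ω'] (f : Ω → Ω' → ℝ) :
    avg (fun x => avg (fun y => f x y)) = avg (fun y => avg (fun x => f x y)) := by
  unfold avg
  rw [← sum_div, ← sum_div, sum_comm, div_div, div_div, mul_comm]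

variable {V C : Type*} [Fintype V] [DecidableEq V] [Fintype C]

/-- Resampling a set of coordinates does not change the uniform measure. -/
lemma avg_piecewise [Nonempty C] (I : Finset V) (f : (V → C) → ℝ) :
    avg (fun ξ => avg (fun ζ => f (I.piecewise ζ ξ))) = avg f := by
  have key : ∑ x : (V → C) × (V → C), f (I.piecewise x.2 x.1)
      = ∑ x : (V → C) × (V → C), f x.1 := by
    refine Finset.sum_bij' (fun x _ => (I.piecewise x.2 x.1, I.piecewise x.1 x.2))
      (fun x _ => (I.piecewise x.2 x.1, I.piecewise x.1 x.2)) ?_ ?_ ?_ ?_ ?_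
    · simp
    · simp
    · intro x _
      ext v <;> by_cases h : v ∈ I <;> simp [h]
    · intro x _
      ext v <;> by_cases h : v ∈ I <;> simp [h]
    · intro x _
      rfl
  rw [Fintype.sum_prod_type, Fintype.sum_prod_type] at key
  have hpos : (0 : ℝ) < Fintype.card (V → C) := by exact_mod_cast Fintype.card_pos
  simp only [sum_const, card_univ, nsmul_eq_mul, ← mul_sum] at key
  unfold avg
  rw [← sum_div, key]
  field_simp

/-- Resampling a single coordinate. -/
lemma avg_update [Nonempty C] (a : V) (f : (V → C) → ℝ) :
    avg (fun ξ => avg (fun c => f (Function.update ξ a c))) = avg f := by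
  rw [avg_comm]
  have key : ∑ x : C × (V → C), f (Function.update x.2 a x.1)
      = ∑ x : C × (V → C), f x.2 := by
    refine Finset.sum_bij' (fun x _ => (x.2 a, Function.update x.2 a x.1))
      (fun x _ => (x.2 a, Function.update x.2 a x.1)) ?_ ?_ ?_ ?_ ?_ <;> simp
  rw [Fintype.sum_prod_type, Fintype.sum_prod_type] at key
  have hpos : (0 : ℝ) < Fintype.card (V → C) := by exact_mod_cast Fintype.card_pos
  have hpos' : (0 : ℝ) < Fintype.card C := by exact_mod_cast Fintype.card_pos
  simp only [sum_const, card_univ, nsmul_eq_mul] at key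
  unfold avg
  rw [← sum_div, key]
  field_simp

lemma avg_coord [Nonempty C] (a : V) (φ : C → ℝ) :
    avg (fun ξ : V → C => φ (ξ a)) = avg φ := by
  rw [← avg_update a]
  simp only [Function.update_self]
  exact avg_isExp.const _

lemma avg_coord₂ [Nonempty C] {a b : V} (hab : a ≠ b) (φ : C → C → ℝ) :
    avg (fun ξ : V → C => φ (ξ a) (ξ b)) = avg (fun c => avg (fun d => φ c d)) := by
  rw [← avg_update b]
  simp only [Function.update_self, Function.update_of_ne hab]
  exact avg_coord a fun c => avg fun d => φ c d

/-- Forcing the colours on `B` costs a factor `|C| ^ |B|`. -/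
lemma avg_force [Nonempty C] (B : Finset V) (c₀ : C) {f : (V → C) → ℝ} (hf : ∀ ξ, 0 ≤ f ξ) :
    ((Fintype.card C : ℝ)⁻¹) ^ #B * avg (fun ξ => f (B.piecewise (fun _ => c₀) ξ)) ≤ avg f := by
  induction B using Finset.induction_on generalizing f with
  | empty => simp
  | insert a B ha ih =>
    have h1 : avg (fun ξ => f ((insert a B).piecewise (fun _ => c₀) ξ))
        = avg (fun ξ => (fun η => f (Function.update η a c₀)) (B.piecewise (fun _ => c₀) ξ)) := by
      congr 1; funext ξ
      rw [Finset.piecewise_insert]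
    rw [h1, card_insert_of_notMem ha, pow_succ']
    have h2 := ih (f := fun η => f (Function.update η a c₀)) fun ξ => hf _
    have hC : (0 : ℝ) < Fintype.card C := by exact_mod_cast Fintype.card_pos
    have h3 : (Fintype.card C : ℝ)⁻¹ * avg (fun η => f (Function.update η a c₀)) ≤ avg f := by
      rw [← avg_update a f, ← avg_isExp.smul]
      refine avg_isExp.mono _ _ fun ξ _ => ?_
      simp only [avg]
      rw [inv_mul_eq_div]
      gcongr
      exact single_le_sum (f := fun c => f (Function.update ξ a c)) (fun c _ => hf _) (mem_univ c₀)
    calc _ = (Fintype.card C : ℝ)⁻¹ * ((Fintype.card C : ℝ)⁻¹ ^ #B *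
          avg (fun ξ => (fun η => f (Function.update η a c₀)) (B.piecewise (fun _ => c₀) ξ))) := by
          ring
      _ ≤ (Fintype.card C : ℝ)⁻¹ * avg (fun η => f (Function.update η a c₀)) := by gcongr
      _ ≤ _ := h3

/-- The marginal of the uniform measure along an injection is uniform. -/
lemma avg_comp_injective {W : Type*} [Fintype W] {q : ℕ} [NeZero q] {ι : W → V}
    (hι : Function.Injective ι) (f : (W → Fin q) → ℝ) :
    avg (fun ξ : V → Fin q => f (fun w => ξ (ι w))) = avg f := by
  have h1 : ∀ c : W → Fin q, avg (fun ξ : V → Fin q => f (fun w => ξ (ι w)))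
      = avg (fun ξ : V → Fin q => f ((fun w => ξ (ι w)) + c)) := by
    intro c
    rw [← avg_equiv (Equiv.addRight (Function.extend ι c 0))]
    congr 1; funext ξ; congr 1; funext w
    simp [hι.extend_apply]
  calc avg (fun ξ : V → Fin q => f (fun w => ξ (ι w)))
      = avg (fun c : W → Fin q => avg (fun ξ : V → Fin q => f ((fun w => ξ (ι w)) + c))) := by
        simp_rw [← h1]; exact (avg_isExp.const _).symm
    _ = avg (fun ξ : V → Fin q => avg (fun c : W → Fin q => f ((fun w => ξ (ι w)) + c))) :=
        avg_comm _
    _ = avg (fun ξ : V → Fin q => avg f) := by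
        congr 1; funext ξ
        exact avg_equiv (Equiv.addLeft (fun w => ξ (ι w))) f
    _ = _ := avg_isExp.const _

end avg

/-! ### Percolation on the monochromatic pairs -/

section graph

variable {n q : ℕ}

/-- The vertices connected to `A` in the graph `(V, E)`. -/
noncomputable def clus (E : Finset (Fin n × Fin n)) (A : Finset (Fin n)) : Finset (Fin n) :=
  univ.filter (fun v => ∃ a ∈ A, (graphOf E).Reachable a v)

lemma mem_clus {E : Finset (Fin n × Fin n)} {A : Finset (Fin n)} {v : Fin n} :
    v ∈ clus E A ↔ ∃ a ∈ A, (graphOf E).Reachable a v := by simp [clus]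

lemma graphOf_adj {E : Finset (Fin n × Fin n)} {u v : Fin n} :
    (graphOf E).Adj u v ↔ u ≠ v ∧ ((u, v) ∈ E ∨ (v, u) ∈ E) := by
  simp [graphOf, SimpleGraph.fromRel_adj]

lemma subset_clus (E : Finset (Fin n × Fin n)) (A : Finset (Fin n)) : A ⊆ clus E A :=
  fun a ha => mem_clus.2 ⟨a, ha, SimpleGraph.Reachable.refl a⟩

lemma clus_closed {E : Finset (Fin n × Fin n)} {A : Finset (Fin n)} {u v : Fin n}
    (hu : u ∈ clus E A) (huv : (u, v) ∈ E ∨ (v, u) ∈ E) : v ∈ clus E A := by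
  obtain ⟨a, ha, hau⟩ := mem_clus.1 hu
  by_cases h : u = v
  · exact h ▸ hu
  · exact mem_clus.2 ⟨a, ha, hau.trans (SimpleGraph.Adj.reachable (graphOf_adj.2 ⟨h, huv⟩))⟩

lemma clus_subset {E : Finset (Fin n × Fin n)} {A C : Finset (Fin n)} (hA : A ⊆ C)
    (hC : ∀ u ∈ C, ∀ v, (u, v) ∈ E ∨ (v, u) ∈ E → v ∈ C) : clus E A ⊆ C := by
  intro v hv
  obtain ⟨a, ha, hav⟩ := mem_clus.1 hv
  obtain ⟨w⟩ := hav
  have haC := hA ha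
  clear hv ha
  induction w with
  | nil => exact haC
  | cons h _ ih => exact ih (hC _ haC _ (graphOf_adj.1 h).2)

lemma clus_empty (E : Finset (Fin n × Fin n)) : clus E ∅ = ∅ := by simp [clus]

lemma clus_mono {E : Finset (Fin n × Fin n)} {A B : Finset (Fin n)} (h : A ⊆ B) :
    clus E A ⊆ clus E B := fun v hv => by
  obtain ⟨a, ha, hav⟩ := mem_clus.1 hv
  exact mem_clus.2 ⟨a, h ha, hav⟩

lemma clus_union (E : Finset (Fin n × Fin n)) (A B : Finset (Fin n)) :
    clus E (A ∪ B) = clus E A ∪ clus E B := by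
  ext v
  simp only [mem_clus, mem_union, or_and_right, exists_or]

lemma mem_clus_singleton {E : Finset (Fin n × Fin n)} {v w : Fin n} :
    w ∈ clus E {v} ↔ (graphOf E).Reachable v w := by simp [mem_clus]

/-- The monochromatic pairs inside `R`. -/
def mp (σ : Conf n q) (R : Finset (Fin n)) : Finset (Fin n × Fin n) :=
  univ.filter (fun e : Fin n × Fin n => e.1 < e.2 ∧ σ e.1 = σ e.2 ∧ e.1 ∈ R ∧ e.2 ∈ R)

lemma mp_univ (σ : Conf n q) : mp σ univ = monoPairs σ := by
  ext e; simp [mp, monoPairs]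

/-- Percolation on the monochromatic pairs inside `R`. -/
noncomputable def perc (p : ℝ) (σ : Conf n q) (R : Finset (Fin n))
    (f : Finset (Fin n × Fin n) → ℝ) : ℝ := bern p (mp σ R) f

lemma perc_isExp {p : ℝ} (hp : 0 ≤ p) (hp1 : p ≤ 1) (σ : Conf n q) (R : Finset (Fin n)) :
    IsExp {E | E ⊆ mp σ R} (perc p σ R) := bern_isExp hp hp1 _

/-- The unordered pair `{a, w}` as an increasing pair. -/
def pr (a w : Fin n) : Fin n × Fin n := if a < w then (a, w) else (w, a)

/-- The pairs joining `a` to the elements of `N`. -/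
def star (a : Fin n) (N : Finset (Fin n)) : Finset (Fin n × Fin n) := N.image (pr a)

/-- The possible neighbours of `a` inside `R`. -/
def nb (σ : Conf n q) (R : Finset (Fin n)) (a : Fin n) : Finset (Fin n) :=
  R.filter (fun w => w ≠ a ∧ σ w = σ a)

lemma mem_star {a u v : Fin n} {N : Finset (Fin n)} :
    (u, v) ∈ star a N ↔ (u = a ∧ v ∈ N ∧ a < v) ∨ (v = a ∧ u ∈ N ∧ ¬ a < u) := by
  simp only [star, mem_image, pr]
  constructor
  · rintro ⟨w, hw, h⟩
    split_ifs at h with h1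
    · obtain ⟨rfl, rfl⟩ := Prod.mk.inj h; exact Or.inl ⟨rfl, hw, h1⟩
    · obtain ⟨rfl, rfl⟩ := Prod.mk.inj h; exact Or.inr ⟨rfl, hw, h1⟩
  · rintro (⟨rfl, hv, h⟩ | ⟨rfl, hu, h⟩)
    · exact ⟨v, hv, by rw [if_pos h]⟩
    · exact ⟨u, hu, by rw [if_neg h]⟩

lemma pr_injective (a : Fin n) : Function.Injective (pr a) := by
  intro u v h
  simp only [pr] at h
  split_ifs at h with h1 h2 h2 <;> simp only [Prod.mk.injEq] at h
  · exact h.2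
  · obtain ⟨rfl, rfl⟩ := h; rfl
  · obtain ⟨rfl, rfl⟩ := h; rfl
  · exact h.1

lemma mp_eq_union {σ : Conf n q} {R : Finset (Fin n)} {a : Fin n} (ha : a ∈ R) :
    mp σ R = star a (nb σ R a) ∪ mp σ (R.erase a) := by
  ext ⟨u, v⟩
  simp only [mp, mem_filter, mem_univ, true_and, mem_union, mem_star, nb, mem_erase]
  constructor
  · rintro ⟨h1, h2, h3, h4⟩
    by_cases hu : u = a
    · subst hu
      exact Or.inl (Or.inl ⟨rfl, ⟨h4, h1.ne', h2.symm⟩, h1⟩)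
    · by_cases hv : v = a
      · subst hv
        exact Or.inl (Or.inr ⟨rfl, ⟨h3, h1.ne, h2⟩, h1.not_gt⟩)
      · exact Or.inr ⟨h1, h2, ⟨hu, h3⟩, hv, h4⟩
  · rintro ((⟨rfl, h, h'⟩ | ⟨rfl, h, h'⟩) | h)
    · exact ⟨h', h.2.2.symm, ha, h.1⟩
    · exact ⟨lt_of_le_of_ne (not_lt.1 h') h.2.1, h.2.2, h.1, ha⟩
    · exact ⟨h.1, h.2.1, h.2.2.1.2, h.2.2.2.2⟩

lemma disjoint_star_mp {σ : Conf n q} {R N : Finset (Fin n)} {a : Fin n} :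
    Disjoint (star a N) (mp σ (R.erase a)) := by
  rw [Finset.disjoint_left]
  rintro ⟨u, v⟩ h h'
  simp only [mp, mem_filter, mem_univ, true_and, mem_erase] at h'
  rcases mem_star.1 h with h | h
  · exact h'.2.2.1.1 h.1
  · exact h'.2.2.2.1 h.1

/-- Exposing the edges at `a`. -/
lemma perc_expose (p : ℝ) {σ : Conf n q} {R : Finset (Fin n)} {a : Fin n} (ha : a ∈ R)
    (f : Finset (Fin n × Fin n) → ℝ) :
    perc p σ R f = bern p (nb σ R a)
      (fun N => perc p σ (R.erase a) (fun E => f (star a N ∪ E))) := by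
  unfold perc
  rw [mp_eq_union ha, bern_union disjoint_star_mp, star, bern_image (pr_injective a).injOn]
  rfl

lemma clus_star {σ : Conf n q} {R A N : Finset (Fin n)} {a : Fin n} (haA : a ∈ A)
    {E : Finset (Fin n × Fin n)} (hE : E ⊆ mp σ (R.erase a)) (hN : a ∉ N) :
    clus (star a N ∪ E) A = insert a (clus E (A.erase a ∪ N)) := by
  have hE' : ∀ u v, (u, v) ∈ E ∨ (v, u) ∈ E → u ≠ a ∧ v ≠ a := by
    rintro u v (h | h) <;>
    · have := hE h
      simp only [mp, mem_filter, mem_univ, true_and, mem_erase] at this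
      tauto
  apply subset_antisymm
  · refine clus_subset (fun x hx => ?_) fun u hu v huv => ?_
    · by_cases hxa : x = a
      · simp [hxa]
      · exact mem_insert_of_mem (subset_clus _ _ (mem_union_left _ (mem_erase.2 ⟨hxa, hx⟩)))
    · have huv' : ((u, v) ∈ star a N ∨ (v, u) ∈ star a N) ∨ ((u, v) ∈ E ∨ (v, u) ∈ E) := by
        simp only [mem_union] at huv; tauto
      rcases huv' with h | h
      · simp only [mem_star] at h
        have : v = a ∨ v ∈ N := by tauto
        rcases this with h | h
        · simp [h]
        · exact mem_insert_of_mem (subset_clus _ _ (mem_union_right _ h))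
      · have hu' : u ∈ clus E (A.erase a ∪ N) := by
          rcases mem_insert.1 hu with h' | h'
          · exact absurd h' (hE' u v h).1
          · exact h'
        exact mem_insert_of_mem (clus_closed hu' h)
  · intro x hx
    rcases mem_insert.1 hx with rfl | hx
    · exact subset_clus _ _ haA
    · refine clus_subset (C := clus (star a N ∪ E) A) ?_ ?_ hx
      · intro y hy
        rcases mem_union.1 hy with hy | hy
        · exact subset_clus _ _ (mem_of_mem_erase hy)
        · refine clus_closed (subset_clus _ _ haA) ?_
          have hya : y ≠ a := fun h => hN (h ▸ hy)
          simp only [mem_union, mem_star]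
          rcases lt_or_gt_of_ne hya with h | h
          · exact Or.inr (Or.inl (Or.inr ⟨trivial, hy, h.not_gt⟩))
          · exact Or.inl (Or.inl (Or.inl ⟨trivial, hy, h⟩))
      · intro u hu v huv
        refine clus_closed hu ?_
        simp only [mem_union]; tauto

lemma clus_subset_of_subset {σ : Conf n q} {R A : Finset (Fin n)} {E : Finset (Fin n × Fin n)}
    (hE : E ⊆ mp σ R) (hA : A ⊆ R) : clus E A ⊆ R := by
  refine clus_subset hA fun u _ v huv => ?_
  rcases huv with h | h <;>
  · have := hE h
    simp only [mp, mem_filter, mem_univ, true_and] at this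
    tauto

/-- Clusters are monochromatic. -/
lemma color_eq_of_mem_clus {σ : Conf n q} {R : Finset (Fin n)} {E : Finset (Fin n × Fin n)}
    (hE : E ⊆ mp σ R) {v w : Fin n} (h : w ∈ clus E {v}) : σ w = σ v := by
  have : clus E {v} ⊆ univ.filter (fun w => σ w = σ v) := by
    refine clus_subset (by simp) fun u hu x hux => ?_
    simp only [mem_filter, mem_univ, true_and] at hu ⊢
    rcases hux with h | h <;>
    · have := hE h
      simp only [mp, mem_filter, mem_univ, true_and] at this
      rw [← hu, this.2.1]
  simpa using this h

lemma mem_nb {σ : Conf n q} {R : Finset (Fin n)} {a w : Fin n} :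
    w ∈ nb σ R a ↔ w ∈ R ∧ w ≠ a ∧ σ w = σ a := by simp [nb]

lemma nb_subset_erase (σ : Conf n q) (R : Finset (Fin n)) (a : Fin n) : nb σ R a ⊆ R.erase a :=
  fun w hw => by rw [mem_nb] at hw; simp [hw]

lemma notMem_of_subset_nb {σ : Conf n q} {R N : Finset (Fin n)} {a : Fin n}
    (hN : N ⊆ nb σ R a) : a ∉ N := fun h => (mem_nb.1 (hN h)).2.1 rfl

/-- Domain Markov property: given the cluster of `A`, the remaining edges are percolated
independently. -/
lemma perc_domain_markov {p : ℝ} (hp : 0 ≤ p) (hp1 : p ≤ 1) (σ : Conf n q)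
    (R A : Finset (Fin n)) (hA : A ⊆ R)
    (Ψ : Finset (Fin n) → Finset (Fin n × Fin n) → ℝ) :
    perc p σ R (fun E => Ψ (clus E A)
      (E.filter fun e => e.1 ∉ clus E A ∧ e.2 ∉ clus E A)) =
    perc p σ R (fun E => perc p σ (R \ clus E A) (Ψ (clus E A))) := by
  induction hk : #R generalizing R A Ψ with
  | zero =>
    rw [card_eq_zero] at hk
    subst hk
    have : A = ∅ := subset_empty.1 hA
    subst this
    simp only [clus_empty, sdiff_empty, notMem_empty, not_false_eq_true, and_self, filter_true]
    exact ((perc_isExp hp hp1 σ ∅).const _).symm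
  | succ k ih =>
    rcases A.eq_empty_or_nonempty with rfl | ⟨a, ha⟩
    · simp only [clus_empty, sdiff_empty, notMem_empty, not_false_eq_true, and_self, filter_true]
      exact ((perc_isExp hp hp1 σ R).const _).symm
    rw [perc_expose p (hA ha), perc_expose p (hA ha)]
    refine (bern_isExp hp hp1 _).congr fun N hN => ?_
    have hN : N ⊆ nb σ R a := hN
    have haN := notMem_of_subset_nb hN
    have hA' : A.erase a ∪ N ⊆ R.erase a :=
      union_subset (erase_subset_erase _ hA) (hN.trans (nb_subset_erase σ R a))
    have hcard : #(R.erase a) = k := by rw [card_erase_of_mem (hA ha), hk]; rfl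
    have := ih (R.erase a) (A.erase a ∪ N) hA' (fun C X => Ψ (insert a C) X) hcard
    refine Eq.trans ?_ (this.trans ?_)
    · refine (perc_isExp hp hp1 _ _).congr fun E hE => ?_
      have hE : E ⊆ mp σ (R.erase a) := hE
      rw [clus_star ha hE haN]
      congr 1
      ext ⟨u, v⟩
      simp only [mem_filter, mem_union, mem_star, mem_insert, not_or]
      constructor
      · rintro ⟨h1, h2, h3⟩
        refine ⟨?_, h2.2, h3.2⟩
        tauto
      · rintro ⟨h1, h2, h3⟩
        have := hE h1
        simp only [mp, mem_filter, mem_univ, true_and, mem_erase] at this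
        tauto
    · refine (perc_isExp hp hp1 _ _).congr fun E hE => ?_
      have hE : E ⊆ mp σ (R.erase a) := hE
      rw [clus_star ha hE haN]
      have : R.erase a \ clus E (A.erase a ∪ N) = R \ insert a (clus E (A.erase a ∪ N)) := by
        ext x; simp only [mem_sdiff, mem_erase, mem_insert]; tauto
      rw [this]

/-- Outside the cluster of `A`, clusters only depend on the edges outside that cluster. -/
lemma clus_filter_eq {E : Finset (Fin n × Fin n)} {A : Finset (Fin n)} {w : Fin n}
    (hw : w ∉ clus E A) :
    clus (E.filter fun e => e.1 ∉ clus E A ∧ e.2 ∉ clus E A) {w} = clus E {w} := by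
  apply subset_antisymm
  · refine clus_subset (subset_clus _ _) fun u hu v huv => clus_closed hu ?_
    simp only [mem_filter] at huv
    tauto
  · have h : clus E {w} ⊆ clus (E.filter fun e => e.1 ∉ clus E A ∧ e.2 ∉ clus E A) {w} ∩
        univ.filter (fun u => u ∉ clus E A) := by
      refine clus_subset (by simp [hw, subset_clus _ _ (mem_singleton_self w)])
        fun u hu v huv => ?_
      simp only [mem_inter, mem_filter, mem_univ, true_and] at hu ⊢
      have hv : v ∉ clus E A := fun hv => hu.2 (clus_closed hv huv.symm)
      refine ⟨clus_closed hu.1 ?_, hv⟩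
      simp only [mem_filter]
      tauto
    exact h.trans inter_subset_left

/-- Expected cluster sizes in the subcritical regime. -/
lemma perc_card_clus_le {p : ℝ} (hp : 0 ≤ p) (hp1 : p ≤ 1) (σ : Conf n q) {M : ℝ}
    (hM : M * p < 1) (R A : Finset (Fin n)) (hA : A ⊆ R)
    (hR : ∀ j, (#(R.filter fun v => σ v = j) : ℝ) ≤ M) :
    perc p σ R (fun E => (#(clus E A) : ℝ)) ≤ #A / (1 - M * p) := by
  have hpos : 0 < 1 - M * p := by linarith
  induction hk : #R generalizing R A with
  | zero =>
    rw [card_eq_zero] at hk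
    subst hk
    have : A = ∅ := subset_empty.1 hA
    subst this
    simp only [clus_empty, card_empty, Nat.cast_zero, zero_div]
    exact ((perc_isExp hp hp1 σ ∅).const _).le
  | succ k ih =>
    rcases A.eq_empty_or_nonempty with rfl | ⟨a, ha⟩
    · simp only [clus_empty, card_empty, Nat.cast_zero, zero_div]
      exact ((perc_isExp hp hp1 σ R).const _).le
    rw [perc_expose p (hA ha)]
    have hcard : #(R.erase a) = k := by rw [card_erase_of_mem (hA ha), hk]; rfl
    have hM' : ∀ j, (#((R.erase a).filter fun v => σ v = j) : ℝ) ≤ M := fun j =>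
      le_trans (by exact_mod_cast card_le_card (filter_subset_filter _ (erase_subset _ _))) (hR j)
    have step : ∀ N ∈ {N | N ⊆ nb σ R a},
        perc p σ (R.erase a) (fun E => (#(clus (star a N ∪ E) A) : ℝ)) ≤
          (#N : ℝ) * (1 - M * p)⁻¹ + (1 + ((#A : ℝ) - 1) * (1 - M * p)⁻¹) := by
      intro N hN
      have hN : N ⊆ nb σ R a := hN
      have hA' : A.erase a ∪ N ⊆ R.erase a :=
        union_subset (erase_subset_erase _ hA) (hN.trans (nb_subset_erase σ R a))
      have h1 : perc p σ (R.erase a) (fun E => (#(clus (star a N ∪ E) A) : ℝ)) ≤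
          perc p σ (R.erase a) (fun E => (#(clus E (A.erase a ∪ N)) : ℝ) + 1) := by
        refine (perc_isExp hp hp1 _ _).mono _ _ fun E hE => ?_
        rw [clus_star ha hE (notMem_of_subset_nb hN)]
        exact_mod_cast card_insert_le _ _
      rw [(perc_isExp hp hp1 _ _).add_const] at h1
      have h2 := ih (R.erase a) (A.erase a ∪ N) hA' hM' hcard
      have h3 : (#(A.erase a ∪ N) : ℝ) ≤ #A - 1 + #N := by
        have h4 := card_union_le (A.erase a) N
        have h5 := card_erase_add_one ha
        have : #(A.erase a ∪ N) + 1 ≤ #A + #N := by omega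
        have : (#(A.erase a ∪ N) : ℝ) + 1 ≤ #A + #N := by exact_mod_cast this
        linarith
      have h4 : (#(A.erase a ∪ N) : ℝ) / (1 - M * p) ≤ (#A - 1 + #N) / (1 - M * p) := by gcongr
      rw [div_eq_mul_inv, div_eq_mul_inv] at h4
      rw [div_eq_mul_inv] at h2
      linarith
    refine ((bern_isExp hp hp1 _).mono _ _ step).trans ?_
    rw [(bern_isExp hp hp1 _).add_const, (bern_isExp hp hp1 _).mul_const, bern_card hp hp1]
    have h6 : (#(nb σ R a) : ℝ) ≤ M := by
      refine le_trans ?_ (hR (σ a))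
      exact_mod_cast card_le_card fun w hw => by
        rw [mem_nb] at hw; simp [hw]
    have h7 : p * (#(nb σ R a) : ℝ) * (1 - M * p)⁻¹ ≤ p * M * (1 - M * p)⁻¹ := by gcongr
    have h8 : p * M * (1 - M * p)⁻¹ + (1 + ((#A : ℝ) - 1) * (1 - M * p)⁻¹)
        = #A / (1 - M * p) := by
      have := mul_inv_cancel₀ hpos.ne'
      rw [div_eq_mul_inv]; linear_combination -this
    linarith

end graph

/-! ### Exponential moments of cluster sizes -/

lemma exp_le_one_add_sq {z : ℝ} (hz : |z| ≤ 1) : Real.exp z ≤ 1 + z + z ^ 2 := by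
  have := (abs_le.1 (Real.abs_exp_sub_one_sub_id_le hz)).2
  linarith

section mgf

variable {n q : ℕ}

lemma bern_exp_card_le {α : Type*} [DecidableEq α] {p : ℝ} (hp : 0 ≤ p) (hp1 : p ≤ 1)
    (s A : Finset α) {x : ℝ} (hx : |x| ≤ 1) :
    bern p s (fun N => Real.exp (x * (#(N \ A) - p * #(s \ A)))) ≤
      Real.exp (p * #(s \ A) * x ^ 2) := by
  have h1 : (fun N : Finset α => Real.exp (x * (#(N \ A) - p * #(s \ A))))
      = fun N => Real.exp (-(x * p * #(s \ A))) *
        ∏ e ∈ N, (if e ∈ A then 1 else Real.exp x) := by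
    funext N
    have : ∏ e ∈ N, (if e ∈ A then 1 else Real.exp x) = Real.exp (x * #(N \ A)) := by
      rw [← prod_sdiff (sdiff_subset : N \ A ⊆ N)]
      rw [prod_eq_one, one_mul]
      · rw [prod_congr rfl fun e he => by rw [if_neg (mem_sdiff.1 he).2], prod_const,
          ← Real.exp_nat_mul, mul_comm]
      · intro e he
        have : e ∈ A := by
          simp only [mem_sdiff, not_and, not_not] at he; exact he.2 he.1
        rw [if_pos this]
    rw [this, ← Real.exp_add]; ring_nf
  rw [h1, (bern_isExp hp hp1 s).smul, bern_prod]
  have h2 : ∏ e ∈ s, (1 - p + p * (if e ∈ A then 1 else Real.exp x))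
      ≤ Real.exp (p * #(s \ A) * (x + x ^ 2)) := by
    rw [← prod_sdiff (sdiff_subset : s \ A ⊆ s)]
    rw [prod_eq_one (s := s \ (s \ A)), one_mul]
    · rw [prod_congr rfl fun e he => by rw [if_neg (mem_sdiff.1 he).2], prod_const]
      have h3 : 1 - p + p * Real.exp x ≤ Real.exp (p * (x + x ^ 2)) := by
        have := Real.add_one_le_exp (p * (x + x ^ 2))
        have h4 := mul_le_mul_of_nonneg_left (exp_le_one_add_sq hx) hp
        linarith
      calc (1 - p + p * Real.exp x) ^ #(s \ A) ≤ Real.exp (p * (x + x ^ 2)) ^ #(s \ A) := by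
            have : 0 ≤ 1 - p := by linarith
            gcongr
        _ = _ := by rw [← Real.exp_nat_mul]; ring_nf
    · intro e he
      have : e ∈ A := by
        simp only [mem_sdiff, not_and, not_not] at he; exact he.2 he.1
      rw [if_pos this]; ring
  calc _ ≤ Real.exp (-(x * p * #(s \ A))) * Real.exp (p * #(s \ A) * (x + x ^ 2)) := by gcongr
    _ = _ := by rw [← Real.exp_add]; ring_nf

lemma perc_exp_le {p c β : ℝ} (hp : 0 ≤ p) (hp1 : p ≤ 1) (hc1 : 1 ≤ c) (hc : c * (1 - p) = 1)
    (hβ : p * n ≤ β) (σ : Conf n q) (i : Fin q) (s : ℝ) (R A : Finset (Fin n)) (hA : A ⊆ R)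
    (hAi : ∀ v ∈ A, σ v = i) (m : ℕ) (hm : #(R.filter fun v => σ v = i) = m)
    (hs : |s| * c ^ m ≤ 1) :
    perc p σ R (fun E => Real.exp (s * ((m - #(clus E A)) * c ^ #(clus E A) - (m - #A)))) ≤
      Real.exp (β * m * c ^ (2 * m) * s ^ 2) := by
  have hβ0 : 0 ≤ β := le_trans (by positivity) hβ
  induction hk : #R generalizing R A m s with
  | zero =>
    rw [card_eq_zero] at hk
    subst hk
    have : A = ∅ := subset_empty.1 hA
    subst this
    simp only [clus_empty, card_empty, Nat.cast_zero, sub_zero, pow_zero, mul_one, sub_self,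
      mul_zero, Real.exp_zero]
    rw [(perc_isExp hp hp1 σ ∅).const, Real.one_le_exp_iff]
    positivity
  | succ k ih =>
    rcases A.eq_empty_or_nonempty with rfl | ⟨a, ha⟩
    · simp only [clus_empty, card_empty, Nat.cast_zero, sub_zero, pow_zero, mul_one, sub_self,
        mul_zero, Real.exp_zero]
      rw [(perc_isExp hp hp1 σ R).const, Real.one_le_exp_iff]
      positivity
    have haR := hA ha
    have hai := hAi a ha
    have hcard : #(R.erase a) = k := by rw [card_erase_of_mem haR, hk]; rfl
    have hSa : (R.erase a).filter (fun v => σ v = i) = (R.filter fun v => σ v = i).erase a := by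
      ext v; simp only [mem_filter, mem_erase]; tauto
    have haS : a ∈ R.filter fun v => σ v = i := by simp [haR, hai]
    obtain ⟨m', rfl⟩ : ∃ m', m = m' + 1 := by
      refine Nat.exists_eq_succ_of_ne_zero ?_
      rw [← hm]; exact card_ne_zero_of_mem haS
    have hm' : #((R.erase a).filter fun v => σ v = i) = m' := by
      rw [hSa, card_erase_of_mem haS, hm]; rfl
    have hnb : nb σ R a = (R.filter fun v => σ v = i).erase a := by
      ext v; simp only [mem_nb, mem_filter, mem_erase, hai]; tauto
    have hnbA : (#(nb σ R a \ A) : ℝ) = m' + 1 - #A := by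
      have h1 : nb σ R a \ A = (R.filter fun v => σ v = i) \ A := by
        rw [hnb]; ext v; simp only [mem_sdiff, mem_erase]
        exact ⟨fun h => ⟨h.1.2, h.2⟩, fun h => ⟨⟨fun h' => h.2 (h' ▸ ha), h.1⟩, h.2⟩⟩
      have h2 : A ⊆ R.filter fun v => σ v = i := fun v hv => by simp [hA hv, hAi v hv]
      rw [h1, cast_card_sdiff h2, hm]; push_cast; ring
    have hsc : |s * c| * c ^ m' ≤ 1 := by
      rw [abs_mul, abs_of_pos (by linarith : (0 : ℝ) < c)]
      calc _ = |s| * c ^ (m' + 1) := by ring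
        _ ≤ 1 := hs
    have hx : |-(s * c)| ≤ 1 := by
      rw [abs_neg]
      refine le_trans ?_ hsc
      exact le_mul_of_one_le_right (abs_nonneg _) (one_le_pow₀ hc1)
    rw [perc_expose p haR]
    have step : ∀ N ∈ {N | N ⊆ nb σ R a}, perc p σ (R.erase a) (fun E => Real.exp
        (s * ((((m' + 1 : ℕ) : ℝ) - #(clus (star a N ∪ E) A)) * c ^ #(clus (star a N ∪ E) A) -
          (((m' + 1 : ℕ) : ℝ) - #A)))) ≤
        Real.exp (β * m' * c ^ (2 * m') * (s * c) ^ 2) *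
          Real.exp (-(s * c) * (#(N \ A) - p * #(nb σ R a \ A))) := by
      intro N hN
      have hN : N ⊆ nb σ R a := hN
      have haN := notMem_of_subset_nb hN
      have hA' : A.erase a ∪ N ⊆ R.erase a :=
        union_subset (erase_subset_erase _ hA) (hN.trans (nb_subset_erase σ R a))
      have hAi' : ∀ v ∈ A.erase a ∪ N, σ v = i := by
        intro v hv
        rcases mem_union.1 hv with h | h
        · exact hAi v (mem_of_mem_erase h)
        · rw [(mem_nb.1 (hN h)).2.2, hai]
      have hcA : (#(A.erase a ∪ N) : ℝ) = #A - 1 + #(N \ A) := by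
        have h1 : A.erase a ∪ N = A.erase a ∪ (N \ A) := by
          ext v; simp only [mem_union, mem_erase, mem_sdiff]
          by_cases hva : v = a
          · subst hva; tauto
          · tauto
        have h2 : Disjoint (A.erase a) (N \ A) :=
          disjoint_of_subset_left (erase_subset _ _) disjoint_sdiff
        rw [h1, card_union_of_disjoint h2, card_erase_of_mem ha,
          Nat.cast_add, Nat.cast_sub (card_pos.2 ⟨a, ha⟩)]
        simp
      have h3 := ih (s * c) (R.erase a) (A.erase a ∪ N) hA' hAi' m' hm' hsc hcard
      refine le_trans (le_of_eq ?_) (mul_le_mul_of_nonneg_right h3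
        (Real.exp_pos (-(s * c) * (#(N \ A) - p * #(nb σ R a \ A)))).le)
      rw [← (perc_isExp hp hp1 _ _).mul_const]
      refine (perc_isExp hp hp1 _ _).congr fun E hE => ?_
      have haC : a ∉ clus E (A.erase a ∪ N) := fun h =>
        notMem_erase a R (clus_subset_of_subset hE hA' h)
      rw [clus_star ha hE haN, card_insert_of_notMem haC, hcA, hnbA, ← Real.exp_add]
      congr 1
      push_cast
      rw [pow_succ]
      linear_combination (s * (m' + 1 - (#A : ℝ))) * hc
    refine ((bern_isExp hp hp1 _).mono _ _ step).trans ?_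
    rw [(bern_isExp hp hp1 _).smul]
    refine le_trans (mul_le_mul_of_nonneg_left (bern_exp_card_le hp hp1 _ _ hx)
      (Real.exp_pos _).le) ?_
    rw [← Real.exp_add, Real.exp_le_exp]
    have h5 : p * #(nb σ R a \ A) ≤ β := by
      refine le_trans ?_ hβ
      gcongr
      simpa using card_le_univ (nb σ R a \ A)
    have h6 : c ^ 2 ≤ c ^ (2 * (m' + 1)) := pow_le_pow_right₀ hc1 (by omega)
    have h7 : p * #(nb σ R a \ A) * (-(s * c)) ^ 2 ≤ β * (s ^ 2 * c ^ (2 * (m' + 1))) := by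
      calc _ ≤ β * (-(s * c)) ^ 2 := by gcongr
        _ = β * (s ^ 2 * c ^ 2) := by ring
        _ ≤ _ := by gcongr
    calc _ ≤ β * m' * c ^ (2 * m') * (s * c) ^ 2 + β * (s ^ 2 * c ^ (2 * (m' + 1))) := by gcongr
      _ = _ := by push_cast; ring

/-- Edge probability of the Swendsen–Wang percolation step. -/
noncomputable def pp (n : ℕ) (β : ℝ) : ℝ := 1 - Real.exp (-(β / n))

lemma pp_nonneg {β : ℝ} (hβ : 0 ≤ β) : 0 ≤ pp n β := by
  have : Real.exp (-(β / n)) ≤ 1 := Real.exp_le_one_iff.2 (by simp only [Left.neg_nonpos_iff]; positivity)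
  unfold pp; linarith

lemma pp_le_one {β : ℝ} : pp n β ≤ 1 := by
  have := Real.exp_pos (-(β / n))
  unfold pp; linarith

lemma pp_mul_le {β : ℝ} (hβ : 0 ≤ β) : pp n β * n ≤ β := by
  rcases Nat.eq_zero_or_pos n with rfl | hn
  · simpa using hβ
  have h1 := Real.add_one_le_exp (-(β / n))
  have h2 : pp n β ≤ β / n := by unfold pp; linarith
  have hn' : (0 : ℝ) < n := by exact_mod_cast hn
  calc pp n β * n ≤ β / n * n := by gcongr
    _ = β := by field_simp

lemma exp_mul_one_sub_pp {β : ℝ} : Real.exp (β / n) * (1 - pp n β) = 1 := by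
  unfold pp
  rw [sub_sub_cancel, ← Real.exp_add]; simp

lemma exp_pow_le {β : ℝ} (hβ : 0 ≤ β) {m : ℕ} (hm : m ≤ n) : Real.exp (β / n) ^ m ≤ Real.exp β := by
  rw [← Real.exp_nat_mul, Real.exp_le_exp]
  rcases Nat.eq_zero_or_pos n with rfl | hn
  · simpa using hβ
  have hn' : (0 : ℝ) < n := by exact_mod_cast hn
  have : (m : ℝ) ≤ n := by exact_mod_cast hm
  calc (m : ℝ) * (β / n) ≤ n * (β / n) := by gcongr
    _ = β := by field_simp

/-- The martingale-type discrepancy of a cluster of size `T` grown from `k` vertices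
in a class of size `m`. -/
noncomputable def disc (n : ℕ) (β : ℝ) (m k T : ℕ) : ℝ :=
  (m - T) * Real.exp (β / n) ^ T - (m - k)

lemma cntN_le (σ : Conf n q) (i : Fin q) : cntN σ i ≤ n := by
  simpa [cntN] using card_le_univ (univ.filter fun v => σ v = i)

lemma perc_exp_disc_le {β : ℝ} (hβ : 0 ≤ β) (σ : Conf n q) (i : Fin q) {A : Finset (Fin n)}
    (hAi : ∀ v ∈ A, σ v = i) {s : ℝ} (hs : |s| * Real.exp β ≤ 1) :
    perc (pp n β) σ univ (fun E => Real.exp (s * disc n β (cntN σ i) #A #(clus E A))) ≤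
      Real.exp (β * Real.exp β ^ 2 * n * s ^ 2) := by
  have hc1 : 1 ≤ Real.exp (β / n) := Real.one_le_exp (by positivity)
  have hm := cntN_le σ i
  refine (perc_exp_le (pp_nonneg hβ) pp_le_one hc1 exp_mul_one_sub_pp (pp_mul_le hβ) σ i s univ A
    (subset_univ _) hAi (cntN σ i) rfl ?_).trans ?_
  · exact le_trans (by gcongr; exact exp_pow_le hβ hm) hs
  · rw [Real.exp_le_exp]
    have h1 : Real.exp (β / n) ^ (2 * cntN σ i) ≤ Real.exp β ^ 2 := by
      rw [mul_comm, pow_mul]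
      gcongr
      exact exp_pow_le hβ hm
    have h2 : (cntN σ i : ℝ) ≤ n := by exact_mod_cast hm
    calc _ ≤ β * n * Real.exp β ^ 2 * s ^ 2 := by gcongr
      _ = _ := by ring

lemma sq_le_exp_add_exp_neg (x : ℝ) : x ^ 2 ≤ Real.exp x + Real.exp (-x) := by
  have h1 : Real.exp x + Real.exp (-x) = 2 * Real.cosh (2 * (x / 2)) := by
    rw [mul_div_cancel₀ x two_ne_zero, Real.cosh_eq]; ring
  have h2 : (x / 2) ^ 2 ≤ Real.sinh (x / 2) ^ 2 := by
    rw [sq_le_sq, Real.abs_sinh]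
    exact Real.self_le_sinh_iff.2 (abs_nonneg _)
  have h3 := Real.cosh_sq (x / 2)
  rw [h1, Real.cosh_two_mul]
  nlinarith

/-- Second moment bound for the discrepancy. -/
lemma perc_disc_sq_le {β : ℝ} (hβ : 0 ≤ β) (hn : 1 ≤ n) (σ : Conf n q) (i : Fin q)
    {A : Finset (Fin n)} (hAi : ∀ v ∈ A, σ v = i) :
    perc (pp n β) σ univ (fun E => disc n β (cntN σ i) #A #(clus E A) ^ 2) ≤
      2 * Real.exp β ^ 3 * n := by
  have hn' : (1 : ℝ) ≤ n := by exact_mod_cast hn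
  have hL := perc_isExp (pp_nonneg hβ) (pp_le_one (n := n)) σ univ
  set s : ℝ := Real.exp (-β) / √n with hs
  have hsq : (√n : ℝ) ^ 2 = n := Real.sq_sqrt (by linarith)
  have hsq1 : 1 ≤ √(n : ℝ) := by rw [Real.one_le_sqrt]; exact hn'
  have hspos : 0 < s := by positivity
  have hs1 : |s| * Real.exp β ≤ 1 := by
    rw [abs_of_pos hspos, hs, div_mul_eq_mul_div, ← Real.exp_add, neg_add_cancel, Real.exp_zero]
    exact (div_le_one (by linarith)).2 hsq1
  have hs2 : Real.exp β ^ 2 * n * s ^ 2 = 1 := by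
    rw [hs, div_pow, hsq, Real.exp_neg]
    field_simp
  have h1 := perc_exp_disc_le hβ σ i hAi hs1
  have h2 := perc_exp_disc_le hβ σ i hAi (s := -s) (by rwa [abs_neg])
  have h3 : perc (pp n β) σ univ (fun E => (s * disc n β (cntN σ i) #A #(clus E A)) ^ 2) ≤
      Real.exp β + Real.exp β := by
    refine (hL.mono _ _ fun E _ => sq_le_exp_add_exp_neg _).trans ?_
    rw [hL.add]
    simp only [← neg_mul]
    refine add_le_add (h1.trans_eq ?_) (h2.trans_eq ?_)
    · congr 1; linear_combination β * hs2
    · congr 1; linear_combination β * hs2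
  simp only [mul_pow] at h3
  rw [hL.smul] at h3
  have h4 : perc (pp n β) σ univ (fun E => disc n β (cntN σ i) #A #(clus E A) ^ 2)
      = (Real.exp β ^ 2 * n) * (s ^ 2 * perc (pp n β) σ univ
        (fun E => disc n β (cntN σ i) #A #(clus E A) ^ 2)) := by
    linear_combination -(perc (pp n β) σ univ
        (fun E => disc n β (cntN σ i) #A #(clus E A) ^ 2)) * hs2
  rw [h4]
  calc _ ≤ (Real.exp β ^ 2 * n) * (Real.exp β + Real.exp β) := by gcongr
    _ = _ := by ring

/-- Large deviation bound for the discrepancy. -/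
lemma perc_disc_ld {β : ℝ} (hβ : 0 < β) {δ : ℝ} (hδ : 0 < δ) :
    ∃ κ > 0, ∀ (n q : ℕ) (σ : Conf n q) (i : Fin q) (A : Finset (Fin n)),
      (∀ v ∈ A, σ v = i) →
      perc (pp n β) σ univ (fun E => ind (δ * n ≤ |disc n β (cntN σ i) #A #(clus E A)|)) ≤
        2 * Real.exp (-(κ * n)) := by
  set s : ℝ := min (Real.exp (-β)) (δ / (2 * (β * Real.exp β ^ 2))) with hs
  have hspos : 0 < s := by positivity
  have hs1 : |s| * Real.exp β ≤ 1 := by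
    rw [abs_of_pos hspos]
    calc s * Real.exp β ≤ Real.exp (-β) * Real.exp β := by gcongr; exact min_le_left _ _
      _ = 1 := by rw [← Real.exp_add]; simp
  have hs2 : β * Real.exp β ^ 2 * s ≤ δ / 2 := by
    calc β * Real.exp β ^ 2 * s ≤ β * Real.exp β ^ 2 * (δ / (2 * (β * Real.exp β ^ 2))) := by
          gcongr; exact min_le_right _ _
      _ = δ / 2 := by field_simp
  refine ⟨s * δ / 2, by positivity, fun n q σ i A hAi => ?_⟩
  have hL := perc_isExp (pp_nonneg hβ.le) (pp_le_one (n := n)) σ univ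
  set D := fun E : Finset (Fin n × Fin n) => disc n β (cntN σ i) #A #(clus E A) with hD
  have h1 := perc_exp_disc_le hβ.le σ i hAi hs1
  have h2 := perc_exp_disc_le hβ.le σ i hAi (s := -s) (by rwa [abs_neg])
  have h3 : perc (pp n β) σ univ (fun E => ind (δ * n ≤ |D E|)) ≤
      perc (pp n β) σ univ (fun E => Real.exp (-(s * δ * n)) *
        (Real.exp (s * D E) + Real.exp (-s * D E))) := by
    refine hL.mono _ _ fun E _ => ?_
    by_cases h : δ * n ≤ |D E|
    · rw [ind_true h, mul_add, ← Real.exp_add, ← Real.exp_add]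
      rcases le_abs.1 h with h | h
      · have : 1 ≤ Real.exp (-(s * δ * n) + s * D E) := Real.one_le_exp (by nlinarith)
        linarith [Real.exp_pos (-(s * δ * n) + -s * D E)]
      · have : 1 ≤ Real.exp (-(s * δ * n) + -s * D E) := Real.one_le_exp (by nlinarith)
        linarith [Real.exp_pos (-(s * δ * n) + s * D E)]
    · rw [ind_false h]; positivity
  refine h3.trans ?_
  rw [hL.smul, hL.add]
  have h4 : Real.exp (β * Real.exp β ^ 2 * n * s ^ 2) ≤ Real.exp (s * δ * n / 2) := by
    rw [Real.exp_le_exp]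
    calc _ = β * Real.exp β ^ 2 * s * (n * s) := by ring
      _ ≤ δ / 2 * (n * s) := by gcongr
      _ = _ := by ring
  have h5 : Real.exp (β * Real.exp β ^ 2 * n * (-s) ^ 2) ≤ Real.exp (s * δ * n / 2) := by
    rwa [neg_sq]
  calc _ ≤ Real.exp (-(s * δ * n)) * (Real.exp (s * δ * n / 2) + Real.exp (s * δ * n / 2)) := by
        gcongr
        · exact h1.trans h4
        · exact h2.trans h5
    _ = 2 * (Real.exp (-(s * δ * n)) * Real.exp (s * δ * n / 2)) := by ring
    _ = _ := by rw [← Real.exp_add]; ring_nf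

end mgf

/-! ### The drift function -/

lemma theta_spec {lam : ℝ} (h : 1 < lam) :
    0 < theta lam ∧ theta lam < 1 ∧ Real.exp (-lam * theta lam) = 1 - theta lam := by
  have uniq : ∀ x y : ℝ, 0 < x → x < y → Real.exp (-lam * x) = 1 - x →
      Real.exp (-lam * y) = 1 - y → False := by
    intro x y hx hxy h1 h2
    have hy : 0 < y := hx.trans hxy
    have := strictConvexOn_exp.2 (Set.mem_univ (-lam * y)) (Set.mem_univ 0)
      (by simp; exact ⟨by linarith, hy.ne'⟩) (div_pos hx hy)
      (show 0 < 1 - x / y by rw [sub_pos, div_lt_one hy]; exact hxy) (by ring)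
    simp only [smul_eq_mul, mul_zero, add_zero, Real.exp_zero, mul_one, h2] at this
    rw [show x / y * (-lam * y) = -lam * x by field_simp, h1] at this
    have h3 : x / y * (1 - y) + (1 - x / y) = 1 - x := by field_simp; ring
    linarith
  obtain ⟨x, hx, hx2⟩ : ∃ x ∈ Set.Ioo (0 : ℝ) 1, Real.exp (-lam * x) = 1 - x := by
    set x0 : ℝ := (lam - 1) / (2 * lam) with hx0
    have hx0pos : 0 < x0 := div_pos (by linarith) (by linarith)
    have hx0lt : x0 < 1 := by rw [hx0, div_lt_one (by linarith)]; linarith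
    have hlx : lam * x0 = (lam - 1) / 2 := by
      rw [hx0]; have : lam ≠ 0 := by linarith
      field_simp
    have hcont : ContinuousOn (fun x : ℝ => 1 - x - Real.exp (-lam * x)) (Set.Icc x0 1) := by
      fun_prop
    have h1 : 0 ≤ 1 - x0 - Real.exp (-lam * x0) := by
      have h2 := Real.add_one_le_exp (lam * x0)
      rw [neg_mul, Real.exp_neg]
      have h3 : (Real.exp (lam * x0))⁻¹ ≤ (lam * x0 + 1)⁻¹ :=
        inv_anti₀ (by nlinarith) h2
      have h4 : (lam * x0 + 1)⁻¹ ≤ 1 - x0 := by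
        rw [inv_le_iff_one_le_mul₀ (by nlinarith)]
        nlinarith
      linarith
    have h2 : 1 - (1 : ℝ) - Real.exp (-lam * 1) ≤ 0 := by
      have := Real.exp_pos (-lam * 1); linarith
    obtain ⟨x, hx, hx'⟩ := intermediate_value_Icc' hx0lt.le hcont ⟨h2, h1⟩
    simp only at hx'
    refine ⟨x, ⟨hx0pos.trans_le hx.1, lt_of_le_of_ne hx.2 ?_⟩, by linarith⟩
    rintro rfl
    have := Real.exp_pos (-lam * 1); linarith
  have hset : {x : ℝ | x ∈ Set.Ioo (0 : ℝ) 1 ∧ Real.exp (-lam * x) = 1 - x} = {x} := by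
    ext y
    simp only [Set.mem_ofPred_eq, Set.mem_singleton_iff]
    refine ⟨fun hy => ?_, fun hy => hy ▸ ⟨hx, hx2⟩⟩
    rcases lt_trichotomy x y with hlt | heq | hgt
    · exact (uniq x y hx.1 hlt hx2 hy.2).elim
    · exact heq.symm
    · exact (uniq y x hy.1.1 hgt hy.2 hx2).elim
  have : theta lam = x := by rw [theta, if_neg (not_le.2 h), hset, csSup_singleton]
  rw [this]
  exact ⟨hx.1, hx.2, hx2⟩

/-- Limiting size of the giant component in a class of density `y`. -/
noncomputable def gg (β y : ℝ) : ℝ := theta (β * y) * y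

/-- The function whose positive zero is `gg β y`. -/
noncomputable def fy (β y s : ℝ) : ℝ := y * (1 - Real.exp (-(β * s))) - s

lemma gg_spec {β y : ℝ} (hy : 0 < y) (h : 1 < β * y) :
    0 < gg β y ∧ gg β y < y ∧ fy β y (gg β y) = 0 := by
  obtain ⟨h1, h2, h3⟩ := theta_spec h
  refine ⟨mul_pos h1 hy, by unfold gg; nlinarith, ?_⟩
  unfold fy gg
  rw [show -(β * (theta (β * y) * y)) = -(β * y) * theta (β * y) by ring, h3]; ring

lemma F_eq (q : ℕ) (β x : ℝ) : F q β x = 1 / q + (1 - 1 / q) * gg β x := by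
  unfold F gg; ring

lemma fy_mono {β y y' s : ℝ} (hβ : 0 ≤ β) (hs : 0 ≤ s) (h : y ≤ y') : fy β y s ≤ fy β y' s := by
  unfold fy
  have : Real.exp (-(β * s)) ≤ 1 := Real.exp_le_one_iff.2 (by nlinarith)
  nlinarith

lemma fy_concave {β y : ℝ} (hy : 0 ≤ y) {a b c : ℝ} (hab : a ≤ b) (hbc : b ≤ c) :
    (c - b) * fy β y a + (b - a) * fy β y c ≤ (c - a) * fy β y b := by
  rcases eq_or_lt_of_le (hab.trans hbc) with h | h
  · subst h
    have : a = b := le_antisymm hab hbc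
    subst this; simp
  have hca : 0 < c - a := by linarith
  have := convexOn_exp.2 (Set.mem_univ (-(β * a))) (Set.mem_univ (-(β * c)))
    (div_nonneg (sub_nonneg.2 hbc) hca.le) (div_nonneg (sub_nonneg.2 hab) hca.le)
    (by field_simp; ring)
  simp only [smul_eq_mul] at this
  rw [show (c - b) / (c - a) * -(β * a) + (b - a) / (c - a) * -(β * c) = -(β * b) by
    field_simp; ring] at this
  have h2 : (c - a) * Real.exp (-(β * b)) ≤
      (c - b) * Real.exp (-(β * a)) + (b - a) * Real.exp (-(β * c)) := by
    calc _ ≤ (c - a) * ((c - b) / (c - a) * Real.exp (-(β * a)) +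
          (b - a) / (c - a) * Real.exp (-(β * c))) := by gcongr
      _ = _ := by field_simp
  unfold fy
  nlinarith

/-- Quantitative control of `fy` around its zero, uniformly over the densities `y ∈ [1/q, 1]`. -/
structure Consts (q : ℕ) (β e c : ℝ) : Prop where
  e_pos : 0 < e
  c_pos : 0 < c
  c_le : c ≤ 1
  e_le : ∀ y, 1 / (q : ℝ) ≤ y → y ≤ 1 → 3 * e ≤ gg β y
  lower : ∀ y, 1 / (q : ℝ) ≤ y → y ≤ 1 → ∀ s, e ≤ s → s ≤ gg β y → c * (gg β y - s) ≤ fy β y s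
  upper : ∀ y, 1 / (q : ℝ) ≤ y → y ≤ 1 → ∀ s, gg β y ≤ s → fy β y s ≤ -(c * (s - gg β y))
  sub : ∀ y, 1 / (q : ℝ) ≤ y → y ≤ 1 → β * (y - gg β y) ≤ 1 - c

section

variable {q : ℕ} {β : ℝ}

lemma one_lt_mul (hq : 2 ≤ q) (hβ : (q : ℝ) < β) {y : ℝ} (hy : 1 / (q : ℝ) ≤ y) : 1 < β * y := by
  have hq' : (0 : ℝ) < q := by positivity
  calc (1 : ℝ) = q * (1 / q) := by field_simp
    _ < β * (1 / q) := by gcongr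
    _ ≤ β * y := by have : 0 < β := hq'.trans hβ
                    gcongr

lemma exists_consts (hq : 2 ≤ q) (hβ : (q : ℝ) < β) : ∃ e c, Consts q β e c := by
  have hq' : (0 : ℝ) < q := by positivity
  have hβ0 : 0 < β := hq'.trans hβ
  have h0 : 0 < 1 / (q : ℝ) := by positivity
  obtain ⟨hg1, hg2, hg3⟩ := gg_spec h0 (one_lt_mul hq hβ le_rfl)
  set g0 := gg β (1 / q) with hg0
  set e := g0 / 3 with he
  have he0 : 0 < e := by positivity
  -- strict positivity of `fy` at `e`
  have hc0 : 0 < fy β (1 / q) e := by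
    have := strictConvexOn_exp.2 (Set.mem_univ (-(β * g0))) (Set.mem_univ 0)
      (by simp; exact ⟨by linarith, hg1.ne'⟩) (show (0 : ℝ) < 1 / 3 by norm_num)
      (show (0 : ℝ) < 2 / 3 by norm_num) (by norm_num)
    simp only [smul_eq_mul, mul_zero, add_zero, Real.exp_zero, mul_one] at this
    rw [show 1 / 3 * -(β * g0) = -(β * e) by rw [he]; ring] at this
    unfold fy at hg3 ⊢
    have h4 : e = 1 / 3 * g0 := by rw [he]; ring
    have h5 := mul_lt_mul_of_pos_left this h0
    nlinarith
  set c := fy β (1 / q) e with hc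
  have hcle : c ≤ 1 := by
    have : c ≤ 1 / q := by
      rw [hc]; unfold fy
      have := Real.exp_pos (-(β * e))
      nlinarith
    refine this.trans ?_
    rw [div_le_one hq']
    exact_mod_cast (by omega : 1 ≤ q)
  have key : ∀ y, 1 / (q : ℝ) ≤ y → y ≤ 1 → c ≤ fy β y e := fun y hy _ =>
    fy_mono hβ0.le he0.le hy
  have hspec : ∀ y, 1 / (q : ℝ) ≤ y → 0 < gg β y ∧ gg β y < y ∧ fy β y (gg β y) = 0 := fun y hy =>
    gg_spec (h0.trans_le hy) (one_lt_mul hq hβ hy)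
  have hle : ∀ y, 1 / (q : ℝ) ≤ y → y ≤ 1 → 3 * e ≤ gg β y := by
    intro y hy hy1
    by_contra hcon
    push Not at hcon
    obtain ⟨h1, h2, h3⟩ := hspec y hy
    have h4 : 3 * e = g0 := by rw [he]; ring
    have h5 := fy_mono hβ0.le hg1.le hy
    rw [hg3] at h5
    rcases le_or_gt (gg β y) e with h6 | h6
    · have h7 := fy_concave (β := β) (h0.le.trans hy) h1.le h6
      have h8 := fy_concave (β := β) (h0.le.trans hy) h6 (by linarith : e ≤ g0)
      have h10 := key y hy hy1
      have h9 : fy β y 0 = 0 := by unfold fy; simp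
      rw [h9, h3] at h7
      have h11 : gg β y * fy β y e ≤ 0 := by nlinarith
      have : 0 < gg β y * fy β y e := mul_pos h1 (hc0.trans_le h10)
      linarith
    · have h7 := fy_concave (β := β) (h0.le.trans hy) h6.le (by linarith : gg β y ≤ g0)
      rw [h3] at h7
      have h10 := key y hy hy1
      have h11 : 0 < (g0 - gg β y) * fy β y e := mul_pos (by linarith) (hc0.trans_le h10)
      have h12 : 0 ≤ (gg β y - e) * fy β y g0 := mul_nonneg (by linarith) h5
      linarith
  refine ⟨e, c, he0, hc0, hcle, hle, ?_, ?_, ?_⟩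
  · intro y hy hy1 s hs1 hs2
    obtain ⟨h1, h2, h3⟩ := hspec y hy
    have h4 := fy_concave (β := β) (h0.le.trans hy) hs1 hs2
    rw [h3] at h4
    have h5 := key y hy hy1
    have h6 := hle y hy hy1
    have h7 : 0 < gg β y - e := by linarith
    have h8 : (gg β y - s) * c ≤ (gg β y - s) * fy β y e :=
      mul_le_mul_of_nonneg_left h5 (by linarith)
    have h9 : 0 ≤ fy β y s := by
      by_contra hcon
      push Not at hcon
      have : (gg β y - e) * fy β y s < 0 := mul_neg_of_pos_of_neg h7 hcon
      have : 0 ≤ (gg β y - s) * c := mul_nonneg (by linarith) hc0.le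
      linarith
    have h10 : (gg β y - e) * fy β y s ≤ 1 * fy β y s :=
      mul_le_mul_of_nonneg_right (by linarith) h9
    linarith
  · intro y hy hy1 s hs1
    obtain ⟨h1, h2, h3⟩ := hspec y hy
    have h6 := hle y hy hy1
    have h4 := fy_concave (β := β) (h0.le.trans hy) (by linarith : e ≤ gg β y) hs1
    rw [h3] at h4
    have h5 := key y hy hy1
    have h8 : (s - gg β y) * c ≤ (s - gg β y) * fy β y e :=
      mul_le_mul_of_nonneg_left h5 (by linarith)
    have h11 : (gg β y - e) * fy β y s ≤ -((s - gg β y) * c) := by linarith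
    by_contra hcon
    push Not at hcon
    have h0' : 0 ≤ (s - gg β y) * c := mul_nonneg (by linarith) hc0.le
    have h12 : (gg β y - e) * (-(c * (s - gg β y))) < (gg β y - e) * fy β y s :=
      mul_lt_mul_of_pos_left hcon (by linarith)
    nlinarith
  · intro y hy hy1
    obtain ⟨h1, h2, h3⟩ := hspec y hy
    have h6 := hle y hy hy1
    have h5 := key y hy hy1
    have h7 : Real.exp (-(β * e)) = Real.exp (-(β * gg β y)) * Real.exp (β * (gg β y - e)) := by
      rw [← Real.exp_add]; ring_nf
    have h8 := Real.add_one_le_exp (β * (gg β y - e))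
    have h9 : y * Real.exp (-(β * gg β y)) = y - gg β y := by unfold fy at h3; linarith
    have h10 : fy β y e ≤ (gg β y - e) * (1 - β * (y - gg β y)) := by
      unfold fy
      rw [h7]
      have : (y - gg β y) * (β * (gg β y - e) + 1) ≤
        (y - gg β y) * Real.exp (β * (gg β y - e)) := by
        apply mul_le_mul_of_nonneg_left h8; linarith
      have h9' : y * (Real.exp (-(β * gg β y)) * Real.exp (β * (gg β y - e))) =
          (y - gg β y) * Real.exp (β * (gg β y - e)) := by rw [← mul_assoc, h9]
      rw [mul_sub, h9']
      linarith
    have h13 : 0 < 1 - β * (y - gg β y) := by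
      by_contra hcon
      push Not at hcon
      have := mul_nonpos_of_nonneg_of_nonpos (by linarith : 0 ≤ gg β y - e) hcon
      linarith
    have h14 : (gg β y - e) * (1 - β * (y - gg β y)) ≤ 1 * (1 - β * (y - gg β y)) :=
      mul_le_mul_of_nonneg_right (by linarith) h13.le
    linarith

end

lemma sub_two_add_exp_nonneg {z : ℝ} (hz : 0 ≤ z) :
    0 ≤ (z - 2) + (z + 2) * Real.exp (-z) := by
  have hd : ∀ x : ℝ, HasDerivAt (fun z : ℝ => (z - 2) + (z + 2) * Real.exp (-z))
      (1 + (1 * Real.exp (-x) + (x + 2) * (Real.exp (-x) * -1))) x := fun x =>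
    ((hasDerivAt_id x).sub_const 2).add
      (((hasDerivAt_id x).add_const 2).mul ((hasDerivAt_neg x).exp))
  have hm : MonotoneOn (fun z : ℝ => (z - 2) + (z + 2) * Real.exp (-z)) (Set.Ici 0) := by
    apply monotoneOn_of_deriv_nonneg (convex_Ici 0)
    · exact fun x _ => (hd x).continuousAt.continuousWithinAt
    · exact fun x _ => (hd x).differentiableAt.differentiableWithinAt
    · intro x hx
      rw [(hd x).deriv]
      rw [interior_Ici, Set.mem_Ioi] at hx
      have h1 := Real.add_one_le_exp x
      have h2 := Real.exp_pos (-x)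
      have h3 : Real.exp x * Real.exp (-x) = 1 := by rw [← Real.exp_add]; simp
      nlinarith
  have := hm (Set.mem_Ici.2 le_rfl) (Set.mem_Ici.2 hz) hz
  simpa using this

lemma convexOn_div_one_sub_exp :
    ConvexOn ℝ (Set.Ioi (0 : ℝ)) (fun z => z / (1 - Real.exp (-z))) := by
  have hpos : ∀ x : ℝ, 0 < x → 0 < 1 - Real.exp (-x) := fun x hx => by
    have : Real.exp (-x) < 1 := by rw [Real.exp_lt_one_iff]; linarith
    linarith
  have hE : ∀ x : ℝ, HasDerivAt (fun z : ℝ => 1 - Real.exp (-z)) (Real.exp (-x)) x := fun x => by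
    exact (((hasDerivAt_neg x).exp).const_sub 1).congr_deriv (by ring)
  have hd : ∀ x : ℝ, 0 < x → HasDerivAt (fun z : ℝ => z / (1 - Real.exp (-z)))
      ((1 * (1 - Real.exp (-x)) - x * Real.exp (-x)) / (1 - Real.exp (-x)) ^ 2) x := fun x hx =>
    (hasDerivAt_id x).div (hE x) (hpos x hx).ne'
  have hd2 : ∀ x : ℝ, 0 < x → HasDerivAt
      (fun z : ℝ => (1 * (1 - Real.exp (-z)) - z * Real.exp (-z)) / (1 - Real.exp (-z)) ^ 2)
      (Real.exp (-x) * ((x - 2) + (x + 2) * Real.exp (-x)) / (1 - Real.exp (-x)) ^ 3) x := by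
    intro x hx
    have h1 : HasDerivAt (fun z : ℝ => Real.exp (-z)) (Real.exp (-x) * -1) x :=
      (hasDerivAt_neg x).exp
    have := ((((hE x).const_mul 1)).sub ((hasDerivAt_id x).mul h1)).div ((hE x).pow 2)
      (pow_ne_zero 2 (hpos x hx).ne')
    refine this.congr_deriv ?_
    have := (hpos x hx).ne'
    simp only [Pi.pow_apply, Pi.sub_apply, Pi.mul_apply, id_eq, Nat.cast_ofNat]
    field_simp
    ring
  refine convexOn_of_hasDerivWithinAt2_nonneg (convex_Ioi 0)
    (fun x hx => (hd x hx).continuousAt.continuousWithinAt)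
    (f' := fun z => (1 * (1 - Real.exp (-z)) - z * Real.exp (-z)) / (1 - Real.exp (-z)) ^ 2)
    (f'' := fun x => Real.exp (-x) * ((x - 2) + (x + 2) * Real.exp (-x)) / (1 - Real.exp (-x)) ^ 3)
    ?_ ?_ ?_
  · intro x hx
    rw [interior_Ioi] at hx
    exact (hd x hx).hasDerivWithinAt
  · intro x hx
    rw [interior_Ioi] at hx
    exact (hd2 x hx).hasDerivWithinAt
  · intro x hx
    rw [interior_Ioi] at hx
    have := hpos x hx
    have h2 := sub_two_add_exp_nonneg (le_of_lt hx)
    positivity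

section

variable {q : ℕ} {β e c : ℝ}

lemma gg_lipschitz (hq : 2 ≤ q) (hβ : (q : ℝ) < β) (hC : Consts q β e c) {y y' : ℝ}
    (hy : 1 / (q : ℝ) ≤ y) (hyy : y < y') (hy' : y' ≤ 1) :
    gg β y < gg β y' ∧ c * (gg β y' - gg β y) ≤ y' - y := by
  have hq' : (0 : ℝ) < q := by positivity
  have h0 : 0 < 1 / (q : ℝ) := by positivity
  have hβ0 : 0 < β := hq'.trans hβ
  obtain ⟨h1, h2, h3⟩ := gg_spec (h0.trans_le hy) (one_lt_mul hq hβ hy)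
  have h4 : fy β y' (gg β y) = (y' - y) * (1 - Real.exp (-(β * gg β y))) := by
    unfold fy at h3 ⊢; linarith
  have h5 : Real.exp (-(β * gg β y)) < 1 := by
    rw [Real.exp_lt_one_iff]; have := mul_pos hβ0 h1; linarith
  have h6 : 0 < fy β y' (gg β y) := by rw [h4]; apply mul_pos <;> linarith
  have hlt : gg β y < gg β y' := by
    by_contra hcon
    push Not at hcon
    have := hC.upper y' (hy.trans hyy.le) hy' _ hcon
    have := mul_nonneg hC.c_pos.le (sub_nonneg.2 hcon)
    linarith
  refine ⟨hlt, ?_⟩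
  have h7 := hC.lower y' (hy.trans hyy.le) hy' (gg β y)
    (by linarith [hC.e_le y hy (hyy.le.trans hy'), hC.e_pos]) hlt.le
  have := Real.exp_pos (-(β * gg β y))
  nlinarith

lemma gg_concave (hq : 2 ≤ q) (hβ : (q : ℝ) < β) (hC : Consts q β e c) :
    ConcaveOn ℝ (Set.Icc (1 / (q : ℝ)) 1) (gg β) := by
  have hq' : (0 : ℝ) < q := by positivity
  have h0 : 0 < 1 / (q : ℝ) := by positivity
  have hβ0 : 0 < β := hq'.trans hβ
  refine ⟨convex_Icc _ _, fun y1 hy1 y2 hy2 t1 t2 ht1 ht2 ht => ?_⟩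
  have hY := convex_Icc _ _ hy1 hy2 ht1 ht2 ht
  have hs : ∀ y, y ∈ Set.Icc (1 / (q : ℝ)) 1 → 0 < gg β y ∧
      β * gg β y / (1 - Real.exp (-(β * gg β y))) = β * y := by
    intro y hy
    obtain ⟨h1, h2, h3⟩ := gg_spec (h0.trans_le hy.1) (one_lt_mul hq hβ hy.1)
    refine ⟨h1, ?_⟩
    have h5 : Real.exp (-(β * gg β y)) < 1 := by
      rw [Real.exp_lt_one_iff]; have := mul_pos hβ0 h1; linarith
    rw [div_eq_iff (by linarith)]
    unfold fy at h3
    linear_combination (-β) * h3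
  have hcv := convexOn_div_one_sub_exp.2 (Set.mem_Ioi.2 (mul_pos hβ0 (hs y1 hy1).1))
    (Set.mem_Ioi.2 (mul_pos hβ0 (hs y2 hy2).1)) ht1 ht2 ht
  simp only [smul_eq_mul, (hs y1 hy1).2, (hs y2 hy2).2] at hcv hY ⊢
  set s := t1 * gg β y1 + t2 * gg β y2 with hsdef
  have hspos : 0 < s := (convex_Ioi (0 : ℝ)) (hs y1 hy1).1 (hs y2 hy2).1 ht1 ht2 ht
  rw [show t1 * (β * gg β y1) + t2 * (β * gg β y2) = β * s by rw [hsdef]; ring,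
    show t1 * (β * y1) + t2 * (β * y2) = β * (t1 * y1 + t2 * y2) by ring] at hcv
  have h5 : Real.exp (-(β * s)) < 1 := by
    rw [Real.exp_lt_one_iff]; have := mul_pos hβ0 hspos; linarith
  rw [div_le_iff₀ (by linarith), mul_assoc] at hcv
  have h6 := le_of_mul_le_mul_left hcv hβ0
  by_contra hcon
  push Not at hcon
  have h7 := hC.upper _ hY.1 hY.2 s hcon.le
  have h8 := mul_pos hC.c_pos (sub_pos.2 hcon)
  unfold fy at h7
  linarith

end

/-- The facts about the drift function near its fixed point used by the probabilistic argument. -/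
structure Drift (q : ℕ) (β a ρ ρ' δ K c₀ : ℝ) : Prop where
  a_gt : 1 / (q : ℝ) < a
  a_lt : a < 1
  fix : F q β a = a
  lt_ρ : 1 - 1 / (q : ℝ) < ρ
  ρ_le : ρ ≤ ρ'
  ρ'_lt : ρ' < 1
  δ_pos : 0 < δ
  le_sub : 1 / (q : ℝ) ≤ a - δ
  lip : ∀ x ∈ Set.Icc (a - δ) 1, ∀ x' ∈ Set.Icc (a - δ) 1,
    |F q β x - F q β x'| ≤ ρ' * |x - x'|
  lt_F : ∀ x, 1 / (q : ℝ) ≤ x → x < a → x < F q β x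
  mono : MonotoneOn (F q β) (Set.Icc (1 / (q : ℝ)) 1)
  maps : Set.MapsTo (F q β) (Set.Icc (1 / (q : ℝ)) 1) (Set.Icc (1 / (q : ℝ)) 1)
  cont : ContinuousOn (F q β) (Set.Icc (1 / (q : ℝ)) 1)
  maps' : Set.MapsTo (F q β) (Set.Icc (a - δ) 1) (Set.Icc (a - δ) 1)
  c₀_pos : 0 < c₀
  iter_le : ∀ y ∈ Set.Icc (a - δ) 1, ∀ t : ℕ, |(F q β)^[t] y - a| ≤ K * ρ ^ t
  iter_ge : ∀ t : ℕ, c₀ * ρ ^ t ≤ (F q β)^[t] 1 - a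

section

variable {q : ℕ} {β e c : ℝ}

lemma abs_exp_neg_sub_le {z b : ℝ} (hz : |z| ≤ b) :
    |Real.exp (-z) - 1 + z| ≤ (Real.exp b + 1 + b) * z ^ 2 := by
  have hb : 0 ≤ b := (abs_nonneg z).trans hz
  have hE := Real.exp_pos b
  rcases le_or_gt |z| 1 with h | h
  · have := Real.abs_exp_sub_one_sub_id_le (x := -z) (by rwa [abs_neg])
    rw [sub_neg_eq_add, neg_sq] at this
    nlinarith [sq_nonneg z]
  · have h1 : 1 ≤ z ^ 2 := by rw [← sq_abs]; nlinarith
    have h2 : Real.exp (-z) ≤ Real.exp b := Real.exp_le_exp.2 (by linarith [neg_abs_le z])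
    have h3 := Real.exp_pos (-z)
    have h4 : |Real.exp (-z) - 1 + z| ≤ Real.exp b + 1 + b := by
      rw [abs_le] at hz ⊢; constructor <;> linarith
    nlinarith

lemma F_lipschitz (hq : 2 ≤ q) (hβ : (q : ℝ) < β) (hC : Consts q β e c) {y y' : ℝ}
    (hy : 1 / (q : ℝ) ≤ y) (hyy : y < y') (hy' : y' ≤ 1) :
    F q β y < F q β y' ∧ c * (F q β y' - F q β y) ≤ y' - y := by
  obtain ⟨h1, h2⟩ := gg_lipschitz hq hβ hC hy hyy hy'
  have hq' : (2 : ℝ) ≤ q := by exact_mod_cast hq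
  have h3 : 1 / (q : ℝ) ≤ 1 / 2 := by gcongr
  have h4 : 0 < 1 / (q : ℝ) := by positivity
  rw [F_eq, F_eq]
  constructor
  · nlinarith
  · have := mul_pos hC.c_pos (sub_pos.2 h1)
    nlinarith

lemma F_concave (hq : 2 ≤ q) (hβ : (q : ℝ) < β) (hC : Consts q β e c) :
    ConcaveOn ℝ (Set.Icc (1 / (q : ℝ)) 1) (F q β) := by
  have hq' : (2 : ℝ) ≤ q := by exact_mod_cast hq
  have h3 : 1 / (q : ℝ) ≤ 1 / 2 := by gcongr
  have h1 := (concaveOn_const (1 / (q : ℝ)) (convex_Icc (1 / (q : ℝ)) 1)).add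
    ((gg_concave hq hβ hC).smul (show 0 ≤ 1 - 1 / (q : ℝ) by linarith))
  refine h1.congr (fun x _ => ?_)
  simp only [F_eq, smul_eq_mul, Pi.add_apply]

lemma F_abs_lipschitz (hq : 2 ≤ q) (hβ : (q : ℝ) < β) (hC : Consts q β e c) {y y' : ℝ}
    (hy : y ∈ Set.Icc (1 / (q : ℝ)) 1) (hy' : y' ∈ Set.Icc (1 / (q : ℝ)) 1) :
    c * |F q β y - F q β y'| ≤ |y - y'| := by
  rcases lt_trichotomy y y' with h | h | h
  · obtain ⟨h1, h2⟩ := F_lipschitz hq hβ hC hy.1 h hy'.2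
    rw [abs_of_neg (by linarith), abs_of_neg (by linarith)]; linarith
  · subst h; simp
  · obtain ⟨h1, h2⟩ := F_lipschitz hq hβ hC hy'.1 h hy.2
    rw [abs_of_pos (by linarith), abs_of_pos (by linarith)]; linarith

lemma F_continuousOn (hq : 2 ≤ q) (hβ : (q : ℝ) < β) (hC : Consts q β e c) :
    ContinuousOn (F q β) (Set.Icc (1 / (q : ℝ)) 1) := by
  have : LipschitzOnWith (Real.toNNReal (1 / c)) (F q β) (Set.Icc (1 / (q : ℝ)) 1) := by
    refine LipschitzOnWith.of_dist_le_mul fun x hx y hy => ?_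
    rw [Real.coe_toNNReal _ (by have := hC.c_pos; positivity), Real.dist_eq, Real.dist_eq]
    have := F_abs_lipschitz hq hβ hC hx hy
    rw [one_div, inv_mul_eq_div, le_div_iff₀ hC.c_pos]; linarith
  exact this.continuousOn

/-- Second-order expansion of the drift at a point. -/
lemma F_taylor (hq : 2 ≤ q) (hβ : (q : ℝ) < β) (hC : Consts q β e c) {a : ℝ}
    (ha : a ∈ Set.Icc (1 / (q : ℝ)) 1) :
    ∃ ρ K : ℝ, 0 ≤ K ∧ (1 - β * (a - gg β a)) * ρ = (1 - 1 / q) * (1 - Real.exp (-(β * gg β a))) ∧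
      ∀ x ∈ Set.Icc (1 / (q : ℝ)) 1, |F q β x - F q β a - ρ * (x - a)| ≤ K * (x - a) ^ 2 := by
  have hq' : (2 : ℝ) ≤ q := by exact_mod_cast hq
  have h0 : 0 < 1 / (q : ℝ) := by positivity
  have h12 : 1 / (q : ℝ) ≤ 1 / 2 := by gcongr
  have hβ0 : 0 < β := by linarith
  have hc := hC.c_pos
  set B := 1 - β * (a - gg β a) with hB
  have hBc : c ≤ B := by have := hC.sub a ha.1 ha.2; linarith
  have hB0 : 0 < B := by linarith
  set u := Real.exp (-(β * gg β a)) with hu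
  have hu0 : 0 < u := Real.exp_pos _
  have hgs : ∀ x ∈ Set.Icc (1 / (q : ℝ)) 1, 0 < gg β x ∧ gg β x < x ∧ fy β x (gg β x) = 0 :=
    fun x hx => gg_spec (h0.trans_le hx.1) (one_lt_mul hq hβ hx.1)
  have hu1 : u ≤ 1 := by
    rw [hu, Real.exp_le_one_iff]; have := mul_pos hβ0 (hgs a ha).1; linarith
  set M := (Real.exp β + 1 + β) * β ^ 2 with hM
  have hM0 : 0 ≤ M := by positivity
  set K := (β / c + M / c ^ 2) / c with hK
  refine ⟨(1 - 1 / q) * (1 - u) / B, K, by positivity, by field_simp, fun x hx => ?_⟩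
  obtain ⟨hx1, hx2, hx3⟩ := hgs x hx
  obtain ⟨ha1, ha2, ha3⟩ := hgs a ha
  set h := gg β x - gg β a with hh
  have hh1 : |h| ≤ 1 := by
    rw [abs_le]; constructor <;> linarith [hx.2, ha.2]
  have hhl : c * |h| ≤ |x - a| := by
    rcases lt_trichotomy x a with hlt | heq | hlt
    · obtain ⟨h1, h2⟩ := gg_lipschitz hq hβ hC hx.1 hlt ha.2
      rw [abs_of_neg (by linarith), abs_of_neg (by linarith)]; linarith
    · simp [hh, heq]
    · obtain ⟨h1, h2⟩ := gg_lipschitz hq hβ hC ha.1 hlt hx.2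
      rw [abs_of_pos (by linarith), abs_of_pos (by linarith)]; linarith
  set R := Real.exp (-(β * h)) - 1 + β * h with hR
  have hRb : |R| ≤ M * h ^ 2 := by
    have := abs_exp_neg_sub_le (z := β * h) (b := β) (by
      rw [abs_mul, abs_of_pos hβ0]; nlinarith)
    rw [hM]; calc |R| ≤ _ := this
      _ = _ := by ring
  have hexp : Real.exp (-(β * gg β x)) = u * (1 - β * h + R) := by
    rw [hR, show 1 - β * h + (Real.exp (-(β * h)) - 1 + β * h) = Real.exp (-(β * h)) by ring,
      hu, ← Real.exp_add]
    congr 1; rw [hh]; ring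
  have hid : h * B = (x - a) * (1 - u) + ((x - a) * u * β * h - x * u * R) := by
    unfold fy at hx3 ha3
    rw [hexp] at hx3
    rw [← hu] at ha3
    have hau : a - gg β a = a * u := by linarith
    rw [hB, hau]
    linear_combination ha3 - hx3
  set S := (x - a) * u * β * h - x * u * R with hS
  have hSb : |S| ≤ (β / c + M / c ^ 2) * (x - a) ^ 2 := by
    have e1 : |h| ≤ |x - a| / c := by rw [le_div_iff₀ hc]; linarith
    have e2 : |(x - a) * u * β * h| ≤ β / c * (x - a) ^ 2 := by
      rw [abs_mul, abs_mul, abs_mul, abs_of_pos hu0, abs_of_pos hβ0, ← sq_abs (x - a)]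
      calc |x - a| * u * β * |h| ≤ |x - a| * 1 * β * (|x - a| / c) := by gcongr
        _ = _ := by ring
    have e3 : |x * u * R| ≤ M / c ^ 2 * (x - a) ^ 2 := by
      have hx0 : 0 ≤ x := h0.le.trans hx.1
      rw [abs_mul, abs_of_nonneg (mul_nonneg hx0 hu0.le)]
      calc x * u * |R| ≤ 1 * 1 * (M * h ^ 2) := by gcongr; exact hx.2
        _ = M * |h| ^ 2 := by rw [sq_abs]; ring
        _ ≤ M * (|x - a| / c) ^ 2 := by gcongr
        _ = _ := by rw [div_pow, sq_abs]; ring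
    calc |S| ≤ |(x - a) * u * β * h| + |x * u * R| := abs_sub _ _
      _ ≤ _ := by linarith
  have hfin : F q β x - F q β a - (1 - 1 / q) * (1 - u) / B * (x - a) = (1 - 1 / q) * (S / B) := by
    rw [F_eq, F_eq]
    have : h = ((x - a) * (1 - u) + S) / B := by rw [eq_div_iff hB0.ne']; exact hid
    rw [show 1 / (q : ℝ) + (1 - 1 / q) * gg β x - (1 / q + (1 - 1 / q) * gg β a) =
      (1 - 1 / q) * h by rw [hh]; ring, this]
    ring
  rw [hfin, abs_mul, abs_div, abs_of_pos hB0, abs_of_nonneg (by linarith)]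
  calc (1 - 1 / (q : ℝ)) * (|S| / B) ≤ 1 * ((β / c + M / c ^ 2) * (x - a) ^ 2 / c) := by
        gcongr; linarith
    _ = _ := by rw [hK]; ring

end

/-- Iterating a one-dimensional recursion with a quadratic error. -/
lemma iterate_upper {d : ℕ → ℝ} {ρ ρ' K : ℝ} (hρ : 0 < ρ) (hρ' : 0 ≤ ρ') (hρ1 : ρ' < 1)
    (hK : 0 ≤ K) (hd : ∀ t, 0 ≤ d t) (hb : ∀ t, d t ≤ ρ' ^ t)
    (hs : ∀ t, d (t + 1) ≤ ρ * d t + K * d t ^ 2) (t : ℕ) :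
    d t ≤ ρ ^ t * Real.exp (K / (ρ * (1 - ρ')) * (1 - ρ' ^ t)) := by
  induction t with
  | zero => simpa using hb 0
  | succ t ih =>
    have h1 : d (t + 1) ≤ d t * (ρ * (1 + K / ρ * ρ' ^ t)) := by
      have : d t * (ρ * (1 + K / ρ * ρ' ^ t)) = ρ * d t + K * (d t * ρ' ^ t) := by
        field_simp
      rw [this]
      have := mul_le_mul_of_nonneg_left (hb t) (hd t)
      nlinarith [hs t]
    have h2 : 1 + K / ρ * ρ' ^ t ≤ Real.exp (K / ρ * ρ' ^ t) := by
      rw [add_comm]; exact Real.add_one_le_exp _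
    have hne : (1 - ρ') ≠ 0 := by linarith
    calc d (t + 1) ≤ d t * (ρ * (1 + K / ρ * ρ' ^ t)) := h1
      _ ≤ (ρ ^ t * Real.exp (K / (ρ * (1 - ρ')) * (1 - ρ' ^ t))) *
          (ρ * Real.exp (K / ρ * ρ' ^ t)) := by gcongr
      _ = ρ ^ (t + 1) * (Real.exp (K / (ρ * (1 - ρ')) * (1 - ρ' ^ t)) *
          Real.exp (K / ρ * ρ' ^ t)) := by ring
      _ = _ := by
        rw [← Real.exp_add]; congr 2; field_simp; ring

lemma iterate_lower {d : ℕ → ℝ} {ρ ρ' K : ℝ} (hρ : 0 < ρ) (hρle : ρ ≤ ρ') (hρ1 : ρ' < 1)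
    (hK : 0 ≤ K) (hd : ∀ t, 0 < d t) (hb : ∀ t, d t ≤ ρ' ^ t) (hanti : ∀ t, d (t + 1) ≤ d t)
    (hs : ∀ t, ρ * d t - K * d t ^ 2 ≤ d (t + 1)) :
    ∃ c₀ : ℝ, 0 < c₀ ∧ ∀ t, c₀ * ρ ^ t ≤ d t := by
  have hρ'0 : 0 < ρ' := hρ.trans_le hρle
  set L := K / (ρ * (1 - ρ')) with hL
  have hL0 : 0 ≤ L := div_nonneg hK (mul_nonneg hρ.le (by linarith))
  obtain ⟨T, hT⟩ : ∃ T : ℕ, K / ρ * ρ' ^ T ≤ 1 / 2 := by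
    have := (tendsto_pow_atTop_nhds_zero_of_lt_one hρ'0.le hρ1).const_mul (K / ρ)
    rw [mul_zero] at this
    exact (this.eventually (ge_mem_nhds (by norm_num : (0 : ℝ) < 1 / 2))).exists
  have key : ∀ s, d T * (ρ ^ s * Real.exp (-(2 * L * (1 - ρ' ^ s)))) ≤ d (T + s) := by
    intro s
    induction s with
    | zero => simp
    | succ s ih =>
      have hx : K / ρ * ρ' ^ (T + s) ≤ 1 / 2 := by
        refine le_trans ?_ hT
        exact mul_le_mul_of_nonneg_left
          (pow_le_pow_of_le_one hρ'0.le hρ1.le (by omega)) (by positivity)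
      have hx0 : 0 ≤ K / ρ * ρ' ^ (T + s) := by positivity
      have h1 : d (T + s) * (ρ * (1 - K / ρ * ρ' ^ (T + s))) ≤ d (T + (s + 1)) := by
        have e : d (T + s) * (ρ * (1 - K / ρ * ρ' ^ (T + s))) =
          ρ * d (T + s) - K * (d (T + s) * ρ' ^ (T + s)) := by field_simp
        rw [e]
        have := mul_le_mul_of_nonneg_left (hb (T + s)) (hd (T + s)).le
        have h2 := hs (T + s)
        rw [← add_assoc]
        nlinarith
      have h2 : Real.exp (-(2 * (K / ρ * ρ' ^ s))) ≤ 1 - K / ρ * ρ' ^ (T + s) := by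
        have h3 : Real.exp (-(2 * (K / ρ * ρ' ^ s))) ≤
            Real.exp (-(2 * (K / ρ * ρ' ^ (T + s)))) := by
          apply Real.exp_le_exp.2
          have : ρ' ^ (T + s) ≤ ρ' ^ s := pow_le_pow_of_le_one hρ'0.le hρ1.le (by omega)
          have : K / ρ * ρ' ^ (T + s) ≤ K / ρ * ρ' ^ s := by gcongr
          linarith
        refine h3.trans ?_
        set x := K / ρ * ρ' ^ (T + s)
        rw [Real.exp_neg]
        have h5 := Real.add_one_le_exp (2 * x)
        rw [inv_le_iff_one_le_mul₀ (Real.exp_pos _)]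
        nlinarith
      have hne : (1 - ρ') ≠ 0 := by linarith
      have h5 : Real.exp (-(2 * L * (1 - ρ' ^ (s + 1)))) =
          Real.exp (-(2 * L * (1 - ρ' ^ s))) * Real.exp (-(2 * (K / ρ * ρ' ^ s))) := by
        rw [← Real.exp_add]; congr 1; rw [hL]; field_simp; ring
      have hdT := hd T
      calc _ = (d T * (ρ ^ s * Real.exp (-(2 * L * (1 - ρ' ^ s))))) *
            (ρ * Real.exp (-(2 * (K / ρ * ρ' ^ s)))) := by rw [h5]; ring
        _ ≤ d (T + s) * (ρ * (1 - K / ρ * ρ' ^ (T + s))) := by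
            have := hd (T + s)
            gcongr
        _ ≤ _ := h1
  refine ⟨d T * Real.exp (-(2 * L)), mul_pos (hd T) (Real.exp_pos _), fun t => ?_⟩
  have hE : Real.exp (-(2 * L)) ≤ 1 := by rw [Real.exp_le_one_iff]; linarith
  have hρ1' : ρ ≤ 1 := by linarith
  have hdT := hd T
  rcases le_or_gt T t with h | h
  · obtain ⟨s, rfl⟩ := Nat.exists_eq_add_of_le h
    refine le_trans ?_ (key s)
    rw [mul_assoc]
    refine mul_le_mul_of_nonneg_left ?_ (hd T).le
    rw [mul_comm]
    have : 0 ≤ ρ' ^ s := by positivity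
    gcongr ?_ * Real.exp ?_
    · exact pow_le_pow_of_le_one hρ.le hρ1' (by omega)
    · nlinarith
  · have : d T ≤ d t := antitone_nat_of_succ_le hanti h.le
    have h1 : ρ ^ t ≤ 1 := pow_le_one₀ hρ.le hρ1'
    calc d T * Real.exp (-(2 * L)) * ρ ^ t ≤ d T * 1 * 1 := by gcongr
      _ ≤ d t := by linarith

theorem exists_drift {q : ℕ} {β e c : ℝ} (hq : 2 ≤ q) (hβ : (q : ℝ) < β) (hC : Consts q β e c) :
    ∃ ρ ρ' δ K c₀, Drift q β (aFix q β) ρ ρ' δ K c₀ ∧ HasDerivAt (F q β) ρ (aFix q β) ∧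
      β * ((1 - aFix q β) / (q - 1)) ≤ 1 - c := by
  have hq' : (2 : ℝ) ≤ q := by exact_mod_cast hq
  have h0 : 0 < 1 / (q : ℝ) := by positivity
  have h12 : 1 / (q : ℝ) ≤ 1 / 2 := by gcongr
  have hβ0 : 0 < β := by linarith
  set b := 1 / (q : ℝ) with hb
  have hmb : b ∈ Set.Icc b 1 := ⟨le_rfl, by linarith⟩
  have hm1 : (1 : ℝ) ∈ Set.Icc b 1 := ⟨by linarith, le_rfl⟩
  have hgs : ∀ x ∈ Set.Icc b 1, 0 < gg β x ∧ gg β x < x ∧ fy β x (gg β x) = 0 :=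
    fun x hx => gg_spec (h0.trans_le hx.1) (one_lt_mul hq hβ hx.1)
  have hFb : ∀ x ∈ Set.Icc b 1, b < F q β x := by
    intro x hx
    have := (hgs x hx).1
    rw [F_eq]
    have : 0 < (1 - b) * gg β x := mul_pos (by linarith) this
    linarith
  have hF1 : ∀ x ∈ Set.Icc b 1, F q β x < 1 := by
    intro x hx
    have h1 := (hgs x hx).2.1
    rw [F_eq]
    have : (1 - b) * gg β x < (1 - b) * 1 := mul_lt_mul_of_pos_left (by linarith [hx.2]) (by linarith)
    linarith
  have hcont := F_continuousOn hq hβ hC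
  have hcv := F_concave hq hβ hC
  have hmono : ∀ x x', b ≤ x → x < x' → x' ≤ 1 → F q β x < F q β x' := fun x x' h h' h'' =>
    (F_lipschitz hq hβ hC h h' h'').1
  have hmonoOn : MonotoneOn (F q β) (Set.Icc b 1) := by
    intro x hx x' hx' hxx
    rcases hxx.eq_or_lt with rfl | h
    · exact le_rfl
    · exact (hmono x x' hx.1 h hx'.2).le
  have hc3 : ∀ x y z, b ≤ x → x ≤ y → y ≤ z → z ≤ 1 →
      (z - y) * F q β x + (y - x) * F q β z ≤ (z - x) * F q β y := by
    intro x y z hx hxy hyz hz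
    rcases eq_or_lt_of_le (hxy.trans hyz) with h | h
    · have : x = y := le_antisymm hxy (h ▸ hyz)
      subst this; subst h; simp
    have hzx : 0 < z - x := by linarith
    have := hcv.2 (x := x) ⟨hx, by linarith⟩ (y := z) ⟨by linarith, hz⟩
      (div_nonneg (sub_nonneg.2 hyz) hzx.le) (div_nonneg (sub_nonneg.2 hxy) hzx.le)
      (by field_simp; ring)
    simp only [smul_eq_mul] at this
    rw [show (z - y) / (z - x) * x + (y - x) / (z - x) * z = y by field_simp; ring] at this
    calc _ = (z - x) * ((z - y) / (z - x) * F q β x + (y - x) / (z - x) * F q β z) := by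
          field_simp
      _ ≤ _ := by gcongr
  -- existence and uniqueness of the fixed point
  obtain ⟨a, ⟨hab, ha1⟩, hfix⟩ : ∃ a ∈ Set.Icc b 1, F q β a = a := by
    have := intermediate_value_Icc' (f := fun x => F q β x - x) (by linarith : b ≤ 1)
      (hcont.sub continuousOn_id) (show (0 : ℝ) ∈ _ from
        ⟨by have := hF1 1 hm1; linarith, by have := hFb b hmb; linarith⟩)
    obtain ⟨a, ha, h⟩ := this
    exact ⟨a, ha, by simp only at h; linarith⟩
  have ha : a ∈ Set.Icc b 1 := ⟨hab, ha1⟩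
  have hab' : b < a := by have := hFb a ha; linarith
  have ha1' : a < 1 := by have := hF1 a ha; linarith
  have hFbb := hFb b hmb
  have hset : {x : ℝ | x ∈ Set.Ioc b 1 ∧ F q β x = x} = {a} := by
    ext x
    simp only [Set.mem_ofPred_eq, Set.mem_singleton_iff]
    refine ⟨fun ⟨hx, hx2⟩ => ?_, fun h => h ▸ ⟨⟨hab', ha1⟩, hfix⟩⟩
    rcases lt_trichotomy x a with h | h | h
    · have := hc3 b x a le_rfl hx.1.le h.le ha1
      rw [hfix, hx2] at this
      have : 0 < (a - x) * (F q β b - b) := mul_pos (by linarith) (by linarith)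
      linarith
    · exact h
    · have := hc3 b a x le_rfl hab'.le h.le hx.2
      rw [hfix, hx2] at this
      have : 0 < (x - a) * (F q β b - b) := mul_pos (by linarith) (by linarith)
      linarith
  have haF : aFix q β = a := by
    unfold aFix; rw [hset, csSup_singleton]
  rw [haF]
  obtain ⟨ρ, K, hK, hρ, htay⟩ := F_taylor hq hβ hC ha
  rw [hfix] at htay
  obtain ⟨hg1, hg2, hg3⟩ := hgs a ha
  have hBsub := hC.sub a hab ha1
  -- the slope
  have hrρ : 1 - b < ρ := by
    have hau : a - gg β a = a * Real.exp (-(β * gg β a)) := by unfold fy at hg3; linarith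
    set u := Real.exp (-(β * gg β a)) with hu
    have hu0 : 0 < u := Real.exp_pos _
    have h1 := one_lt_mul hq hβ hab
    rw [hau] at hρ hBsub
    have hB : 0 < 1 - β * (a * u) := by linarith [hC.c_pos]
    have h2 : (1 - β * (a * u)) * (1 - b) < (1 - β * (a * u)) * ρ := by
      rw [hρ]
      have : 0 < (1 - b) * (u * (β * a - 1)) := mul_pos (by linarith) (mul_pos hu0 (by linarith))
      linarith
    exact lt_of_mul_lt_mul_left h2 hB.le
  set δ := (F q β b - b) / 2 with hδ
  have hδ0 : 0 < δ := by rw [hδ]; linarith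
  have hFab : F q β b < a := hfix ▸ hmono b a le_rfl hab' ha1
  have hbδ : b < a - δ := by rw [hδ]; linarith
  set ρ' := (a - F q β b) / (a - δ - b) with hρ'
  have hden : 0 < a - δ - b := by linarith
  have hρ'0 : 0 < ρ' := div_pos (by linarith) hden
  have hρ'1 : ρ' < 1 := by rw [hρ', div_lt_one hden]; rw [hδ]; linarith
  have hlip' : ∀ x x', a - δ ≤ x → x < x' → x' ≤ 1 → F q β x' - F q β x ≤ ρ' * (x' - x) := by
    intro x x' hx hxx hx'
    have h1 := hc3 b x x' le_rfl (by linarith) hxx.le hx'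
    have h2 := hc3 b (a - δ) x le_rfl hbδ.le hx (by linarith)
    have h3 : F q β (a - δ) ≤ a := by
      have := hmonoOn (a := a - δ) ⟨hbδ.le, by linarith⟩ ⟨hab, ha1⟩ (by linarith)
      rwa [hfix] at this
    have hxb : 0 < x - b := by linarith
    have h4 : (F q β x' - F q β x) * (x - b) ≤ (F q β x - F q β b) * (x' - x) := by linarith
    have h5 : (F q β x - F q β b) * (a - δ - b) ≤ (F q β (a - δ) - F q β b) * (x - b) := by
      linarith
    have h6 : (F q β x - F q β b) * (a - δ - b) ≤ (a - F q β b) * (x - b) :=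
      h5.trans (mul_le_mul_of_nonneg_right (by linarith) hxb.le)
    rw [hρ', div_mul_eq_mul_div, le_div_iff₀ hden]
    have h7 : ((F q β x' - F q β x) * (a - δ - b)) * (x - b) ≤
        ((a - F q β b) * (x' - x)) * (x - b) := by
      calc _ = ((F q β x' - F q β x) * (x - b)) * (a - δ - b) := by ring
        _ ≤ ((F q β x - F q β b) * (x' - x)) * (a - δ - b) := by gcongr
        _ = ((F q β x - F q β b) * (a - δ - b)) * (x' - x) := by ring
        _ ≤ ((a - F q β b) * (x - b)) * (x' - x) :=
          mul_le_mul_of_nonneg_right h6 (by linarith)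
        _ = _ := by ring
    exact le_of_mul_le_mul_right h7 hxb
  have hlip : ∀ x ∈ Set.Icc (a - δ) 1, ∀ x' ∈ Set.Icc (a - δ) 1,
      |F q β x - F q β x'| ≤ ρ' * |x - x'| := by
    intro x hx x' hx'
    rcases lt_trichotomy x x' with h | h | h
    · have h1 := hlip' x x' hx.1 h hx'.2
      have h2 := hmono x x' (by linarith [hx.1]) h hx'.2
      rw [abs_of_neg (by linarith), abs_of_neg (by linarith)]; linarith
    · subst h; simp
    · have h1 := hlip' x' x hx'.1 h hx.2
      have h2 := hmono x' x (by linarith [hx'.1]) h hx.2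
      rw [abs_of_pos (by linarith), abs_of_pos (by linarith)]; linarith
  have hderiv : HasDerivAt (F q β) ρ a := by
    rw [hasDerivAt_iff_isLittleO]
    refine Asymptotics.IsBigO.trans_isLittleO (g := fun x => (x - a) ^ 2) ?_ ?_
    · refine Asymptotics.IsBigO.of_bound K ?_
      filter_upwards [Icc_mem_nhds hab' ha1'] with x hx
      have := htay x hx
      rw [Real.norm_eq_abs, Real.norm_eq_abs, hfix, smul_eq_mul, abs_of_nonneg (sq_nonneg (x - a)),
        mul_comm (x - a)]
      exact this
    · have : (fun x => (x - a) ^ 2) = fun x => (x - a) * (x - a) := by ext; ring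
      rw [this]
      have h1 : (fun x : ℝ => x - a) =o[nhds a] (fun _ => (1 : ℝ)) := by
        rw [Asymptotics.isLittleO_one_iff]
        have : Filter.Tendsto (fun x : ℝ => x - a) (nhds a) (nhds (a - a)) :=
          (continuous_id.sub continuous_const).tendsto a
        simpa using this
      simpa using h1.mul_isBigO (Asymptotics.isBigO_refl (fun x : ℝ => x - a) (nhds a))
  have hρρ' : ρ ≤ ρ' := by
    have h1 : ‖ρ‖ ≤ ρ' := by
      refine hderiv.le_of_lip' hρ'0.le ?_
      filter_upwards [Icc_mem_nhds (show a - δ < a by linarith) ha1'] with x hx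
      exact hlip x hx a ⟨by linarith, ha1⟩
    exact (le_abs_self _).trans h1
  have hρ0 : 0 < ρ := by linarith
  have hltF : ∀ x, b ≤ x → x < a → x < F q β x := by
    intro x hx hxa
    have := hc3 b x a le_rfl hx hxa.le ha1
    rw [hfix] at this
    have h2 : 0 < (a - x) * (F q β b - b) := mul_pos (by linarith) (by linarith)
    have h3 : (a - b) * x < (a - b) * F q β x := by linarith
    exact lt_of_mul_lt_mul_left h3 (by linarith)
  have hmaps : Set.MapsTo (F q β) (Set.Icc b 1) (Set.Icc b 1) := fun x hx =>
    ⟨(hFb x hx).le, (hF1 x hx).le⟩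
  have hmaps' : Set.MapsTo (F q β) (Set.Icc (a - δ) 1) (Set.Icc (a - δ) 1) := by
    intro x hx
    refine ⟨?_, (hF1 x ⟨by linarith [hx.1], hx.2⟩).le⟩
    have h1 := hltF (a - δ) hbδ.le (by linarith)
    exact h1.le.trans (hmonoOn ⟨hbδ.le, by linarith⟩ ⟨by linarith [hx.1], hx.2⟩ hx.1)
  have hiter : ∀ y ∈ Set.Icc (a - δ) 1, ∀ t : ℕ, (F q β)^[t] y ∈ Set.Icc (a - δ) 1 := by
    intro y hy t
    exact hmaps'.iterate t hy
  have haI : a ∈ Set.Icc (a - δ) 1 := ⟨by linarith, ha1⟩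
  have hstep : ∀ y ∈ Set.Icc (a - δ) 1, ∀ t : ℕ,
      |(F q β)^[t + 1] y - a| ≤ ρ' * |(F q β)^[t] y - a| := by
    intro y hy t
    rw [Function.iterate_succ_apply']
    have := hlip _ (hiter y hy t) a haI
    rwa [hfix] at this
  have hgeo : ∀ y ∈ Set.Icc (a - δ) 1, ∀ t : ℕ, |(F q β)^[t] y - a| ≤ ρ' ^ t := by
    intro y hy t
    induction t with
    | zero => simp only [Function.iterate_zero, id_eq, pow_zero, abs_le]
              constructor <;> linarith [hy.1, hy.2]
    | succ t ih =>
      rw [pow_succ']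
      exact (hstep y hy t).trans (mul_le_mul_of_nonneg_left ih hρ'0.le)
  have hquad : ∀ y ∈ Set.Icc (a - δ) 1, ∀ t : ℕ,
      |((F q β)^[t + 1] y - a) - ρ * ((F q β)^[t] y - a)| ≤ K * ((F q β)^[t] y - a) ^ 2 := by
    intro y hy t
    rw [Function.iterate_succ_apply']
    have h1 := hiter y hy t
    exact htay _ ⟨by linarith [h1.1], h1.2⟩
  have hm1' : (1 : ℝ) ∈ Set.Icc (a - δ) 1 := ⟨by linarith, le_rfl⟩
  have hgt : ∀ t : ℕ, a < (F q β)^[t] 1 := by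
    intro t
    induction t with
    | zero => exact ha1'
    | succ t ih =>
      rw [Function.iterate_succ_apply']
      have := hmono a _ hab ih (hiter 1 hm1' t).2
      rwa [hfix] at this
  obtain ⟨c₀, hc₀, hlow⟩ := iterate_lower (d := fun t => (F q β)^[t] 1 - a) hρ0 hρρ' hρ'1 hK
    (fun t => by have := hgt t; linarith)
    (fun t => (le_abs_self _).trans (hgeo 1 hm1' t))
    (fun t => by
      have := hstep 1 hm1' t
      have h1 := hgt t
      have h2 := hgt (t + 1)
      rw [abs_of_pos (by linarith), abs_of_pos (by linarith)] at this
      nlinarith)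
    (fun t => by
      have := (abs_le.1 (hquad 1 hm1' t)).1
      linarith)
  have hup : ∀ y ∈ Set.Icc (a - δ) 1, ∀ t : ℕ,
      |(F q β)^[t] y - a| ≤ Real.exp (K / (ρ * (1 - ρ'))) * ρ ^ t := by
    intro y hy t
    have := iterate_upper (d := fun t => |(F q β)^[t] y - a|) hρ0 hρ'0.le hρ'1 hK
      (fun t => abs_nonneg _) (hgeo y hy) (fun t => by
        have h1 := hquad y hy t
        rw [sq_abs]
        have h2 := abs_sub_abs_le_abs_sub ((F q β)^[t + 1] y - a) (ρ * ((F q β)^[t] y - a))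
        rw [abs_mul, abs_of_pos hρ0] at h2
        linarith) t
    refine this.trans ?_
    rw [mul_comm]
    gcongr
    have h1 : 0 ≤ K / (ρ * (1 - ρ')) := div_nonneg hK (mul_nonneg hρ0.le (by linarith))
    have h2 : 0 ≤ ρ' ^ t := by positivity
    nlinarith
  refine ⟨ρ, ρ', δ, _, c₀, ⟨hab', ha1', hfix, hrρ, hρρ', hρ'1, hδ0, hbδ.le, hlip, hltF, hmonoOn,
    hmaps, hcont, hmaps', hc₀, hup, hlow⟩, hderiv, ?_⟩
  have h1 : (1 - a) / ((q : ℝ) - 1) = a - gg β a := by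
    have h2 := hfix
    rw [F_eq] at h2
    have h3 : (q : ℝ) - 1 ≠ 0 := by linarith
    have h4 : (q : ℝ) * (1 / q) = 1 := by field_simp
    rw [div_eq_iff h3]
    linear_combination (q : ℝ) * h2 - (1 - gg β a) * h4
  rw [h1]
  exact hBsub

/-! ### The giant component of a supercritical class -/

variable {n q : ℕ} {β e c : ℝ}

lemma disc_eq (hn : 1 ≤ n) (m k T : ℕ) :
    disc n β m k T =
      n * (Real.exp (β * (T / n)) * fy β (m / n) (T / n)) + k := by
  have hn' : (n : ℝ) ≠ 0 := by positivity
  have h1 : Real.exp (β / n) ^ T = Real.exp (β * (T / n)) := by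
    rw [← Real.exp_nat_mul]; congr 1; field_simp
  have h2 : Real.exp (β * (T / n)) * Real.exp (-(β * (T / n))) = 1 := by
    rw [← Real.exp_add]; simp
  unfold disc fy
  rw [h1]
  generalize hs : (T : ℝ) / n = s at *
  have hT : (T : ℝ) = s * n := by rw [← hs]; field_simp
  have hm : (n : ℝ) * (m / n) = m := by field_simp
  rw [hT]
  generalize (m : ℝ) / n = y at *
  rw [← hm]
  linear_combination ((n : ℝ) * y) * h2

lemma disc_lower (hC : Consts q β e c) (hβ0 : 0 ≤ β) (hn : 1 ≤ n) {m k T : ℕ}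
    (hm : (n : ℝ) / q ≤ m) (hmn : m ≤ n) (hT : e * n ≤ T)
    (hT2 : (T : ℝ) ≤ gg β (m / n) * n) :
    c * (gg β (m / n) * n - T) + k ≤ disc n β m k T := by
  have hn' : (0 : ℝ) < n := by positivity
  have hy1 : 1 / (q : ℝ) ≤ m / n := by
    rw [le_div_iff₀ hn']; linarith [show 1 / (q : ℝ) * n = n / q by ring]
  have hy2 : (m : ℝ) / n ≤ 1 := by rw [div_le_one hn']; exact_mod_cast hmn
  have h1 := hC.lower _ hy1 hy2 (T / n) (by rwa [le_div_iff₀ hn']) (by rwa [div_le_iff₀ hn'])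
  have h2 : 1 ≤ Real.exp (β * (T / n)) := Real.one_le_exp (by positivity)
  have h3 : 0 ≤ c * (gg β (m / n) - T / n) :=
    mul_nonneg hC.c_pos.le (by rw [sub_nonneg]; rwa [div_le_iff₀ hn'])
  rw [disc_eq hn]
  have h4 : c * (gg β (m / n) - T / n) ≤ Real.exp (β * (T / n)) * fy β (m / n) (T / n) := by
    nlinarith
  have h5 := mul_le_mul_of_nonneg_left h4 hn'.le
  have h6 : (n : ℝ) * (c * (gg β (m / n) - T / n)) = c * (gg β (m / n) * n - T) := by field_simp
  linarith

lemma disc_upper (hC : Consts q β e c) (hβ0 : 0 ≤ β) (hn : 1 ≤ n) {m k T : ℕ}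
    (hm : (n : ℝ) / q ≤ m) (hmn : m ≤ n)
    (hT2 : gg β (m / n) * n ≤ T) :
    disc n β m k T ≤ -(c * (T - gg β (m / n) * n)) + k := by
  have hn' : (0 : ℝ) < n := by positivity
  have hy1 : 1 / (q : ℝ) ≤ m / n := by
    rw [le_div_iff₀ hn']; linarith [show 1 / (q : ℝ) * n = n / q by ring]
  have hy2 : (m : ℝ) / n ≤ 1 := by rw [div_le_one hn']; exact_mod_cast hmn
  have h1 := hC.upper _ hy1 hy2 (T / n) (by rwa [le_div_iff₀ hn'])
  have h2 : 1 ≤ Real.exp (β * (T / n)) := Real.one_le_exp (by positivity)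
  have h3 : 0 ≤ c * (T / n - gg β (m / n)) :=
    mul_nonneg hC.c_pos.le (by rw [sub_nonneg]; rwa [le_div_iff₀ hn'])
  rw [disc_eq hn]
  have h4 : Real.exp (β * (T / n)) * fy β (m / n) (T / n) ≤ -(c * (T / n - gg β (m / n))) := by
    nlinarith
  have h5 := mul_le_mul_of_nonneg_left h4 hn'.le
  have h6 : (n : ℝ) * -(c * (T / n - gg β (m / n))) = -(c * (T - gg β (m / n) * n)) := by
    field_simp
  linarith

lemma disc_abs (hC : Consts q β e c) (hβ0 : 0 ≤ β) (hn : 1 ≤ n) {m k T : ℕ}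
    (hm : (n : ℝ) / q ≤ m) (hmn : m ≤ n) (hT : e * n ≤ T) :
    c * |T - gg β (m / n) * n| ≤ |disc n β m k T| + k := by
  rcases le_total (T : ℝ) (gg β (m / n) * n) with h | h
  · have h1 := disc_lower hC hβ0 hn (k := k) hm hmn hT h
    have h2 := le_abs_self (disc n β m k T)
    have h3 : (0 : ℝ) ≤ k := by positivity
    rw [abs_of_nonpos (by linarith)]
    linarith
  · have h1 := disc_upper hC hβ0 hn (k := k) hm hmn h
    have h2 := neg_abs_le (disc n β m k T)
    rw [abs_of_nonneg (by linarith)]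
    linarith

/-- The graph has a component of linear size inside class `i`, and all such components have
about the expected size. -/
def Giant (β e ε : ℝ) (σ : Conf n q) (i : Fin q) (E : Finset (Fin n × Fin n)) : Prop :=
  (∃ v, σ v = i ∧ e * n ≤ #(clus E {v})) ∧
    ∀ v, σ v = i → e * n ≤ #(clus E {v}) →
      |(#(clus E {v}) : ℝ) - gg β (cntN σ i / n) * n| ≤ ε * n

/-- The first vertices of class `i`. -/
def initSeg (σ : Conf n q) (i : Fin q) (k : ℕ) : Finset (Fin n) :=
  univ.filter fun v => σ v = i ∧ v.val < k

lemma giant_of_disc (hq : 2 ≤ q) (hβ : (q : ℝ) < β) (hC : Consts q β e c) (hn : 1 ≤ n)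
    {ε : ℝ} (hε : 0 < ε) (hεe : ε ≤ e) (hnε : 1 ≤ c * ε / 2 * n) (σ : Conf n q) (i : Fin q)
    (hi : (n : ℝ) / q ≤ cntN σ i) (E : Finset (Fin n × Fin n))
    (h1 : ∀ k ∈ range (n + 1),
      |disc n β (cntN σ i) #(initSeg σ i k) #(clus E (initSeg σ i k))| < c * ε / 2 * n)
    (h2 : ∀ v ∈ univ.filter (fun v => σ v = i),
      |disc n β (cntN σ i) #({v} : Finset (Fin n)) #(clus E {v})| < c * ε / 2 * n) :
    Giant β e ε σ i E := by
  have hβ0 : 0 ≤ β := by have : (0 : ℝ) ≤ q := by positivity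
                         linarith
  have hn' : (0 : ℝ) < n := by positivity
  have hmn := cntN_le σ i
  have hq0 : (0 : ℝ) < q := by positivity
  have hy1 : 1 / (q : ℝ) ≤ (cntN σ i : ℝ) / n := by
    rw [le_div_iff₀ hn']; linarith [show 1 / (q : ℝ) * n = n / q by ring]
  have hy2 : (cntN σ i : ℝ) / n ≤ 1 := by rw [div_le_one hn']; exact_mod_cast hmn
  set g := gg β (cntN σ i / n) with hg
  have hge : 3 * e ≤ g := hC.e_le _ hy1 hy2
  have hgy : g < cntN σ i / n :=
    (gg_spec ((by positivity : (0 : ℝ) < 1 / q).trans_le hy1) (one_lt_mul hq hβ hy1)).2.1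
  have hgm : g * n < cntN σ i := by rwa [lt_div_iff₀ hn'] at hgy
  have hcε : 0 < c * ε := mul_pos hC.c_pos hε
  refine ⟨?_, fun v hv hve => ?_⟩
  · have hex : ∃ k, e * n ≤ #(clus E (initSeg σ i k)) := by
      refine ⟨n, ?_⟩
      have : cntN σ i ≤ #(clus E (initSeg σ i n)) := by
        refine card_le_card (Subset.trans ?_ (subset_clus E _))
        intro v hv
        simp only [initSeg, mem_filter, mem_univ, true_and] at hv ⊢
        exact ⟨hv, v.isLt⟩
      have h3 : (cntN σ i : ℝ) ≤ #(clus E (initSeg σ i n)) := by exact_mod_cast this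
      have := hC.e_pos
      nlinarith
    obtain ⟨k, hk, hmin⟩ : ∃ k, e * n ≤ #(clus E (initSeg σ i k)) ∧
        ∀ k' < k, ¬ e * n ≤ #(clus E (initSeg σ i k')) :=
      ⟨Nat.find hex, Nat.find_spec hex, fun k' h => Nat.find_min hex h⟩
    have hkn : k ≤ n := by
      by_contra hcon
      push Not at hcon
      refine hmin n hcon ?_
      have : initSeg σ i n = initSeg σ i k := by
        ext v; simp only [initSeg, mem_filter, mem_univ, true_and]
        have := v.isLt
        constructor
        · rintro ⟨h, -⟩; exact ⟨h, by omega⟩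
        · rintro ⟨h, -⟩; exact ⟨h, by omega⟩
      rw [this]; exact hk
    rcases k with _ | k
    · have : initSeg σ i 0 = ∅ := by simp [initSeg]
      rw [this, clus_empty] at hk
      have := mul_pos hC.e_pos hn'
      simp at hk; linarith
    have hk' := hmin k (Nat.lt_succ_self k)
    push Not at hk'
    have hsplit : initSeg σ i (k + 1) ⊆ initSeg σ i k ∪ {⟨k, hkn⟩} := by
      intro v hv
      simp only [initSeg, mem_filter, mem_univ, true_and, mem_union, mem_singleton, Fin.ext_iff]
        at hv ⊢
      by_cases h : v.val = k
      · right; exact h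
      · left; exact ⟨hv.1, by omega⟩
    have hσ : σ ⟨k, hkn⟩ = i := by
      by_contra hcon
      have : initSeg σ i (k + 1) ⊆ initSeg σ i k := by
        intro v hv
        have h5 := hsplit hv
        rcases mem_union.1 h5 with h6 | h6
        · exact h6
        · rw [mem_singleton] at h6
          rw [h6] at hv
          simp [initSeg, hcon] at hv
      have h5 : (#(clus E (initSeg σ i (k + 1))) : ℝ) ≤ #(clus E (initSeg σ i k)) := by
        exact_mod_cast card_le_card (clus_mono this)
      linarith
    have hbig : (g - ε) * n < #(clus E (initSeg σ i (k + 1))) := by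
      by_contra hcon
      push Not at hcon
      have h4 := disc_lower hC hβ0 hn (k := #(initSeg σ i (k + 1))) hi hmn hk (by
        rw [← hg]; nlinarith)
      have h5 := h1 (k + 1) (by simp; omega)
      have h6 := le_abs_self (disc n β (cntN σ i) #(initSeg σ i (k + 1))
        #(clus E (initSeg σ i (k + 1))))
      rw [← hg] at h4
      have h7 : (0 : ℝ) ≤ #(initSeg σ i (k + 1)) := by positivity
      have h8 : c * (ε * n) ≤ c * (g * n - #(clus E (initSeg σ i (k + 1)))) :=
        mul_le_mul_of_nonneg_left (by linarith) hC.c_pos.le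
      have := mul_pos hcε hn'
      linarith
    have hle : (#(clus E (initSeg σ i (k + 1))) : ℝ) ≤
        #(clus E (initSeg σ i k)) + #(clus E {⟨k, hkn⟩}) := by
      have h3 := card_le_card (clus_mono (E := E) hsplit)
      rw [clus_union] at h3
      exact_mod_cast h3.trans (card_union_le _ _)
    refine ⟨⟨k, hkn⟩, hσ, ?_⟩
    nlinarith
  · have h4 := disc_abs hC hβ0 hn (k := 1) hi hmn hve
    have h5 := h2 v (by simp [hv])
    rw [card_singleton] at h5
    rw [← hg] at h4
    push_cast at h4
    have h6 : c * |(#(clus E {v}) : ℝ) - g * n| ≤ c * (ε * n) := by linarith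
    exact le_of_mul_le_mul_left h6 hC.c_pos

theorem giant_fail (hq : 2 ≤ q) (hβ : (q : ℝ) < β) (hC : Consts q β e c)
    {ε : ℝ} (hε : 0 < ε) (hεe : ε ≤ e) :
    ∃ K : ℝ, 0 < K ∧ ∀ (n : ℕ) (σ : Conf n q) (i : Fin q), 1 ≤ n → (n : ℝ) / q ≤ cntN σ i →
      perc (pp n β) σ univ (fun E => ind (¬ Giant β e ε σ i E)) ≤ K / n := by
  have hβ0 : 0 < β := by have : (0 : ℝ) ≤ q := by positivity
                         linarith
  have hδ : 0 < c * ε / 2 := by have := mul_pos hC.c_pos hε; positivity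
  obtain ⟨κ, hκ, hld⟩ := perc_disc_ld hβ0 hδ
  refine ⟨1 / (c * ε / 2) + 12 / κ ^ 2, by positivity, fun n σ i hn hi => ?_⟩
  have hn' : (1 : ℝ) ≤ n := by exact_mod_cast hn
  have hex := perc_isExp (pp_nonneg (n := n) hβ0.le) pp_le_one σ univ
  rcases lt_or_ge (c * ε / 2 * n) 1 with h | h
  · have h1 : perc (pp n β) σ univ (fun E => ind (¬ Giant β e ε σ i E)) ≤ 1 :=
      hex.le_const fun _ _ => ind_le_one _
    refine h1.trans ?_
    rw [le_div_iff₀ (by linarith), one_mul]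
    have : (n : ℝ) ≤ 1 / (c * ε / 2) := by rw [le_div_iff₀ hδ]; linarith
    have h3 : 0 < 12 / κ ^ 2 := by positivity
    linarith
  set B1 : ℕ → Finset (Fin n × Fin n) → ℝ := fun k E =>
    ind (c * ε / 2 * n ≤ |disc n β (cntN σ i) #(initSeg σ i k) #(clus E (initSeg σ i k))|) with hB1
  set B2 : Fin n → Finset (Fin n × Fin n) → ℝ := fun v E =>
    ind (c * ε / 2 * n ≤ |disc n β (cntN σ i) #({v} : Finset (Fin n)) #(clus E {v})|) with hB2
  have hpt : ∀ E : Finset (Fin n × Fin n), ind (¬ Giant β e ε σ i E) ≤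
      ∑ k ∈ range (n + 1), B1 k E + ∑ v ∈ univ.filter (fun v => σ v = i), B2 v E := by
    intro E
    have hs1 : 0 ≤ ∑ k ∈ range (n + 1), B1 k E := sum_nonneg fun _ _ => ind_nonneg _
    have hs2 : 0 ≤ ∑ v ∈ univ.filter (fun v => σ v = i), B2 v E :=
      sum_nonneg fun _ _ => ind_nonneg _
    by_cases hG : Giant β e ε σ i E
    · rw [ind_false (not_not.2 hG)]; linarith
    rw [ind_true hG]
    by_contra hcon
    push Not at hcon
    refine hG (giant_of_disc hq hβ hC hn hε hεe h σ i hi E ?_ ?_)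
    · intro k hk
      by_contra hcon2
      push Not at hcon2
      have h3 := single_le_sum (f := fun k => B1 k E) (fun _ _ => ind_nonneg _) hk
      have h4 : B1 k E = 1 := ind_true hcon2
      simp only [h4] at h3
      linarith
    · intro v hv
      by_contra hcon2
      push Not at hcon2
      have h3 := single_le_sum (f := fun k => B2 k E) (fun _ _ => ind_nonneg _) hv
      have h4 : B2 v E = 1 := ind_true hcon2
      simp only [h4] at h3
      linarith
  have hb1 : ∀ k ∈ range (n + 1), perc (pp n β) σ univ (B1 k) ≤ 2 * Real.exp (-(κ * n)) := by
    intro k _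
    exact hld n q σ i _ (fun v hv => by simp [initSeg] at hv; exact hv.1)
  have hb2 : ∀ v ∈ univ.filter (fun v => σ v = i),
      perc (pp n β) σ univ (B2 v) ≤ 2 * Real.exp (-(κ * n)) := by
    intro v hv
    exact hld n q σ i _ (fun w hw => by simp at hw hv; rw [hw]; exact hv)
  have htot : perc (pp n β) σ univ (fun E => ind (¬ Giant β e ε σ i E)) ≤
      ∑ k ∈ range (n + 1), 2 * Real.exp (-(κ * n)) +
        ∑ v ∈ univ.filter (fun v => σ v = i), 2 * Real.exp (-(κ * n)) := by
    refine (hex.mono _ _ fun E _ => hpt E).trans ?_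
    rw [hex.add, hex.sum, hex.sum]
    exact add_le_add (sum_le_sum hb1) (sum_le_sum hb2)
  refine htot.trans ?_
  rw [sum_const, sum_const, card_range, nsmul_eq_mul, nsmul_eq_mul]
  have hcard : (#(univ.filter (fun v => σ v = i)) : ℝ) ≤ n := by
    exact_mod_cast cntN_le σ i
  have hE : Real.exp (-(κ * n)) ≤ 2 / (κ * n) ^ 2 := by
    have hx : 0 < κ * n := by positivity
    have := Real.quadratic_le_exp_of_nonneg hx.le
    rw [Real.exp_neg, inv_le_comm₀ (Real.exp_pos _) (by positivity), inv_div]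
    linarith
  have hE0 := Real.exp_pos (-(κ * n))
  calc _ ≤ (3 * n) * (2 * Real.exp (-(κ * n))) := by push_cast; nlinarith
    _ ≤ (3 * n) * (2 * (2 / (κ * n) ^ 2)) := by gcongr
    _ = 12 / κ ^ 2 / n := by field_simp; ring
    _ ≤ _ := by gcongr; have : 0 < 1 / (c * ε / 2) := by positivity
                linarith

variable {n q : ℕ} {β e c : ℝ}

lemma clus_singleton_eq {E : Finset (Fin n × Fin n)} {v w : Fin n} (h : w ∈ clus E {v}) :
    clus E {w} = clus E {v} := by
  rw [mem_clus_singleton] at h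
  ext x
  simp only [mem_clus_singleton]
  exact ⟨fun hx => h.trans hx, fun hx => h.symm.trans hx⟩

/-- Size fluctuation of the cluster of `v` plus the susceptibility outside. -/
noncomputable def fluct (g : ℝ) (E : Finset (Fin n × Fin n)) (v : Fin n) : ℝ :=
  ((#(clus E {v}) : ℝ) - g) ^ 2 + ∑ w ∈ univ \ clus E {v}, (#(clus E {w}) : ℝ)

lemma fluct_nonneg (g : ℝ) (E : Finset (Fin n × Fin n)) (v : Fin n) : 0 ≤ fluct g E v := by
  unfold fluct; positivity

lemma fluct_moment_vertex (hβ : 0 < β) (hC : Consts q β e c) {ε : ℝ}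
    (hε : β * ε ≤ c / 2) (hn : 1 ≤ n) (σ : Conf n q) (i : Fin q)
    (hi : (n : ℝ) / q ≤ cntN σ i)
    (hj : ∀ j ≠ i, β * cntN σ j ≤ (1 - c / 2) * n) (v : Fin n) (hv : σ v = i) :
    perc (pp n β) σ univ (fun E =>
      ind (e * n ≤ #(clus E {v}) ∧
        |(#(clus E {v}) : ℝ) - gg β (cntN σ i / n) * n| ≤ ε * n) *
      fluct (gg β (cntN σ i / n) * n) E v) ≤
      ((4 * Real.exp β ^ 3 + 2) / c ^ 2 + 2 / c) * n := by
  have hn' : (0 : ℝ) < n := by positivity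
  have hn1 : (1 : ℝ) ≤ n := by exact_mod_cast hn
  have hp := pp_nonneg (n := n) hβ.le
  have hp1 := pp_le_one (n := n) (β := β)
  have hc := hC.c_pos
  set g := gg β (cntN σ i / n) * n with hg
  set G : Finset (Fin n) → Prop := fun C => e * n ≤ #C ∧ |(#C : ℝ) - g| ≤ ε * n with hG
  have hexp := perc_isExp hp hp1 σ univ
  have hmn : cntN σ i ≤ n := cntN_le σ i
  have h1 : perc (pp n β) σ univ (fun E => ind (G (clus E {v})) * ((#(clus E {v}) : ℝ) - g) ^ 2) ≤
      (4 * Real.exp β ^ 3 + 2) / c ^ 2 * n := by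
    have h2 := perc_disc_sq_le hβ.le hn σ i (A := {v}) (by simpa using hv)
    have h3 : ∀ E ∈ {E | E ⊆ mp σ univ},
        ind (G (clus E {v})) * ((#(clus E {v}) : ℝ) - g) ^ 2 ≤
        (2 / c ^ 2) * disc n β (cntN σ i) #({v} : Finset (Fin n)) #(clus E {v}) ^ 2
          + 2 / c ^ 2 := by
      intro E _
      by_cases h : G (clus E {v})
      · rw [ind_true h, one_mul]
        have h4 := disc_abs hC hβ.le hn (k := #({v} : Finset (Fin n))) hi hmn h.1
        rw [card_singleton] at h4 ⊢
        generalize disc n β (cntN σ i) 1 #(clus E {v}) = D at *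
        rw [← hg] at h4
        generalize (#(clus E {v}) : ℝ) - g = X at *
        push_cast at h4
        have h5 : (c * |X|) ^ 2 ≤ (|D| + 1) ^ 2 := by gcongr
        rw [mul_pow, sq_abs] at h5
        have h6 : c ^ 2 * X ^ 2 ≤ 2 * D ^ 2 + 2 := by
          nlinarith [sq_abs D, sq_nonneg (|D| - 1)]
        rw [show 2 / c ^ 2 * D ^ 2 + 2 / c ^ 2 = (2 * D ^ 2 + 2) / c ^ 2 by ring,
          le_div_iff₀ (by positivity)]
        linarith
      · rw [ind_false h, zero_mul]; positivity
    have h4 := hexp.mono _ _ h3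
    rw [hexp.add_const, hexp.smul] at h4
    refine h4.trans ?_
    have : 2 / c ^ 2 * perc (pp n β) σ univ (fun E =>
        disc n β (cntN σ i) #({v} : Finset (Fin n)) #(clus E {v}) ^ 2) ≤
        2 / c ^ 2 * (2 * Real.exp β ^ 3 * n) := by gcongr
    have h5 : 2 / c ^ 2 ≤ 2 / c ^ 2 * n := le_mul_of_one_le_right (by positivity) hn1
    calc _ ≤ 2 / c ^ 2 * (2 * Real.exp β ^ 3 * n) + 2 / c ^ 2 * n := by linarith
      _ = _ := by ring
  have h2 : perc (pp n β) σ univ (fun E => ind (G (clus E {v})) *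
      ∑ w ∈ univ \ clus E {v}, (#(clus E {w}) : ℝ)) ≤ 2 / c * n := by
    set Ψ : Finset (Fin n) → Finset (Fin n × Fin n) → ℝ := fun C X =>
      ind (G C) * ∑ w ∈ univ \ C, (#(clus X {w}) : ℝ) with hΨ
    have h3 := perc_domain_markov hp hp1 σ univ {v} (subset_univ _) Ψ
    have h4 : perc (pp n β) σ univ (fun E => ind (G (clus E {v})) *
        ∑ w ∈ univ \ clus E {v}, (#(clus E {w}) : ℝ)) =
        perc (pp n β) σ univ (fun E => Ψ (clus E {v})
          (E.filter fun e => e.1 ∉ clus E {v} ∧ e.2 ∉ clus E {v})) := by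
      congr 1; ext E
      simp only [hΨ]
      congr 1
      refine sum_congr rfl fun w hw => ?_
      rw [clus_filter_eq]
      simpa using hw
    rw [h4, h3]
    refine hexp.le_const fun E hE => ?_
    have hexp' := perc_isExp hp hp1 σ (univ \ clus E {v})
    simp only [hΨ]
    rw [hexp'.smul]
    by_cases h : G (clus E {v})
    · rw [ind_true h, one_mul, hexp'.sum]
      set M : ℝ := (1 - c / 2) * n / β with hM
      have hMp : M * pp n β ≤ 1 - c / 2 := by
        have h5 := pp_mul_le (n := n) hβ.le
        have h6 : 0 ≤ (1 - c / 2) / β := by have := hC.c_le; apply div_nonneg <;> linarith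
        calc M * pp n β = (1 - c / 2) / β * (pp n β * n) := by rw [hM]; ring
          _ ≤ (1 - c / 2) / β * β := by gcongr
          _ = 1 - c / 2 := by field_simp
      have hsub : clus E {v} ⊆ univ.filter (fun w => σ w = i) := fun w hw => by
        simp [color_eq_of_mem_clus hE hw, hv]
      have hcl : ∀ j, (#((univ \ clus E {v}).filter fun w => σ w = j) : ℝ) ≤ M := by
        intro j
        rw [hM, le_div_iff₀ hβ, mul_comm]
        by_cases hji : j = i
        · subst hji
          have h5 : (univ \ clus E {v}).filter (fun w => σ w = j) =
              univ.filter (fun w => σ w = j) \ clus E {v} := by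
            ext w; simp [and_comm]
          rw [h5, card_sdiff_of_subset hsub, Nat.cast_sub (card_le_card hsub)]
          have h6 := hC.sub (cntN σ j / n) (by
            rw [le_div_iff₀ hn']; linarith [show 1 / (q : ℝ) * n = n / q by ring])
            (by rw [div_le_one hn']; exact_mod_cast hmn)
          have h7 := (abs_le.1 h.2).1
          have h8 : β * ((cntN σ j : ℝ) - g) ≤ (1 - c) * n := by
            have := mul_le_mul_of_nonneg_right h6 hn'.le
            rw [hg]
            have h9 : (cntN σ j : ℝ) / n * n = cntN σ j := by field_simp
            calc _ = β * (cntN σ j / n * n - gg β (cntN σ j / n) * n) := by rw [h9]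
              _ = β * (cntN σ j / n - gg β (cntN σ j / n)) * n := by ring
              _ ≤ _ := this
          have h9 : β * (g - #(clus E {v})) ≤ β * (ε * n) := by gcongr; linarith
          have h10 : β * (ε * n) ≤ c / 2 * n := by rw [← mul_assoc]; gcongr
          change β * ((cntN σ j : ℝ) - #(clus E {v})) ≤ _
          nlinarith
        · refine le_trans ?_ (hj j hji)
          gcongr
          exact card_le_card (filter_subset_filter _ (subset_univ _))
      have h5 : ∀ w ∈ univ \ clus E {v},
          perc (pp n β) σ (univ \ clus E {v}) (fun X => (#(clus X {w}) : ℝ)) ≤ 2 / c := by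
        intro w hw
        refine (perc_card_clus_le hp hp1 σ (by linarith) _ {w} (by simpa using hw) hcl).trans ?_
        rw [card_singleton, Nat.cast_one, div_le_div_iff₀ (by linarith) hc]
        linarith
      refine (sum_le_sum h5).trans ?_
      rw [sum_const, nsmul_eq_mul, mul_comm]
      gcongr
      simpa using card_le_univ (univ \ clus E {v})
    · rw [ind_false h, zero_mul]; positivity
  have h3 : (fun E => ind (G (clus E {v})) * fluct g E v) = fun E =>
      ind (G (clus E {v})) * ((#(clus E {v}) : ℝ) - g) ^ 2 + ind (G (clus E {v})) *
      ∑ w ∈ univ \ clus E {v}, (#(clus E {w}) : ℝ) := by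
    ext E; unfold fluct; ring
  have h4 := hexp.add (fun E => ind (G (clus E {v})) * ((#(clus E {v}) : ℝ) - g) ^ 2)
    (fun E => ind (G (clus E {v})) * ∑ w ∈ univ \ clus E {v}, (#(clus E {w}) : ℝ))
  change perc (pp n β) σ univ (fun E => ind (G (clus E {v})) * fluct g E v) ≤ _
  rw [h3, h4]
  linarith

/-- Second moment bound for the giant component of a supercritical class, together with
the susceptibility of the rest of the graph. -/
theorem giant_moment (hβ : 0 < β) (hC : Consts q β e c) {ε : ℝ}
    (hε : β * ε ≤ c / 2) (hn : 1 ≤ n) (σ : Conf n q) (i : Fin q)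
    (hi : (n : ℝ) / q ≤ cntN σ i)
    (hj : ∀ j ≠ i, β * cntN σ j ≤ (1 - c / 2) * n)
    (v : Finset (Fin n × Fin n) → Fin n)
    (hv : ∀ E, Giant β e ε σ i E → σ (v E) = i ∧ e * n ≤ #(clus E {v E})) :
    perc (pp n β) σ univ (fun E =>
      ind (Giant β e ε σ i E) * fluct (gg β (cntN σ i / n) * n) E (v E)) ≤
      ((4 * Real.exp β ^ 3 + 2) / c ^ 2 + 2 / c) / e * n := by
  have hn' : (0 : ℝ) < n := by positivity
  have hp := pp_nonneg (n := n) hβ.le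
  have hp1 := pp_le_one (n := n) (β := β)
  have hexp := perc_isExp hp hp1 σ univ
  have he := hC.e_pos
  have hc := hC.c_pos
  set g := gg β (cntN σ i / n) * n with hg
  set K := (4 * Real.exp β ^ 3 + 2) / c ^ 2 + 2 / c with hK
  set Y : Fin n → Finset (Fin n × Fin n) → ℝ := fun w E =>
    ind (e * n ≤ #(clus E {w}) ∧ |(#(clus E {w}) : ℝ) - g| ≤ ε * n) * fluct g E w with hY
  have hY0 : ∀ w E, 0 ≤ Y w E := fun w E => mul_nonneg (ind_nonneg _) (fluct_nonneg _ _ _)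
  have h1 : ∀ E ∈ {E | E ⊆ mp σ univ}, ind (Giant β e ε σ i E) * fluct g E (v E) ≤
      (e * n)⁻¹ * ∑ w ∈ univ.filter (fun w => σ w = i), Y w E := by
    intro E hE
    by_cases h : Giant β e ε σ i E
    · rw [ind_true h, one_mul]
      obtain ⟨h2, h3⟩ := hv E h
      have hsub : clus E {v E} ⊆ univ.filter (fun w => σ w = i) := fun w hw => by
        simp [color_eq_of_mem_clus hE hw, h2]
      have h4 : ∑ w ∈ clus E {v E}, Y w E ≤ ∑ w ∈ univ.filter (fun w => σ w = i), Y w E :=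
        sum_le_sum_of_subset_of_nonneg hsub fun w _ _ => hY0 w E
      have h5 : ∑ w ∈ clus E {v E}, Y w E = #(clus E {v E}) * fluct g E (v E) := by
        rw [← nsmul_eq_mul]
        refine sum_eq_card_nsmul fun w hw => ?_
        simp only [hY, fluct, clus_singleton_eq hw]
        rw [ind_true ⟨h3, h.2 _ h2 h3⟩, one_mul]
      rw [inv_mul_eq_div, le_div_iff₀ (by positivity)]
      calc _ ≤ (#(clus E {v E}) : ℝ) * fluct g E (v E) := by
            rw [mul_comm]; exact mul_le_mul_of_nonneg_right h3 (fluct_nonneg _ _ _)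
        _ ≤ _ := by rw [← h5]; exact h4
    · rw [ind_false h, zero_mul]
      exact mul_nonneg (by positivity) (sum_nonneg fun w _ => hY0 w E)
  refine (hexp.mono _ _ h1).trans ?_
  rw [hexp.smul, hexp.sum]
  have h2 : ∑ w ∈ univ.filter (fun w => σ w = i), perc (pp n β) σ univ (Y w) ≤ n * (K * n) := by
    refine (sum_le_sum fun w hw => fluct_moment_vertex hβ hC hε hn σ i hi hj w
      (by simpa using hw)).trans ?_
    rw [sum_const, nsmul_eq_mul]
    gcongr
    exact cntN_le σ i
  calc _ ≤ (e * n)⁻¹ * (n * (K * n)) := by gcongr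
    _ = K / e * n := by field_simp

/-! ### The Swendsen–Wang operator -/

section operator

variable {n q : ℕ} {β : ℝ}

/-- A representative of the component of `v`. -/
noncomputable def rep (E : Finset (Fin n × Fin n)) (v : Fin n) : Fin n :=
  ((graphOf E).connectedComponentMk v).out

lemma reachable_rep (E : Finset (Fin n × Fin n)) (v : Fin n) : (graphOf E).Reachable (rep E v) v :=
  SimpleGraph.ConnectedComponent.exact (Quot.out_eq _)

lemma rep_eq_iff {E : Finset (Fin n × Fin n)} {u v : Fin n} :
    rep E u = rep E v ↔ v ∈ clus E {u} := by
  rw [mem_clus_singleton]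
  constructor
  · intro h
    exact (reachable_rep E u).symm.trans (h ▸ reachable_rep E v)
  · intro h
    unfold rep
    rw [SimpleGraph.ConnectedComponent.sound h]

lemma rep_mem (E : Finset (Fin n × Fin n)) (v : Fin n) : rep E v ∈ clus E {v} :=
  mem_clus_singleton.2 (reachable_rep E v).symm

/-- The colouring of the clusters induced by a colouring of their representatives. -/
noncomputable def clr (E : Finset (Fin n × Fin n)) (ξ : Conf n q) : Conf n q := fun v => ξ (rep E v)

lemma clr_eq_of_mem_clus {E : Finset (Fin n × Fin n)} (ξ : Conf n q) {v w : Fin n}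
    (h : w ∈ clus E {v}) : clr E ξ w = clr E ξ v := by
  unfold clr; rw [rep_eq_iff.2 h]

/-- The transition operator of the Swendsen–Wang dynamics. -/
noncomputable def Pop (β : ℝ) (f : Conf n q → ℝ) (σ : Conf n q) : ℝ :=
  perc (pp n β) σ univ (fun E => avg (fun ξ : Conf n q => f (clr E ξ)))

lemma avg_clr [NeZero q] (E : Finset (Fin n × Fin n)) (f : Conf n q → ℝ) :
    avg (fun ξ : Conf n q => f (clr E ξ)) =
    ∑ τ : Conf n q, (if ∀ u v : Fin n, (graphOf E).Reachable u v → τ u = τ v then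
        ((q : ℝ))⁻¹ ^ numComps E else 0) * f τ := by
  have h1 := avg_comp_injective (q := q) (ι := fun c : (graphOf E).ConnectedComponent => c.out)
    (fun c d h => by
      have := congrArg (graphOf E).connectedComponentMk h
      rwa [show (graphOf E).connectedComponentMk c.out = c from Quot.out_eq c,
        show (graphOf E).connectedComponentMk d.out = d from Quot.out_eq d] at this)
    (fun ζ => f (fun v => ζ ((graphOf E).connectedComponentMk v)))
  have h2 : avg (fun ξ : Conf n q => f (clr E ξ)) = _ := h1
  rw [h2]
  simp only [ite_mul, zero_mul]
  rw [← sum_filter, ← mul_sum]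
  unfold avg
  have h3 : ((Fintype.card ((graphOf E).ConnectedComponent → Fin q) : ℕ) : ℝ) =
      (q : ℝ) ^ numComps E := by
    rw [Fintype.card_fun, Fintype.card_fin, numComps, Nat.card_eq_fintype_card]; push_cast; rfl
  rw [h3, div_eq_mul_inv, mul_comm, inv_pow]
  congr 1
  refine sum_bij (fun ζ _ v => ζ ((graphOf E).connectedComponentMk v)) ?_ ?_ ?_ ?_
  · intro ζ _
    simp only [mem_filter, mem_univ, true_and]
    intro u v h
    rw [SimpleGraph.ConnectedComponent.sound h]
  · intro ζ _ ζ' _ h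
    funext c
    have := congrFun h c.out
    rwa [show (graphOf E).connectedComponentMk c.out = c from Quot.out_eq c] at this
  · intro τ hτ
    simp only [mem_filter, mem_univ, true_and] at hτ
    refine ⟨fun c => τ c.out, mem_univ _, ?_⟩
    funext v
    exact hτ _ _ (reachable_rep E v)
  · intro ζ _; rfl

lemma Pop_eq_sum [NeZero q] (f : Conf n q → ℝ) (σ : Conf n q) :
    Pop β f σ = ∑ τ, swStep n q β σ τ * f τ := by
  unfold Pop perc bern
  rw [mp_univ]
  simp only [avg_clr, swStep, sum_mul]
  rw [sum_comm]
  refine sum_congr rfl fun E _ => ?_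
  rw [mul_sum]
  refine sum_congr rfl fun τ _ => ?_
  rw [show 1 - pp n β = Real.exp (-(β / n)) by unfold pp; ring, show
    (1 : ℝ) - Real.exp (-(β / n)) = pp n β from rfl]
  ring

lemma sum_swProb [NeZero q] (t : ℕ) (f : Conf n q → ℝ) (σ : Conf n q) :
    ∑ τ, swProb n q β t σ τ * f τ = (Pop β)^[t] f σ := by
  induction t generalizing σ with
  | zero => simp [swProb]
  | succ t ih =>
    rw [Function.iterate_succ_apply', Pop_eq_sum]
    simp only [swProb, sum_mul]
    rw [sum_comm]
    refine sum_congr rfl fun η _ => ?_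
    rw [← ih, mul_sum]
    refine sum_congr rfl fun τ _ => by ring

lemma Pop_isExp (hβ : 0 ≤ β) [NeZero q] (σ : Conf n q) :
    IsExp Set.univ (fun f : Conf n q → ℝ => Pop β f σ) := by
  have h := perc_isExp (pp_nonneg (n := n) hβ) (pp_le_one (n := n)) σ univ
  have ha := avg_isExp (Ω := Conf n q)
  refine ⟨fun f g => ?_, fun c f => ?_, fun f g hfg => ?_, ?_⟩
  · simp only [Pop]
    rw [← h.add]
    refine h.congr fun E _ => ha.add (fun ξ => f (clr E ξ)) (fun ξ => g (clr E ξ))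
  · simp only [Pop]
    rw [← h.smul]
    refine h.congr fun E _ => ha.smul c (fun ξ => f (clr E ξ))
  · exact h.mono _ _ fun E _ => ha.mono _ _ fun ξ _ => hfg _ (Set.mem_univ _)
  · simp only [Pop]
    rw [ha.one, h.one]

lemma Pop_iterate_isExp (hβ : 0 ≤ β) [NeZero q] (t : ℕ) (σ : Conf n q) :
    IsExp Set.univ (fun f : Conf n q → ℝ => (Pop β)^[t] f σ) := by
  induction t generalizing σ with
  | zero => exact ⟨fun _ _ => rfl, fun _ _ => rfl, fun _ _ h => h _ (Set.mem_univ _), rfl⟩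
  | succ t ih =>
    have h := Pop_isExp (n := n) (q := q) hβ σ
    simp only [Function.iterate_succ_apply']
    refine ⟨fun f g => ?_, fun c f => ?_, fun f g hfg => ?_, ?_⟩
    · rw [← h.add]
      exact h.congr fun τ _ => (ih τ).add f g
    · rw [← h.smul]
      exact h.congr fun τ _ => (ih τ).smul c f
    · exact h.mono _ _ fun τ _ => (ih τ).mono f g hfg
    · rw [show (Pop β)^[t] (fun _ : Conf n q => (1 : ℝ)) = fun _ => 1 from
        funext fun τ => (ih τ).one, h.one]

end operator

lemma card_filter_eq_sum_ind {α : Type*} (s : Finset α) (P : α → Prop) [DecidablePred P] :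
    (#(s.filter P) : ℝ) = ∑ x ∈ s, ind (P x) := by
  rw [card_filter]
  push_cast
  refine sum_congr rfl fun x _ => ?_
  by_cases h : P x <;> simp [ind, h]

/-! ### Fluctuations of the colour counts -/

section colours

variable {n q : ℕ} [NeZero q]

lemma avg_ind_sub (j : Fin q) : avg (fun c : Fin q => ind (c = j) - (q : ℝ)⁻¹) = 0 := by
  have hq : (q : ℝ) ≠ 0 := NeZero.ne _
  unfold avg
  rw [sum_sub_distrib, ← card_filter_eq_sum_ind]
  simp [hq, filter_eq']

/-- Variance of the number of vertices of `S` receiving colour `j`. -/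
lemma avg_count_var (E : Finset (Fin n × Fin n)) (S : Finset (Fin n)) (j : Fin q) :
    avg (fun ξ : Conf n q => ((#(S.filter fun w => clr E ξ w = j) : ℝ) - #S / q) ^ 2) ≤
      ∑ w ∈ S, (#(clus E {w}) : ℝ) := by
  have ha := avg_isExp (Ω := Conf n q)
  have h1 : ∀ ξ : Conf n q, ((#(S.filter fun w => clr E ξ w = j) : ℝ) - #S / q) ^ 2 =
      ∑ w ∈ S, ∑ w' ∈ S, (ind (ξ (rep E w) = j) - (q : ℝ)⁻¹) *
        (ind (ξ (rep E w') = j) - (q : ℝ)⁻¹) := by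
    intro ξ
    have : (#(S.filter fun w => clr E ξ w = j) : ℝ) - #S / q =
        ∑ w ∈ S, (ind (ξ (rep E w) = j) - (q : ℝ)⁻¹) := by
      rw [sum_sub_distrib, sum_const, nsmul_eq_mul, ← div_eq_mul_inv, card_filter_eq_sum_ind]
      rfl
    rw [this, sq, sum_mul_sum]
  simp only [h1]
  rw [ha.sum]
  refine sum_le_sum fun w _ => ?_
  rw [ha.sum]
  have h2 : ∀ w' ∈ S, avg (fun ξ : Conf n q => (ind (ξ (rep E w) = j) - (q : ℝ)⁻¹) *
        (ind (ξ (rep E w') = j) - (q : ℝ)⁻¹)) ≤ ind (w' ∈ clus E {w}) := by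
    intro w' _
    by_cases h : w' ∈ clus E {w}
    · rw [ind_true h]
      refine ha.le_const fun ξ _ => ?_
      rw [rep_eq_iff.2 h]
      have hq : (q : ℝ)⁻¹ ≤ 1 := Nat.cast_inv_le_one q
      have hq0 : 0 ≤ (q : ℝ)⁻¹ := by positivity
      have h3 := ind_nonneg (ξ (rep E w') = j)
      have h4 := ind_le_one (ξ (rep E w') = j)
      nlinarith
    · rw [ind_false h, avg_coord₂ (fun h' => h (rep_eq_iff.1 h'))
        (fun c d => (ind (c = j) - (q : ℝ)⁻¹) * (ind (d = j) - (q : ℝ)⁻¹))]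
      have h5 : (fun c : Fin q => avg fun d : Fin q =>
          (ind (c = j) - (q : ℝ)⁻¹) * (ind (d = j) - (q : ℝ)⁻¹)) = fun _ => 0 := by
        funext c
        rw [(avg_isExp (Ω := Fin q)).smul, avg_ind_sub, mul_zero]
      rw [h5, (avg_isExp (Ω := Fin q)).const]
  refine (sum_le_sum h2).trans ?_
  have h6 : ∑ w' ∈ S, ind (w' ∈ clus E {w}) = (#(S.filter fun w' => w' ∈ clus E {w}) : ℝ) := by
    rw [card_filter_eq_sum_ind]
  rw [h6]
  exact_mod_cast card_le_card fun x hx => (mem_filter.1 hx).2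

end colours

/-! ### One step of the dynamics -/

section distance

variable {n q : ℕ}

/-- The profile with a fraction `y` of colour `J`, the rest being equidistributed. -/
noncomputable def kap (q : ℕ) (J : Fin q) (y : ℝ) : Fin q → ℝ :=
  fun j => if j = J then y else (1 - y) / ((q : ℝ) - 1)

/-- Distance of the colour profile of `σ` to the orbit of `kap · y`. -/
noncomputable def dd (σ : Conf n q) (y : ℝ) : ℝ := ⨅ J, ‖cntFrac σ - kap q J y‖

lemma dd_le (σ : Conf n q) (y : ℝ) (J : Fin q) : dd σ y ≤ ‖cntFrac σ - kap q J y‖ :=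
  ciInf_le (Set.finite_range _).bddBelow J

lemma exists_dd_eq [NeZero q] (σ : Conf n q) (y : ℝ) :
    ∃ J, ‖cntFrac σ - kap q J y‖ = dd σ y := exists_eq_ciInf_of_finite

lemma dd_nonneg (σ : Conf n q) (y : ℝ) : 0 ≤ dd σ y := Real.iInf_nonneg fun _ => norm_nonneg _

lemma kap_dist (hq : 2 ≤ q) (J : Fin q) (y y' : ℝ) : ‖kap q J y - kap q J y'‖ ≤ |y - y'| := by
  have hq' : (2 : ℝ) ≤ q := by exact_mod_cast hq
  rw [pi_norm_le_iff_of_nonneg (abs_nonneg _)]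
  intro j
  simp only [Pi.sub_apply, kap, Real.norm_eq_abs]
  split_ifs
  · exact le_rfl
  · rw [← sub_div, abs_div, show 1 - y - (1 - y') = -(y - y') by ring, abs_neg]
    apply div_le_self (abs_nonneg _)
    rw [abs_of_nonneg (by linarith)]
    linarith

lemma dd_le_add (hq : 2 ≤ q) (σ : Conf n q) (y y' : ℝ) : dd σ y ≤ dd σ y' + |y - y'| := by
  have : NeZero q := ⟨by omega⟩
  obtain ⟨J, hJ⟩ := exists_dd_eq σ y'
  refine (dd_le σ y J).trans ?_
  rw [← hJ, ← sub_add_sub_cancel (cntFrac σ) (kap q J y') (kap q J y)]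
  refine (norm_add_le _ _).trans ?_
  gcongr
  rw [abs_sub_comm]
  exact kap_dist hq J y' y

lemma cntFrac_nonneg (σ : Conf n q) (j : Fin q) : 0 ≤ cntFrac σ j := by
  unfold cntFrac; positivity

lemma cntFrac_le_one (σ : Conf n q) (j : Fin q) : cntFrac σ j ≤ 1 :=
  div_le_one_of_le₀ (by exact_mod_cast cntN_le σ j) (by positivity)

lemma kap_nonneg (hq : 2 ≤ q) {y : ℝ} (hy : 0 ≤ y) (hy1 : y ≤ 1) (J j : Fin q) :
    0 ≤ kap q J y j := by
  have hq' : (2 : ℝ) ≤ q := by exact_mod_cast hq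
  unfold kap; split_ifs
  · exact hy
  · exact div_nonneg (by linarith) (by linarith)

lemma kap_le_one (hq : 2 ≤ q) {y : ℝ} (hy : 0 ≤ y) (hy1 : y ≤ 1) (J j : Fin q) :
    kap q J y j ≤ 1 := by
  have hq' : (2 : ℝ) ≤ q := by exact_mod_cast hq
  unfold kap; split_ifs
  · exact hy1
  · rw [div_le_one (by linarith)]; linarith

lemma dd_le_one (hq : 2 ≤ q) (σ : Conf n q) {y : ℝ} (hy : 0 ≤ y) (hy1 : y ≤ 1) : dd σ y ≤ 1 := by
  refine (dd_le σ y ⟨0, by omega⟩).trans ?_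
  rw [pi_norm_le_iff_of_nonneg zero_le_one]
  intro j
  simp only [Pi.sub_apply, Real.norm_eq_abs]
  have h1 := cntFrac_nonneg σ j
  have h2 := cntFrac_le_one σ j
  have h3 := kap_nonneg hq hy hy1 ⟨0, by omega⟩ j
  have h4 := kap_le_one hq hy hy1 ⟨0, by omega⟩ j
  rw [abs_le]; constructor <;> linarith

lemma cntN_eq_add (τ : Conf n q) (C : Finset (Fin n)) (j : Fin q) :
    cntN τ j = #(C.filter fun w => τ w = j) + #((univ \ C).filter fun w => τ w = j) := by
  rw [← card_union_of_disjoint, ← filter_union, union_sdiff_of_subset (subset_univ _)]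
  · rfl
  · exact disjoint_filter_filter disjoint_sdiff

lemma kap_self_sub {n q C R g : ℝ} (hn : n ≠ 0) (hq : q ≠ 0) :
    (C + R) / n - (1 / q + (1 - 1 / q) * g) =
      ((C - g * n) * (1 - q⁻¹) + (R - (n - C) / q)) / n := by
  field_simp; ring

lemma kap_other_sub {n q C R g : ℝ} (hn : n ≠ 0) (hq : q ≠ 0) (hq1 : q - 1 ≠ 0) :
    (0 + R) / n - (1 - (1 / q + (1 - 1 / q) * g)) / (q - 1) =
      ((C - g * n) * (-q⁻¹) + (R - (n - C) / q)) / n := by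
  field_simp; ring

lemma avg_dd_sq_le (hq : 2 ≤ q) (hn : 1 ≤ n) (E : Finset (Fin n × Fin n)) (v : Fin n) (g : ℝ) :
    avg (fun ξ : Conf n q => dd (clr E ξ) (1 / q + (1 - 1 / q) * g) ^ 2) ≤
      2 * (1 + q) / n ^ 2 * fluct (g * n) E v := by
  have : NeZero q := ⟨by omega⟩
  have hn' : (0 : ℝ) < n := by positivity
  have hq' : (2 : ℝ) ≤ q := by exact_mod_cast hq
  have ha := avg_isExp (Ω := Conf n q)
  set C := clus E {v} with hC
  set S := univ \ C with hS
  have hcard : (#S : ℝ) = n - #C := by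
    rw [hS, card_sdiff_of_subset (subset_univ _), Nat.cast_sub (card_le_card (subset_univ _))]
    simp
  have h1 : ∀ ξ ∈ (Set.univ : Set (Conf n q)),
      dd (clr E ξ) (1 / q + (1 - 1 / q) * g) ^ 2 ≤
      (2 / n ^ 2) * (((#C : ℝ) - g * n) ^ 2 +
        ∑ j : Fin q, ((#(S.filter fun w => clr E ξ w = j) : ℝ) - #S / q) ^ 2) := by
    intro ξ _
    set τ := clr E ξ with hτ
    set R : Fin q → ℝ := fun j => (#(S.filter fun w => τ w = j) : ℝ) with hR
    set B := ((#C : ℝ) - g * n) ^ 2 + ∑ j : Fin q, (R j - #S / q) ^ 2 with hB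
    have hB0 : 0 ≤ B := by positivity
    have hj : ∀ j, |(cntFrac τ - kap q (τ v) (1 / q + (1 - 1 / q) * g)) j| ≤
        √((2 / n ^ 2) * B) := by
      intro j
      apply Real.abs_le_sqrt
      have h2 : (R j - #S / q) ^ 2 ≤ ∑ j : Fin q, (R j - #S / q) ^ 2 :=
        single_le_sum (f := fun j => (R j - #S / q) ^ 2) (fun _ _ => sq_nonneg _) (mem_univ j)
      have h3 : ∃ s : ℝ, |s| ≤ 1 ∧ (cntFrac τ - kap q (τ v) (1 / q + (1 - 1 / q) * g)) j =
          (((#C : ℝ) - g * n) * s + (R j - #S / q)) / n := by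
        have hC' : (#(C.filter fun w => τ w = j) : ℝ) = if j = τ v then (#C : ℝ) else 0 := by
          split_ifs with h
          · rw [filter_true_of_mem]
            intro w hw
            rw [h]; exact clr_eq_of_mem_clus ξ hw
          · rw [filter_false_of_mem]; · simp
            intro w hw h'
            exact h (h'.symm.trans (clr_eq_of_mem_clus ξ hw))
        have hN : (cntN τ j : ℝ) = (if j = τ v then (#C : ℝ) else 0) + R j := by
          rw [cntN_eq_add τ C j, Nat.cast_add, hC']
        simp only [Pi.sub_apply, cntFrac, kap, hN]
        have hq1 : (q : ℝ) - 1 ≠ 0 := by linarith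
        have hqi : (q : ℝ)⁻¹ ≤ 1 := Nat.cast_inv_le_one q
        have hqi0 : 0 ≤ (q : ℝ)⁻¹ := by positivity
        split_ifs with h
        · refine ⟨1 - (q : ℝ)⁻¹, ?_, ?_⟩
          · rw [abs_le]; constructor <;> linarith
          · rw [hcard]; exact kap_self_sub hn'.ne' (by linarith)
        · refine ⟨- (q : ℝ)⁻¹, ?_, ?_⟩
          · rw [abs_le]; constructor <;> linarith
          · rw [hcard]; exact kap_other_sub hn'.ne' (by linarith) hq1
      obtain ⟨s, hs, h3⟩ := h3
      rw [h3, div_pow, div_mul_eq_mul_div]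
      gcongr
      have h4 : s ^ 2 ≤ 1 := by rw [← sq_abs]; exact pow_le_one₀ (abs_nonneg _) hs
      have h5 : (((#C : ℝ) - g * n) * s) ^ 2 ≤ ((#C : ℝ) - g * n) ^ 2 := by
        rw [mul_pow]; exact mul_le_of_le_one_right (sq_nonneg _) h4
      nlinarith [sq_nonneg (((#C : ℝ) - g * n) * s - (R j - #S / q))]
    have h6 : dd τ (1 / q + (1 - 1 / q) * g) ≤ √((2 / n ^ 2) * B) := by
      refine (dd_le _ _ (τ v)).trans ?_
      rw [pi_norm_le_iff_of_nonneg (Real.sqrt_nonneg _)]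
      exact hj
    calc _ ≤ √((2 / n ^ 2) * B) ^ 2 := by
          gcongr; exact dd_nonneg _ _
      _ = _ := Real.sq_sqrt (by positivity)
  refine (ha.mono _ _ h1).trans ?_
  rw [ha.smul, ha.add (fun _ => ((#C : ℝ) - g * n) ^ 2), ha.const, ha.sum]
  have h2 := sum_le_sum fun j (_ : j ∈ (univ : Finset (Fin q))) => avg_count_var E S j
  rw [sum_const, card_univ, Fintype.card_fin, nsmul_eq_mul] at h2
  have hfl : fluct (g * n) E v = ((#C : ℝ) - g * n) ^ 2 + ∑ w ∈ S, (#(clus E {w}) : ℝ) := rfl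
  rw [hfl]
  have h3 : 0 ≤ ∑ w ∈ S, (#(clus E {w}) : ℝ) := sum_nonneg fun w _ => Nat.cast_nonneg _
  calc _ ≤ 2 / (n : ℝ) ^ 2 * (((#C : ℝ) - g * n) ^ 2 + q * ∑ w ∈ S, (#(clus E {w}) : ℝ)) := by
        gcongr
    _ ≤ 2 / (n : ℝ) ^ 2 * ((1 + q) * (((#C : ℝ) - g * n) ^ 2 +
          ∑ w ∈ S, (#(clus E {w}) : ℝ))) := by
        gcongr
        generalize ∑ w ∈ S, (#(clus E {w}) : ℝ) = s at *
        nlinarith [sq_nonneg ((#C : ℝ) - g * n)]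
    _ = _ := by ring

end distance

section onestep

variable {q : ℕ} {β e c : ℝ}

/-- One step of the dynamics contracts towards the drift, with Gaussian fluctuations. -/
theorem one_step (hq : 2 ≤ q) (hβ : (q : ℝ) < β) (hC : Consts q β e c) :
    ∃ K : ℝ, 0 < K ∧ ∀ (n : ℕ) (σ : Conf n q) (i : Fin q), 1 ≤ n → (n : ℝ) / q ≤ cntN σ i →
      (∀ j ≠ i, β * cntN σ j ≤ (1 - c / 2) * n) →
      Pop β (fun τ => dd τ (F q β (cntFrac σ i)) ^ 2) σ ≤ K / n := by
  have : NeZero q := ⟨by omega⟩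
  have hq' : (2 : ℝ) ≤ q := by exact_mod_cast hq
  have hβ0 : 0 < β := by linarith
  have hc := hC.c_pos
  have he := hC.e_pos
  set ε := min e (c / (2 * β)) with hε
  have hε0 : 0 < ε := by positivity
  have hεc : β * ε ≤ c / 2 := by
    have h1 : ε ≤ c / (2 * β) := min_le_right _ _
    calc β * ε ≤ β * (c / (2 * β)) := by gcongr
      _ = c / 2 := by field_simp
  obtain ⟨K₁, hK₁, hfail⟩ := giant_fail hq hβ hC hε0 (min_le_left _ _)
  set K₂ := ((4 * Real.exp β ^ 3 + 2) / c ^ 2 + 2 / c) / e with hK₂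
  have hK₂0 : 0 < K₂ := by positivity
  refine ⟨2 * (1 + q) * K₂ + K₁, by positivity, fun n σ i hn hi hj => ?_⟩
  have hn' : (0 : ℝ) < n := by positivity
  have hexp := perc_isExp (pp_nonneg (n := n) hβ0.le) (pp_le_one (n := n)) σ univ
  have ha := avg_isExp (Ω := Conf n q)
  set y := cntFrac σ i with hy
  have hy1 : 1 / (q : ℝ) ≤ y := by
    rw [hy]; unfold cntFrac
    rw [le_div_iff₀ hn']; linarith [show 1 / (q : ℝ) * n = n / q by ring]
  have hy2 : y ≤ 1 := cntFrac_le_one σ i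
  have hg := gg_spec (by have : 0 < 1 / (q : ℝ) := by positivity
                         linarith) (one_lt_mul hq hβ hy1)
  have hF : F q β y = 1 / q + (1 - 1 / q) * gg β y := F_eq q β y
  have hqi : 1 / (q : ℝ) ≤ 1 := by rw [div_le_one (by linarith)]; linarith
  have hF0 : 0 ≤ F q β y := by
    rw [hF]; have : 0 ≤ (1 - 1 / (q : ℝ)) * gg β y := mul_nonneg (by linarith) hg.1.le
    positivity
  have hF1 : F q β y ≤ 1 := by rw [hF]; nlinarith [hg.2.1]
  set v : Finset (Fin n × Fin n) → Fin n := fun E =>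
    if h : Giant β e ε σ i E then h.1.choose else ⟨0, hn⟩ with hv
  have hvs : ∀ E, Giant β e ε σ i E → σ (v E) = i ∧ e * n ≤ #(clus E {v E}) := by
    intro E h
    simp only [hv, dif_pos h]
    exact h.1.choose_spec
  have hmom := giant_moment hβ0 hC hεc hn σ i hi hj v hvs
  have hgy : gg β (cntN σ i / n) = gg β y := rfl
  rw [hgy] at hmom
  have h1 : ∀ E ∈ {E | E ⊆ mp σ univ}, avg (fun ξ : Conf n q => dd (clr E ξ) (F q β y) ^ 2) ≤
      2 * (1 + q) / n ^ 2 * (ind (Giant β e ε σ i E) * fluct (gg β y * n) E (v E)) +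
        ind (¬ Giant β e ε σ i E) := by
    intro E _
    by_cases h : Giant β e ε σ i E
    · rw [ind_true h, one_mul, ind_false (not_not.2 h), add_zero, hF]
      exact avg_dd_sq_le hq hn E (v E) _
    · rw [ind_false h, zero_mul, mul_zero, zero_add, ind_true h]
      exact ha.le_const fun ξ _ => pow_le_one₀ (dd_nonneg _ _) (dd_le_one hq _ hF0 hF1)
  have h2 := hexp.mono _ _ h1
  rw [hexp.add, hexp.smul] at h2
  have h3 : 2 * (1 + q) / (n : ℝ) ^ 2 * (K₂ * n) = 2 * (1 + q) * K₂ / n := by field_simp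
  have h4 : 2 * (1 + q) / (n : ℝ) ^ 2 * perc (pp n β) σ univ (fun E =>
      ind (Giant β e ε σ i E) * fluct (gg β y * n) E (v E)) ≤
      2 * (1 + q) / (n : ℝ) ^ 2 * (K₂ * n) := by gcongr
  calc _ ≤ _ := h2
    _ ≤ 2 * (1 + q) * K₂ / n + K₁ / n := by
      have := hfail n σ i hn hi
      linarith
    _ = _ := by ring

end onestep

/-! ### Iterating the dynamics near the fixed point -/

section track

variable {n q : ℕ} {β e c a ρ ρ' δ K c₀ η : ℝ}

lemma abs_cntFrac_sub_le (σ : Conf n q) (J : Fin q) (y : ℝ) :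
    |cntFrac σ J - y| ≤ ‖cntFrac σ - kap q J y‖ := by
  have := norm_le_pi_norm (cntFrac σ - kap q J y) J
  simpa [kap] using this

lemma div_le_cntN_of_le (hn : 1 ≤ n) {σ : Conf n q} {J : Fin q}
    (h : 1 / (q : ℝ) ≤ cntFrac σ J) : (n : ℝ) / q ≤ cntN σ J := by
  have hn' : (0 : ℝ) < n := by positivity
  unfold cntFrac at h
  rw [le_div_iff₀ hn'] at h
  linarith [show 1 / (q : ℝ) * n = n / q by ring]

lemma region (hq : 2 ≤ q) (hβ : 0 < β) (hD : Drift q β a ρ ρ' δ K c₀)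
    (hη : 0 < η) (hηδ : 2 * η ≤ δ) (hηc : β * (2 * η) ≤ c / 2)
    (hb : β * ((1 - a) / (q - 1)) ≤ 1 - c) (hn : 1 ≤ n) {σ : Conf n q} {y : ℝ}
    (hy : a - η ≤ y) {J : Fin q} (hJ : ‖cntFrac σ - kap q J y‖ ≤ η) :
    cntFrac σ J ∈ Set.Icc (a - δ) 1 ∧ (n : ℝ) / q ≤ cntN σ J ∧
      ∀ j ≠ J, β * cntN σ j ≤ (1 - c / 2) * n := by
  have hn' : (0 : ℝ) < n := by positivity
  have hq' : (2 : ℝ) ≤ q := by exact_mod_cast hq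
  have h1 := (abs_le.1 ((abs_cntFrac_sub_le σ J y).trans hJ)).1
  have h2 : a - δ ≤ cntFrac σ J := by linarith
  refine ⟨⟨h2, cntFrac_le_one σ J⟩, div_le_cntN_of_le hn (hD.le_sub.trans h2), fun j hj => ?_⟩
  have h3 := norm_le_pi_norm (cntFrac σ - kap q J y) j
  simp only [Pi.sub_apply, kap, if_neg hj, Real.norm_eq_abs] at h3
  have h4 := (abs_le.1 (h3.trans hJ)).2
  have h5 : (1 - y) / ((q : ℝ) - 1) ≤ (1 - a) / (q - 1) + η := by
    have : (1 - y) / ((q : ℝ) - 1) ≤ (1 - a + η) / (q - 1) := by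
      gcongr <;> linarith
    refine this.trans ?_
    rw [add_div]
    gcongr
    apply div_le_self hη.le
    linarith
  have h6 : cntFrac σ j ≤ (1 - a) / (q - 1) + 2 * η := by linarith
  have h7 : β * cntFrac σ j ≤ 1 - c / 2 := by
    calc β * cntFrac σ j ≤ β * ((1 - a) / (q - 1) + 2 * η) := by gcongr
      _ ≤ _ := by rw [mul_add]; linarith
  have h8 : (cntN σ j : ℝ) = cntFrac σ j * n := by unfold cntFrac; field_simp
  rw [h8, ← mul_assoc]
  gcongr

/-- Quantitative description of the dynamics around the fixed point. -/
structure Dyn (q : ℕ) (β a ρ ρ' η K : ℝ) : Prop where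
  η_pos : 0 < η
  K_pos : 0 < K
  step : ∀ (n : ℕ) (σ : Conf n q) (y : ℝ), 1 ≤ n → y ∈ Set.Icc (a - η) 1 → dd σ y ≤ η →
    Pop β (fun τ => dd τ (F q β y)) σ ≤ ρ' * dd σ y + K / √n
  exit : ∀ (n : ℕ) (σ : Conf n q) (y : ℝ), 1 ≤ n → y ∈ Set.Icc (a - η) 1 → dd σ y ≤ η →
    Pop β (fun τ => ind (η < dd τ (F q β y))) σ ≤ K / n
  one_step : ∀ (n : ℕ) (σ : Conf n q) (y : ℝ), 1 ≤ n → y ∈ Set.Icc (a - η) 1 → dd σ y ≤ η →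
    ∃ y' ∈ Set.Icc (a - 2 * η) 1, |y' - y| ≤ dd σ y ∧
      Pop β (fun τ => dd τ (F q β y') ^ 2) σ ≤ K / n

theorem exists_dyn (hq : 2 ≤ q) (hβ : (q : ℝ) < β) (hC : Consts q β e c)
    (hD : Drift q β a ρ ρ' δ K c₀) (hb : β * ((1 - a) / (q - 1)) ≤ 1 - c)
    {η₀ : ℝ} (hη₀ : 0 < η₀) :
    ∃ η K', η ≤ η₀ ∧ 2 * η ≤ δ ∧ Dyn q β a ρ ρ' η K' := by
  have : NeZero q := ⟨by omega⟩
  have hβ0 : 0 < β := by have : (0 : ℝ) ≤ q := by positivity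
                         linarith
  have hc := hC.c_pos
  have hδ := hD.δ_pos
  obtain ⟨K₁, hK₁, hos⟩ := one_step hq hβ hC
  have hρ' : 0 < 1 - ρ' := by linarith [hD.ρ'_lt]
  set η := min η₀ (min (δ / 2) (c / (4 * β))) with hη
  have hη1 : η ≤ δ / 2 := (min_le_right _ _).trans (min_le_left _ _)
  have hη2 : η ≤ c / (4 * β) := (min_le_right _ _).trans (min_le_right _ _)
  have hη0 : 0 < η := by positivity
  have hηc : β * (2 * η) ≤ c / 2 := by
    calc β * (2 * η) ≤ β * (2 * (c / (4 * β))) := by gcongr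
      _ = c / 2 := by field_simp; norm_num
  have main : ∀ (n : ℕ) (σ : Conf n q) (y : ℝ), 1 ≤ n → y ∈ Set.Icc (a - η) 1 → dd σ y ≤ η →
    ∃ y' ∈ Set.Icc (a - 2 * η) 1, |y' - y| ≤ dd σ y ∧
      Pop β (fun τ => dd τ (F q β y') ^ 2) σ ≤ K₁ / n := by
    intro n σ y hn hy hd
    obtain ⟨J, hJ⟩ := exists_dd_eq σ y
    obtain ⟨h1, h2, h3⟩ := region hq hβ0 hD hη0 (by linarith) hηc hb hn hy.1 (hJ.trans_le hd)
    have h4 : |cntFrac σ J - y| ≤ dd σ y := hJ ▸ abs_cntFrac_sub_le σ J y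
    refine ⟨cntFrac σ J, ⟨?_, h1.2⟩, h4, hos n σ J hn h2 h3⟩
    have := (abs_le.1 h4).1
    linarith [hy.1]
  have hle : ∀ (n : ℕ) (τ : Conf n q) (y y' : ℝ), y ∈ Set.Icc (a - η) 1 →
      y' ∈ Set.Icc (a - 2 * η) 1 → dd τ (F q β y) ≤ dd τ (F q β y') + ρ' * |y' - y| := by
    intro n τ y y' hy hy'
    refine (dd_le_add hq τ _ (F q β y')).trans ?_
    gcongr
    rw [abs_sub_comm y']
    exact hD.lip y ⟨by linarith [hy.1], hy.2⟩ y' ⟨by linarith [hy'.1], hy'.2⟩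
  have hρ0 : 0 ≤ ρ' := by
    have h1 := hD.lt_ρ
    have h2 := hD.ρ_le
    have : (1 : ℝ) / q ≤ 1 := by
      have : (2 : ℝ) ≤ q := by exact_mod_cast hq
      rw [div_le_one (by linarith)]; linarith
    linarith
  refine ⟨η, K₁ + √K₁ + K₁ / ((1 - ρ') * η) ^ 2, min_le_left _ _, by linarith, hη0, by positivity,
    ?_, ?_, ?_⟩
  · intro n σ y hn hy hd
    have hn' : (0 : ℝ) < n := by positivity
    have hP := Pop_isExp (n := n) (q := q) hβ0.le σ
    obtain ⟨y', hy', h1, h2⟩ := main n σ y hn hy hd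
    have h3 := hP.mono _ _ fun τ _ => hle n τ y y' hy hy'
    rw [hP.add_const] at h3
    have h4 : K₁ / n = (√K₁ / √n) ^ 2 := by
      rw [div_pow, Real.sq_sqrt hK₁.le, Real.sq_sqrt hn'.le]
    have h5 := (le_abs_self _).trans ((hP.abs_le _).trans
      (hP.abs_le_of_sq (fun τ => dd τ (F q β y'))
        (s := √K₁ / √n) (by positivity) (h2.trans_eq h4)))
    have h6 : ρ' * |y' - y| ≤ ρ' * dd σ y := by gcongr
    have h7 : √K₁ / √n ≤ (K₁ + √K₁ + K₁ / ((1 - ρ') * η) ^ 2) / √n := by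
      gcongr
      have : 0 < K₁ / ((1 - ρ') * η) ^ 2 := by positivity
      linarith
    linarith
  · intro n σ y hn hy hd
    have hn' : (0 : ℝ) < n := by positivity
    have hP := Pop_isExp (n := n) (q := q) hβ0.le σ
    obtain ⟨y', hy', h1, h2⟩ := main n σ y hn hy hd
    have h3 : Pop β (fun τ => ind (η < dd τ (F q β y))) σ ≤
        Pop β (fun τ => ind ((1 - ρ') * η ≤ |dd τ (F q β y')|)) σ := by
      refine hP.mono _ _ fun τ _ => ind_mono fun h => ?_
      rw [abs_of_nonneg (dd_nonneg _ _)]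
      have h4 := hle n τ y y' hy hy'
      have h5 : ρ' * |y' - y| ≤ ρ' * η := by gcongr; exact h1.trans hd
      linarith
    refine h3.trans ((hP.chebyshev (fun τ => dd τ (F q β y')) (by positivity)).trans ?_)
    calc _ ≤ K₁ / n / ((1 - ρ') * η) ^ 2 := by gcongr
      _ = K₁ / ((1 - ρ') * η) ^ 2 / n := by ring
      _ ≤ _ := by
        gcongr
        have := Real.sqrt_nonneg K₁
        linarith
  · intro n σ y hn hy hd
    have hn' : (0 : ℝ) < n := by positivity
    obtain ⟨y', hy', h1, h2⟩ := main n σ y hn hy hd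
    refine ⟨y', hy', h1, h2.trans ?_⟩
    gcongr
    have := Real.sqrt_nonneg K₁
    have : 0 < K₁ / ((1 - ρ') * η) ^ 2 := by positivity
    linarith

variable {K' : ℝ}

lemma Drift.mapsTo_of_le (hD : Drift q β a ρ ρ' δ K c₀) (hη0 : 0 ≤ η) (hη : η ≤ δ) {y : ℝ}
    (hy : y ∈ Set.Icc (a - η) 1) : F q β y ∈ Set.Icc (a - η) 1 := by
  have ha := hD.a_gt
  have h1 : y ∈ Set.Icc (1 / (q : ℝ)) 1 := ⟨by linarith [hD.le_sub, hy.1], hy.2⟩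
  refine ⟨?_, (hD.maps h1).2⟩
  rcases lt_or_ge y a with h | h
  · linarith [hD.lt_F y h1.1 h, hy.1]
  · have := hD.mono ⟨ha.le, hD.a_lt.le⟩ h1 h
    rw [hD.fix] at this
    linarith

lemma iterate_mapsTo (hD : Drift q β a ρ ρ' δ K c₀) (hη0 : 0 ≤ η) (hη : η ≤ δ) {y : ℝ}
    (hy : y ∈ Set.Icc (a - η) 1) (t : ℕ) : (F q β)^[t] y ∈ Set.Icc (a - η) 1 := by
  induction t with
  | zero => exact hy
  | succ t ih => rw [Function.iterate_succ_apply']; exact hD.mapsTo_of_le hη0 hη ih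

lemma Drift.icc_subset (hD : Drift q β a ρ ρ' δ K c₀) (hη : η ≤ δ) {y : ℝ}
    (hy : y ∈ Set.Icc (a - η) 1) : 0 ≤ y ∧ 1 / (q : ℝ) ≤ y := by
  have h1 := hD.le_sub
  have h2 : 0 ≤ 1 / (q : ℝ) := by positivity
  constructor <;> linarith [hy.1]

lemma Drift.ρ'_nonneg (hq : 2 ≤ q) (hD : Drift q β a ρ ρ' δ K c₀) : 0 < ρ ∧ 0 < ρ' := by
  have h1 := hD.lt_ρ
  have h2 := hD.ρ_le
  have : (1 : ℝ) / q ≤ 1 := by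
    have : (2 : ℝ) ≤ q := by exact_mod_cast hq
    rw [div_le_one (by linarith)]; linarith
  constructor <;> linarith

/-- The dynamics follows the deterministic drift. -/
theorem Dyn.track (hq : 2 ≤ q) (hβ : 0 < β) (hD : Drift q β a ρ ρ' δ K c₀)
    (hY : Dyn q β a ρ ρ' η K') (hηδ : η ≤ δ) (hn : 1 ≤ n) (t : ℕ) (σ : Conf n q) {y : ℝ}
    (hy : y ∈ Set.Icc (a - η) 1) (hd : dd σ y ≤ η) :
    (Pop β)^[t] (fun τ => dd τ ((F q β)^[t] y)) σ ≤
      ρ' ^ t * dd σ y + K' / (1 - ρ') / √n + t * (K' / n) := by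
  have : NeZero q := ⟨by omega⟩
  have hn' : (0 : ℝ) < n := by positivity
  have hK' := hY.K_pos
  have hρ0 := (hD.ρ'_nonneg hq).2
  have hρ1 : 0 < 1 - ρ' := by linarith [hD.ρ'_lt]
  have key : (Pop β)^[t] (fun τ => dd τ ((F q β)^[t] y)) σ ≤
      ρ' ^ t * dd σ y + (∑ s ∈ range t, ρ' ^ s) * (K' / √n) + t * (K' / n) := by
    induction t generalizing σ y with
    | zero => simp
    | succ t ih =>
      have hP := Pop_isExp (n := n) (q := q) hβ.le σ
      rw [Function.iterate_succ_apply' (Pop β)]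
      have hFy := hD.mapsTo_of_le hY.η_pos.le hηδ hy
      have h1 : ∀ τ ∈ (Set.univ : Set (Conf n q)),
          (Pop β)^[t] (fun τ => dd τ ((F q β)^[t + 1] y)) τ ≤
          (ρ' ^ t * dd τ (F q β y) + ind (η < dd τ (F q β y))) +
          ((∑ s ∈ range t, ρ' ^ s) * (K' / √n) + t * (K' / n)) := by
        intro τ _
        rw [Function.iterate_succ_apply (F q β)]
        by_cases h : dd τ (F q β y) ≤ η
        · rw [ind_false (not_lt.2 h)]
          linarith [ih τ hFy h]
        · rw [ind_true (not_le.1 h)]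
          have h2 := iterate_mapsTo hD hY.η_pos.le hηδ hFy t
          have h3 := (Pop_iterate_isExp (n := n) (q := q) hβ.le t τ).le_const
            (f := fun τ => dd τ ((F q β)^[t] (F q β y))) (c := 1)
            fun τ _ => dd_le_one hq τ (hD.icc_subset hηδ h2).1 h2.2
          have h4 : 0 ≤ ρ' ^ t * dd τ (F q β y) := mul_nonneg (by positivity) (dd_nonneg _ _)
          have h5 : 0 ≤ (∑ s ∈ range t, ρ' ^ s) * (K' / √n) + t * (K' / n) := by positivity
          linarith
      refine (hP.mono _ _ h1).trans ?_
      rw [hP.add_const, hP.add, hP.smul]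
      have h6 := hY.step n σ y hn hy hd
      have h7 := hY.exit n σ y hn hy hd
      have h8 : ρ' ^ t * Pop β (fun τ => dd τ (F q β y)) σ ≤
          ρ' ^ t * (ρ' * dd σ y + K' / √n) := by gcongr
      rw [sum_range_succ]
      push_cast
      calc _ ≤ ρ' ^ t * (ρ' * dd σ y + K' / √n) + K' / n +
            ((∑ s ∈ range t, ρ' ^ s) * (K' / √n) + t * (K' / n)) := by linarith
        _ = _ := by ring
  refine key.trans ?_
  have hgeom : ∑ s ∈ range t, ρ' ^ s ≤ 1 / (1 - ρ') := by
    rw [le_div_iff₀ hρ1, geom_sum_mul_neg]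
    have : 0 < ρ' ^ t := by positivity
    linarith
  gcongr
  calc _ ≤ 1 / (1 - ρ') * (K' / √n) := by gcongr
    _ = _ := by ring

/-- Starting near the fixed point, the dynamics converges to it at rate `ρ`. -/
theorem Dyn.converge (hq : 2 ≤ q) (hβ : 0 < β) (hD : Drift q β a ρ ρ' δ K c₀)
    (hY : Dyn q β a ρ ρ' η K') (hηδ : 2 * η ≤ δ) :
    ∃ K'' : ℝ, 0 < K'' ∧ ∀ (n : ℕ) (t : ℕ) (σ : Conf n q), 1 ≤ n → dd σ a ≤ η →
      (Pop β)^[t + 1] (fun τ => dd τ a) σ ≤ K'' * ρ ^ t + K'' / √n + (t + 1) * (K'' / n) := by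
  have : NeZero q := ⟨by omega⟩
  have hK' := hY.K_pos
  have hη := hY.η_pos
  have hρ0 := (hD.ρ'_nonneg hq).2
  have hρ1 : 0 < 1 - ρ' := by linarith [hD.ρ'_lt]
  have hρ0' := (hD.ρ'_nonneg hq).1
  have hρ1' : ρ ≤ 1 := by linarith [hD.ρ_le, hD.ρ'_lt]
  set K₂ := |K| + √K' + K' / (1 - ρ') + K' + K' / η ^ 2 with hK₂
  have e1 : 0 ≤ |K| := abs_nonneg K
  have e2 : 0 < √K' := Real.sqrt_pos.2 hK'
  have e3 : 0 < K' / (1 - ρ') := by positivity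
  have e4 : 0 < K' / η ^ 2 := by positivity
  refine ⟨K₂, by positivity, fun n t σ hn hd => ?_⟩
  have hn' : (0 : ℝ) < n := by positivity
  have hP := Pop_isExp (n := n) (q := q) hβ.le σ
  have ha1 := hD.a_lt
  obtain ⟨y', hy', h1, h2⟩ := hY.one_step n σ a hn ⟨by linarith, ha1.le⟩ hd
  have hy'' : y' ∈ Set.Icc (a - η) 1 := ⟨by linarith [(abs_le.1 (h1.trans hd)).1], hy'.2⟩
  have hηδ' : η ≤ δ := by linarith
  have hFy := hD.mapsTo_of_le hη.le hηδ' hy''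
  have hit := hD.iter_le y' ⟨by linarith [hy'.1], hy'.2⟩ (t + 1)
  have hKρ : K * ρ ^ (t + 1) ≤ |K| * ρ ^ t := by
    rw [pow_succ]
    have h3 : ρ ^ t * ρ ≤ ρ ^ t := mul_le_of_le_one_right (by positivity) hρ1'
    calc K * (ρ ^ t * ρ) ≤ |K| * (ρ ^ t * ρ) := by gcongr; exact le_abs_self K
      _ ≤ _ := by gcongr
  rw [Function.iterate_succ_apply' (Pop β)]
  have h3 : ∀ τ ∈ (Set.univ : Set (Conf n q)), (Pop β)^[t] (fun τ => dd τ a) τ ≤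
      (dd τ (F q β y') + ind (η ≤ |dd τ (F q β y')|)) +
        (K' / (1 - ρ') / √n + t * (K' / n) + |K| * ρ ^ t) := by
    intro τ _
    have hPt := Pop_iterate_isExp (n := n) (q := q) hβ.le t τ
    have h4 : (Pop β)^[t] (fun τ => dd τ a) τ ≤
        (Pop β)^[t] (fun τ => dd τ ((F q β)^[t] (F q β y'))) τ + |K| * ρ ^ t := by
      rw [← hPt.add_const]
      refine hPt.mono _ _ fun x _ => (dd_le_add hq x a
        ((F q β)^[t] (F q β y'))).trans ?_
      rw [abs_sub_comm a, ← Function.iterate_succ_apply]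
      linarith
    by_cases h : dd τ (F q β y') ≤ η
    · have h5 := hY.track hq hβ hD hηδ' hn t τ hFy h
      have h6 : ρ' ^ t * dd τ (F q β y') ≤ dd τ (F q β y') :=
        mul_le_of_le_one_left (dd_nonneg _ _) (pow_le_one₀ hρ0.le hD.ρ'_lt.le)
      have := ind_nonneg (η ≤ |dd τ (F q β y')|)
      linarith
    · have h5 := iterate_mapsTo hD hη.le hηδ' hFy t
      have h6 := hPt.le_const
        (f := fun τ => dd τ ((F q β)^[t] (F q β y'))) (c := 1)
        fun τ _ => dd_le_one hq τ (hD.icc_subset hηδ' h5).1 h5.2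
      rw [ind_true (by rw [abs_of_nonneg (dd_nonneg _ _)]; linarith)]
      have h7 : 0 ≤ K' / (1 - ρ') / √n := by positivity
      have h8 : 0 ≤ t * (K' / n) := by positivity
      have := dd_nonneg τ (F q β y')
      linarith
  refine (hP.mono _ _ h3).trans ?_
  rw [hP.add_const, hP.add]
  have h4 : K' / n = (√K' / √n) ^ 2 := by
    rw [div_pow, Real.sq_sqrt hK'.le, Real.sq_sqrt hn'.le]
  have h5 := (le_abs_self _).trans ((hP.abs_le _).trans
    (hP.abs_le_of_sq (fun τ => dd τ (F q β y'))
      (s := √K' / √n) (by positivity) (h2.trans_eq h4)))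
  have h6 : Pop β (fun τ => ind (η ≤ |dd τ (F q β y')|)) σ ≤ K' / n / η ^ 2 :=
    (hP.chebyshev (fun τ => dd τ (F q β y')) hη).trans (by gcongr)
  have f1 : |K| * ρ ^ t ≤ K₂ * ρ ^ t := by gcongr; linarith
  have f2 : √K' / √n + K' / (1 - ρ') / √n ≤ K₂ / √n := by rw [← add_div]; gcongr; linarith
  have f3 : K' / n / η ^ 2 + t * (K' / n) ≤ (t + 1) * (K₂ / n) := by
    calc _ = t * (K' / n) + K' / η ^ 2 / n := by ring
      _ ≤ t * (K₂ / n) + K₂ / n := by gcongr <;> linarith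
      _ = _ := by ring
  linarith

end track

/-! ### Isolated vertices -/

section isolated

variable {n q : ℕ} {β : ℝ}

/-- The isolated vertices of the graph `(V, E)`. -/
noncomputable def iso (E : Finset (Fin n × Fin n)) : Finset (Fin n) :=
  univ.filter (fun v => ∀ w, (v, w) ∉ E ∧ (w, v) ∉ E)

lemma mem_iso {E : Finset (Fin n × Fin n)} {v : Fin n} :
    v ∈ iso E ↔ ∀ w, (v, w) ∉ E ∧ (w, v) ∉ E := by simp [iso]

lemma clus_iso {E : Finset (Fin n × Fin n)} {v : Fin n} (h : v ∈ iso E) : clus E {v} = {v} := by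
  refine subset_antisymm (clus_subset subset_rfl fun u hu w hw => ?_) (subset_clus _ _)
  rw [mem_singleton.1 hu] at hw
  exact (hw.elim (mem_iso.1 h w).1 (mem_iso.1 h w).2).elim

lemma rep_eq_iso_iff {E : Finset (Fin n × Fin n)} {u v : Fin n} (h : v ∈ iso E) :
    rep E u = v ↔ u = v := by
  have h1 : rep E v = v := by
    have := rep_mem E v
    rwa [clus_iso h, mem_singleton] at this
  constructor
  · intro h2
    have h3 : u ∈ clus E {v} := rep_eq_iff.1 (h1.trans h2.symm)
    rwa [clus_iso h, mem_singleton] at h3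
  · rintro rfl; exact h1

lemma clr_piecewise {E : Finset (Fin n × Fin n)} {I : Finset (Fin n)} (hI : I ⊆ iso E)
    (ζ ξ : Conf n q) : clr E (I.piecewise ζ ξ) = I.piecewise ζ (clr E ξ) := by
  funext v
  by_cases h : v ∈ I
  · have h' := (rep_eq_iso_iff (hI h)).2 rfl
    simp only [clr]
    rw [h', piecewise_eq_of_mem _ _ _ h, piecewise_eq_of_mem _ _ _ h]
  · have h' : rep E v ∉ I := fun h' => by
      have := (rep_eq_iso_iff (hI h')).1 rfl
      rw [← this] at h'
      exact h h'
    simp only [clr, piecewise_eq_of_notMem _ _ _ h, piecewise_eq_of_notMem _ _ _ h']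

lemma mem_iso_iff_disjoint {σ : Conf n q} {E : Finset (Fin n × Fin n)} (hE : E ⊆ mp σ univ)
    (v : Fin n) : v ∈ iso E ↔ Disjoint E (star v (nb σ univ v)) := by
  rw [mem_iso, Finset.disjoint_right]
  constructor
  · rintro h ⟨x, y⟩ h1 h2
    rcases mem_star.1 h1 with h3 | h3
    · exact (h y).1 (h3.1 ▸ h2)
    · exact (h x).2 (h3.1 ▸ h2)
  · intro h w
    constructor <;> intro hw
    · have h1 := hE hw
      simp only [mp, mem_filter, mem_univ, true_and, and_true] at h1
      exact h (mem_star.2 (Or.inl ⟨rfl, mem_nb.2 ⟨mem_univ _, h1.1.ne', h1.2.symm⟩, h1.1⟩)) hw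
    · have h1 := hE hw
      simp only [mp, mem_filter, mem_univ, true_and, and_true] at h1
      exact h (mem_star.2 (Or.inr ⟨rfl, mem_nb.2 ⟨mem_univ _, h1.1.ne, h1.2⟩, h1.1.not_gt⟩)) hw

lemma star_subset_mp (σ : Conf n q) (v : Fin n) : star v (nb σ univ v) ⊆ mp σ univ := by
  rw [mp_eq_union (mem_univ v)]
  exact subset_union_left

lemma card_star_le (σ : Conf n q) (v : Fin n) : #(star v (nb σ univ v)) ≤ n :=
  card_image_le.trans ((card_le_univ _).trans_eq (Fintype.card_fin n))

lemma perc_iso (σ : Conf n q) (v : Fin n) :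
    perc (pp n β) σ univ (fun E => ind (v ∈ iso E)) =
      (1 - pp n β) ^ #(star v (nb σ univ v)) := by
  rw [← bern_avoid (star_subset_mp σ v)]
  unfold perc bern
  refine sum_congr rfl fun E hE => ?_
  simp only [propext (mem_iso_iff_disjoint (mem_powerset.1 hE) v)]

lemma perc_iso_ge (hβ : 0 ≤ β) (hn : 1 ≤ n) (σ : Conf n q) (v : Fin n) :
    Real.exp (-β) ≤ perc (pp n β) σ univ (fun E => ind (v ∈ iso E)) := by
  rw [perc_iso]
  have hn' : (0 : ℝ) < n := by positivity
  have h0 : 0 ≤ 1 - pp n β := by have := pp_le_one (n := n) (β := β); linarith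
  calc Real.exp (-β) = (1 - pp n β) ^ n := by
        rw [show 1 - pp n β = Real.exp (-(β / n)) by unfold pp; ring, ← Real.exp_nat_mul]
        congr 1
        field_simp
    _ ≤ _ := pow_le_pow_of_le_one h0 (by have := pp_nonneg (n := n) hβ; linarith)
        (card_star_le σ v)

lemma card_star_inter_le (σ : Conf n q) {u v : Fin n} (huv : u ≠ v) :
    #(star u (nb σ univ u) ∩ star v (nb σ univ v)) ≤ 1 := by
  refine (card_le_card (t := {pr u v}) ?_).trans (card_singleton _).le
  rintro ⟨x, y⟩ h
  obtain ⟨h1, h2⟩ := mem_inter.1 h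
  rw [mem_singleton, pr]
  rcases mem_star.1 h1 with ⟨rfl, -, h3⟩ | ⟨rfl, -, h3⟩ <;>
    rcases mem_star.1 h2 with ⟨rfl, -, h4⟩ | ⟨rfl, -, h4⟩
  · exact (huv rfl).elim
  · rw [if_pos h3]
  · rw [if_neg h3]
  · exact (huv rfl).elim

lemma perc_iso_pair_le (hβ : 0 ≤ β) (σ : Conf n q) {u v : Fin n} (huv : u ≠ v) :
    perc (pp n β) σ univ (fun E => ind (u ∈ iso E) * ind (v ∈ iso E)) ≤
      Real.exp (β / n) * (perc (pp n β) σ univ (fun E => ind (u ∈ iso E)) *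
        perc (pp n β) σ univ (fun E => ind (v ∈ iso E))) := by
  have h0 : 0 ≤ 1 - pp n β := by have := pp_le_one (n := n) (β := β); linarith
  have h1 : perc (pp n β) σ univ (fun E => ind (u ∈ iso E) * ind (v ∈ iso E)) =
      (1 - pp n β) ^ #(star u (nb σ univ u) ∪ star v (nb σ univ v)) := by
    rw [← bern_avoid (union_subset (star_subset_mp σ u) (star_subset_mp σ v))]
    unfold perc bern
    refine sum_congr rfl fun E hE => ?_
    simp only [propext (mem_iso_iff_disjoint (mem_powerset.1 hE) v),
      propext (mem_iso_iff_disjoint (mem_powerset.1 hE) u), disjoint_union_right]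
    congr 1
    by_cases h : Disjoint E (star u (nb σ univ u)) <;>
      by_cases h' : Disjoint E (star v (nb σ univ v)) <;> simp [ind, h, h']
  rw [h1, perc_iso, perc_iso, ← pow_add, ← card_union_add_card_inter, pow_add]
  have h2 : 1 - pp n β ≤ (1 - pp n β) ^ #(star u (nb σ univ u) ∩ star v (nb σ univ v)) := by
    have := pow_le_pow_of_le_one h0 (by have := pp_nonneg (n := n) hβ; linarith)
      (card_star_inter_le σ huv)
    simpa using this
  set x := (1 - pp n β) ^ #(star u (nb σ univ u) ∪ star v (nb σ univ v)) with hx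
  have hx0 : 0 ≤ x := by positivity
  calc x = Real.exp (β / n) * (x * (1 - pp n β)) := by
        have := exp_mul_one_sub_pp (n := n) (β := β)
        linear_combination -x * this
    _ ≤ _ := by gcongr

/-- Many vertices of any given set are isolated. -/
theorem iso_few (hβ : 0 ≤ β) : ∃ K : ℝ, 0 < K ∧ ∀ (n : ℕ) (σ : Conf n q) (C : Finset (Fin n)),
    C.Nonempty →
    perc (pp n β) σ univ (fun E => ind ((#(C ∩ iso E) : ℝ) < Real.exp (-β) / 2 * #C)) ≤
      K / #C := by
  refine ⟨(1 + β * Real.exp β) / (Real.exp (-β) / 2) ^ 2, by positivity, fun n σ C hC => ?_⟩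
  have hL := perc_isExp (pp_nonneg (n := n) hβ) (pp_le_one (n := n)) σ univ
  have hn : 1 ≤ n := by
    obtain ⟨v, _⟩ := hC
    exact Nat.one_le_iff_ne_zero.2 fun h => by subst h; exact v.elim0
  have hn' : (0 : ℝ) < n := by positivity
  have hC' : (0 : ℝ) < #C := by exact_mod_cast hC.card_pos
  have hCn : (#C : ℝ) ≤ n := by exact_mod_cast (card_le_univ C).trans_eq (Fintype.card_fin n)
  set P : Fin n → ℝ := fun v => perc (pp n β) σ univ (fun E => ind (v ∈ iso E)) with hP
  have hP1 : ∀ v, P v ≤ 1 := fun v => hL.le_const fun E _ => ind_le_one _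
  have hP0 : ∀ v, 0 ≤ P v := fun v => hL.nonneg fun E _ => ind_nonneg _
  have hmean : Real.exp (-β) * #C ≤ ∑ v ∈ C, P v := by
    rw [mul_comm, ← nsmul_eq_mul, ← sum_const]
    exact sum_le_sum fun v _ => perc_iso_ge hβ hn σ v
  have hexp : Real.exp (β / n) - 1 ≤ β * Real.exp β / n := by
    have h1 : β / n ≤ β := div_le_self hβ (by exact_mod_cast hn)
    have h2 : Real.exp (β / n) - 1 ≤ β / n * Real.exp (β / n) := by
      have h3 := Real.add_one_le_exp (-(β / n))
      have h4 : Real.exp (-(β / n)) * Real.exp (β / n) = 1 := by rw [← Real.exp_add]; simp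
      nlinarith [Real.exp_pos (β / n)]
    refine h2.trans ?_
    rw [mul_div_right_comm]
    gcongr
  have hvar : perc (pp n β) σ univ (fun E => (∑ v ∈ C, (ind (v ∈ iso E) - P v)) ^ 2) ≤
      (1 + β * Real.exp β) * #C := by
    have h1 : (fun E : Finset (Fin n × Fin n) => (∑ v ∈ C, (ind (v ∈ iso E) - P v)) ^ 2) =
        fun E => ∑ u ∈ C, ∑ v ∈ C, (ind (u ∈ iso E) - P u) * (ind (v ∈ iso E) - P v) := by
      funext E; rw [sq, sum_mul_sum]
    rw [h1, hL.sum]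
    have h2 : ∀ u ∈ C, ∀ v ∈ C, perc (pp n β) σ univ
        (fun E => (ind (u ∈ iso E) - P u) * (ind (v ∈ iso E) - P v)) ≤
        (if u = v then 1 else 0) + β * Real.exp β / n := by
      intro u _ v _
      have h3 : perc (pp n β) σ univ
          (fun E => (ind (u ∈ iso E) - P u) * (ind (v ∈ iso E) - P v)) =
          perc (pp n β) σ univ (fun E => ind (u ∈ iso E) * ind (v ∈ iso E)) - P u * P v := by
        have h4 : (fun E : Finset (Fin n × Fin n) =>
            (ind (u ∈ iso E) - P u) * (ind (v ∈ iso E) - P v)) =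
            fun E => (ind (u ∈ iso E) * ind (v ∈ iso E) - P u * ind (v ∈ iso E)) -
              (P v * ind (u ∈ iso E) + - (P u * P v)) := by funext E; ring
        rw [h4, hL.sub, hL.sub, hL.smul, hL.add_const, hL.smul]
        simp only [hP]
        ring
      rw [h3]
      have h5 := mul_nonneg (hP0 u) (hP0 v)
      have h6 : P u * P v ≤ 1 := mul_le_one₀ (hP1 u) (hP0 v) (hP1 v)
      split_ifs with huv
      · have h7 : perc (pp n β) σ univ (fun E => ind (u ∈ iso E) * ind (v ∈ iso E)) ≤ 1 :=
          hL.le_const fun E _ => mul_le_one₀ (ind_le_one _) (ind_nonneg _) (ind_le_one _)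
        have h8 : 0 ≤ β * Real.exp β / n := by positivity
        linarith
      · have h7 := perc_iso_pair_le hβ σ huv
        have h9 : 1 ≤ Real.exp (β / n) := Real.one_le_exp (by positivity)
        have h8 : (Real.exp (β / n) - 1) * (P u * P v) ≤ Real.exp (β / n) - 1 :=
          mul_le_of_le_one_right (by linarith) h6
        simp only [hP] at h8 ⊢
        linarith
    calc _ ≤ ∑ u ∈ C, ∑ v ∈ C, (((if u = v then 1 else 0) : ℝ) + β * Real.exp β / n) := by
          refine sum_le_sum fun u hu => ?_
          rw [hL.sum]
          exact sum_le_sum fun v hv => h2 u hu v hv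
      _ = #C + #C * (#C * (β * Real.exp β / n)) := by
          simp [sum_add_distrib]
      _ ≤ #C + #C * (n * (β * Real.exp β / n)) := by gcongr
      _ = _ := by field_simp
  have h1 : perc (pp n β) σ univ (fun E => ind ((#(C ∩ iso E) : ℝ) < Real.exp (-β) / 2 * #C)) ≤
      perc (pp n β) σ univ (fun E => ind (Real.exp (-β) / 2 * #C ≤
        |∑ v ∈ C, (ind (v ∈ iso E) - P v)|)) := by
    refine hL.mono _ _ fun E _ => ind_mono fun h => ?_
    rw [sum_sub_distrib, ← card_filter_eq_sum_ind, filter_mem_eq_inter, le_abs]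
    right
    linarith
  refine h1.trans ((hL.chebyshev _ (by positivity)).trans ?_)
  calc _ ≤ (1 + β * Real.exp β) * #C / (Real.exp (-β) / 2 * #C) ^ 2 := by gcongr
    _ = _ := by
      have := Real.exp_pos (-β)
      field_simp

end isolated

/-! ### Coupling of configurations with equal colour counts -/

section swap

variable {n q : ℕ} [NeZero q] {β : ℝ}

lemma avg_mul_ind {C : Type*} [Fintype C] (g : C → ℝ) (j : C) :
    avg (fun c => g c * ind (c = j)) = g j / Fintype.card C := by
  unfold avg
  congr 1
  rw [sum_eq_single j, ind_true rfl, mul_one]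
  · intro c _ h; rw [ind_false h, mul_zero]
  · simp

lemma avg_swap_vertex {f : Conf n q → ℝ} {I : Finset (Fin n)} {u v : Fin n} (hv : v ∉ I)
    (hu : u ∈ I) (hf : ∀ τ, f (τ ∘ Equiv.swap u v) = f τ) (η : Conf n q) (i j : Fin q) :
    avg (fun ζ : Conf n q => f (I.piecewise ζ (Function.update η v i)) * ind (ζ u = j)) =
    avg (fun ζ : Conf n q => f (I.piecewise ζ (Function.update η v j)) * ind (ζ u = i)) := by
  have huv : u ≠ v := fun h => hv (h ▸ hu)
  rw [← avg_update u, ← avg_update u (fun ζ => f (I.piecewise ζ (Function.update η v j)) * _)]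
  congr 1
  funext ζ
  simp only [Function.update_self]
  rw [avg_mul_ind, avg_mul_ind]
  congr 1
  rw [← hf]
  congr 1
  funext w
  rw [Function.comp_apply]
  by_cases h1 : w = u
  · subst h1
    rw [Equiv.swap_apply_left, piecewise_eq_of_notMem _ _ _ hv, piecewise_eq_of_mem _ _ _ hu]
    simp
  by_cases h2 : w = v
  · subst h2
    rw [Equiv.swap_apply_right, piecewise_eq_of_notMem _ _ _ hv, piecewise_eq_of_mem _ _ _ hu]
    simp
  rw [Equiv.swap_apply_of_ne_of_ne h1 h2]
  by_cases h3 : w ∈ I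
  · simp [h3, Function.update_of_ne h1]
  · simp [h3, Function.update_of_ne h2]

lemma avg_abs_count_sub_le {I : Finset (Fin n)} (hI : I.Nonempty) (j : Fin q) :
    avg (fun ζ : Conf n q => |∑ u ∈ I, ind (ζ u = j) - #I / q|) ≤ √(#I) := by
  have ha := avg_isExp (Ω := Conf n q)
  have hI' : (0 : ℝ) < #I := by exact_mod_cast hI.card_pos
  have h1 := avg_count_var (q := q) ∅ I j
  have h2 : ∀ w : Fin n, w ∈ iso (∅ : Finset (Fin n × Fin n)) := fun w => mem_iso.2 (by simp)
  have h3 : ∀ ζ : Conf n q, clr ∅ ζ = ζ := fun ζ => by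
    funext w
    rw [clr, (rep_eq_iso_iff (h2 w)).2 rfl]
  simp only [h3, clus_iso (h2 _), card_singleton, Nat.cast_one, sum_const, nsmul_eq_mul, mul_one,
    card_filter_eq_sum_ind] at h1
  exact ha.abs_le_of_sq _ (Real.sqrt_pos.2 hI') (by rwa [Real.sq_sqrt hI'.le])

/-- The cost of recolouring one vertex in presence of `m` exchangeable free vertices. -/
noncomputable def cst (q m : ℕ) : ℝ := if m = 0 then 2 else 2 * q / √m

lemma cst_le (m : ℕ) : cst q m ≤ 2 * q := by
  have hq : (1 : ℝ) ≤ q := by exact_mod_cast NeZero.one_le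
  unfold cst
  split_ifs with h
  · linarith
  · have h1 : (1 : ℝ) ≤ m := by exact_mod_cast Nat.one_le_iff_ne_zero.2 h
    exact div_le_self (by positivity) (Real.one_le_sqrt.2 h1)

lemma cst_le_of_le {q : ℕ} {m : ℕ} {x : ℝ} (hx : 0 < x) (h : x ≤ m) : cst q m ≤ 2 * q / √x := by
  have hm : m ≠ 0 := fun h0 => by subst h0; simp at h; linarith
  rw [cst, if_neg hm]
  gcongr

lemma swap_cost {f : Conf n q → ℝ} (hf1 : ∀ τ, |f τ| ≤ 1) {I : Finset (Fin n)} {v : Fin n}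
    (hv : v ∉ I) (hf : ∀ u ∈ I, ∀ τ, f (τ ∘ Equiv.swap u v) = f τ) (η : Conf n q) (i j : Fin q) :
    |avg (fun ζ : Conf n q => f (I.piecewise ζ (Function.update η v i))) -
      avg (fun ζ : Conf n q => f (I.piecewise ζ (Function.update η v j)))| ≤ cst q #I := by
  have ha := avg_isExp (Ω := Conf n q)
  have hq : (0 : ℝ) < q := by exact_mod_cast NeZero.pos q
  set A : Fin q → Conf n q → ℝ := fun i ζ => f (I.piecewise ζ (Function.update η v i)) with hA
  have hA1 : ∀ i ζ, |A i ζ| ≤ 1 := fun i ζ => hf1 _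
  change |avg (A i) - avg (A j)| ≤ _
  by_cases hI : I.Nonempty
  · have hI' : (0 : ℝ) < #I := by exact_mod_cast hI.card_pos
    rw [cst, if_neg hI.card_pos.ne']
    have h1 : avg (fun ζ => A i ζ * ∑ u ∈ I, ind (ζ u = j)) =
        avg (fun ζ => A j ζ * ∑ u ∈ I, ind (ζ u = i)) := by
      simp only [mul_sum]
      rw [ha.sum, ha.sum]
      exact sum_congr rfl fun u hu => avg_swap_vertex hv hu (hf u hu) η i j
    have h2 : ∀ i j, |avg (fun ζ => A i ζ * ∑ u ∈ I, ind (ζ u = j)) - avg (A i) * (#I / q)| ≤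
        √(#I) := by
      intro i j
      rw [← ha.mul_const, ← ha.sub]
      refine (ha.abs_le _).trans ((ha.mono _ _ fun ζ _ => ?_).trans (avg_abs_count_sub_le hI j))
      rw [← mul_sub, abs_mul]
      exact mul_le_of_le_one_left (abs_nonneg _) (hA1 _ _)
    have h3 := h2 i j
    have h4 := h2 j i
    rw [h1] at h3
    have h5 : |avg (A i) - avg (A j)| * (#I / q) ≤ 2 * √(#I) := by
      rw [← abs_of_nonneg (show (0 : ℝ) ≤ #I / q by positivity), ← abs_mul,
        sub_mul, abs_le]
      rw [abs_le] at h3 h4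
      constructor <;> linarith [h3.1, h3.2, h4.1, h4.2]
    rw [le_div_iff₀ (Real.sqrt_pos.2 hI')]
    have h6 := Real.mul_self_sqrt hI'.le
    have h7 := Real.sqrt_pos.2 hI'
    rw [← mul_div_assoc, div_le_iff₀ hq] at h5
    refine le_of_mul_le_mul_right ?_ h7
    rw [mul_assoc, h6]
    linarith
  · rw [not_nonempty_iff_eq_empty.1 hI, card_empty, cst, if_pos rfl]
    have h1 := (ha.abs_le (A i)).trans (ha.le_const fun ζ _ => hA1 i ζ)
    have h2 := (ha.abs_le (A j)).trans (ha.le_const fun ζ _ => hA1 j ζ)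
    rw [abs_le] at *
    constructor <;> linarith [h1.1, h1.2, h2.1, h2.2]

lemma avg_clr_comp_sub_le {f : Conf n q → ℝ} (hf1 : ∀ τ, |f τ| ≤ 1) (E : Finset (Fin n × Fin n))
    (φ : Equiv.Perm (Fin n)) (I : Fin n → Finset (Fin n))
    (hI : ∀ v, I v ⊆ iso E) (hφ : ∀ v, ∀ u ∈ I v, φ u = u)
    (hf : ∀ v, ∀ u ∈ I v, ∀ τ, f (τ ∘ Equiv.swap u v) = f τ) :
    |avg (fun ξ : Conf n q => f (clr E ξ)) - avg (fun ξ : Conf n q => f (clr E ξ ∘ φ))| ≤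
      ∑ v ∈ univ.filter (fun v => φ v ≠ v), cst q #(I v) := by
  have ha := avg_isExp (Ω := Conf n q)
  have key : ∀ A : Finset (Fin n), (∀ v ∈ A, φ v ≠ v) →
      |avg (fun ξ : Conf n q => f (clr E ξ)) -
        avg (fun ξ : Conf n q => f (A.piecewise (clr E ξ ∘ φ) (clr E ξ)))| ≤
      ∑ v ∈ A, cst q #(I v) := by
    intro A hA
    induction A using Finset.induction_on with
    | empty => simp
    | insert v A hvA ih =>
      have hv := hA v (mem_insert_self _ _)
      have ih := ih fun w hw => hA w (mem_insert_of_mem hw)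
      rw [sum_insert hvA]
      set H : Finset (Fin n) → Conf n q → Conf n q :=
        fun A ξ => A.piecewise (clr E ξ ∘ φ) (clr E ξ) with hH
      have hvI : v ∉ I v := fun h => hv (hφ v v h)
      have h1 : ∀ (B : Finset (Fin n)) (ζ ξ : Conf n q),
          H B ((I v).piecewise ζ ξ) = (I v).piecewise ζ (H B ξ) := by
        intro B ζ ξ
        simp only [hH, clr_piecewise (hI v)]
        funext w
        by_cases hw : w ∈ I v
        · by_cases hB : w ∈ B <;> simp [hw, hB, hφ v w hw]
        · have hw' : φ w ∉ I v := fun h => hw (by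
            have := hφ v _ h
            rw [φ.injective this] at h; exact h)
          by_cases hB : w ∈ B <;> simp [hw, hB, hw']
      have h2 : ∀ B, avg (fun ξ => f (H B ξ)) =
          avg (fun ξ => avg (fun ζ => f ((I v).piecewise ζ (H B ξ)))) := by
        intro B
        rw [← avg_piecewise (I v)]
        simp only [h1]
      have h3 : ∀ ξ, H A ξ = Function.update (H A ξ) v (H A ξ v) := fun ξ => by simp
      have h4 : ∀ ξ, H (insert v A) ξ = Function.update (H A ξ) v (clr E ξ (φ v)) := fun ξ => by
        simp only [hH]
        rw [piecewise_insert]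
        rfl
      have h5 : |avg (fun ξ => f (H A ξ)) - avg (fun ξ => f (H (insert v A) ξ))| ≤
          cst q #(I v) := by
        rw [h2 A, h2 (insert v A), ← ha.sub]
        refine (ha.abs_le _).trans (ha.le_const fun ξ _ => ?_)
        rw [h4 ξ, h3 ξ, Function.update_idem]
        exact swap_cost hf1 hvI (hf v) (H A ξ) _ _
      have := abs_sub_le (avg fun ξ : Conf n q => f (clr E ξ)) (avg (fun ξ => f (H A ξ)))
        (avg (fun ξ => f (H (insert v A) ξ)))
      linarith
  have := key (univ.filter fun v => φ v ≠ v) (fun v hv => (mem_filter.1 hv).2)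
  convert this using 6 with ξ
  funext v
  by_cases h : φ v = v
  · simp [h]
  · simp [h]

end swap

/-- One step of the dynamics hides a permutation moving few vertices in each cell. -/
theorem swap_base {q : ℕ} [NeZero q] {β : ℝ} (hβ : 0 ≤ β) : ∃ K : ℝ, 0 < K ∧
    ∀ (n : ℕ) (κ : Fin n → Fin q × Fin q) (f : Conf n q → ℝ) (σ : Conf n q)
      (φ : Equiv.Perm (Fin n)), (∀ τ, |f τ| ≤ 1) →
      (∀ u v, κ u = κ v → ∀ τ, f (τ ∘ Equiv.swap u v) = f τ) →
      |Pop β f σ - Pop β (fun τ => f (τ ∘ φ)) σ| ≤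
        K * ∑ v, ind (φ v ≠ v) * (1 / √(#(univ.filter (fun u => κ u = κ v)))) := by
  obtain ⟨K, hK, hiso⟩ := iso_few hβ
  set b := Real.exp (-β) / 2 with hb
  have hb0 : 0 < b := by positivity
  have hq : (0 : ℝ) < q := by exact_mod_cast NeZero.pos q
  set K₁ := 2 * q * (2 * K) + 2 * q / √(b / 2) with hK₁
  refine ⟨4 + K₁, by positivity, fun n κ f σ φ hf1 hf => ?_⟩
  have hL := perc_isExp (pp_nonneg (n := n) hβ) (pp_le_one (n := n)) σ univ
  have hP := Pop_isExp (n := n) (q := q) hβ σ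
  set C : Fin n → Finset (Fin n) := fun v => univ.filter (fun u => κ u = κ v) with hC
  have hC0 : ∀ v, (1 : ℝ) ≤ #(C v) := fun v => by
    exact_mod_cast card_pos.2 ⟨v, by simp [hC]⟩
  have hK₁0 : 0 < K₁ := by positivity
  by_cases htriv : ∃ v, (#(C v) : ℝ) < 2 * #((C v).filter fun u => φ u ≠ u)
  · obtain ⟨v, hv⟩ := htriv
    have h1 : |Pop β f σ - Pop β (fun τ => f (τ ∘ φ)) σ| ≤ 2 := by
      have h1 := (hP.abs_le f).trans (hP.le_const fun τ _ => hf1 τ)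
      have h2 := (hP.abs_le (fun τ => f (τ ∘ φ))).trans (hP.le_const fun τ _ => hf1 _)
      rw [abs_le] at *
      constructor <;> linarith [h1.1, h1.2, h2.1, h2.2]
    have h2 : (1 : ℝ) / 2 ≤ ∑ v, ind (φ v ≠ v) * (1 / √(#(C v))) := by
      calc (1 : ℝ) / 2 ≤ #((C v).filter fun u => φ u ≠ u) * (1 / √(#(C v))) := by
            have h3 := Real.one_le_sqrt.2 (hC0 v)
            have h4 := Real.mul_self_sqrt (show (0 : ℝ) ≤ #(C v) by positivity)
            rw [mul_one_div, le_div_iff₀ (by linarith)]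
            nlinarith
        _ = ∑ u ∈ (C v).filter fun u => φ u ≠ u, ind (φ u ≠ u) * (1 / √(#(C u))) := by
            rw [← nsmul_eq_mul, ← sum_const]
            refine sum_congr rfl fun u hu => ?_
            simp only [hC, mem_filter, mem_univ, true_and] at hu ⊢
            rw [ind_true hu.2, hu.1, one_mul]
        _ ≤ _ := sum_le_sum_of_subset_of_nonneg (subset_univ _)
            fun u _ _ => mul_nonneg (ind_nonneg _) (by positivity)
    nlinarith
  · push Not at htriv
    set I : Finset (Fin n × Fin n) → Fin n → Finset (Fin n) :=
      fun E v => (C v).filter (fun u => φ u = u) ∩ iso E with hI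
    have h1 : |Pop β f σ - Pop β (fun τ => f (τ ∘ φ)) σ| ≤
        ∑ v ∈ univ.filter (fun v => φ v ≠ v), perc (pp n β) σ univ (fun E => cst q #(I E v)) := by
      rw [← hL.sum]
      unfold Pop
      rw [← hL.sub]
      refine (hL.abs_le _).trans (hL.mono _ _ fun E _ => ?_)
      refine avg_clr_comp_sub_le hf1 E φ (I E) (fun v => inter_subset_right) ?_ ?_
      · intro v u hu
        exact (mem_filter.1 (mem_inter.1 hu).1).2
      · intro v u hu τ
        have := (mem_filter.1 (mem_inter.1 hu).1).1
        simp only [hC, mem_filter, mem_univ, true_and] at this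
        exact hf u v this τ
    refine h1.trans ?_
    rw [sum_filter, mul_sum]
    refine sum_le_sum fun v _ => ?_
    split_ifs with hv
    · rw [ind_true hv, one_mul]
      set D := (C v).filter (fun u => φ u = u) with hD
      have hm := hC0 v
      set m : ℝ := ((#(C v) : ℕ) : ℝ) with hm_def
      have hDm : m / 2 ≤ #D := by
        have h2 := htriv v
        have h3 := card_filter_add_card_filter_not (s := C v) (fun u => φ u = u)
        have h4 : (#D : ℝ) + #((C v).filter fun u => φ u ≠ u) = m := by
          rw [hm_def, ← h3]; push_cast; rfl
        linarith
      have hD0 : (0 : ℝ) < #D := by linarith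
      have h2 := hiso n σ D (card_pos.1 (by exact_mod_cast hD0))
      have hsq : √m ≤ m := by
        have h3 := Real.one_le_sqrt.2 hm
        have h4 := Real.mul_self_sqrt (show (0 : ℝ) ≤ m by linarith)
        nlinarith
      have hsq0 : 0 < √m := Real.sqrt_pos.2 (by linarith)
      have h3 : perc (pp n β) σ univ (fun E => cst q #(I E v)) ≤
          2 * q * (K / #D) + 2 * q / √(b * #D) := by
        refine (hL.mono _ (fun E => 2 * q * ind ((#(D ∩ iso E) : ℝ) < b * #D) +
          2 * q / √(b * #D)) fun E _ => ?_).trans ?_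
        · by_cases h : (#(D ∩ iso E) : ℝ) < b * #D
          · rw [ind_true h]
            have := cst_le (q := q) #(I E v)
            have h5 : 0 ≤ 2 * q / √(b * #D) := by positivity
            linarith
          · rw [ind_false h, mul_zero, zero_add]
            exact cst_le_of_le (by positivity) (not_lt.1 h)
        · rw [hL.add_const, hL.smul]
          gcongr
      refine h3.trans ?_
      have h4 : 2 * q * (K / #D) ≤ 2 * q * (2 * K) * (1 / √m) := by
        calc 2 * q * (K / #D) ≤ 2 * q * (K / (m / 2)) := by gcongr
          _ = 2 * q * (2 * K) * (1 / m) := by field_simp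
          _ ≤ _ := by gcongr
      have h5 : 2 * q / √(b * #D) ≤ 2 * q / √(b / 2) * (1 / √m) := by
        rw [mul_one_div, div_div, ← Real.sqrt_mul (by positivity)]
        have h6 : 0 < b / 2 * m := by positivity
        exact div_le_div_of_nonneg_left (by positivity) (Real.sqrt_pos.2 h6)
          (Real.sqrt_le_sqrt (by nlinarith))
      have h6 : 0 < 1 / √m := by positivity
      rw [hK₁]
      nlinarith
    · exact mul_nonneg (by positivity) (mul_nonneg (ind_nonneg _) (by positivity))

/-! ### Equivariance under permutations of the vertices -/

section equivariance

variable {n q : ℕ} [NeZero q] {β : ℝ}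

/-- The action of a permutation of the vertices on increasing pairs. -/
def permPair (φ : Equiv.Perm (Fin n)) (e : Fin n × Fin n) : Fin n × Fin n := pr (φ e.1) (φ e.2)

lemma pr_eq_or (a b : Fin n) : pr a b = (a, b) ∨ pr a b = (b, a) := by
  unfold pr; split_ifs <;> simp

/-- A permutation of the vertices as a graph isomorphism. -/
def permIso (φ : Equiv.Perm (Fin n)) (E : Finset (Fin n × Fin n)) :
    graphOf E ≃g graphOf (E.image (permPair φ)) where
  toEquiv := φ
  map_rel_iff' := by
    intro u v
    rw [graphOf_adj, graphOf_adj]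
    refine and_congr (by simp) ?_
    simp only [mem_image, permPair]
    constructor
    · rintro (⟨e, he, h⟩ | ⟨e, he, h⟩) <;> rcases pr_eq_or (φ e.1) (φ e.2) with h1 | h1 <;>
        (rw [h1, Prod.mk.injEq, φ.injective.eq_iff, φ.injective.eq_iff] at h
         obtain ⟨rfl, rfl⟩ := h)
      · exact Or.inl he
      · exact Or.inr he
      · exact Or.inr he
      · exact Or.inl he
    · rintro (h | h)
      · rcases pr_eq_or (φ u) (φ v) with h1 | h1
        · exact Or.inl ⟨(u, v), h, h1⟩
        · exact Or.inr ⟨(u, v), h, h1⟩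
      · rcases pr_eq_or (φ v) (φ u) with h1 | h1
        · exact Or.inr ⟨(v, u), h, h1⟩
        · exact Or.inl ⟨(v, u), h, h1⟩

lemma avg_clr_perm (φ : Equiv.Perm (Fin n)) (E : Finset (Fin n × Fin n)) (f : Conf n q → ℝ) :
    avg (fun ξ : Conf n q => f (clr (E.image (permPair φ)) ξ ∘ φ)) =
      avg (fun ξ : Conf n q => f (clr E ξ)) := by
  rw [avg_clr (E.image (permPair φ)) (fun τ => f (τ ∘ φ)), avg_clr E f]
  refine Fintype.sum_equiv (φ.symm.arrowCongr (Equiv.refl (Fin q))) _ _ fun τ => ?_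
  have h1 : φ.symm.arrowCongr (Equiv.refl (Fin q)) τ = τ ∘ φ := by
    funext v; simp [Equiv.arrowCongr]
  have h2 : numComps (E.image (permPair φ)) = numComps E :=
    (Nat.card_congr (permIso φ E).connectedComponentEquiv).symm
  have h3 : (∀ u v : Fin n, (graphOf (E.image (permPair φ))).Reachable u v → τ u = τ v) ↔
      ∀ u v : Fin n, (graphOf E).Reachable u v → (τ ∘ φ) u = (τ ∘ φ) v := by
    constructor
    · intro h u v huv
      exact h _ _ ((permIso φ E).reachable_iff.2 huv)
    · intro h u v huv
      have h4 := h (φ.symm u) (φ.symm v) ((permIso φ E).reachable_iff.1 (by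
        change (graphOf _).Reachable (φ (φ.symm u)) (φ (φ.symm v))
        simpa using huv))
      simpa using h4
  rw [h1, h2]
  simp only [h3]

lemma mp_comp {q : ℕ} (φ : Equiv.Perm (Fin n)) (σ : Conf n q) :
    (mp (σ ∘ φ) univ).image (permPair φ) = mp σ univ := by
  ext ⟨x, y⟩
  simp only [mem_image, mp, mem_filter, mem_univ, true_and, and_true, Function.comp_apply,
    permPair, pr]
  constructor
  · rintro ⟨e, ⟨h1, h2⟩, h3⟩
    split_ifs at h3 with h4 <;> obtain ⟨rfl, rfl⟩ := Prod.mk.inj h3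
    · exact ⟨h4, h2⟩
    · exact ⟨lt_of_le_of_ne (not_lt.1 h4) (fun h => h1.ne' (φ.injective h)), h2.symm⟩
  · rintro ⟨h1, h2⟩
    rcases lt_or_gt_of_ne (fun h => h1.ne (φ.symm.injective h) : φ.symm x ≠ φ.symm y) with h | h
    · exact ⟨(φ.symm x, φ.symm y), by simpa using ⟨h, h2⟩, by simp [h1]⟩
    · exact ⟨(φ.symm y, φ.symm x), by simpa using ⟨h, h2.symm⟩, by simp [h1.not_gt]⟩

lemma permPair_injOn {q : ℕ} (φ : Equiv.Perm (Fin n)) (σ : Conf n q) :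
    Set.InjOn (permPair φ) (mp σ univ : Finset (Fin n × Fin n)) := by
  rintro ⟨x, y⟩ h ⟨x', y'⟩ h' he
  simp only [mp, coe_filter, mem_univ, true_and, and_true, Set.mem_ofPred_eq] at h h'
  simp only [permPair] at he
  rcases pr_eq_or (φ x) (φ y) with h1 | h1 <;> rcases pr_eq_or (φ x') (φ y') with h2 | h2 <;>
    rw [h1, h2, Prod.mk.injEq, φ.injective.eq_iff, φ.injective.eq_iff] at he <;>
    obtain ⟨rfl, rfl⟩ := he
  · rfl
  · exact absurd h.1 h'.1.not_gt
  · exact absurd h.1 h'.1.not_gt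
  · rfl

lemma Pop_comp (φ : Equiv.Perm (Fin n)) (f : Conf n q → ℝ) (σ : Conf n q) :
    Pop β f (σ ∘ φ) = Pop β (fun τ => f (τ ∘ φ)) σ := by
  unfold Pop perc
  rw [← mp_comp φ σ, bern_image (permPair_injOn φ _)]
  simp only [avg_clr_perm]

lemma Pop_iterate_comp (φ : Equiv.Perm (Fin n)) (t : ℕ) (f : Conf n q → ℝ) (σ : Conf n q) :
    (Pop β)^[t] f (σ ∘ φ) = (Pop β)^[t] (fun τ => f (τ ∘ φ)) σ := by
  induction t generalizing σ with
  | zero => rfl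
  | succ t ih =>
    rw [Function.iterate_succ_apply', Function.iterate_succ_apply', Pop_comp]
    congr 1
    funext τ
    exact ih τ

end equivariance

section coupling

variable {n q : ℕ} {β : ℝ}

/-- A rearrangement can be realised by a permutation fixing the points of agreement. -/
lemma exists_perm_fix (σ : Conf n q) (φ : Equiv.Perm (Fin n)) :
    ∃ ψ : Equiv.Perm (Fin n), σ ∘ ψ = σ ∘ φ ∧ ∀ v, σ v = σ (φ v) → ψ v = v := by
  obtain ⟨ψ, hψ, hmax⟩ := exists_max_image (univ.filter fun ψ : Equiv.Perm (Fin n) => σ ∘ ψ = σ ∘ φ)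
    (fun ψ => #(univ.filter fun v => ψ v = v)) ⟨φ, by simp⟩
  simp only [mem_filter, mem_univ, true_and] at hψ hmax
  refine ⟨ψ, hψ, fun v hv => ?_⟩
  by_contra hne
  have hval : ∀ w, σ (ψ w) = σ (φ w) := congrFun hψ
  set u := ψ.symm v with hu
  have hψu : ψ u = v := by simp [hu]
  have huv : u ≠ v := fun h => hne (h ▸ hψu)
  have h1 : σ ∘ (Equiv.swap u v * 1 |>.trans ψ) = σ ∘ φ := by
    funext w
    simp only [Function.comp_apply, mul_one, Equiv.trans_apply]
    by_cases hw : w = u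
    · rw [hw, Equiv.swap_apply_left, hval, ← hv, ← hval u, hψu]
    by_cases hw' : w = v
    · rw [hw', Equiv.swap_apply_right, hψu, hv]
    rw [Equiv.swap_apply_of_ne_of_ne hw hw', hval]
  have h2 := hmax _ h1
  refine absurd h2 (not_le.2 (card_lt_card ?_))
  rw [Finset.ssubset_iff_of_subset]
  · refine ⟨v, ?_, ?_⟩
    · simp [hψu]
    · simpa using hne
  · intro w hw
    simp only [mem_filter, mem_univ, true_and, mul_one, Equiv.trans_apply] at hw ⊢
    have hwv : w ≠ v := fun h => hne (h ▸ hw)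
    have hwu : w ≠ u := fun h => by
      rw [h, hψu] at hw
      exact huv hw.symm
    rw [Equiv.swap_apply_of_ne_of_ne hwu hwv, hw]

variable [NeZero q]

lemma Pop_disagree (hβ : 0 ≤ β) (σ : Conf n q) {u v : Fin n} (h : σ u ≠ σ v) :
    Pop β (fun τ => ind (τ u ≠ τ v)) σ = 1 - 1 / q := by
  have hL := perc_isExp (pp_nonneg (n := n) hβ) (pp_le_one (n := n)) σ univ
  have ha := avg_isExp (Ω := Fin q)
  unfold Pop
  rw [← hL.const (1 - 1 / (q : ℝ))]
  refine hL.congr fun E hE => ?_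
  have h1 : rep E u ≠ rep E v := fun h1 => h (by
    have := color_eq_of_mem_clus hE (rep_eq_iff.1 h1)
    exact this.symm)
  have h2 := avg_coord₂ h1 (fun c d : Fin q => ind (c ≠ d))
  simp only [clr]
  rw [h2]
  have h3 : ∀ c : Fin q, avg (fun d : Fin q => ind (c ≠ d)) = 1 - 1 / q := by
    intro c
    have h4 := avg_mul_ind (fun _ : Fin q => (1 : ℝ)) c
    simp only [one_mul, Fintype.card_fin] at h4
    simp only [ne_eq, ind_not]
    rw [ha.sub, ha.one, ← h4]
    simp only [eq_comm]
  simp only [h3]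
  exact ha.const _

/-- Two configurations with the same colour counts couple, on the scale of fluctuations,
at rate `1 - 1/q`. -/
theorem perm_decay (hβ : 0 ≤ β) : ∃ K : ℝ, 0 < K ∧
    ∀ (n : ℕ) (κ : Fin n → Fin q × Fin q) (f : Conf n q → ℝ), (∀ τ, |f τ| ≤ 1) →
      (∀ u v, κ u = κ v → ∀ τ, f (τ ∘ Equiv.swap u v) = f τ) →
      ∀ (t : ℕ) (σ : Conf n q) (φ : Equiv.Perm (Fin n)),
      |(Pop β)^[t + 1] f σ - (Pop β)^[t + 1] f (σ ∘ φ)| ≤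
        K * (1 - 1 / q) ^ t *
          ∑ v, ind (σ v ≠ σ (φ v)) * (1 / √(#(univ.filter (fun u => κ u = κ v)))) := by
  obtain ⟨K, hK, hbase⟩ := swap_base (q := q) hβ
  refine ⟨K, hK, fun n κ f hf1 hf t => ?_⟩
  set w : Fin n → ℝ := fun v => 1 / √(#(univ.filter (fun u => κ u = κ v))) with hw
  have hw0 : ∀ v, 0 ≤ w v := fun v => by simp only [hw]; positivity
  induction t with
  | zero =>
    intro σ φ
    obtain ⟨ψ, hψ, hfix⟩ := exists_perm_fix σ φ
    rw [← hψ, zero_add, Function.iterate_one, Pop_comp, pow_zero, mul_one]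
    refine (hbase n κ f σ ψ hf1 hf).trans ?_
    gcongr with v _
    exact ind_mono fun h h' => h (hfix v h')
  | succ t ih =>
    intro σ φ
    obtain ⟨ψ, hψ, hfix⟩ := exists_perm_fix σ φ
    have hP := Pop_isExp (n := n) (q := q) hβ σ
    rw [← hψ, Function.iterate_succ_apply', Pop_comp, ← hP.sub]
    refine (hP.abs_le _).trans ((hP.mono _ _ fun τ _ => ih τ ψ).trans ?_)
    rw [hP.smul, hP.sum, pow_succ, mul_assoc, mul_assoc, mul_assoc]
    have hq : (1 : ℝ) ≤ q := by exact_mod_cast NeZero.one_le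
    have hr : 0 ≤ 1 - 1 / (q : ℝ) := by
      have : 1 / (q : ℝ) ≤ 1 := by rw [div_le_one (by linarith)]; exact hq
      linarith
    gcongr
    rw [mul_sum]
    refine sum_le_sum fun v _ => ?_
    rw [hP.mul_const, ← mul_assoc]
    refine mul_le_mul_of_nonneg_right ?_ (hw0 v)
    by_cases h : σ v = σ (φ v)
    · rw [hfix v h, ind_false (by simpa using h)]
      simp [ind, hP.const]
    · have h' : σ v ≠ σ (ψ v) := fun h1 => h (h1.trans (congrFun hψ v))
      rw [Pop_disagree hβ σ h', ind_true h, mul_one]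

lemma sum_inv_sqrt_le {ι : Type*} [Fintype ι] [DecidableEq ι] (κ : Fin n → ι) :
    ∑ v, 1 / √(#(univ.filter (fun u => κ u = κ v))) ≤ Fintype.card ι * √n := by
  rw [← sum_fiberwise univ κ]
  calc _ ≤ ∑ _c : ι, √n := by
        refine sum_le_sum fun c _ => ?_
        have h1 : ∑ v ∈ univ.filter (fun v => κ v = c), 1 / √(#(univ.filter (fun u => κ u = κ v))) =
            ∑ v ∈ univ.filter (fun v => κ v = c), 1 / √(#(univ.filter (fun u => κ u = c))) :=
          sum_congr rfl fun v hv => by rw [(mem_filter.1 hv).2]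
        rw [h1, sum_const, nsmul_eq_mul, mul_one_div, Real.div_sqrt]
        exact Real.sqrt_le_sqrt (by
          exact_mod_cast (card_le_univ _).trans_eq (Fintype.card_fin n))
    _ = _ := by simp

/-- The law of the dynamics from `σ` nearly depends only on the colour counts of `σ`. -/
theorem perm_mixing (hβ : 0 ≤ β) : ∃ K : ℝ, 0 < K ∧
    ∀ (n : ℕ) (f : Conf n q → ℝ), (∀ τ, |f τ| ≤ 1) →
      ∀ (t : ℕ) (σ : Conf n q) (φ : Equiv.Perm (Fin n)),
      |(Pop β)^[t + 1] f σ - (Pop β)^[t + 1] f (σ ∘ φ)| ≤ K * (1 - 1 / q) ^ t * √n := by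
  obtain ⟨K, hK, hd⟩ := perm_decay (q := q) hβ
  have hq : (1 : ℝ) ≤ q := by exact_mod_cast NeZero.one_le
  have hr : 0 ≤ 1 - 1 / (q : ℝ) := by
    have : 1 / (q : ℝ) ≤ 1 := by rw [div_le_one (by linarith)]; exact hq
    linarith
  refine ⟨K * (q * q), by positivity, fun n f hf1 t σ φ => ?_⟩
  set κ : Fin n → Fin q × Fin q := fun v => (σ v, σ (φ v)) with hκ
  set S : Finset (Equiv.Perm (Fin n)) := univ.filter (fun ψ => ∀ v, κ (ψ v) = κ v) with hS
  have hS0 : (0 : ℝ) < #S := by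
    exact_mod_cast card_pos.2 ⟨1, by simp [hS]⟩
  set g : Conf n q → ℝ := fun τ => (#S : ℝ)⁻¹ * ∑ ψ ∈ S, f (τ ∘ ψ) with hg
  have hg1 : ∀ τ, |g τ| ≤ 1 := by
    intro τ
    simp only [hg]
    rw [abs_mul, abs_of_pos (by positivity : (0 : ℝ) < (#S : ℝ)⁻¹), inv_mul_le_iff₀ hS0, mul_one]
    refine (abs_sum_le_sum_abs _ _).trans ((sum_le_sum fun ψ _ => hf1 _).trans ?_)
    simp
  have hgs : ∀ u v, κ u = κ v → ∀ τ, g (τ ∘ Equiv.swap u v) = g τ := by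
    intro u v huv τ
    simp only [hg]
    congr 1
    have hsw : ∀ w, κ (Equiv.swap u v w) = κ w := by
      intro w
      by_cases h1 : w = u
      · rw [h1, Equiv.swap_apply_left, huv]
      by_cases h2 : w = v
      · rw [h2, Equiv.swap_apply_right, huv]
      rw [Equiv.swap_apply_of_ne_of_ne h1 h2]
    refine sum_bij' (fun ψ _ => Equiv.swap u v * ψ) (fun ψ _ => Equiv.swap u v * ψ) ?_ ?_ ?_ ?_ ?_
    · intro ψ hψ
      simp only [hS, mem_filter, mem_univ, true_and, Equiv.Perm.mul_apply, hsw] at hψ ⊢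
      exact hψ
    · intro ψ hψ
      simp only [hS, mem_filter, mem_univ, true_and, Equiv.Perm.mul_apply, hsw] at hψ ⊢
      exact hψ
    · intro ψ _; rw [← mul_assoc, Equiv.swap_mul_self, one_mul]
    · intro ψ _; rw [← mul_assoc, Equiv.swap_mul_self, one_mul]
    · intro ψ _; rfl
  have hfg : ∀ η : Conf n q, (∀ ψ ∈ S, η ∘ ψ = η) →
      (Pop β)^[t + 1] g η = (Pop β)^[t + 1] f η := by
    intro η hη
    have hP := Pop_iterate_isExp (n := n) (q := q) hβ (t + 1) η
    have h1 : (Pop β)^[t + 1] g η =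
        (#S : ℝ)⁻¹ * ∑ ψ ∈ S, (Pop β)^[t + 1] (fun τ => f (τ ∘ ψ)) η := by
      rw [← hP.sum, ← hP.smul]
    rw [h1, sum_congr rfl fun ψ hψ => by rw [← Pop_iterate_comp, hη ψ hψ], sum_const,
      nsmul_eq_mul, inv_mul_cancel_left₀ hS0.ne']
  have h1 := hd n κ g hg1 hgs t σ φ
  rw [hfg σ, hfg (σ ∘ φ)] at h1
  · refine h1.trans ?_
    calc _ ≤ K * (1 - 1 / (q : ℝ)) ^ t *
          ∑ v, 1 / √(#(univ.filter (fun u => κ u = κ v))) := by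
          gcongr with v _
          exact mul_le_of_le_one_left (by positivity) (ind_le_one _)
      _ ≤ K * (1 - 1 / (q : ℝ)) ^ t * (Fintype.card (Fin q × Fin q) * √n) := by
          gcongr
          exact sum_inv_sqrt_le κ
      _ = _ := by
          rw [Fintype.card_prod, Fintype.card_fin]
          push_cast
          ring
  · intro ψ hψ
    funext v
    have := (mem_filter.1 hψ).2 v
    exact (Prod.mk.inj this).2
  · intro ψ hψ
    funext v
    have := (mem_filter.1 hψ).2 v
    exact (Prod.mk.inj this).1

end coupling

/-! ### Reaching the attracting region from an arbitrary configuration -/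

section force

variable {n q : ℕ}

lemma sum_clus_rep_le (E : Finset (Fin n × Fin n)) (B : Finset (Fin n))
    (hB : ∀ w ∈ B, rep E w = w) : ∑ w ∈ B, #(clus E {w}) ≤ n := by
  have h1 : ∀ w ∈ B, #(clus E {w}) = #((univ : Finset (Fin n)).filter fun u => rep E u = w) := by
    intro w hw
    congr 1
    ext u
    rw [mem_filter, ← rep_eq_iff, hB w hw]
    simp [eq_comm]
  rw [sum_congr rfl h1, sum_card_fiberwise_eq_card_filter]
  exact (card_le_univ _).trans_eq (Fintype.card_fin n)

lemma avg_force_large (hq : 2 ≤ q) {s h : ℝ} (hs : 0 < s) (hh : 0 < h) (hhs : 2 * q * h ≤ s ^ 2)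
    (hn : 1 ≤ n) (E : Finset (Fin n × Fin n)) (v : Fin n) (hv : h * n ≤ #(clus E {v})) :
    ((q : ℝ)⁻¹) ^ ⌊1 / h⌋₊ / 2 ≤ avg (fun ξ : Conf n q =>
      ind (∃ y : ℝ, 1 / q + (1 - 1 / q) * (#(clus E {v}) / n) ≤ y ∧ y ≤ 1 ∧ dd (clr E ξ) y ≤ s)) := by
  have : NeZero q := ⟨by omega⟩
  have hn' : (0 : ℝ) < n := by positivity
  have hq' : (2 : ℝ) ≤ q := by exact_mod_cast hq
  have ha := avg_isExp (Ω := Conf n q)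
  have hqi : (q : ℝ)⁻¹ ≤ 1 := Nat.cast_inv_le_one q
  have hqi0 : 0 < (q : ℝ)⁻¹ := by positivity
  set B := (univ : Finset (Fin n)).filter (fun w => rep E w = w ∧ h * n ≤ #(clus E {w})) with hB
  set S := (univ : Finset (Fin n)).filter (fun w => ¬ h * n ≤ #(clus E {w})) with hS
  have hBc : #B ≤ ⌊1 / h⌋₊ := by
    apply Nat.le_floor
    rw [le_div_iff₀ hh]
    have h1 : (#B : ℝ) * (h * n) ≤ n := by
      calc (#B : ℝ) * (h * n) = ∑ w ∈ B, h * n := by rw [sum_const, nsmul_eq_mul]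
        _ ≤ ∑ w ∈ B, (#(clus E {w}) : ℝ) := sum_le_sum fun w hw => (mem_filter.1 hw).2.2
        _ ≤ n := by exact_mod_cast sum_clus_rep_le E B fun w hw => (mem_filter.1 hw).2.1
    nlinarith
  set c₀ : Fin q := 0
  set y : ℝ := 1 - (1 - 1 / q) * (#S / n) with hy
  have hSv : (#S : ℝ) ≤ n - #(clus E {v}) := by
    have h1 : S ⊆ univ \ clus E {v} := by
      intro w hw
      rw [mem_sdiff]
      refine ⟨mem_univ _, fun hwv => (mem_filter.1 hw).2 ?_⟩
      rwa [clus_singleton_eq hwv]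
    have h2 := card_le_card h1
    rw [card_sdiff_of_subset (subset_univ _), card_univ, Fintype.card_fin] at h2
    have h3 : #(clus E {v}) ≤ n := (card_le_univ _).trans_eq (Fintype.card_fin n)
    have h4 : ((n - #(clus E {v}) : ℕ) : ℝ) = n - #(clus E {v}) := Nat.cast_sub h3
    rw [← h4]; exact_mod_cast h2
  have hy1 : 1 / q + (1 - 1 / q) * (#(clus E {v}) / n) ≤ y := by
    have h1 : (#S : ℝ) / n ≤ 1 - #(clus E {v}) / n := by
      rw [div_le_iff₀ hn', sub_mul, div_mul_cancel₀ _ hn'.ne', one_mul]; exact hSv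
    have h2 : 0 ≤ 1 - 1 / (q : ℝ) := by rw [one_div]; linarith
    have := mul_le_mul_of_nonneg_left h1 h2
    rw [hy]; linarith
  have hy2 : y ≤ 1 := by
    have h2 : 0 ≤ 1 - 1 / (q : ℝ) := by rw [one_div]; linarith
    have : 0 ≤ (1 - 1 / (q : ℝ)) * (#S / n) := by positivity
    linarith
  set f : Conf n q → ℝ := fun ξ =>
    ind (∃ y : ℝ, 1 / q + (1 - 1 / q) * (#(clus E {v}) / n) ≤ y ∧ y ≤ 1 ∧ dd (clr E ξ) y ≤ s) with hf
  have h1 := avg_force B c₀ (f := f) fun ξ => ind_nonneg _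
  rw [Fintype.card_fin] at h1
  refine le_trans ?_ h1
  have h2 : ∀ ξ ∈ (Set.univ : Set (Conf n q)),
      1 - (∑ j : Fin q, ((#(S.filter fun w => clr E ξ w = j) : ℝ) - #S / q) ^ 2) *
        ((s * n) ^ 2)⁻¹ ≤ f (B.piecewise (fun _ => c₀) ξ) := by
    intro ξ _
    by_cases hall : ∀ j : Fin q, |(#(S.filter fun w => clr E ξ w = j) : ℝ) - #S / q| ≤ s * n
    · have : f (B.piecewise (fun _ => c₀) ξ) = 1 := by
        apply ind_true
        refine ⟨y, hy1, hy2, (dd_le _ _ c₀).trans ?_⟩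
        rw [pi_norm_le_iff_of_nonneg hs.le]
        intro j
        set τ := clr E (B.piecewise (fun _ => c₀) ξ) with hτ
        have hτS : ∀ w ∈ S, τ w = clr E ξ w := by
          intro w hw
          simp only [hτ, clr]
          rw [piecewise_eq_of_notMem]
          intro hB'
          apply (mem_filter.1 hw).2
          rw [← clus_singleton_eq (rep_mem E w)]
          exact (mem_filter.1 hB').2.2
        have hτC : ∀ w ∈ univ \ S, τ w = c₀ := by
          intro w hw
          simp only [hτ, clr]
          rw [piecewise_eq_of_mem]
          have hw' : h * n ≤ #(clus E {w}) := by
            by_contra h'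
            exact (mem_sdiff.1 hw).2 (mem_filter.2 ⟨mem_univ _, h'⟩)
          rw [hB, mem_filter]
          refine ⟨mem_univ _, ?_, ?_⟩
          · exact (rep_eq_iff.2 (rep_mem E w)).symm
          · rw [clus_singleton_eq (rep_mem E w)]; exact hw'
        have hN : (cntN τ j : ℝ) = #(S.filter fun w => clr E ξ w = j) +
            if j = c₀ then (n : ℝ) - #S else 0 := by
          rw [cntN_eq_add τ S j, Nat.cast_add]
          congr 1
          · congr 2
            exact filter_congr fun w hw => by rw [hτS w hw]
          · split_ifs with hj
            · rw [filter_true_of_mem fun w hw => by rw [hτC w hw, hj],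
                card_sdiff_of_subset (subset_univ _), Nat.cast_sub (card_le_card (subset_univ _))]
              simp
            · rw [filter_false_of_mem fun w hw => by rw [hτC w hw]; exact fun h => hj h.symm]
              simp
        have hR := hall j
        have key : (cntFrac τ - kap q c₀ y) j =
            ((#(S.filter fun w => clr E ξ w = j) : ℝ) - #S / q) / n := by
          simp only [Pi.sub_apply, cntFrac, kap, hN, hy]
          have hq1 : (q : ℝ) - 1 ≠ 0 := by linarith
          have hq0 : (q : ℝ) ≠ 0 := by linarith
          generalize (#(S.filter fun w => clr E ξ w = j) : ℝ) = R
          generalize (#S : ℝ) = S'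
          split_ifs with hj
          · field_simp; ring
          · field_simp; ring
        rw [key, Real.norm_eq_abs, abs_div, abs_of_pos hn', div_le_iff₀ hn']
        exact hR
      rw [this]
      have : 0 ≤ (∑ j : Fin q, ((#(S.filter fun w => clr E ξ w = j) : ℝ) - #S / q) ^ 2) *
        ((s * n) ^ 2)⁻¹ := by positivity
      linarith
    · push Not at hall
      obtain ⟨j, hj⟩ := hall
      refine le_trans ?_ (ind_nonneg _)
      rw [sub_nonpos, ← div_eq_mul_inv, one_le_div (by positivity)]
      calc (s * n) ^ 2 ≤ |(#(S.filter fun w => clr E ξ w = j) : ℝ) - #S / q| ^ 2 := by gcongr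
        _ = ((#(S.filter fun w => clr E ξ w = j) : ℝ) - #S / q) ^ 2 := sq_abs _
        _ ≤ _ := single_le_sum (f := fun j : Fin q =>
            ((#(S.filter fun w => clr E ξ w = j) : ℝ) - #S / q) ^ 2)
            (fun _ _ => sq_nonneg _) (mem_univ j)
  have h3 := ha.mono _ _ h2
  rw [ha.sub, ha.const, ha.mul_const, ha.sum] at h3
  have h4 : ∑ j : Fin q, avg (fun ξ : Conf n q =>
      ((#(S.filter fun w => clr E ξ w = j) : ℝ) - #S / q) ^ 2) ≤ q * (h * n * n) := by
    calc _ ≤ ∑ _j : Fin q, h * n * n := by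
          refine sum_le_sum fun j _ => (avg_count_var E S j).trans ?_
          calc ∑ w ∈ S, (#(clus E {w}) : ℝ) ≤ ∑ w ∈ S, h * n :=
                sum_le_sum fun w hw => (not_le.1 (mem_filter.1 hw).2).le
            _ = #S * (h * n) := by rw [sum_const, nsmul_eq_mul]
            _ ≤ n * (h * n) := by
                gcongr
                exact (card_le_univ _).trans_eq (Fintype.card_fin n)
            _ = _ := by ring
      _ = _ := by simp
  have h5 : (1 : ℝ) / 2 ≤ avg (fun ξ => f (B.piecewise (fun _ => c₀) ξ)) := by
    refine le_trans ?_ h3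
    have h6 := mul_le_mul_of_nonneg_right h4 (by positivity : 0 ≤ ((s * n) ^ 2)⁻¹)
    have h7 : q * (h * n * n) * ((s * n) ^ 2)⁻¹ ≤ 1 / 2 := by
      rw [← div_eq_mul_inv, div_le_iff₀ (by positivity)]
      nlinarith [mul_le_mul_of_nonneg_right hhs (sq_nonneg (n : ℝ))]
    linarith
  calc ((q : ℝ)⁻¹) ^ ⌊1 / h⌋₊ / 2 = ((q : ℝ)⁻¹) ^ ⌊1 / h⌋₊ * (1 / 2) := by ring
    _ ≤ _ := by
      gcongr ?_ * ?_
      exact pow_le_pow_of_le_one hqi0.le hqi hBc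

end force

section reach

variable {q : ℕ} {β e c a ρ ρ' δ K c₀ : ℝ}

/-- With probability bounded below, one step moves the dynamics close to the line of
configurations having one dominant colour, losing little compared to the drift. -/
theorem one_step_force (hq : 2 ≤ q) (hβ : (q : ℝ) < β) (hC : Consts q β e c)
    {s : ℝ} (hs : 0 < s) :
    ∃ κ : ℝ, 0 < κ ∧ ∃ N : ℕ, ∀ n : ℕ, N ≤ n → ∀ (σ : Conf n q) (i : Fin q),
      (n : ℝ) / q ≤ cntN σ i → κ ≤ Pop β (fun τ => ind (∃ y : ℝ, F q β (cntFrac σ i) - s ≤ y ∧ y ≤ 1 ∧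
        dd τ y ≤ s)) σ := by
  have : NeZero q := ⟨by omega⟩
  have hq' : (2 : ℝ) ≤ q := by exact_mod_cast hq
  have hβ0 : 0 ≤ β := by linarith
  have he := hC.e_pos
  obtain ⟨K, hK, hG⟩ := giant_fail hq hβ hC (ε := min e s) (lt_min he hs) (min_le_left _ _)
  set h : ℝ := min e (s ^ 2 / (2 * q)) with hh
  have hh0 : 0 < h := lt_min he (by positivity)
  have hhs : 2 * q * h ≤ s ^ 2 := by
    have := min_le_right e (s ^ 2 / (2 * q))
    rw [← hh, le_div_iff₀ (by positivity)] at this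
    linarith
  refine ⟨((q : ℝ)⁻¹) ^ ⌊1 / h⌋₊ / 2 / 2, by positivity, ⌈2 * K⌉₊ + 1, fun n hn σ i hi => ?_⟩
  have hn1 : 1 ≤ n := by omega
  have hn' : (0 : ℝ) < n := by positivity
  have hKn : K / n ≤ 1 / 2 := by
    rw [div_le_iff₀ hn']
    have h1 : ((⌈2 * K⌉₊ : ℕ) : ℝ) ≤ n := by exact_mod_cast (by omega : ⌈2 * K⌉₊ ≤ n)
    linarith [Nat.le_ceil (2 * K)]
  have hP := perc_isExp (pp_nonneg (n := n) hβ0) (pp_le_one (n := n)) σ univ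
  set κ : ℝ := ((q : ℝ)⁻¹) ^ ⌊1 / h⌋₊ / 2 with hκ
  have hκ0 : 0 < κ := by positivity
  have h1 : ∀ E ∈ {E : Finset (Fin n × Fin n) | E ⊆ mp σ univ},
      κ * (1 - ind (¬ Giant β e (min e s) σ i E)) ≤ avg (fun ξ : Conf n q =>
        ind (∃ y : ℝ, F q β (cntFrac σ i) - s ≤ y ∧ y ≤ 1 ∧ dd (clr E ξ) y ≤ s)) := by
    intro E _
    have ha := avg_isExp (Ω := Conf n q)
    by_cases hg : Giant β e (min e s) σ i E
    · rw [ind_false (not_not.2 hg), sub_zero, mul_one]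
      obtain ⟨⟨v, hvi, hv⟩, hall⟩ := hg
      have h2 := hall v hvi hv
      have hhe : h ≤ e := min_le_left _ _
      refine (avg_force_large hq hs hh0 hhs hn1 E v (le_trans (by gcongr) hv)).trans
        (ha.mono _ _ fun ξ _ => ind_mono ?_)
      rintro ⟨y, hy, hy1, hyd⟩
      refine ⟨y, le_trans ?_ hy, hy1, hyd⟩
      have h3 : gg β (cntFrac σ i) - s ≤ #(clus E {v}) / n := by
        rw [le_div_iff₀ hn']
        have h4 := (abs_le.1 h2).1
        have h5 : min e s * n ≤ s * n := by gcongr; exact min_le_right _ _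
        simp only [cntFrac]
        linarith
      have h6 : 0 < 1 / (q : ℝ) := by positivity
      have h7 : 1 / (q : ℝ) ≤ 1 := by rw [div_le_one (by linarith)]; linarith
      have h8 := mul_le_mul_of_nonneg_left h3 (by linarith : 0 ≤ 1 - 1 / (q : ℝ))
      rw [F_eq]
      nlinarith
    · rw [ind_true hg, sub_self, mul_zero]
      exact ha.nonneg fun ξ _ => ind_nonneg _
  have h2 := hP.mono _ _ h1
  rw [hP.smul, hP.sub, hP.const] at h2
  refine le_trans ?_ h2
  have := hG n σ i hn1 hi
  rw [div_eq_mul_inv κ 2]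
  gcongr
  linarith

lemma exists_cntN_ge [NeZero q] {n : ℕ} (σ : Conf n q) : ∃ i, (n : ℝ) / q ≤ cntN σ i := by
  by_contra! h
  have h1 : ∑ i, (cntN σ i : ℝ) < ∑ _i : Fin q, (n : ℝ) / q :=
    sum_lt_sum_of_nonempty univ_nonempty fun i _ => h i
  have hq : (q : ℝ) ≠ 0 := by exact_mod_cast NeZero.ne q
  rw [sum_const, card_univ, Fintype.card_fin, nsmul_eq_mul, mul_div_cancel₀ _ hq] at h1
  have h2 : ∑ i, cntN σ i = n := by
    unfold cntN
    rw [sum_card_fiberwise_eq_card_filter]; simp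
  rw [← Nat.cast_sum, h2] at h1
  exact lt_irrefl _ h1

lemma Pop_iterate_ge {n : ℕ} (hβ : 0 ≤ β) [NeZero q] {κ : ℝ} (f : ℕ → Conf n q → ℝ) (hκ : 0 ≤ κ)
    (h : ∀ t σ, κ * f t σ ≤ Pop β (f (t + 1)) σ) (t : ℕ) (σ : Conf n q) :
    κ ^ t * f 0 σ ≤ (Pop β)^[t] (f t) σ := by
  induction t generalizing f with
  | zero => simp
  | succ t ih =>
    have hP := Pop_iterate_isExp (n := n) (q := q) hβ t σ
    have h1 := ih (fun s => Pop β (f (s + 1))) (fun s σ => by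
      have hP := Pop_isExp (n := n) (q := q) hβ σ
      rw [← hP.smul]
      exact hP.mono _ _ fun τ _ => h (s + 1) τ)
    rw [Function.iterate_succ_apply]
    refine le_trans ?_ h1
    rw [pow_succ, mul_assoc]
    exact mul_le_mul_of_nonneg_left (h 0 σ) (pow_nonneg hκ t)

lemma le_cntFrac_of_dd_le {n : ℕ} [NeZero q] (τ : Conf n q) {y s : ℝ} (h : dd τ y ≤ s) :
    ∃ i, y - s ≤ cntFrac τ i := by
  obtain ⟨J, hJ⟩ := exists_dd_eq τ y
  refine ⟨J, ?_⟩
  have h1 := norm_le_pi_norm (cntFrac τ - kap q J y) J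
  rw [hJ, Real.norm_eq_abs, Pi.sub_apply, kap, if_pos rfl] at h1
  linarith [(abs_le.1 h1).1]

theorem reach_line (hq : 2 ≤ q) (hβ : (q : ℝ) < β) (hC : Consts q β e c)
    (hD : Drift q β a ρ ρ' δ K c₀) {η : ℝ} (hη : 0 < η) (hηδ : η ≤ δ) :
    ∃ κ : ℝ, 0 < κ ∧ ∃ m N : ℕ, ∀ n : ℕ, N ≤ n → ∀ σ : Conf n q,
      κ ≤ (Pop β)^[m] (fun τ => ind (∃ y : ℝ, y ∈ Set.Icc (a - η) 1 ∧ dd τ y ≤ η)) σ := by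
  have : NeZero q := ⟨by omega⟩
  have hq' : (2 : ℝ) ≤ q := by exact_mod_cast hq
  have hβ0 : 0 ≤ β := by linarith
  have haq := hD.le_sub
  have hqa : 1 / (q : ℝ) ≤ a - η := by linarith
  -- a uniform gap between the drift and the diagonal
  obtain ⟨s, hs, hgap⟩ : ∃ s : ℝ, 0 < s ∧ ∀ x ∈ Set.Icc (1 / (q : ℝ)) (a - η), 4 * s ≤ F q β x - x := by
    have hsub : Set.Icc (1 / (q : ℝ)) (a - η) ⊆ Set.Icc (1 / (q : ℝ)) 1 :=
      Set.Icc_subset_Icc_right (by linarith [hD.a_lt])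
    obtain ⟨x₀, hx₀, hmin⟩ := isCompact_Icc.exists_isMinOn (Set.nonempty_Icc.2 hqa)
      ((hD.cont.mono hsub).sub continuousOn_id)
    refine ⟨(F q β x₀ - x₀) / 4, ?_, fun x hx => ?_⟩
    · have := hD.lt_F x₀ hx₀.1 (by linarith [hx₀.2])
      linarith
    · have := hmin hx
      simp only [Pi.sub_apply, id, Set.mem_ofPred_eq] at this
      linarith
  set s' := min s η with hs'
  have hs'0 : 0 < s' := lt_min hs hη
  have hs's : s' ≤ s := min_le_left _ _
  have hs'η : s' ≤ η := min_le_right _ _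
  obtain ⟨κ, hκ, N, hstep⟩ := one_step_force hq hβ hC hs'0
  set x : ℕ → ℝ := fun t => min (1 / q + 2 * s' * t) (a - η) with hx
  have hx1 : ∀ t, 1 / (q : ℝ) ≤ x t := fun t => le_min (by
    have : 0 ≤ 2 * s' * t := by positivity
    linarith) hqa
  have hx2 : ∀ t, x t ≤ a - η := fun t => min_le_right _ _
  have hxs : ∀ t, x (t + 1) ≤ x t + 2 * s' := by
    intro t
    simp only [hx]
    rw [← min_add_add_right]
    refine min_le_min ?_ (by linarith)
    push_cast; linarith
  obtain ⟨m, hm⟩ := exists_nat_ge (1 / (2 * s'))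
  have hxm : x m = a - η := by
    apply min_eq_right
    rw [div_le_iff₀ (by positivity)] at hm
    have : 0 < 1 / (q : ℝ) := by positivity
    linarith [hD.a_lt]
  refine ⟨κ ^ m * κ, by positivity, m + 1, N + 1, fun n hn σ => ?_⟩
  have hn1 : 1 ≤ n := by omega
  have hn' : (0 : ℝ) < n := by positivity
  have hcnt : ∀ (τ : Conf n q) t i, x t ≤ cntFrac τ i → (n : ℝ) / q ≤ cntN τ i := by
    intro τ t i hi
    have := (hx1 t).trans hi
    rw [cntFrac, le_div_iff₀ hn'] at this
    linarith [(by ring : (n : ℝ) / q = 1 / q * n)]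
  have hF : ∀ (τ : Conf n q) t i, x t ≤ cntFrac τ i → x t + 4 * s' ≤ F q β (cntFrac τ i) := by
    intro τ t i hi
    have h1 := hgap (x t) ⟨hx1 t, hx2 t⟩
    have h2 : F q β (x t) ≤ F q β (cntFrac τ i) :=
      hD.mono ⟨hx1 t, (hx2 t).trans (by linarith [hD.a_lt])⟩
        ⟨(hx1 t).trans hi, cntFrac_le_one _ _⟩ hi
    linarith
  set f : ℕ → Conf n q → ℝ := fun t τ => ind (∃ i, x t ≤ cntFrac τ i) with hf
  have h1 : ∀ t τ, κ * f t τ ≤ Pop β (f (t + 1)) τ := by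
    intro t τ
    have hP := Pop_isExp (n := n) (q := q) hβ0 τ
    by_cases h : ∃ i, x t ≤ cntFrac τ i
    · simp only [hf]
      rw [ind_true h, mul_one]
      obtain ⟨i, hi⟩ := h
      refine (hstep n (by omega) τ i (hcnt τ t i hi)).trans (hP.mono _ _ fun τ' _ => ind_mono ?_)
      rintro ⟨y, hy, -, hyd⟩
      obtain ⟨i', hi'⟩ := le_cntFrac_of_dd_le τ' hyd
      refine ⟨i', (hxs t).trans ?_⟩
      linarith [hF τ t i hi]
    · simp only [hf]
      rw [ind_false h, mul_zero]
      exact hP.nonneg fun _ _ => ind_nonneg _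
  have h2 := Pop_iterate_ge hβ0 f hκ.le h1 m σ
  have h3 : f 0 σ = 1 := by
    obtain ⟨i, hi⟩ := exists_cntN_ge σ
    apply ind_true
    refine ⟨i, (min_le_left _ _).trans ?_⟩
    rw [Nat.cast_zero, mul_zero, add_zero, cntFrac, le_div_iff₀ hn']
    linarith [(by ring : (n : ℝ) / q = 1 / q * n)]
  rw [h3, mul_one] at h2
  have hP := Pop_iterate_isExp (n := n) (q := q) hβ0 m σ
  rw [Function.iterate_succ_apply]
  calc κ ^ m * κ ≤ (Pop β)^[m] (f m) σ * κ := by gcongr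
    _ = (Pop β)^[m] (fun τ => f m τ * κ) σ := (hP.mul_const _ _).symm
    _ ≤ _ := hP.mono _ _ fun τ _ => by
      have hP := Pop_isExp (n := n) (q := q) hβ0 τ
      by_cases h : ∃ i, x m ≤ cntFrac τ i
      · simp only [hf]
        rw [ind_true h, one_mul]
        obtain ⟨i, hi⟩ := h
        refine (hstep n (by omega) τ i (hcnt τ m i hi)).trans (hP.mono _ _ fun τ' _ => ind_mono ?_)
        rintro ⟨y, hy, hy1, hyd⟩
        refine ⟨y, ⟨?_, hy1⟩, hyd.trans hs'η⟩
        linarith [hF τ m i hi, hxm]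
      · simp only [hf]
        rw [ind_false h, zero_mul]
        exact hP.nonneg fun _ _ => ind_nonneg _

end reach

section burn

variable {q : ℕ} {β e c a ρ ρ' δ K c₀ η K' : ℝ}

lemma exists_forall_div_le (A B : ℝ) {ε : ℝ} (hε : 0 < ε) :
    ∃ N : ℕ, ∀ n : ℕ, N ≤ n → A / √n + B / n ≤ ε := by
  have h1 : Filter.Tendsto (fun n : ℕ => A / √n + B / n) Filter.atTop (nhds (0 + 0)) :=
    (Filter.Tendsto.const_div_atTop
      (Real.tendsto_sqrt_atTop.comp tendsto_natCast_atTop_atTop) A).add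
      (tendsto_const_div_atTop_nhds_zero_nat B)
  rw [add_zero] at h1
  exact Filter.eventually_atTop.1 ((h1.eventually_lt_const hε).mono fun _ h => h.le)

/-- From every configuration the neighbourhood of equilibrium is reached in a bounded number
of steps, with probability bounded below. -/
theorem reach_region (hq : 2 ≤ q) (hβ : (q : ℝ) < β) (hC : Consts q β e c)
    (hD : Drift q β a ρ ρ' δ K c₀) (hY : Dyn q β a ρ ρ' η K') (hηδ : η ≤ δ) :
    ∃ κ : ℝ, 0 < κ ∧ ∃ m N : ℕ, ∀ n : ℕ, N ≤ n → ∀ σ : Conf n q,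
      κ ≤ (Pop β)^[m] (fun τ => ind (dd τ a ≤ η)) σ := by
  have : NeZero q := ⟨by omega⟩
  have hq' : (2 : ℝ) ≤ q := by exact_mod_cast hq
  have hβ0 : 0 < β := by linarith
  have hη := hY.η_pos
  obtain ⟨hρ0, hρ'0⟩ := hD.ρ'_nonneg hq
  obtain ⟨κ, hκ, m, N, hreach⟩ := reach_line hq hβ hC hD hη hηδ
  obtain ⟨t, ht1, ht2⟩ : ∃ t : ℕ, K * ρ ^ t ≤ η / 4 ∧ ρ' ^ t ≤ 1 / 8 := by
    have h1 : Filter.Tendsto (fun t : ℕ => K * ρ ^ t) Filter.atTop (nhds (K * 0)) :=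
      (tendsto_pow_atTop_nhds_zero_of_lt_one hρ0.le (hD.ρ_le.trans_lt hD.ρ'_lt)).const_mul K
    rw [mul_zero] at h1
    have h2 := tendsto_pow_atTop_nhds_zero_of_lt_one hρ'0.le hD.ρ'_lt
    obtain ⟨t, h3, h4⟩ := ((h1.eventually_lt_const (by positivity : 0 < η / 4)).and
      (h2.eventually_lt_const (by norm_num : (0 : ℝ) < 1 / 8))).exists
    exact ⟨t, h3.le, h4.le⟩
  obtain ⟨N', hN'⟩ := exists_forall_div_le (K' / (1 - ρ')) (t * K') (by positivity : 0 < η / 8)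
  refine ⟨κ * (1 / 2), by positivity, m + t, N + N' + 1, fun n hn σ => ?_⟩
  rw [Function.iterate_add_apply]
  have hP := Pop_iterate_isExp (n := n) (q := q) hβ0.le m σ
  refine le_trans (mul_le_mul_of_nonneg_right (hreach n (by omega) σ) (by norm_num)) ?_
  rw [← hP.mul_const]
  refine hP.mono _ _ fun τ _ => ?_
  have hPt := Pop_iterate_isExp (n := n) (q := q) hβ0.le t τ
  by_cases h : ∃ y, y ∈ Set.Icc (a - η) 1 ∧ dd τ y ≤ η
  · rw [ind_true h, one_mul]
    obtain ⟨y, hy, hyd⟩ := h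
    have h1 := hY.track hq hβ0 hD hηδ (by omega : 1 ≤ n) t τ hy hyd
    have h2 := hN' n (by omega)
    have h3 := hD.iter_le y ⟨by linarith [hy.1], hy.2⟩ t
    have h4 : (Pop β)^[t] (fun τ => dd τ a) τ ≤ η / 2 := by
      calc _ ≤ (Pop β)^[t] (fun τ => dd τ ((F q β)^[t] y) + η / 4) τ := by
            refine hPt.mono _ _ fun τ' _ => (dd_le_add hq τ' a ((F q β)^[t] y)).trans ?_
            rw [abs_sub_comm]
            linarith
        _ = (Pop β)^[t] (fun τ => dd τ ((F q β)^[t] y)) τ + η / 4 := hPt.add_const _ _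
        _ ≤ η / 2 := by
            have h5 : ρ' ^ t * dd τ y ≤ 1 / 8 * η :=
              mul_le_mul ht2 hyd (dd_nonneg _ _) (by norm_num)
            rw [mul_div_assoc] at h2
            linarith
    have h5 := hPt.markov (X := fun τ => dd τ a) (fun _ _ => dd_nonneg _ _) hη
    have h6 : (Pop β)^[t] (fun τ => 1 - ind (η ≤ dd τ a)) τ ≤
        (Pop β)^[t] (fun τ => ind (dd τ a ≤ η)) τ := by
      refine hPt.mono _ _ fun τ' _ => ?_
      rw [← ind_not]
      exact ind_mono fun h => (not_le.1 h).le
    rw [hPt.sub, hPt.const] at h6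
    have h7 : (Pop β)^[t] (fun τ => dd τ a) τ / η ≤ 1 / 2 := by
      rw [div_le_iff₀ hη]; linarith
    linarith
  · rw [ind_false h, zero_mul]
    exact hPt.nonneg fun _ _ => ind_nonneg _

theorem burn_in (hq : 2 ≤ q) (hβ : (q : ℝ) < β) (hC : Consts q β e c)
    (hD : Drift q β a ρ ρ' δ K c₀) (hY : Dyn q β a ρ ρ' η K') (hηδ : η ≤ δ)
    {ε : ℝ} (hε : 0 < ε) :
    ∃ T N : ℕ, ∀ n : ℕ, N ≤ n → ∀ σ : Conf n q,
      (Pop β)^[T] (fun τ => ind (¬ dd τ a ≤ η)) σ ≤ ε := by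
  have : NeZero q := ⟨by omega⟩
  have hq' : (2 : ℝ) ≤ q := by exact_mod_cast hq
  have hβ0 : 0 ≤ β := by linarith
  have hη := hY.η_pos
  have hK' := hY.K_pos
  obtain ⟨κ, hκ, m, N, hreach⟩ := reach_region hq hβ hC hD hY hηδ
  set κ' := min κ 1 with hκ'
  have hκ'0 : 0 < κ' := lt_min hκ one_pos
  have hκ'1 : 0 ≤ 1 - κ' := by linarith [min_le_right κ 1]
  have h1 := tendsto_pow_atTop_nhds_zero_of_lt_one hκ'1 (by linarith : 1 - κ' < 1)
  obtain ⟨j, hj⟩ := (h1.eventually_lt_const (by positivity : 0 < ε / 2)).exists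
  obtain ⟨N', hN'⟩ := exists_forall_div_le 0 (j * (m * K')) (by positivity : 0 < ε / 2)
  refine ⟨m * j, N + N' + 1, fun n hn => ?_⟩
  have hn1 : 1 ≤ n := by omega
  set u : Conf n q → ℝ := fun τ => ind (¬ dd τ a ≤ η) with hu
  have ha : a ∈ Set.Icc (a - η) 1 := ⟨by linarith, hD.a_lt.le⟩
  have hu0 : ∀ σ, 0 ≤ u σ := fun σ => ind_nonneg _
  have hu1 : ∀ σ, u σ ≤ 1 := fun σ => ind_le_one _
  have hstep : ∀ σ, Pop β u σ ≤ u σ + K' / n := by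
    intro σ
    have hP := Pop_isExp (n := n) (q := q) hβ0 σ
    have hKn : 0 ≤ K' / n := by positivity
    by_cases h : dd σ a ≤ η
    · have h2 := hY.exit n σ a hn1 ha h
      rw [hD.fix] at h2
      simp only [← not_le] at h2
      linarith [hu0 σ]
    · have : u σ = 1 := ind_true h
      linarith [hP.le_const fun τ _ => hu1 τ]
  have hsteps : ∀ t σ, (Pop β)^[t] u σ ≤ u σ + t * (K' / n) := by
    intro t
    induction t with
    | zero => intro σ; simp
    | succ t ih =>
      intro σ
      have hP := Pop_isExp (n := n) (q := q) hβ0 σ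
      rw [Function.iterate_succ_apply']
      refine (hP.mono _ _ fun τ _ => ih τ).trans ?_
      rw [hP.add_const]
      push_cast
      linarith [hstep σ]
  have hblock : ∀ σ, (Pop β)^[m] u σ ≤ (1 - κ') * u σ + m * (K' / n) := by
    intro σ
    have hP := Pop_iterate_isExp (n := n) (q := q) hβ0 m σ
    by_cases h : dd σ a ≤ η
    · have h2 : u σ = 0 := ind_false (not_not.2 h)
      have := hsteps m σ
      rw [h2] at this ⊢
      linarith
    · have h2 : u σ = 1 := ind_true h
      have h3 := hreach n (by omega) σ
      have h4 : (Pop β)^[m] u σ = 1 - (Pop β)^[m] (fun τ => ind (dd τ a ≤ η)) σ := by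
        simp only [hu, ind_not]
        rw [hP.sub, hP.const]
      have h5 : 0 ≤ (m : ℝ) * (K' / n) := by positivity
      rw [h4, h2]
      linarith [min_le_left κ 1]
  have hblocks : ∀ i σ, ((Pop β)^[m])^[i] u σ ≤ (1 - κ') ^ i * u σ + i * (m * (K' / n)) := by
    intro i
    induction i with
    | zero => intro σ; simp
    | succ i ih =>
      intro σ
      have hP := Pop_iterate_isExp (n := n) (q := q) hβ0 m σ
      rw [Function.iterate_succ_apply']
      refine (hP.mono _ _ fun τ _ => ih τ).trans ?_
      rw [hP.add_const, hP.smul]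
      have h2 := mul_le_mul_of_nonneg_left (hblock σ) (pow_nonneg hκ'1 i)
      have h3 : (1 - κ') ^ i * (m * (K' / n)) ≤ m * (K' / n) :=
        mul_le_of_le_one_left (by positivity) (pow_le_one₀ hκ'1 (by linarith))
      push_cast
      rw [pow_succ]
      linarith
  intro σ
  rw [Function.iterate_mul]
  refine (hblocks j σ).trans ?_
  have h2 := hN' n (by omega)
  have h3 : (1 - κ') ^ j * u σ ≤ (1 - κ') ^ j :=
    mul_le_of_le_one_right (pow_nonneg hκ'1 j) (hu1 σ)
  have h4 : (j : ℝ) * (m * (K' / n)) = j * (m * K') / n := by ring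
  rw [h4]
  rw [zero_div, zero_add] at h2
  linarith

end burn

/-! ### A Harnack inequality for symmetric functions under resampling of vertices -/

section harnack

variable {n q : ℕ}

lemma exists_perm_of_fibers {ι : Type*} [DecidableEq ι] (κ κ' : Fin n → ι)
    (h : ∀ c, #(univ.filter fun v => κ v = c) = #(univ.filter fun v => κ' v = c)) :
    ∃ φ : Equiv.Perm (Fin n), ∀ v, κ (φ v) = κ' v := by
  have e : ∀ c, {v // κ' v = c} ≃ {v // κ v = c} := fun c =>
    Fintype.equivOfCardEq (by rw [Fintype.card_subtype, Fintype.card_subtype, h])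
  exact ⟨Equiv.ofFiberEquiv e, fun v => Equiv.ofFiberEquiv_map e v⟩

/-- Number of vertices outside `I` of colour `j`. -/
def cntOff (I : Finset (Fin n)) (τ : Conf n q) (j : Fin q) : ℕ :=
  #((univ \ I).filter fun w => τ w = j)

lemma sum_cntOff (I : Finset (Fin n)) (τ : Conf n q) : ∑ j, cntOff I τ j = n - #I := by
  unfold cntOff
  rw [sum_card_fiberwise_eq_card_filter]
  simp [card_sdiff_of_subset (subset_univ I)]

lemma cntN_piecewise (I : Finset (Fin n)) (ζ τ : Conf n q) (j : Fin q) :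
    (cntN (I.piecewise ζ τ) j : ℝ) = ∑ u ∈ I, ind (ζ u = j) + cntOff I τ j := by
  rw [cntN_eq_add _ I j, Nat.cast_add, card_filter_eq_sum_ind, cntOff]
  congr 1
  · exact sum_congr rfl fun u hu => by rw [piecewise_eq_of_mem _ _ _ hu]
  · congr 2
    exact filter_congr fun u hu => by
      rw [piecewise_eq_of_notMem _ _ _ (mem_sdiff.1 hu).2]

lemma cntOff_update {I : Finset (Fin n)} {τ : Conf n q} {v : Fin n} (hv : v ∉ I) {i j : Fin q}
    (hi : τ v = i) (hij : i ≠ j) :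
    cntOff I (Function.update τ v j) i + 1 = cntOff I τ i ∧
    cntOff I (Function.update τ v j) j = cntOff I τ j + 1 ∧
    ∀ l, l ≠ i → l ≠ j → cntOff I (Function.update τ v j) l = cntOff I τ l := by
  have hv' : v ∈ univ \ I := by simp [hv]
  unfold cntOff
  refine ⟨?_, ?_, fun l hl1 hl2 => ?_⟩
  · have h1 : (univ \ I).filter (fun w => τ w = i) =
        insert v ((univ \ I).filter fun w => Function.update τ v j w = i) := by
      ext w
      simp only [mem_insert, mem_filter]
      by_cases hw : w = v
      · subst hw; simp [hi, hv]
      · simp [hw]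
    rw [h1, card_insert_of_notMem]
    simp [hij.symm]
  · have h1 : (univ \ I).filter (fun w => Function.update τ v j w = j) =
        insert v ((univ \ I).filter fun w => τ w = j) := by
      ext w
      simp only [mem_insert, mem_filter]
      by_cases hw : w = v
      · subst hw; simp [hv]
      · simp [hw]
    rw [h1, card_insert_of_notMem]
    simp [hi, hij]
  · congr 1
    ext w
    simp only [mem_filter]
    by_cases hw : w = v
    · subst hw; simp [hi, hl1.symm, hl2.symm]
    · simp [Function.update_of_ne hw]

lemma avg_piecewise_perm {f : Conf n q → ℝ} (hf : ∀ τ (φ : Equiv.Perm (Fin n)), f (τ ∘ φ) = f τ)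
    {I I' : Finset (Fin n)} (hII : #I = #I') {τ τ' : Conf n q}
    (h : ∀ j, cntOff I τ j = cntOff I' τ' j) :
    avg (fun ζ : Conf n q => f (I.piecewise ζ τ)) =
      avg (fun ζ : Conf n q => f (I'.piecewise ζ τ')) := by
  obtain ⟨φ, hφ⟩ := exists_perm_of_fibers
    (fun v => if v ∈ I then none else some (τ v)) (fun v => if v ∈ I' then none else some (τ' v)) (by
      intro c
      rcases c with _ | c
      · have h1 : ∀ (J : Finset (Fin n)) (η : Conf n q),
            (univ.filter fun v => (if v ∈ J then none else some (η v)) = (none : Option (Fin q))) =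
              J := by
          intro J η; ext v; simp
        rw [h1, h1, hII]
      · have h1 : ∀ (J : Finset (Fin n)) (η : Conf n q),
            (univ.filter fun v => (if v ∈ J then none else some (η v)) = some c) =
              (univ \ J).filter fun w => η w = c := by
          intro J η; ext v; simp [mem_filter, mem_sdiff]
        rw [h1, h1]
        exact h c)
  rw [← avg_equiv (Equiv.arrowCongr φ.symm (Equiv.refl (Fin q)))
    (fun ζ => f (I'.piecewise ζ τ'))]
  congr 1
  funext ζ
  rw [← hf _ φ]
  congr 1
  funext v
  have hv := hφ v
  simp only [Function.comp_apply]
  by_cases h1 : v ∈ I'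
  · have h2 : φ v ∈ I := by
      by_contra h2; simp [h1, h2] at hv
    rw [piecewise_eq_of_mem _ _ _ h2, piecewise_eq_of_mem _ _ _ h1]
    simp
  · have h2 : φ v ∉ I := by
      intro h2; simp [h1, h2] at hv
    rw [piecewise_eq_of_notMem _ _ _ h2, piecewise_eq_of_notMem _ _ _ h1]
    simpa [h1, h2] using hv

variable [NeZero q]

lemma harnack_step {f : Conf n q → ℝ} (hf0 : ∀ τ, 0 ≤ f τ)
    (hf : ∀ τ (φ : Equiv.Perm (Fin n)), f (τ ∘ φ) = f τ) {w : Fin q → ℝ} {R R' m : ℝ}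
    (hW : ∀ τ, f τ ≠ 0 → ∀ j, |(cntN τ j : ℝ) - w j| ≤ R) {I : Finset (Fin n)} {τ : Conf n q}
    {v : Fin n} (hv : v ∉ I) {i j : Fin q} (hi : τ v = i)
    (h1 : |(cntOff I τ j : ℝ) - (w j - m)| ≤ R')
    (h2 : |(cntOff I (Function.update τ v j) i : ℝ) - (w i - m)| ≤ R') :
    avg (fun ζ : Conf n q => f (I.piecewise ζ (Function.update τ v j))) * (m - (R + R')) ≤
      avg (fun ζ : Conf n q => f (I.piecewise ζ τ)) * (m + (R + R')) := by
  have ha := avg_isExp (Ω := Conf n q)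
  have key : avg (fun ζ : Conf n q => f (I.piecewise ζ τ) * ∑ u ∈ I, ind (ζ u = j)) =
      avg (fun ζ : Conf n q => f (I.piecewise ζ (Function.update τ v j)) *
        ∑ u ∈ I, ind (ζ u = i)) := by
    simp only [mul_sum]
    rw [ha.sum, ha.sum]
    refine sum_congr rfl fun u hu => ?_
    have := avg_swap_vertex hv hu (fun τ => hf τ _) τ i j
    rwa [← hi, Function.update_eq_self, hi] at this
  rw [← ha.mul_const, ← ha.mul_const]
  refine (ha.mono _ _ fun ζ _ => ?_).trans (key.symm.le.trans (ha.mono _ _ fun ζ _ => ?_))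
  · by_cases h0 : f (I.piecewise ζ (Function.update τ v j)) = 0
    · rw [h0]; simp
    · have h3 := hW _ h0 i
      rw [cntN_piecewise] at h3
      refine mul_le_mul_of_nonneg_left ?_ (hf0 _)
      linarith [(abs_le.1 h3).1, (abs_le.1 h2).2]
  · by_cases h0 : f (I.piecewise ζ τ) = 0
    · rw [h0]; simp
    · have h3 := hW _ h0 j
      rw [cntN_piecewise] at h3
      refine mul_le_mul_of_nonneg_left ?_ (hf0 _)
      linarith [(abs_le.1 h3).2, (abs_le.1 h1).1]

theorem harnack {f : Conf n q → ℝ} (hf0 : ∀ τ, 0 ≤ f τ)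
    (hf : ∀ τ (φ : Equiv.Perm (Fin n)), f (τ ∘ φ) = f τ) {w : Fin q → ℝ} {R R' m x : ℝ}
    (hW : ∀ τ, f τ ≠ 0 → ∀ j, |(cntN τ j : ℝ) - w j| ≤ R) {I I' : Finset (Fin n)}
    (hII : #I = #I') {τ' : Conf n q} (hx0 : 0 ≤ x) (hm : 0 < m + (R + R'))
    (hx : x * (m + (R + R')) ≤ m - (R + R'))
    (h' : ∀ j, |(cntOff I' τ' j : ℝ) - (w j - m)| ≤ R') (k : ℕ) (τ : Conf n q)
    (h : ∀ j, |(cntOff I τ j : ℝ) - (w j - m)| ≤ R')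
    (hk : ∑ j, (cntOff I' τ' j - cntOff I τ j) = k) :
    x ^ k * avg (fun ζ : Conf n q => f (I'.piecewise ζ τ')) ≤
      avg (fun ζ : Conf n q => f (I.piecewise ζ τ)) := by
  have ha := avg_isExp (Ω := Conf n q)
  have htot : ∑ j, cntOff I τ j = ∑ j, cntOff I' τ' j := by
    rw [sum_cntOff, sum_cntOff, hII]
  induction k generalizing τ with
  | zero =>
    have h1 : ∀ j ∈ (univ : Finset (Fin q)), cntOff I' τ' j ≤ cntOff I τ j := by
      intro j _
      have := (sum_eq_zero_iff.1 hk) j (mem_univ j)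
      omega
    have h2 := (sum_eq_sum_iff_of_le h1).1 htot.symm
    rw [pow_zero, one_mul]
    exact (avg_piecewise_perm hf hII fun j => (h2 j (mem_univ j)).symm).ge
  | succ k ih =>
    obtain ⟨j, hj⟩ : ∃ j, cntOff I τ j < cntOff I' τ' j := by
      by_contra! hc
      have : ∑ j, (cntOff I' τ' j - cntOff I τ j) = 0 :=
        sum_eq_zero fun j _ => Nat.sub_eq_zero_of_le (hc j)
      omega
    obtain ⟨i, hi⟩ : ∃ i, cntOff I' τ' i < cntOff I τ i := by
      by_contra! hc
      exact absurd htot (sum_lt_sum (fun l _ => hc l) ⟨j, mem_univ j, hj⟩).ne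
    have hij : i ≠ j := by rintro rfl; omega
    obtain ⟨v, hv⟩ : ((univ \ I).filter fun w => τ w = i).Nonempty :=
      card_pos.1 (lt_of_le_of_lt (Nat.zero_le _) hi)
    have hvI : v ∉ I := (mem_sdiff.1 (mem_filter.1 hv).1).2
    have hvi : τ v = i := (mem_filter.1 hv).2
    obtain ⟨u1, u2, u3⟩ := cntOff_update hvI hvi hij
    set τ₁ := Function.update τ v j with hτ₁
    have hi1 : ((cntOff I τ₁ i : ℕ) : ℝ) + 1 = cntOff I τ i := by exact_mod_cast u1
    have hj1 : ((cntOff I τ₁ j : ℕ) : ℝ) = cntOff I τ j + 1 := by exact_mod_cast u2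
    have hi2 : (cntOff I' τ' i : ℝ) + 1 ≤ cntOff I τ i := by exact_mod_cast hi
    have hj2 : (cntOff I τ j : ℝ) + 1 ≤ cntOff I' τ' j := by exact_mod_cast hj
    have hgood : ∀ l, |(cntOff I τ₁ l : ℝ) - (w l - m)| ≤ R' := by
      intro l
      by_cases hl1 : l = i
      · subst hl1
        have h1 := abs_le.1 (h l)
        have h2 := abs_le.1 (h' l)
        rw [abs_le]; constructor <;> linarith
      by_cases hl2 : l = j
      · subst hl2
        have h1 := abs_le.1 (h l)
        have h2 := abs_le.1 (h' l)
        rw [abs_le]; constructor <;> linarith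
      rw [u3 l hl1 hl2]; exact h l
    have hsum : ∑ l, (cntOff I' τ' l - cntOff I τ₁ l) = k := by
      have h1 : ∑ l, (cntOff I' τ' l - cntOff I τ l) =
          ∑ l, ((cntOff I' τ' l - cntOff I τ₁ l) + if l = j then 1 else 0) := by
        refine sum_congr rfl fun l _ => ?_
        by_cases hl2 : l = j
        · subst hl2; rw [if_pos rfl]; omega
        · rw [if_neg hl2]
          by_cases hl1 : l = i
          · subst hl1; omega
          · rw [u3 l hl1 hl2]; rfl
      rw [hk, sum_add_distrib, sum_ite_eq' univ j, if_pos (mem_univ j)] at h1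
      omega
    have hrec := ih τ₁ hgood hsum (by rw [sum_cntOff, sum_cntOff, hII])
    have hstep := harnack_step hf0 hf hW hvI hvi (h j) (hgood i)
    rw [← hτ₁] at hstep
    set A := avg (fun ζ : Conf n q => f (I.piecewise ζ τ)) with hA
    set A₁ := avg (fun ζ : Conf n q => f (I.piecewise ζ τ₁)) with hA₁
    have hA₁0 : 0 ≤ A₁ := ha.nonneg fun _ _ => hf0 _
    have h3 : x * A₁ ≤ A := by
      have h4 := mul_le_mul_of_nonneg_left hx hA₁0
      refine le_of_mul_le_mul_right ?_ hm
      linarith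
    rw [pow_succ', mul_assoc]
    exact (mul_le_mul_of_nonneg_left hrec hx0).trans h3

end harnack

/-! ### Minorization near equilibrium -/

section minorization

variable {n q : ℕ} [NeZero q] {β : ℝ}

lemma Pop_color {q : ℕ} (π : Equiv.Perm (Fin q)) (f : Conf n q → ℝ) (σ : Conf n q) :
    Pop β (fun τ => f (π ∘ τ)) σ = Pop β f σ := by
  unfold Pop
  congr 1
  funext E
  rw [← avg_equiv (Equiv.arrowCongr (Equiv.refl (Fin n)) π) (fun ξ => f (clr E ξ))]
  rfl

lemma Pop_near_color {q : ℕ} (σ : Conf n q) (a r : ℝ) (J J' : Fin q) :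
    Pop β (fun τ => ind (‖cntFrac τ - kap q J a‖ ≤ r)) σ =
      Pop β (fun τ => ind (‖cntFrac τ - kap q J' a‖ ≤ r)) σ := by
  rw [← Pop_color (Equiv.swap J J') (fun τ => ind (‖cntFrac τ - kap q J' a‖ ≤ r))]
  congr 1
  funext τ
  congr 1
  have h1 : ∀ j, (cntFrac (Equiv.swap J J' ∘ τ) - kap q J' a) (Equiv.swap J J' j) =
      (cntFrac τ - kap q J a) j := by
    intro j
    simp only [Pi.sub_apply, cntFrac, cntN, kap, Function.comp_apply, EmbeddingLike.apply_eq_iff_eq]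
    congr 1
    have : Equiv.swap J J' j = J' ↔ j = J := by
      constructor
      · intro h
        simpa using congrArg (Equiv.swap J J') h
      · rintro rfl
        simp
    simp only [this]
  apply propext
  by_cases hr : 0 ≤ r
  · rw [pi_norm_le_iff_of_nonneg hr, pi_norm_le_iff_of_nonneg hr,
      ← (Equiv.swap J J').forall_congr_right (q := fun j =>
        ‖(cntFrac (Equiv.swap J J' ∘ τ) - kap q J' a) j‖ ≤ r)]
    simp only [h1]
  · exact ⟨fun h => absurd ((norm_nonneg _).trans h) hr, fun h => absurd ((norm_nonneg _).trans h) hr⟩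

lemma near_color_prob (hβ : 0 ≤ β) (σ : Conf n q) {a r p : ℝ} (J : Fin q)
    (h : Pop β (fun τ => ind (¬ dd τ a ≤ r)) σ ≤ 1 - p) :
    p / q ≤ Pop β (fun τ => ind (‖cntFrac τ - kap q J a‖ ≤ r)) σ := by
  have hP := Pop_isExp (n := n) (q := q) hβ σ
  have hq : (0 : ℝ) < q := by exact_mod_cast NeZero.pos q
  have h1 : ∀ τ ∈ (Set.univ : Set (Conf n q)), 1 - ind (¬ dd τ a ≤ r) ≤
      ∑ J : Fin q, ind (‖cntFrac τ - kap q J a‖ ≤ r) := by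
    intro τ _
    rw [ind_not, sub_sub_cancel]
    by_cases hd : dd τ a ≤ r
    · obtain ⟨J, hJ⟩ := exists_dd_eq τ a
      rw [ind_true hd, ← ind_true (hJ.trans_le hd)]
      exact single_le_sum (f := fun J => ind (‖cntFrac τ - kap q J a‖ ≤ r))
        (fun _ _ => ind_nonneg _) (mem_univ J)
    · rw [ind_false hd]
      exact sum_nonneg fun _ _ => ind_nonneg _
  have h2 := hP.mono _ _ h1
  rw [hP.sub, hP.const, hP.sum, sum_congr rfl fun J' _ => Pop_near_color σ a r J' J, sum_const,
    card_univ, Fintype.card_fin, nsmul_eq_mul] at h2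
  rw [div_le_iff₀ hq]
  linarith

lemma Pop_ge_of_resample (hβ : 0 ≤ β) {f : Conf n q → ℝ} (hf : ∀ τ, 0 ≤ f τ) (σ : Conf n q)
    (I : Finset (Fin n × Fin n) → Finset (Fin n)) (hI : ∀ E, I E ⊆ iso E)
    (G : Finset (Fin n × Fin n) → Conf n q → Prop) {c : ℝ}
    (hG : ∀ E ξ, G E ξ → c ≤ avg fun ζ : Conf n q => f ((I E).piecewise ζ (clr E ξ))) :
    perc (pp n β) σ univ (fun E => avg fun ξ => ind (G E ξ)) * c ≤ Pop β f σ := by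
  have hL := perc_isExp (pp_nonneg (n := n) hβ) (pp_le_one (n := n)) σ univ
  have ha := avg_isExp (Ω := Conf n q)
  unfold Pop
  rw [← hL.mul_const]
  refine hL.mono _ _ fun E _ => ?_
  rw [← avg_piecewise (I E) (fun ξ => f (clr E ξ)), ← ha.mul_const]
  refine ha.mono _ _ fun ξ _ => ?_
  simp only [clr_piecewise (hI E)]
  by_cases h : G E ξ
  · rw [ind_true h, one_mul]; exact hG E ξ h
  · rw [ind_false h, zero_mul]; exact ha.nonneg fun _ _ => hf _

lemma avg_count_far_le {I : Finset (Fin n)} (hI : I.Nonempty) {R : ℝ} (hR : 0 < R) :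
    avg (fun ζ : Conf n q => ind (¬ ∀ j, |∑ u ∈ I, ind (ζ u = j) - #I / q| ≤ R)) ≤
      q * (√(#I) / R) := by
  have ha := avg_isExp (Ω := Conf n q)
  calc _ ≤ avg (fun ζ : Conf n q => ∑ j : Fin q, |∑ u ∈ I, ind (ζ u = j) - #I / q| * R⁻¹) := by
        refine ha.mono _ _ fun ζ _ => ?_
        have h0 : ∀ j : Fin q, 0 ≤ |∑ u ∈ I, ind (ζ u = j) - (#I : ℝ) / q| * R⁻¹ := fun j => by
          positivity
        by_cases h : ∀ j, |∑ u ∈ I, ind (ζ u = j) - (#I : ℝ) / q| ≤ R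
        · rw [ind_false (not_not.2 h)]; exact sum_nonneg fun j _ => h0 j
        · rw [ind_true h]
          push Not at h
          obtain ⟨j, hj⟩ := h
          refine le_trans ?_ (single_le_sum (f := fun j : Fin q =>
            |∑ u ∈ I, ind (ζ u = j) - (#I : ℝ) / q| * R⁻¹) (fun j _ => h0 j) (mem_univ j))
          rw [← div_eq_mul_inv, one_le_div hR]
          exact hj.le
    _ = ∑ j : Fin q, avg (fun ζ : Conf n q => |∑ u ∈ I, ind (ζ u = j) - #I / q|) * R⁻¹ := by
        rw [ha.sum]
        exact sum_congr rfl fun j _ => ha.mul_const _ _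
    _ ≤ ∑ _j : Fin q, √(#I) * R⁻¹ := by
        gcongr with j _
        exact avg_abs_count_sub_le hI j
    _ = _ := by simp [div_eq_mul_inv]

lemma cntOff_eq {q : ℕ} {E : Finset (Fin n × Fin n)} {I : Finset (Fin n)} (hI : I ⊆ iso E) (ξ : Conf n q)
    (j : Fin q) : (cntOff I (clr E ξ) j : ℝ) = cntN (clr E ξ) j - ∑ u ∈ I, ind (ξ u = j) := by
  have h1 := cntN_piecewise I (clr E ξ) (clr E ξ) j
  rw [piecewise_same] at h1
  have h2 : ∀ u ∈ I, clr E ξ u = ξ u := by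
    intro u hu
    simp only [clr]
    rw [(rep_eq_iso_iff (hI hu)).2 rfl]
  rw [sum_congr rfl fun u hu => by rw [h2 u hu]] at h1
  linarith

lemma exp_neg_le_pow {y Q : ℝ} (hy0 : 0 ≤ y) (hy : y ≤ 1 / 2) (k : ℕ) (hk : y * k ≤ Q) :
    Real.exp (-(2 * Q)) ≤ (1 - y) ^ k := by
  have h1 : Real.exp (-(2 * y)) ≤ 1 - y := by
    rw [Real.exp_neg]
    refine inv_le_of_inv_le₀ (by linarith) ?_
    have h2 := Real.add_one_le_exp (2 * y)
    refine le_trans ?_ h2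
    rw [inv_le_iff_one_le_mul₀ (by linarith)]
    nlinarith
  calc Real.exp (-(2 * Q)) ≤ Real.exp (k * (-(2 * y))) := by
        apply Real.exp_le_exp.2; linarith
    _ = Real.exp (-(2 * y)) ^ k := Real.exp_nat_mul _ _
    _ ≤ _ := pow_le_pow_left₀ (Real.exp_pos _).le h1 k

end minorization

section minorization

variable {n q : ℕ} {β : ℝ}

/-- A set of `k` isolated vertices of `E`, empty when there are fewer than `k`. -/
noncomputable def isoSub (k : ℕ) (E : Finset (Fin n × Fin n)) : Finset (Fin n) :=
  if h : k ≤ #(iso E) then (exists_subset_card_eq h).choose else ∅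

lemma isoSub_subset (k : ℕ) (E : Finset (Fin n × Fin n)) : isoSub k E ⊆ iso E := by
  unfold isoSub
  split_ifs with h
  · exact (exists_subset_card_eq h).choose_spec.1
  · exact empty_subset _

lemma card_isoSub {k : ℕ} {E : Finset (Fin n × Fin n)} (h : k ≤ #(iso E)) : #(isoSub k E) = k := by
  unfold isoSub
  rw [dif_pos h]
  exact (exists_subset_card_eq h).choose_spec.2

/-- The percolation configuration `E` has many isolated vertices, and the colouring `ξ` is balanced
on them and produces class densities close to `kap q J a`. -/
def Good (k : ℕ) (J : Fin q) (a r R : ℝ) (E : Finset (Fin n × Fin n)) (ξ : Conf n q) : Prop :=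
  k ≤ #(iso E) ∧ ‖cntFrac (clr E ξ) - kap q J a‖ ≤ r ∧
    ∀ j, |∑ u ∈ isoSub k E, ind (ξ u = j) - (k : ℝ) / q| ≤ R

lemma good_prob [NeZero q] (hβ : 0 ≤ β) (σ : Conf n q) (J : Fin q) {a r R p₂ p₃ : ℝ} {k : ℕ}
    (hk : 0 < k) (hR : 0 < R)
    (h1 : Pop β (fun τ => ind (¬ dd τ a ≤ r)) σ ≤ 1 / 4)
    (h2 : perc (pp n β) σ univ (fun E => ind (¬ k ≤ #(iso E))) ≤ p₂)
    (h3 : q * (√(k : ℝ) / R) ≤ p₃) :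
    3 / 4 / q - p₂ - p₃ ≤
      perc (pp n β) σ univ (fun E => avg fun ξ => ind (Good k J a r R E ξ)) := by
  have hL := perc_isExp (pp_nonneg (n := n) hβ) (pp_le_one (n := n)) σ univ
  have ha := avg_isExp (Ω := Conf n q)
  have h4 := near_color_prob hβ σ (p := 3 / 4) J (h1.trans (by norm_num))
  have h5 : 3 / 4 / q - p₂ - p₃ ≤ perc (pp n β) σ univ (fun E =>
      (avg fun ξ => ind (‖cntFrac (clr E ξ) - kap q J a‖ ≤ r)) - ind (¬ k ≤ #(iso E)) - p₃) := by
    rw [hL.sub, hL.sub, hL.const]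
    have : perc (pp n β) σ univ (fun E =>
      (avg fun ξ => ind (‖cntFrac (clr E ξ) - kap q J a‖ ≤ r))) =
      Pop β (fun τ => ind (‖cntFrac τ - kap q J a‖ ≤ r)) σ := rfl
    rw [this]
    linarith
  refine h5.trans (hL.mono _ _ fun E _ => ?_)
  by_cases hE : k ≤ #(iso E)
  · have h6 := avg_count_far_le (q := q) (I := isoSub k E) (R := R)
      (card_pos.1 (by rw [card_isoSub hE]; exact hk)) hR
    rw [card_isoSub hE] at h6
    rw [ind_false (not_not.2 hE), sub_zero, sub_le_iff_le_add]
    calc _ ≤ avg (fun ξ => ind (Good k J a r R E ξ) +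
          ind (¬ ∀ j, |∑ u ∈ isoSub k E, ind (ξ u = j) - (k : ℝ) / q| ≤ R)) := by
          refine ha.mono _ _ fun ξ _ => ?_
          refine le_trans (ind_mono fun h => ?_) (ind_or_le _ _)
          by_cases h' : ∀ j, |∑ u ∈ isoSub k E, ind (ξ u = j) - (k : ℝ) / q| ≤ R
          · exact Or.inl ⟨hE, h, h'⟩
          · exact Or.inr h'
      _ ≤ _ := by
          rw [ha.add]
          linarith
  · have h6 : avg (fun ξ => ind (‖cntFrac (clr E ξ) - kap q J a‖ ≤ r)) ≤ 1 :=
      ha.le_const fun _ _ => ind_le_one _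
    have h7 : 0 ≤ avg (fun ξ => ind (Good k J a r R E ξ)) := ha.nonneg fun _ _ => ind_nonneg _
    have h8 : 0 ≤ p₃ := le_trans (by positivity) h3
    rw [ind_true hE]
    linarith

lemma Good.cntOff_near {k : ℕ} {J : Fin q} {a r R : ℝ} {E : Finset (Fin n × Fin n)} {ξ : Conf n q}
    (h : Good k J a r R E ξ) (hn : 0 < n) (j : Fin q) :
    |(cntOff (isoSub k E) (clr E ξ) j : ℝ) - (n * kap q J a j - k / q)| ≤ n * r + R := by
  have h1 := (norm_le_pi_norm _ j).trans h.2.1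
  have h2 := h.2.2 j
  rw [cntOff_eq (isoSub_subset k E)]
  have hn' : (0 : ℝ) < n := by exact_mod_cast hn
  have h3 : |(cntN (clr E ξ) j : ℝ) - n * kap q J a j| ≤ n * r := by
    have : (cntN (clr E ξ) j : ℝ) - n * kap q J a j = n * (cntFrac (clr E ξ) - kap q J a) j := by
      simp only [Pi.sub_apply, cntFrac]
      field_simp
    rw [this, abs_mul, abs_of_pos hn']
    exact mul_le_mul_of_nonneg_left h1 hn'.le
  rw [abs_le] at *
  constructor <;> linarith [h2.1, h2.2, h3.1, h3.2]

lemma resample_compare [NeZero q] {f : Conf n q → ℝ} (hf0 : ∀ τ, 0 ≤ f τ)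
    (hf : ∀ τ (φ : Equiv.Perm (Fin n)), f (τ ∘ φ) = f τ) {w : Fin q → ℝ} {D' R m y Q : ℝ}
    (hD' : 0 ≤ D') (hR : 0 ≤ R) (hm : 0 < m) {I I' : Finset (Fin n)} (hII : #I = #I')
    {τ τ' : Conf n q} (hy : 2 * (R + D') ≤ y * m) (hy2 : y ≤ 1 / 2)
    (hQ : y * (2 * q * D') ≤ Q) (hW : ∀ τ, f τ ≠ 0 → ∀ j, |(cntN τ j : ℝ) - w j| ≤ R)
    (h : ∀ j, |(cntOff I τ j : ℝ) - (w j - m)| ≤ D')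
    (h' : ∀ j, |(cntOff I' τ' j : ℝ) - (w j - m)| ≤ D') :
    Real.exp (-(2 * Q)) * avg (fun ζ : Conf n q => f (I'.piecewise ζ τ')) ≤
      avg (fun ζ : Conf n q => f (I.piecewise ζ τ)) := by
  have hy0 : 0 ≤ y := by
    by_contra hy0
    push Not at hy0
    nlinarith
  have hk : ((∑ j, (cntOff I' τ' j - cntOff I τ j) : ℕ) : ℝ) ≤ 2 * q * D' := by
    push_cast
    calc _ ≤ ∑ _j : Fin q, 2 * D' := by
          refine sum_le_sum fun j _ => ?_
          have h1 := abs_le.1 (h j)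
          have h2 := abs_le.1 (h' j)
          rcases le_total (cntOff I τ j) (cntOff I' τ' j) with h3 | h3
          · rw [Nat.cast_sub h3]; linarith
          · rw [Nat.sub_eq_zero_of_le h3]; simpa using hD'
      _ = _ := by simp; ring
  refine le_trans (mul_le_mul_of_nonneg_right (exp_neg_le_pow hy0 hy2 _
    ((mul_le_mul_of_nonneg_left hk hy0).trans hQ)) ?_)
    (harnack hf0 hf (x := 1 - y) hW hII (by linarith) (by linarith) ?_ h' _ τ h rfl)
  · exact (avg_isExp (Ω := Conf n q)).nonneg fun _ _ => hf0 _
  · nlinarith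

/-- Two starting points whose one-step law is `Good` with probability at least `p₀` have
overlapping one-step laws of the class counts. -/
lemma Pop_overlap [NeZero q] (hn : 0 < n) (hβ : 0 ≤ β) {X Y : Conf n q} {J : Fin q}
    {a r R y Q p₀ : ℝ} {k : ℕ} (hk : 0 < k) (hr : 0 ≤ r) (hR : 0 < R)
    (hkR : q * (√(k : ℝ) / R) ≤ 1 / 2)
    (hy : 2 * (2 * (n * r) + 3 * R) ≤ y * (k / q)) (hy2 : y ≤ 1 / 2)
    (hQ : y * (2 * q * (n * r + R)) ≤ Q) (hp₀ : 0 < p₀)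
    (hX : p₀ ≤ perc (pp n β) X univ (fun E => avg fun ξ => ind (Good k J a r R E ξ)))
    (hY : p₀ ≤ perc (pp n β) Y univ (fun E => avg fun ξ => ind (Good k J a r R E ξ)))
    {h₁ h₂ : Conf n q → ℝ} (hh₁ : ∀ τ, 0 ≤ h₁ τ) (hh₂ : ∀ τ, 0 ≤ h₂ τ)
    (hs₁ : ∀ τ (φ : Equiv.Perm (Fin n)), h₁ (τ ∘ φ) = h₁ τ)
    (hs₂ : ∀ τ (φ : Equiv.Perm (Fin n)), h₂ (τ ∘ φ) = h₂ τ)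
    {b : ℝ} (hb : 0 ≤ b) (hh : ∀ τ, b ≤ h₁ τ + h₂ τ) :
    Real.exp (-(2 * Q)) * (p₀ / 2) * b ≤ Pop β h₁ X + Pop β h₂ Y := by
  have hn' : (0 : ℝ) < n := by exact_mod_cast hn
  have hq : (0 : ℝ) < q := by exact_mod_cast NeZero.pos q
  have hk' : (0 : ℝ) < k := by exact_mod_cast hk
  have hnr : 0 ≤ n * r := by positivity
  have hL := perc_isExp (pp_nonneg (n := n) hβ) (pp_le_one (n := n)) X univ
  have ha := avg_isExp (Ω := Conf n q)
  obtain ⟨E₀, ξ₀, hG₀⟩ : ∃ E ξ, Good (n := n) k J a r R E ξ := by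
    by_contra! hcon
    have : (fun E => avg fun ξ => ind (Good (n := n) k J a r R E ξ)) = fun _ => 0 := by
      funext E
      rw [show (fun ξ => ind (Good (n := n) k J a r R E ξ)) = fun _ => 0 from
        funext fun ξ => ind_false (hcon E ξ), ha.const]
    rw [this, hL.const] at hX
    linarith
  set I₀ := isoSub k E₀ with hI₀
  set τ₀ := clr E₀ ξ₀ with hτ₀
  have hc₀ : #I₀ = k := card_isoSub hG₀.1
  have hI₀n : I₀.Nonempty := card_pos.1 (by rw [hc₀]; exact hk)
  have hnear₀ := hG₀.cntOff_near hn
  let W : Conf n q → Prop := fun τ => ∀ j, |(cntN τ j : ℝ) - n * kap q J a j| ≤ n * r + 2 * R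
  have hWs : ∀ τ (φ : Equiv.Perm (Fin n)), W (τ ∘ φ) ↔ W τ := by
    intro τ φ
    have : ∀ j, cntN (τ ∘ φ) j = cntN τ j := by
      intro j
      unfold cntN
      exact card_bij (fun u _ => φ u) (by simp) (fun _ _ _ _ h => φ.injective h)
        (fun u hu => ⟨φ.symm u, by simpa using hu, by simp⟩)
    simp only [W, this]
  let A : (Conf n q → ℝ) → ℝ := fun h => avg fun ζ : Conf n q =>
    h (I₀.piecewise ζ τ₀) * ind (W (I₀.piecewise ζ τ₀))
  have key : ∀ (Z : Conf n q) (h : Conf n q → ℝ), (∀ τ, 0 ≤ h τ) →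
      (∀ τ (φ : Equiv.Perm (Fin n)), h (τ ∘ φ) = h τ) →
      p₀ ≤ perc (pp n β) Z univ (fun E => avg fun ξ => ind (Good k J a r R E ξ)) →
      p₀ * (Real.exp (-(2 * Q)) * A h) ≤ Pop β h Z := by
    intro Z h h0 hs hZ
    have hA : 0 ≤ A h := ha.nonneg fun _ _ => mul_nonneg (h0 _) (ind_nonneg _)
    refine le_trans (mul_le_mul_of_nonneg_right hZ (by positivity))
      (Pop_ge_of_resample hβ h0 Z (isoSub k) (isoSub_subset k) _ fun E ξ hG => ?_)
    refine (resample_compare (f := fun τ => h τ * ind (W τ)) (w := fun j => n * kap q J a j)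
      (D' := n * r + R) (R := n * r + 2 * R) (m := k / q) (y := y) (Q := Q) (I := isoSub k E)
      (τ := clr E ξ) (fun τ => mul_nonneg (h0 τ) (ind_nonneg _)) ?_ (by positivity)
      (by positivity) (by positivity) ?_ (by linarith) hy2 hQ ?_ (hG.cntOff_near hn)
      hnear₀).trans ?_
    · intro τ φ
      simp only [hs, hWs]
    · rw [card_isoSub hG.1, hc₀]
    · intro τ hτ
      by_contra hW
      exact hτ (show h τ * ind (W τ) = 0 by rw [ind_false hW, mul_zero])
    · refine ha.mono _ _ fun ζ _ => ?_
      exact mul_le_of_le_one_right (h0 _) (ind_le_one _)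
  have hA1 : b / 2 ≤ A h₁ + A h₂ := by
    have h1 : b * (1 - q * (√(#I₀) / R)) ≤ A h₁ + A h₂ := by
      have h2 := avg_count_far_le (q := q) hI₀n hR
      calc _ ≤ avg (fun ζ : Conf n q =>
            b * (1 - ind (¬ ∀ j, |∑ u ∈ I₀, ind (ζ u = j) - #I₀ / q| ≤ R))) := by
            rw [ha.smul, ha.sub, ha.const]
            refine mul_le_mul_of_nonneg_left ?_ hb
            linarith
        _ ≤ _ := by
            simp only [A]
            rw [← ha.add]
            refine ha.mono _ _ fun ζ _ => ?_
            by_cases hζ : ∀ j, |∑ u ∈ I₀, ind (ζ u = j) - (#I₀ : ℝ) / q| ≤ R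
            · have hW : W (I₀.piecewise ζ τ₀) := by
                intro j
                rw [cntN_piecewise]
                have h3 := abs_le.1 (hζ j)
                have h4 := abs_le.1 (hnear₀ j)
                rw [hc₀] at h3
                rw [abs_le]
                constructor <;> linarith [h3.1, h3.2, h4.1, h4.2]
              rw [ind_true hW, ind_false (not_not.2 hζ)]
              linarith [hh (I₀.piecewise ζ τ₀)]
            · rw [ind_true hζ, sub_self, mul_zero]
              exact add_nonneg (mul_nonneg (hh₁ _) (ind_nonneg _))
                (mul_nonneg (hh₂ _) (ind_nonneg _))
    rw [hc₀] at h1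
    nlinarith
  have h1 := key X h₁ hh₁ hs₁ hX
  have h2 := key Y h₂ hh₂ hs₂ hY
  have h3 : p₀ * Real.exp (-(2 * Q)) * (b / 2) ≤ p₀ * Real.exp (-(2 * Q)) * (A h₁ + A h₂) :=
    mul_le_mul_of_nonneg_left hA1 (by positivity)
  linarith

theorem minorization {a ρ ρ' δ K c₀ η K' : ℝ} (hq : 2 ≤ q) (hβ : 0 < β)
    (hD : Drift q β a ρ ρ' δ K c₀) (hY : Dyn q β a ρ ρ' η K') {R : ℝ} (hR : 0 < R) :
    ∃ κ : ℝ, 0 < κ ∧ κ ≤ 1 ∧ ∃ N : ℕ, ∀ n ≥ N, ∀ X Y : Conf n q,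
      dd X a ≤ η → dd Y a ≤ η → dd X a ≤ R / √n → dd Y a ≤ R / √n →
      ∀ h₁ h₂ : Conf n q → ℝ, (∀ τ, 0 ≤ h₁ τ) → (∀ τ, 0 ≤ h₂ τ) →
      (∀ τ (φ : Equiv.Perm (Fin n)), h₁ (τ ∘ φ) = h₁ τ) →
      (∀ τ (φ : Equiv.Perm (Fin n)), h₂ (τ ∘ φ) = h₂ τ) →
      ∀ b : ℝ, 0 ≤ b → (∀ τ, b ≤ h₁ τ + h₂ τ) → κ * b ≤ Pop β h₁ X + Pop β h₂ Y := by
  have : NeZero q := ⟨by omega⟩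
  have hq' : (2 : ℝ) ≤ q := by exact_mod_cast hq
  have hq0 : (0 : ℝ) < q := by linarith
  have hK' := hY.K_pos
  obtain ⟨K₁, hK₁, hiso⟩ := iso_few (q := q) hβ.le
  obtain ⟨R₁, hR₁⟩ : ∃ R₁, R₁ = 4 * (R + K') := ⟨_, rfl⟩
  obtain ⟨R₂, hR₂⟩ : ∃ R₂ : ℝ, R₂ = 8 * q ^ 2 := ⟨_, rfl⟩
  have hR₁0 : 0 < R₁ := by rw [hR₁]; positivity
  have hR₂0 : 0 < R₂ := by rw [hR₂]; positivity
  obtain ⟨e, he⟩ : ∃ e, e = Real.exp (-β) := ⟨_, rfl⟩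
  have he0 : 0 < e := he ▸ Real.exp_pos _
  have he1 : e ≤ 1 := by rw [he]; exact Real.exp_le_one_iff.2 (by linarith)
  obtain ⟨Q, hQ⟩ : ∃ Q, Q = 2 * (2 * R₁ + 3 * R₂) * (2 * q) / e * (2 * q * (R₁ + R₂)) := ⟨_, rfl⟩
  have hQ0 : 0 ≤ Q := by rw [hQ]; positivity
  obtain ⟨N₁, hN₁⟩ := exists_forall_div_le (2 * (2 * R₁ + 3 * R₂) * (2 * q) / e) 0
    (ε := 1 / 2) (by norm_num)
  obtain ⟨N₂, hN₂⟩ := exists_forall_div_le 0 K₁ (ε := 1 / (8 * q)) (by positivity)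
  refine ⟨Real.exp (-(2 * Q)) * (1 / (2 * q) / 2), by positivity, ?_, max 1 (max N₁ N₂), ?_⟩
  · refine mul_le_one₀ (Real.exp_le_one_iff.2 (by linarith)) (by positivity) ?_
    rw [div_div, div_le_one (by positivity)]
    linarith
  intro n hn X Y hXη hYη hXR hYR h₁ h₂ hh₁ hh₂ hs₁ hs₂ b hb hh
  have hn1 : 1 ≤ n := (le_max_left _ _).trans hn
  have hn' : (0 : ℝ) < n := by exact_mod_cast hn1
  have hs0 : 0 < √(n : ℝ) := Real.sqrt_pos.2 hn'
  have hss : √(n : ℝ) * √n = n := Real.mul_self_sqrt hn'.le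
  have hy2 := hN₁ n ((le_max_left _ _).trans ((le_max_right _ _).trans hn))
  have hK2 := hN₂ n ((le_max_right _ _).trans ((le_max_right _ _).trans hn))
  rw [zero_div, add_zero] at hy2
  rw [zero_div, zero_add] at hK2
  obtain ⟨k, hk⟩ : ∃ k, k = ⌈e / 2 * (n : ℝ)⌉₊ := ⟨_, rfl⟩
  have hk0 : 0 < k := by rw [hk, Nat.ceil_pos]; positivity
  have hkn : k ≤ n := by
    rw [hk, Nat.ceil_le]
    nlinarith
  have hkn' : (k : ℝ) ≤ n := by exact_mod_cast hkn
  have hkl : e / 2 * n ≤ k := by rw [hk]; exact Nat.le_ceil _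
  have hnr : (n : ℝ) * (R₁ / √n) = R₁ * √n := by
    calc _ = √(n : ℝ) * √n * (R₁ / √n) := by rw [hss]
      _ = _ := by field_simp
  have hkR : q * (√(k : ℝ) / (R₂ * √n)) ≤ 1 / (8 * q) := by
    have h1 : √(k : ℝ) / (R₂ * √n) ≤ 1 / R₂ := by
      rw [div_le_div_iff₀ (by positivity) hR₂0]
      nlinarith [Real.sqrt_le_sqrt hkn']
    calc _ ≤ q * (1 / R₂) := mul_le_mul_of_nonneg_left h1 hq0.le
      _ = _ := by rw [hR₂]; field_simp
  have hgood : ∀ Z : Conf n q, dd Z a ≤ η → dd Z a ≤ R / √n →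
      1 / (2 * (q : ℝ)) ≤ perc (pp n β) Z univ
        (fun E => avg fun ξ => ind (Good k (0 : Fin q) a (R₁ / √n) (R₂ * √n) E ξ)) := by
    intro Z hZη hZR
    refine le_trans ?_ (good_prob hβ.le Z 0 (p₂ := 1 / (8 * q)) hk0 (by positivity) ?_ ?_ hkR)
    · refine le_of_eq ?_
      field_simp
      norm_num
    · have h1 := hY.step n Z a hn1 ⟨by linarith [hY.η_pos], hD.a_lt.le⟩ hZη
      rw [hD.fix] at h1
      have hP := Pop_isExp (n := n) (q := q) hβ.le Z
      have h2 : Pop β (fun τ => ind (¬ dd τ a ≤ R₁ / √n)) Z ≤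
          Pop β (fun τ => ind (R₁ / √n ≤ dd τ a)) Z :=
        hP.mono _ _ fun τ _ => ind_mono fun h => (not_le.1 h).le
      refine h2.trans ((hP.markov (fun τ _ => dd_nonneg τ a) (by positivity)).trans ?_)
      rw [div_le_iff₀ (by positivity)]
      have h3 : ρ' * dd Z a ≤ R / √n :=
        (mul_le_of_le_one_left (dd_nonneg Z a) hD.ρ'_lt.le).trans hZR
      calc _ ≤ R / √n + K' / √n := by linarith
        _ = _ := by rw [hR₁]; ring
    · have h1 := hiso n Z univ ⟨⟨0, hn1⟩, mem_univ _⟩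
      rw [card_univ, Fintype.card_fin] at h1
      refine le_trans ?_ (h1.trans hK2)
      refine (perc_isExp (pp_nonneg (n := n) hβ.le) (pp_le_one (n := n)) Z univ).mono _ _
        fun E _ => ind_mono fun h => ?_
      rw [univ_inter, ← he]
      rw [hk, not_le, Nat.lt_ceil] at h
      exact h
  have hqq : 1 / (8 * (q : ℝ)) ≤ 1 / 2 := by
    rw [div_le_div_iff₀ (by positivity) (by norm_num)]; linarith
  refine Pop_overlap (r := R₁ / √n) (R := R₂ * √n)
    (y := 2 * (2 * R₁ + 3 * R₂) * (2 * q) / e / √n) hn1 hβ.le hk0 (by positivity) (by positivity)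
    (hkR.trans hqq) ?_ hy2 ?_ (by positivity) (hgood X hXη hXR) (hgood Y hYη hYR)
    hh₁ hh₂ hs₁ hs₂ hb hh
  · rw [hnr]
    calc 2 * (2 * (R₁ * √n) + 3 * (R₂ * √n)) = 2 * (2 * R₁ + 3 * R₂) * (2 * q) / e / √n *
          (e / 2 * (√(n : ℝ) * √n) / q) := by field_simp
      _ = 2 * (2 * R₁ + 3 * R₂) * (2 * q) / e / √n * (e / 2 * n / q) := by rw [hss]
      _ ≤ _ := by gcongr
  · rw [hnr, hQ]
    refine le_of_eq ?_
    field_simp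

end minorization

/-! ### Contraction of symmetric observables -/

section harris

variable {n q : ℕ} {a ρ ρ' δ K c₀ η K' β : ℝ}

/-- The function `f` only depends on the class counts. -/
def Symm (f : Conf n q → ℝ) : Prop := ∀ τ (φ : Equiv.Perm (Fin n)), f (τ ∘ φ) = f τ

lemma cntN_comp (τ : Conf n q) (φ : Equiv.Perm (Fin n)) (j : Fin q) :
    cntN (τ ∘ φ) j = cntN τ j := by
  unfold cntN
  exact card_bij (fun u _ => φ u) (by simp) (fun _ _ _ _ h => φ.injective h)
    (fun u hu => ⟨φ.symm u, by simpa using hu, by simp⟩)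

lemma Symm.dd (y : ℝ) : Symm (fun τ : Conf n q => dd τ y) := by
  intro τ φ
  have : cntFrac (τ ∘ φ) = cntFrac τ := funext fun j => by simp only [cntFrac, cntN_comp]
  simp only [SW.dd, this]

lemma Symm.Pop [NeZero q] {f : Conf n q → ℝ} (hf : Symm f) : Symm (Pop β f) := by
  intro τ φ
  rw [Pop_comp]
  exact congrArg (fun g => SW.Pop β g τ) (funext fun ζ => hf ζ φ)

/-- The Lyapunov function. -/
noncomputable def lyap (a η : ℝ) (σ : Conf n q) : ℝ := if dd σ a ≤ η then √n * dd σ a else n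

lemma lyap_nonneg (a η : ℝ) (σ : Conf n q) : 0 ≤ lyap a η σ := by
  unfold lyap
  split_ifs
  · exact mul_nonneg (Real.sqrt_nonneg _) (dd_nonneg σ a)
  · positivity

lemma Symm.lyap (a η : ℝ) : Symm (lyap (n := n) (q := q) a η) := by
  intro τ φ
  have : SW.dd (τ ∘ φ) a = SW.dd τ a := Symm.dd a τ φ
  simp only [SW.lyap, this]

lemma lyap_drift [NeZero q] (hβ : 0 < β) (hD : Drift q β a ρ ρ' δ K c₀) (hY : Dyn q β a ρ ρ' η K')
    (hn : 1 ≤ n) {σ : Conf n q} (hσ : SW.dd σ a ≤ η) :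
    Pop β (lyap a η) σ ≤ ρ' * lyap a η σ + 2 * K' := by
  have hP := Pop_isExp (n := n) (q := q) hβ.le σ
  have hn' : (0 : ℝ) < n := by exact_mod_cast hn
  have hs0 : 0 < √(n : ℝ) := Real.sqrt_pos.2 hn'
  have hy : a ∈ Set.Icc (a - η) 1 := ⟨by linarith [hY.η_pos], hD.a_lt.le⟩
  have h1 := hY.step n σ a hn hy hσ
  have h2 := hY.exit n σ a hn hy hσ
  rw [hD.fix] at h1 h2
  calc _ ≤ Pop β (fun τ => √n * dd τ a + n * ind (η < dd τ a)) σ := by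
        refine hP.mono _ _ fun τ _ => ?_
        unfold lyap
        split_ifs with h
        · rw [ind_false (not_lt.2 h)]; simp
        · rw [ind_true (not_le.1 h)]
          have := mul_nonneg hs0.le (dd_nonneg τ a)
          linarith
    _ = √n * Pop β (fun τ => dd τ a) σ + n * Pop β (fun τ => ind (η < dd τ a)) σ := by
        rw [hP.add, hP.smul, hP.smul]
    _ ≤ √n * (ρ' * dd σ a + K' / √n) + n * (K' / n) := by gcongr
    _ = ρ' * (√n * dd σ a) + 2 * K' := by field_simp; ring
    _ = _ := by rw [lyap, if_pos hσ]

/-- One step of the weighted contraction. -/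
theorem contraction (hq : 2 ≤ q) (hβ : 0 < β) (hD : Drift q β a ρ ρ' δ K c₀)
    (hY : Dyn q β a ρ ρ' η K') :
    ∃ α γ : ℝ, 0 < α ∧ α < 1 ∧ 0 < γ ∧ ∀ b₀ > 0, ∃ N : ℕ, ∀ n ≥ N, ∀ b ≥ b₀,
      ∀ g : Conf n q → ℝ, Symm g → (∀ X Y, g X - g Y ≤ 2) →
      (∀ X Y, g X - g Y ≤ b * (2 + γ * lyap a η X + γ * lyap a η Y)) →
      ∀ X Y, Pop β g X - Pop β g Y ≤ α * b * (2 + γ * lyap a η X + γ * lyap a η Y) := by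
  have : NeZero q := ⟨by omega⟩
  obtain ⟨s, hs⟩ : ∃ s, s = 1 - ρ' := ⟨_, rfl⟩
  have hs0 : 0 < s := by rw [hs]; linarith [hD.ρ'_lt]
  have hK' := hY.K_pos
  have hρ' := (hD.ρ'_nonneg hq).2
  obtain ⟨R, hR⟩ : ∃ R, R = 16 * K' / s := ⟨_, rfl⟩
  have hR0 : 0 < R := by rw [hR]; positivity
  have hRs : R * s = 16 * K' := by rw [hR]; field_simp
  obtain ⟨κ, hκ0, hκ1, N, hmin⟩ := minorization hq hβ hD hY hR0
  obtain ⟨γ, hγ⟩ : ∃ γ, γ = κ / (4 * K') := ⟨_, rfl⟩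
  have hγ0 : 0 < γ := by rw [hγ]; positivity
  have hγK : γ * (4 * K') = κ := by rw [hγ]; field_simp
  obtain ⟨ω, hω⟩ : ∃ ω, ω = min (min (1 / 2) (κ / 2)) (min (s / 4) (s * (γ * R) / (4 * (2 + γ * R)))) :=
    ⟨_, rfl⟩
  have hω0 : 0 < ω := by rw [hω]; positivity
  have hω1 : ω ≤ 1 / 2 := by rw [hω]; exact (min_le_left _ _).trans (min_le_left _ _)
  have hω2 : ω ≤ κ / 2 := by rw [hω]; exact (min_le_left _ _).trans (min_le_right _ _)
  have hω3 : ω ≤ s / 4 := by rw [hω]; exact (min_le_right _ _).trans (min_le_left _ _)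
  have hω4 : ω * (4 * (2 + γ * R)) ≤ s * (γ * R) := by
    rw [← le_div_iff₀ (by positivity), hω]
    exact (min_le_right _ _).trans (min_le_right _ _)
  refine ⟨1 - ω, γ, by linarith, by linarith, hγ0, fun b₀ hb₀ => ?_⟩
  refine ⟨max 1 (max N ⌈4 / (b₀ * γ)⌉₊), fun n hn b hb g hg hosc hgb X Y => ?_⟩
  have hn1 : 1 ≤ n := (le_max_left _ _).trans hn
  have hnN : N ≤ n := (le_max_left _ _).trans ((le_max_right _ _).trans hn)
  have hn4 : 4 / (b₀ * γ) ≤ n :=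
    Nat.ceil_le.1 ((le_max_right _ _).trans ((le_max_right _ _).trans hn))
  have hn' : (0 : ℝ) < n := by exact_mod_cast hn1
  have hs0' : 0 < √(n : ℝ) := Real.sqrt_pos.2 hn'
  have hb0 : 0 < b := hb₀.trans_le hb
  have hPX := Pop_isExp (n := n) (q := q) hβ.le X
  have hPY := Pop_isExp (n := n) (q := q) hβ.le Y
  have hVX := lyap_nonneg a η X
  have hVY := lyap_nonneg a η Y
  by_cases hU : dd X a ≤ η ∧ dd Y a ≤ η
  · have hdX := lyap_drift hβ hD hY hn1 hU.1
    have hdY := lyap_drift hβ hD hY hn1 hU.2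
    obtain ⟨S, hS⟩ : ∃ S, S = lyap a η X + lyap a η Y := ⟨_, rfl⟩
    have hS0 : 0 ≤ S := by rw [hS]; positivity
    have hsum : Pop β (lyap a η) X + Pop β (lyap a η) Y ≤ (1 - s) * S + 4 * K' := by
      rw [hS, hs]; linarith
    suffices h : Pop β g X - Pop β g Y ≤ (1 - ω) * b * (2 + γ * S) by
      rw [hS] at h; linarith
    by_cases hSR : S ≤ R
    · obtain ⟨Y₀, hY₀⟩ := Finite.exists_min (fun τ : Conf n q => g τ + b * γ * lyap a η τ)
      have hl : ∀ (τ : Conf n q) (φ : Equiv.Perm (Fin n)), lyap a η (τ ∘ φ) = lyap a η τ :=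
        Symm.lyap a η
      have hlX : lyap a η X = √n * dd X a := by rw [lyap, if_pos hU.1]
      have hlY : lyap a η Y = √n * dd Y a := by rw [lyap, if_pos hU.2]
      have hXR : dd X a ≤ R / √n := by
        rw [le_div_iff₀ hs0']; linarith
      have hYR : dd Y a ≤ R / √n := by
        rw [le_div_iff₀ hs0']; linarith
      have h1 := hmin n hnN X Y hU.1 hU.2 hXR hYR
        (fun τ => (g Y₀ + b * γ * lyap a η Y₀ + 2 * b) - (g τ - b * γ * lyap a η τ))
        (fun τ => (g τ + b * γ * lyap a η τ) - (g Y₀ + b * γ * lyap a η Y₀))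
        (fun τ => by linarith [hgb τ Y₀]) (fun τ => sub_nonneg.2 (hY₀ τ))
        (fun τ φ => by rw [hg τ φ, hl τ φ]) (fun τ φ => by rw [hg τ φ, hl τ φ])
        (2 * b) (by positivity)
        (fun τ => by nlinarith [mul_nonneg (mul_pos hb0 hγ0).le (lyap_nonneg a η τ)])
      rw [hPX.sub, hPX.const, hPX.sub, hPX.smul, hPY.sub, hPY.const, hPY.add, hPY.smul] at h1
      have h2 : b * γ * (Pop β (lyap a η) X + Pop β (lyap a η) Y) ≤
          b * γ * ((1 - s) * S + 4 * K') := mul_le_mul_of_nonneg_left hsum (by positivity)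
      have h3 : b * γ * ((1 - s) * S + 4 * K') = b * (γ * S) * (1 - s) + b * κ := by
        rw [← hγK]; ring
      have h4 : b * (γ * S) * (1 - s) ≤ b * (γ * S) * (1 - ω) :=
        mul_le_mul_of_nonneg_left (by linarith) (by positivity)
      have h5 : b * ω ≤ b * (κ / 2) := mul_le_mul_of_nonneg_left hω2 hb0.le
      have e1 : Pop β (fun x => lyap a η x) X = Pop β (lyap a η) X := rfl
      have e2 : Pop β (fun x => lyap a η x) Y = Pop β (lyap a η) Y := rfl
      linarith
    · push Not at hSR
      have h0 : ∀ Y', Pop β g X - g Y' ≤ b * (2 + γ * Pop β (lyap a η) X + γ * lyap a η Y') := by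
        intro Y'
        have h1 := hPX.mono (fun τ => g τ - g Y') (fun τ => b * (2 + γ * lyap a η τ + γ * lyap a η Y'))
          fun τ _ => hgb τ Y'
        rw [hPX.sub, hPX.const, hPX.smul, hPX.add_const, hPX.add, hPX.const, hPX.smul] at h1
        exact h1
      have h1 := hPY.mono (fun τ => Pop β g X - g τ)
        (fun τ => b * (2 + γ * Pop β (lyap a η) X + γ * lyap a η τ)) fun τ _ => h0 τ
      rw [hPY.sub, hPY.const, hPY.smul, hPY.add, hPY.const, hPY.smul] at h1
      have e2 : Pop β (fun x => lyap a η x) Y = Pop β (lyap a η) Y := rfl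
      have h2 : b * γ * (Pop β (lyap a η) X + Pop β (lyap a η) Y) ≤
          b * γ * ((1 - s) * S + 4 * K') := mul_le_mul_of_nonneg_left hsum (by positivity)
      have h3 : b * (2 + γ * ((1 - s) * S + 4 * K')) ≤ b * ((1 - ω) * (2 + γ * S)) := by
        refine mul_le_mul_of_nonneg_left ?_ hb0.le
        have h4 : ω * (γ * (S - R)) ≤ s / 4 * (γ * (S - R)) :=
          mul_le_mul_of_nonneg_right hω3 (mul_nonneg hγ0.le (by linarith))
        have h5 : γ * (s * R) ≤ γ * (s * S) :=
          mul_le_mul_of_nonneg_left (mul_le_mul_of_nonneg_left hSR.le hs0.le) hγ0.le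
        have h6 : γ * (R * s) = γ * (16 * K') := by rw [hRs]
        linarith
      rw [e2] at h1
      linarith
  · have h1 : Pop β g X - Pop β g Y ≤ 2 := by
      have h2 : ∀ Y', Pop β g X - g Y' ≤ 2 := fun Y' => by
        have := hPX.mono (fun τ => g τ) (fun _ => 2 + g Y') fun τ _ => by linarith [hosc τ Y']
        rw [hPX.const] at this
        linarith
      have := hPY.mono (fun _ => Pop β g X) (fun τ => 2 + g τ) fun τ _ => by linarith [h2 τ]
      rw [hPY.const, hPY.add, hPY.const] at this
      linarith
    have h2 : (n : ℝ) ≤ lyap a η X + lyap a η Y := by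
      rw [not_and_or] at hU
      rcases hU with h | h
      · have : lyap a η X = n := by rw [lyap, if_neg h]
        linarith
      · have : lyap a η Y = n := by rw [lyap, if_neg h]
        linarith
    rw [div_le_iff₀ (by positivity)] at hn4
    have h3 : (n : ℝ) * (b₀ * γ) ≤ (lyap a η X + lyap a η Y) * (b * γ) :=
      mul_le_mul h2 (mul_le_mul_of_nonneg_right hb hγ0.le) (by positivity) (by positivity)
    have h4 : 1 / 2 * (b * (2 + γ * lyap a η X + γ * lyap a η Y)) ≤
        (1 - ω) * (b * (2 + γ * lyap a η X + γ * lyap a η Y)) :=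
      mul_le_mul_of_nonneg_right (by linarith) (by positivity)
    linarith

theorem harris (hq : 2 ≤ q) (hβ : 0 < β) (hD : Drift q β a ρ ρ' δ K c₀)
    (hY : Dyn q β a ρ ρ' η K') :
    ∃ α γ : ℝ, 0 < α ∧ α < 1 ∧ 0 < γ ∧ ∀ t : ℕ, ∃ N : ℕ, ∀ n ≥ N,
      ∀ f : Conf n q → ℝ, Symm f → (∀ τ, |f τ| ≤ 1) → ∀ X Y,
      (Pop β)^[t] f X - (Pop β)^[t] f Y ≤ α ^ t * (2 + γ * lyap a η X + γ * lyap a η Y) := by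
  have : NeZero q := ⟨by omega⟩
  obtain ⟨α, γ, hα0, hα1, hγ, H⟩ := contraction hq hβ hD hY
  refine ⟨α, γ, hα0, hα1, hγ, fun t => ?_⟩
  obtain ⟨N, hN⟩ := H (α ^ t) (by positivity)
  refine ⟨N, fun n hn f hf hf1 => ?_⟩
  have hosc : ∀ (s : ℕ) (X Y : Conf n q), (Pop β)^[s] f X - (Pop β)^[s] f Y ≤ 2 := by
    intro s X Y
    have h1 := (Pop_iterate_isExp hβ.le s X).le_const (f := f) (c := 1)
      fun τ _ => (abs_le.1 (hf1 τ)).2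
    have h2 := (Pop_iterate_isExp hβ.le s Y).const_le (f := f) (c := -1)
      fun τ _ => (abs_le.1 (hf1 τ)).1
    linarith
  have hsym : ∀ s : ℕ, Symm ((Pop β)^[s] f) := by
    intro s
    induction s with
    | zero => exact hf
    | succ s ih => rw [Function.iterate_succ_apply']; exact ih.Pop
  have main : ∀ s ≤ t, ∀ X Y, (Pop β)^[s] f X - (Pop β)^[s] f Y ≤
      α ^ s * (2 + γ * lyap a η X + γ * lyap a η Y) := by
    intro s
    induction s with
    | zero =>
      intro _ X Y
      have h1 := mul_nonneg hγ.le (lyap_nonneg a η X)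
      have h2 := mul_nonneg hγ.le (lyap_nonneg a η Y)
      have := hosc 0 X Y
      rw [pow_zero, one_mul]
      linarith
    | succ s ih =>
      intro hs X Y
      rw [Function.iterate_succ_apply', pow_succ']
      exact hN n hn (α ^ s) (pow_le_pow_of_le_one hα0.le hα1.le (by omega)) _ (hsym s) (hosc s)
        (ih (by omega)) X Y
  exact main t le_rfl

end harris

section symmetric

variable {n q : ℕ} {a ρ ρ' δ K c₀ η K' β e c : ℝ}

/-- Two averages of a function of small oscillation on a set carrying most of both averages. -/
lemma IsExp.sub_le_of_osc {Ω : Type*} {L₁ L₂ : (Ω → ℝ) → ℝ} (h₁ : IsExp Set.univ L₁)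
    (h₂ : IsExp Set.univ L₂) {f : Ω → ℝ} {B : Ω → Prop} {ε p : ℝ} (hε : 0 ≤ ε)
    (hf : ∀ x, |f x| ≤ 1) (hB : ∀ x y, B x → B y → f x - f y ≤ ε)
    (hp₁ : L₁ (fun x => ind (¬ B x)) ≤ p) (hp₂ : L₂ (fun x => ind (¬ B x)) ≤ p) :
    L₁ f - L₂ f ≤ ε + 4 * p := by
  have h0 : ∀ x y, f x ≤ f y + ε + 2 * ind (¬ B x) + 2 * ind (¬ B y) := by
    intro x y
    have hx := _root_.abs_le.1 (hf x)
    have hy := _root_.abs_le.1 (hf y)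
    have ix := ind_nonneg (¬ B x)
    have iy := ind_nonneg (¬ B y)
    by_cases h : B x
    · by_cases h' : B y
      · linarith [hB x y h h']
      · rw [ind_true h']; linarith
    · rw [ind_true h]; linarith
  have h3 : ∀ y, L₁ f ≤ f y + (ε + 2 * p) + 2 * ind (¬ B y) := by
    intro y
    have := h₁.mono _ _ fun x _ => h0 x y
    rw [h₁.add_const, h₁.add, h₁.const, h₁.smul] at this
    linarith
  have := h₂.mono (fun _ => L₁ f) _ fun y _ => h3 y
  rw [h₂.const, h₂.add, h₂.add_const, h₂.smul] at this
  linarith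

lemma Pop_iterate_add (s t : ℕ) (f : Conf n q → ℝ) :
    (Pop β)^[s + t] f = (Pop β)^[s] ((Pop β)^[t] f) := by
  rw [Function.iterate_add_apply]

lemma abs_Pop_iterate_le [NeZero q] (hβ : 0 ≤ β) {f : Conf n q → ℝ} (hf : ∀ τ, |f τ| ≤ 1) (t : ℕ)
    (τ : Conf n q) : |(Pop β)^[t] f τ| ≤ 1 := by
  have h := Pop_iterate_isExp (n := n) (q := q) hβ t τ
  exact abs_le.2 ⟨h.const_le fun τ _ => (abs_le.1 (hf τ)).1, h.le_const fun τ _ => (abs_le.1 (hf τ)).2⟩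

/-- Concentration at the fluctuation scale, from states near equilibrium. -/
lemma concentration (hq : 2 ≤ q) (hβ : 0 < β) (hD : Drift q β a ρ ρ' δ K c₀)
    (hY : Dyn q β a ρ ρ' η K') (hηδ : 2 * η ≤ δ) {ε : ℝ} (hε : 0 < ε) :
    ∃ R : ℝ, 0 < R ∧ ∀ n s : ℕ, 1 ≤ n → ρ ^ s ≤ 1 / √n → (s + 1 : ℝ) ≤ √n →
      ∀ X : Conf n q, dd X a ≤ η →
      (Pop β)^[s + 1] (fun τ => ind (¬ dd τ a ≤ R / √n)) X ≤ ε := by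
  have : NeZero q := ⟨by omega⟩
  obtain ⟨K₂, hK₂, hconv⟩ := hY.converge hq hβ hD hηδ
  refine ⟨3 * K₂ / ε, by positivity, fun n s hn1 hs1 hs2 X hX => ?_⟩
  have hn' : (0 : ℝ) < n := by exact_mod_cast hn1
  have hs0 : 0 < √(n : ℝ) := Real.sqrt_pos.2 hn'
  have hss : √(n : ℝ) * √n = n := Real.mul_self_sqrt hn'.le
  have hP := Pop_iterate_isExp (n := n) (q := q) hβ.le (s + 1) X
  refine (hP.mono _ (fun τ => ind (3 * K₂ / ε / √n ≤ dd τ a)) fun τ _ =>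
    ind_mono fun h => (not_le.1 h).le).trans ?_
  refine (hP.markov (fun τ _ => dd_nonneg τ a) (by positivity)).trans ?_
  rw [div_le_iff₀ (by positivity)]
  refine (hconv n s X hn1 hX).trans ?_
  calc _ ≤ K₂ * (1 / √n) + K₂ / √n + √n * (K₂ / n) := by gcongr
    _ = K₂ * (1 / √n) + K₂ / √n + √n * (K₂ / (√n * √n)) := by rw [hss]
    _ = ε * (3 * K₂ / ε / √n) := by field_simp; ring

/-- Symmetric observables forget their starting point after the time needed by the drift to come
within the fluctuation scale of the fixed point, plus a bounded number of steps. -/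
theorem symm_mixing (hq : 2 ≤ q) (hβ : (q : ℝ) < β) (hC : Consts q β e c)
    (hD : Drift q β a ρ ρ' δ K c₀) (hY : Dyn q β a ρ ρ' η K') (hηδ : 2 * η ≤ δ)
    {ε : ℝ} (hε : 0 < ε) :
    ∃ C N : ℕ, ∀ n ≥ N, ∀ s : ℕ, ρ ^ s ≤ 1 / √n → (s + 1 : ℝ) ≤ √n →
      ∀ f : Conf n q → ℝ, Symm f → (∀ τ, |f τ| ≤ 1) → ∀ X Y,
      (Pop β)^[s + C] f X - (Pop β)^[s + C] f Y ≤ ε := by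
  have : NeZero q := ⟨by omega⟩
  have hβ0 : 0 < β := lt_of_le_of_lt (Nat.cast_nonneg q) hβ
  have hη := hY.η_pos
  obtain ⟨ε', hε'⟩ : ∃ ε', ε' = ε / 9 := ⟨_, rfl⟩
  have hε'0 : 0 < ε' := by rw [hε']; positivity
  obtain ⟨R, hR0, hconc⟩ := concentration hq hβ0 hD hY hηδ hε'0
  obtain ⟨T, N₁, hT⟩ := burn_in hq hβ hC hD hY (by linarith) hε'0
  obtain ⟨α, γ, hα0, hα1, hγ, hH⟩ := harris hq hβ0 hD hY
  obtain ⟨t, ht⟩ : ∃ t : ℕ, α ^ t < ε' / (2 + 2 * (γ * R)) :=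
    exists_pow_lt_of_lt_one (by positivity) hα1
  rw [lt_div_iff₀ (by positivity)] at ht
  obtain ⟨N₂, hN₂⟩ := hH t
  obtain ⟨N₃, hN₃⟩ := exists_forall_div_le R 0 hη
  refine ⟨T + 1 + t, max 1 (max N₁ (max N₂ N₃)), fun n hn s hs1 hs2 f hf hf1 X Y => ?_⟩
  simp only [ge_iff_le, max_le_iff] at hn
  obtain ⟨hn1, hnN₁, hnN₂, hnN₃⟩ := hn
  have hn' : (0 : ℝ) < n := by exact_mod_cast hn1
  have hs0 : 0 < √(n : ℝ) := Real.sqrt_pos.2 hn'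
  have hRη := hN₃ n hnN₃
  rw [zero_div, add_zero] at hRη
  have h1 : ∀ X Y : Conf n q, dd X a ≤ R / √n → dd Y a ≤ R / √n →
      (Pop β)^[t] f X - (Pop β)^[t] f Y ≤ ε' := by
    intro X Y hX hY
    have hlyap : ∀ Z : Conf n q, dd Z a ≤ R / √n → γ * lyap a η Z ≤ γ * R := by
      intro Z hZ
      rw [lyap, if_pos (hZ.trans hRη)]
      rw [le_div_iff₀ hs0] at hZ
      exact mul_le_mul_of_nonneg_left (by linarith) hγ.le
    refine (hN₂ n hnN₂ f hf hf1 X Y).trans (le_trans ?_ ht.le)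
    refine mul_le_mul_of_nonneg_left ?_ (by positivity)
    linarith [hlyap X hX, hlyap Y hY]
  have h2 := hconc n s hn1 hs1 hs2
  have h3 : ∀ X Y : Conf n q, dd X a ≤ η → dd Y a ≤ η →
      (Pop β)^[s + 1] ((Pop β)^[t] f) X - (Pop β)^[s + 1] ((Pop β)^[t] f) Y ≤ ε' + 4 * ε' :=
    fun X Y hX hY => (Pop_iterate_isExp hβ0.le (s + 1) X).sub_le_of_osc
      (Pop_iterate_isExp hβ0.le (s + 1) Y) hε'0.le (abs_Pop_iterate_le hβ0.le hf1 t) h1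
      (h2 X hX) (h2 Y hY)
  have h4 : ∀ Z : Conf n q, (Pop β)^[s + (T + 1 + t)] f Z =
      (Pop β)^[T] ((Pop β)^[s + 1] ((Pop β)^[t] f)) Z := by
    intro Z
    rw [show s + (T + 1 + t) = T + (s + 1 + t) by ring, Pop_iterate_add, Pop_iterate_add]
  rw [h4, h4]
  refine ((Pop_iterate_isExp hβ0.le T X).sub_le_of_osc (Pop_iterate_isExp hβ0.le T Y)
    (by positivity) (abs_Pop_iterate_le hβ0.le (abs_Pop_iterate_le hβ0.le hf1 t) (s + 1)) h3
    (hT n hnN₁ X) (hT n hnN₁ Y)).trans ?_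
  rw [hε']
  linarith

/-- Average over relabellings of the vertices. -/
noncomputable def symmAvg (f : Conf n q → ℝ) : Conf n q → ℝ := fun τ =>
  avg fun φ : Equiv.Perm (Fin n) => f (τ ∘ φ)

lemma symmAvg_symm (f : Conf n q → ℝ) : Symm (symmAvg f) := by
  intro τ φ
  unfold symmAvg
  exact avg_equiv (Equiv.mulLeft φ) (fun ψ : Equiv.Perm (Fin n) => f (τ ∘ ψ))

lemma abs_symmAvg_le {f : Conf n q → ℝ} (hf : ∀ τ, |f τ| ≤ 1) (τ : Conf n q) :
    |symmAvg f τ| ≤ 1 := by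
  have h := avg_isExp (Ω := Equiv.Perm (Fin n))
  exact abs_le.2 ⟨h.const_le fun φ _ => (abs_le.1 (hf _)).1, h.le_const fun φ _ => (abs_le.1 (hf _)).2⟩

lemma Pop_iterate_symmAvg [NeZero q] (t : ℕ) (f : Conf n q → ℝ) (σ : Conf n q) :
    (Pop β)^[t] (symmAvg f) σ = avg fun φ : Equiv.Perm (Fin n) => (Pop β)^[t] f (σ ∘ φ) := by
  have ha := avg_isExp (Ω := Equiv.Perm (Fin n))
  conv_rhs => simp only [Pop_iterate_comp]
  simp only [← sum_swProb]
  unfold symmAvg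
  rw [ha.sum]
  exact sum_congr rfl fun τ _ => (ha.smul _ _).symm

/-- Quantitative loss of memory. -/
theorem mixing (hq : 2 ≤ q) (hβ : (q : ℝ) < β) (hC : Consts q β e c)
    (hD : Drift q β a ρ ρ' δ K c₀) (hY : Dyn q β a ρ ρ' η K') (hηδ : 2 * η ≤ δ)
    {ε : ℝ} (hε : 0 < ε) :
    ∃ C N : ℕ, ∀ n ≥ N, ∀ s : ℕ, ρ ^ s ≤ 1 / √n → (s + 1 : ℝ) ≤ √n →
      ∀ f : Conf n q → ℝ, (∀ τ, |f τ| ≤ 1) → ∀ X Y,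
      (Pop β)^[s + C] f X - (Pop β)^[s + C] f Y ≤ ε := by
  have : NeZero q := ⟨by omega⟩
  have hβ0 : 0 < β := lt_of_le_of_lt (Nat.cast_nonneg q) hβ
  have hq' : (2 : ℝ) ≤ q := by exact_mod_cast hq
  have hρ0 := (hD.ρ'_nonneg hq).1
  have hρ1 : ρ ≤ 1 := hD.ρ_le.trans hD.ρ'_lt.le
  obtain ⟨r, hr⟩ : ∃ r : ℝ, r = 1 - 1 / q := ⟨_, rfl⟩
  have hr0 : 0 ≤ r := by
    rw [hr, sub_nonneg, div_le_one (by linarith)]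
    linarith
  have hr1 : r ≤ 1 := by
    rw [hr]
    linarith [show (0 : ℝ) ≤ 1 / q by positivity]
  have hrρ : r < ρ := hr ▸ hD.lt_ρ
  obtain ⟨K₁, hK₁, hperm⟩ := perm_mixing (q := q) hβ0.le
  obtain ⟨C, N₁, hsym⟩ := symm_mixing hq hβ hC hD hY hηδ (ε := ε / 2) (by positivity)
  obtain ⟨S, hS⟩ : ∃ S : ℕ, (r / ρ) ^ S < ε / (4 * K₁) :=
    exists_pow_lt_of_lt_one (by positivity) ((div_lt_one hρ0).2 hrρ)
  rw [lt_div_iff₀ (by positivity)] at hS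
  obtain ⟨N₂, hN₂⟩ := exists_forall_div_le 1 0 (ε := ρ ^ S / 2) (by positivity)
  refine ⟨C + 1, max 1 (max N₁ N₂), fun n hn s hs1 hs2 f hf1 X Y => ?_⟩
  simp only [ge_iff_le, max_le_iff] at hn
  obtain ⟨hn1, hnN₁, hnN₂⟩ := hn
  have hn' : (0 : ℝ) < n := by exact_mod_cast hn1
  have hs0 : 0 < √(n : ℝ) := Real.sqrt_pos.2 hn'
  have hnS := hN₂ n hnN₂
  rw [zero_div, add_zero] at hnS
  have hSs : S ≤ s := by
    by_contra hcon
    have h1 : ρ ^ S ≤ ρ ^ s := pow_le_pow_of_le_one hρ0.le hρ1 (by omega)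
    have h2 : 0 < ρ ^ S := by positivity
    linarith
  have hbound : K₁ * (1 - 1 / q) ^ (s + C) * √n ≤ ε / 4 := by
    rw [← hr]
    rw [le_div_iff₀ hs0] at hs1
    calc K₁ * r ^ (s + C) * √n ≤ K₁ * r ^ s * √n := by
          gcongr K₁ * ?_ * √(n : ℝ)
          exact pow_le_pow_of_le_one hr0 hr1 (by omega)
      _ = K₁ * ((r / ρ) ^ s * (ρ ^ s * √n)) := by
          rw [div_pow]; field_simp
      _ ≤ K₁ * ((r / ρ) ^ S * 1) := by
          gcongr K₁ * (?_ * ?_)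
          exact pow_le_pow_of_le_one (by positivity) ((div_le_one hρ0).2 hrρ.le) hSs
      _ ≤ ε / 4 := by linarith
  have hp : ∀ Z : Conf n q, |(Pop β)^[s + (C + 1)] f Z - (Pop β)^[s + (C + 1)] (symmAvg f) Z| ≤
      ε / 4 := by
    intro Z
    have ha := avg_isExp (Ω := Equiv.Perm (Fin n))
    have h1 : (Pop β)^[s + (C + 1)] f Z - (Pop β)^[s + (C + 1)] (symmAvg f) Z =
        avg fun φ : Equiv.Perm (Fin n) =>
          (Pop β)^[s + (C + 1)] f Z - (Pop β)^[s + (C + 1)] f (Z ∘ φ) := by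
      rw [ha.sub, ha.const, Pop_iterate_symmAvg]
    rw [h1]
    refine (ha.abs_le _).trans (ha.le_const fun φ _ => ?_)
    exact (hperm n f hf1 (s + C) Z φ).trans hbound
  have h2 : (Pop β)^[s + (C + 1)] (symmAvg f) X - (Pop β)^[s + (C + 1)] (symmAvg f) Y ≤ ε / 2 := by
    have h3 : Symm (symmAvg f) := symmAvg_symm f
    have h4 := hsym n hnN₁ s hs1 hs2 (Pop β (symmAvg f)) h3.Pop
      (abs_Pop_iterate_le hβ0.le (abs_symmAvg_le hf1) 1) X Y
    rw [← add_assoc, Function.iterate_succ_apply]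
    exact h4
  have hX := abs_le.1 (hp X)
  have hY := abs_le.1 (hp Y)
  linarith [hX.1, hX.2, hY.1, hY.2]

end symmetric

/-! ### Stationarity of the Potts measure -/

section stationarity

variable {n q : ℕ} {β : ℝ}

lemma subset_monoPairs_iff {E : Finset (Fin n × Fin n)} {σ : Conf n q} :
    E ⊆ monoPairs σ ↔ (∀ p ∈ E, p.1 < p.2) ∧
      ∀ u v : Fin n, (graphOf E).Reachable u v → σ u = σ v := by
  simp only [subset_iff, monoPairs, mem_filter, mem_univ, true_and]
  constructor
  · intro h
    refine ⟨fun p hp => (h hp).1, ?_⟩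
    rintro u v ⟨w⟩
    induction w with
    | nil => rfl
    | cons hadj _ ih =>
      refine Eq.trans ?_ ih
      rcases (graphOf_adj.1 hadj).2 with h' | h'
      · exact (h h').2
      · exact (h h').2.symm
  · rintro ⟨h1, h2⟩ p hp
    refine ⟨h1 p hp, h2 _ _ (SimpleGraph.Adj.reachable (graphOf_adj.2 ⟨(h1 p hp).ne, Or.inl hp⟩))⟩

/-- The unnormalised Potts weight. -/
noncomputable def wt (β : ℝ) (σ : Conf n q) : ℝ := Real.exp (β / n * numMono σ)

lemma wt_pos (σ : Conf n q) : 0 < wt β σ := Real.exp_pos _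

lemma wt_mul_edge (σ : Conf n q) {E : Finset (Fin n × Fin n)} (hE : E ⊆ monoPairs σ) :
    wt β σ * ((1 - Real.exp (-(β / n))) ^ #E *
      Real.exp (-(β / n)) ^ (#(monoPairs σ) - #E)) = (Real.exp (β / n) - 1) ^ #E := by
  have h1 : wt β σ = Real.exp (β / n) ^ #E * Real.exp (β / n) ^ (#(monoPairs σ) - #E) := by
    rw [← pow_add, Nat.add_sub_of_le (card_le_card hE), ← Real.exp_nat_mul, wt]
    congr 1
    rw [mul_comm]
    rfl
  have h2 : Real.exp (β / n) * Real.exp (-(β / n)) = 1 := by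
    rw [← Real.exp_add, add_neg_cancel, Real.exp_zero]
  calc _ = (Real.exp (β / n) * (1 - Real.exp (-(β / n)))) ^ #E *
      (Real.exp (β / n) * Real.exp (-(β / n))) ^ (#(monoPairs σ) - #E) := by
        rw [h1, mul_pow, mul_pow]; ring
    _ = _ := by rw [h2, one_pow, mul_one, mul_sub, h2, mul_one]

lemma sum_subset_monoPairs [NeZero q] (E : Finset (Fin n × Fin n)) (τ : Conf n q) :
    (∑ σ : Conf n q, if E ⊆ monoPairs σ then (1 : ℝ) else 0) *
      (if ∀ u v : Fin n, (graphOf E).Reachable u v → τ u = τ v then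
        ((q : ℝ))⁻¹ ^ numComps E else 0) = if E ⊆ monoPairs τ then 1 else 0 := by
  by_cases hE : ∀ p ∈ E, p.1 < p.2
  · have h1 := avg_clr (q := q) E (fun _ => (1 : ℝ))
    rw [(avg_isExp (Ω := Conf n q)).const] at h1
    simp only [mul_one] at h1
    have hiff : ∀ σ : Conf n q, E ⊆ monoPairs σ ↔
        ∀ u v : Fin n, (graphOf E).Reachable u v → σ u = σ v :=
      fun σ => subset_monoPairs_iff.trans (and_iff_right hE)
    simp only [hiff]
    by_cases hτ : ∀ u v : Fin n, (graphOf E).Reachable u v → τ u = τ v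
    · rw [if_pos hτ, if_pos hτ]
      refine Eq.trans ?_ h1.symm
      rw [sum_mul]
      refine sum_congr rfl fun σ _ => ?_
      rw [ite_mul, one_mul, zero_mul]
    · rw [if_neg hτ, if_neg hτ, mul_zero]
  · simp only [subset_monoPairs_iff, hE, false_and, if_false, sum_const_zero, zero_mul]

theorem sum_wt_swStep [NeZero q] (τ : Conf n q) :
    ∑ σ : Conf n q, wt β σ * swStep n q β σ τ = wt β τ := by
  have h1 : ∀ σ : Conf n q, wt β σ * swStep n q β σ τ =
      ∑ E : Finset (Fin n × Fin n), (if E ⊆ monoPairs σ then (1 : ℝ) else 0) *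
        ((Real.exp (β / n) - 1) ^ #E *
          (if ∀ u v : Fin n, (graphOf E).Reachable u v → τ u = τ v then
            ((q : ℝ))⁻¹ ^ numComps E else 0)) := by
    intro σ
    unfold swStep
    simp only [ite_mul, one_mul, zero_mul]
    rw [← sum_filter, mul_sum]
    refine sum_congr (by ext E; simp) fun E hE => ?_
    rw [← mul_assoc, wt_mul_edge σ (mem_filter.1 hE).2]
  simp only [h1]
  rw [sum_comm]
  have h2 : ∀ E : Finset (Fin n × Fin n),
      ∑ σ : Conf n q, (if E ⊆ monoPairs σ then (1 : ℝ) else 0) *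
        ((Real.exp (β / n) - 1) ^ #E *
          (if ∀ u v : Fin n, (graphOf E).Reachable u v → τ u = τ v then
            ((q : ℝ))⁻¹ ^ numComps E else 0)) =
      if E ⊆ monoPairs τ then (Real.exp (β / n) - 1) ^ #E else 0 := by
    intro E
    rw [← sum_mul, mul_left_comm, sum_subset_monoPairs, mul_ite, mul_one, mul_zero]
  simp only [h2]
  rw [← sum_filter]
  have h3 := sum_pow_mul_eq_add_pow (Real.exp (β / n) - 1) 1 (monoPairs τ)
  simp only [one_pow, mul_one, sub_add_cancel] at h3
  rw [← Real.exp_nat_mul] at h3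
  rw [wt, mul_comm, show numMono τ = #(monoPairs τ) from rfl, ← h3]
  exact sum_congr (by ext E; simp) fun _ _ => rfl

/-- Expectation under the Potts measure. -/
noncomputable def potts (β : ℝ) (f : Conf n q → ℝ) : ℝ := ∑ σ, pottsProb n q β σ * f σ

lemma sum_wt_pos [NeZero q] : 0 < ∑ σ : Conf n q, wt β σ :=
  sum_pos (fun σ _ => wt_pos σ) univ_nonempty

lemma potts_eq (f : Conf n q → ℝ) : potts β f = (∑ σ, wt β σ * f σ) / ∑ σ : Conf n q, wt β σ := by
  rw [sum_div]
  refine sum_congr rfl fun σ _ => ?_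
  unfold pottsProb wt
  ring

lemma potts_isExp [NeZero q] : IsExp Set.univ (potts (n := n) (q := q) β) where
  add f g := by simp only [potts, mul_add, sum_add_distrib]
  smul c f := by
    unfold potts
    rw [mul_sum]
    exact sum_congr rfl fun σ _ => by ring
  mono f g h := sum_le_sum fun σ _ => mul_le_mul_of_nonneg_left (h σ (Set.mem_univ _))
    (div_nonneg (Real.exp_pos _).le (sum_nonneg fun τ _ => (Real.exp_pos _).le))
  one := by
    rw [potts_eq]
    simp only [mul_one]
    exact div_self sum_wt_pos.ne'

theorem potts_Pop [NeZero q] (f : Conf n q → ℝ) : potts β (Pop β f) = potts β f := by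
  rw [potts_eq, potts_eq]
  congr 1
  simp only [Pop_eq_sum, mul_sum]
  rw [sum_comm]
  refine sum_congr rfl fun τ _ => ?_
  simp only [← mul_assoc]
  rw [← sum_mul, sum_wt_swStep]

lemma potts_Pop_iterate [NeZero q] (t : ℕ) (f : Conf n q → ℝ) :
    potts β ((Pop β)^[t] f) = potts β f := by
  induction t with
  | zero => rfl
  | succ t ih => rw [Function.iterate_succ_apply', potts_Pop, ih]

lemma Pop_iterate_sub_potts_le [NeZero q] {f : Conf n q → ℝ} {t : ℕ} {ε : ℝ}
    (h : ∀ X Y, (Pop β)^[t] f X - (Pop β)^[t] f Y ≤ ε) (X : Conf n q) :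
    |(Pop β)^[t] f X - potts β f| ≤ ε := by
  have hm := potts_isExp (n := n) (q := q) (β := β)
  rw [← potts_Pop_iterate t f, abs_le]
  constructor
  · have := hm.le_const (f := (Pop β)^[t] f) (c := (Pop β)^[t] f X + ε) fun Y _ => by
      linarith [h Y X]
    linarith
  · have := hm.const_le (f := (Pop β)^[t] f) (c := (Pop β)^[t] f X - ε) fun Y _ => by
      linarith [h X Y]
    linarith

lemma tvDist_le_of_forall [NeZero q] {t : ℕ} {σ : Conf n q} {ε : ℝ}
    (h : ∀ f : Conf n q → ℝ, (∀ τ, |f τ| ≤ 1) → (Pop β)^[t] f σ - potts β f ≤ 2 * ε) :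
    tvDist (swProb n q β t σ) (pottsProb n q β) ≤ ε := by
  unfold tvDist
  have h1 := h (fun τ => if pottsProb n q β τ ≤ swProb n q β t σ τ then 1 else -1) fun τ => by
    split_ifs <;> simp
  rw [← sum_swProb, potts, ← sum_sub_distrib] at h1
  rw [div_le_iff₀ (by norm_num), mul_comm]
  refine le_trans (le_of_eq (sum_congr rfl fun τ _ => ?_)) h1
  split_ifs with h2
  · rw [abs_of_nonneg (by linarith)]; ring
  · rw [abs_of_neg (by linarith)]; ring

lemma sub_le_tvDist [NeZero q] (t : ℕ) (σ : Conf n q) {f : Conf n q → ℝ} (hf : ∀ τ, |f τ| ≤ 1) :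
    (Pop β)^[t] f σ - potts β f ≤ 2 * tvDist (swProb n q β t σ) (pottsProb n q β) := by
  unfold tvDist
  rw [← sum_swProb, potts, ← sum_sub_distrib, mul_div_cancel₀ _ (by norm_num)]
  refine sum_le_sum fun τ _ => ?_
  rw [← sub_mul]
  refine (le_abs_self _).trans ?_
  rw [abs_mul]
  exact mul_le_of_le_one_right (abs_nonneg _) (hf τ)

end stationarity

/-! ### Cutoff -/

section cutoff

variable {n q : ℕ} {a ρ ρ' δ K c₀ η K' β e c : ℝ}

lemma pow_le_one_div_sqrt (hρ : 0 < ρ) (hρ1 : ρ < 1) (hn : 1 ≤ n) {s : ℕ}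
    (hs : (2 * Real.log (1 / ρ))⁻¹ * Real.log n ≤ s) : ρ ^ s ≤ 1 / √n := by
  have hl : 0 < Real.log (1 / ρ) := Real.log_pos (by rw [lt_div_iff₀ hρ]; linarith)
  have hn' : (0 : ℝ) < n := by exact_mod_cast hn
  rw [inv_mul_le_iff₀ (by positivity)] at hs
  rw [← Real.log_le_log_iff (by positivity) (by positivity), Real.log_pow, one_div, Real.log_inv,
    Real.log_sqrt hn'.le]
  rw [one_div, Real.log_inv] at hs
  linarith

lemma exp_div_sqrt_le_pow (hρ : 0 < ρ) (hρ1 : ρ < 1) (hn : 1 ≤ n) {s : ℕ} {C : ℝ}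
    (hs : (s : ℝ) ≤ (2 * Real.log (1 / ρ))⁻¹ * Real.log n - C) :
    Real.exp (Real.log (1 / ρ) * C) / √n ≤ ρ ^ s := by
  have hl : 0 < Real.log (1 / ρ) := Real.log_pos (by rw [lt_div_iff₀ hρ]; linarith)
  have hn' : (0 : ℝ) < n := by exact_mod_cast hn
  rw [le_sub_iff_add_le, le_inv_mul_iff₀ (by positivity)] at hs
  rw [← Real.log_le_log_iff (by positivity) (by positivity), Real.log_pow,
    Real.log_div (Real.exp_pos _).ne' (by positivity), Real.log_exp, Real.log_sqrt hn'.le]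
  rw [one_div, Real.log_inv] at *
  linarith

lemma exists_log_add_le_sqrt (A B : ℝ) : ∃ N : ℕ, ∀ n ≥ N, 1 ≤ n ∧ A * Real.log n + B ≤ √n := by
  have h1 : (fun x : ℝ => A * Real.log x + B) =o[Filter.atTop] fun x : ℝ => √x := by
    have h2 := (isLittleO_log_rpow_atTop (r := 1 / 2) (by norm_num)).const_mul_left A
    have h3 : (fun _ : ℝ => B) =o[Filter.atTop] fun x : ℝ => x ^ (1 / 2 : ℝ) :=
      Asymptotics.isLittleO_const_left.2 (Or.inr
        (tendsto_norm_atTop_atTop.comp (tendsto_rpow_atTop (by norm_num))))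
    simpa only [Real.sqrt_eq_rpow] using h2.add h3
  have h4 := (h1.bound one_pos).natCast_atTop
  obtain ⟨N, hN⟩ := Filter.eventually_atTop.1 h4
  refine ⟨N + 1, fun n hn => ⟨by omega, ?_⟩⟩
  have h5 := hN n (by omega)
  rw [one_mul, Real.norm_eq_abs, Real.norm_eq_abs, abs_of_nonneg (Real.sqrt_nonneg _)] at h5
  exact (le_abs_self _).trans h5

lemma dd_const (hn : 1 ≤ n) (J : Fin q) : dd (fun _ : Fin n => J) 1 = 0 := by
  refine le_antisymm ((dd_le _ 1 J).trans (le_of_eq ?_)) (dd_nonneg _ _)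
  have hn' : (n : ℝ) ≠ 0 := by exact_mod_cast (by omega : n ≠ 0)
  rw [norm_eq_zero, sub_eq_zero]
  funext j
  by_cases h : J = j
  · simp [cntFrac, cntN, kap, h, hn']
  · simp [cntFrac, cntN, kap, h, Ne.symm h]

/-- Under the Potts measure the colour proportions are within `O(1/√n)` of the equilibrium. -/
lemma potts_concentration (hq : 2 ≤ q) (hβ : (q : ℝ) < β) (hC : Consts q β e c)
    (hD : Drift q β a ρ ρ' δ K c₀) (hY : Dyn q β a ρ ρ' η K') (hηδ : 2 * η ≤ δ)
    (hρ : 0 < ρ) (hρ1 : ρ < 1) {ε : ℝ} (hε : 0 < ε) :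
    ∃ R : ℝ, 0 < R ∧ ∃ N : ℕ, ∀ n ≥ N,
      potts β (fun τ : Conf n q => ind (¬ dd τ a ≤ R / √n)) ≤ 2 * ε := by
  have : NeZero q := ⟨by omega⟩
  have hβ0 : 0 < β := lt_trans (by exact_mod_cast (by omega : 0 < q)) hβ
  obtain ⟨R, hR, hconc⟩ := concentration hq hβ0 hD hY hηδ hε
  obtain ⟨T, N₁, hburn⟩ := burn_in hq hβ hC hD hY (by linarith [hY.η_pos]) hε
  obtain ⟨N₂, hN₂⟩ := exists_log_add_le_sqrt (2 * Real.log (1 / ρ))⁻¹ 2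
  refine ⟨R, hR, max N₁ N₂, fun n hn => ?_⟩
  obtain ⟨hn1, hlog⟩ := hN₂ n (le_trans (le_max_right _ _) hn)
  have hl : 0 < Real.log (1 / ρ) := Real.log_pos (by rw [lt_div_iff₀ hρ]; linarith)
  have hx : 0 ≤ (2 * Real.log (1 / ρ))⁻¹ * Real.log n :=
    mul_nonneg (by positivity) (Real.log_natCast_nonneg n)
  set s := ⌈(2 * Real.log (1 / ρ))⁻¹ * Real.log n⌉₊ with hs
  have hs1 := Nat.le_ceil ((2 * Real.log (1 / ρ))⁻¹ * Real.log n)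
  have hs2 := Nat.ceil_lt_add_one hx
  rw [← hs] at hs1 hs2
  have hpow := pow_le_one_div_sqrt hρ hρ1 hn1 hs1
  have h1 := hconc n s hn1 hpow (by linarith)
  set g : Conf n q → ℝ := fun τ => ind (¬ dd τ a ≤ R / √n) with hg
  rw [← potts_Pop_iterate (s + 1) g, ← potts_Pop_iterate T]
  refine potts_isExp.le_const fun X _ => ?_
  have h2 := hburn n (le_trans (le_max_left _ _) hn) X
  have hE := Pop_iterate_isExp (n := n) hβ0.le T X
  calc (Pop β)^[T] ((Pop β)^[s + 1] g) X
      ≤ (Pop β)^[T] (fun τ => ind (¬ dd τ a ≤ η) + ε) X := hE.mono _ _ fun τ _ => by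
        by_cases h : dd τ a ≤ η
        · linarith [h1 τ h, ind_nonneg (¬ dd τ a ≤ η)]
        · rw [ind_true h]
          have := (Pop_iterate_isExp hβ0.le (s + 1) τ).le_const (f := g) (c := 1)
            fun x _ => ind_le_one _
          linarith
    _ = (Pop β)^[T] (fun τ => ind (¬ dd τ a ≤ η)) X + ε := by
        rw [hE.add, hE.const]
    _ ≤ 2 * ε := by linarith

theorem mixingTime_upper (hq : 2 ≤ q) (hβ : (q : ℝ) < β) (hC : Consts q β e c)
    (hD : Drift q β a ρ ρ' δ K c₀) (hY : Dyn q β a ρ ρ' η K') (hηδ : 2 * η ≤ δ)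
    (hρ : 0 < ρ) (hρ1 : ρ < 1) {ε : ℝ} (hε : 0 < ε) :
    ∃ C : ℝ, ∃ N : ℕ, ∀ n ≥ N, ∃ t : ℕ, (t : ℝ) ≤ (2 * Real.log (1 / ρ))⁻¹ * Real.log n + C ∧
      ∀ σ : Conf n q, tvDist (swProb n q β t σ) (pottsProb n q β) ≤ ε := by
  have : NeZero q := ⟨by omega⟩
  obtain ⟨C, N₁, hmix⟩ := mixing hq hβ hC hD hY hηδ (ε := 2 * ε) (by positivity)
  obtain ⟨N₂, hN₂⟩ := exists_log_add_le_sqrt (2 * Real.log (1 / ρ))⁻¹ 2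
  refine ⟨C + 1, max N₁ N₂, fun n hn => ?_⟩
  obtain ⟨hn1, hlog⟩ := hN₂ n (le_trans (le_max_right _ _) hn)
  have hl : 0 < Real.log (1 / ρ) := Real.log_pos (by rw [lt_div_iff₀ hρ]; linarith)
  have hx : 0 ≤ (2 * Real.log (1 / ρ))⁻¹ * Real.log n :=
    mul_nonneg (by positivity) (Real.log_natCast_nonneg n)
  set s := ⌈(2 * Real.log (1 / ρ))⁻¹ * Real.log n⌉₊ with hs
  have hs1 := Nat.le_ceil ((2 * Real.log (1 / ρ))⁻¹ * Real.log n)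
  have hs2 := Nat.ceil_lt_add_one hx
  rw [← hs] at hs1 hs2
  have hpow := pow_le_one_div_sqrt hρ hρ1 hn1 hs1
  refine ⟨s + C, by push_cast; linarith, fun σ => tvDist_le_of_forall fun f hf => ?_⟩
  exact (_root_.abs_le.1 (Pop_iterate_sub_potts_le
    (hmix n (le_trans (le_max_left _ _) hn) s hpow (by linarith) f hf) σ)).2

theorem mixingTime_lower (hq : 2 ≤ q) (hβ : (q : ℝ) < β) (hC : Consts q β e c)
    (hD : Drift q β a ρ ρ' δ K c₀) (hY : Dyn q β a ρ ρ' η K') (hηδ : 2 * η ≤ δ)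
    (hρ : 0 < ρ) (hρ1 : ρ < 1) {ε : ℝ} (hε : ε < 1) :
    ∃ C : ℝ, ∃ N : ℕ, ∀ n ≥ N, ∀ t : ℕ,
      (t : ℝ) ≤ (2 * Real.log (1 / ρ))⁻¹ * Real.log n - C →
      ∃ σ : Conf n q, ε < tvDist (swProb n q β t σ) (pottsProb n q β) := by
  have : NeZero q := ⟨by omega⟩
  have hq0 : (2 : ℝ) ≤ q := by exact_mod_cast hq
  have hβ0 : 0 < β := by linarith
  set p : ℝ := (1 - ε) / 6 with hp
  have hp0 : 0 < p := by rw [hp]; linarith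
  have hl : 0 < Real.log (1 / ρ) := Real.log_pos (by rw [lt_div_iff₀ hρ]; linarith)
  obtain ⟨R, hR, N₁, hpot⟩ := potts_concentration hq hβ hC hD hY hηδ hρ hρ1 hp0
  obtain ⟨N₂, hN₂⟩ := exists_log_add_le_sqrt (2 * Real.log (1 / ρ))⁻¹ 0
  set A : ℝ := |K' / (1 - ρ')| + K' + 1 with hA
  have hK' := hY.K_pos
  have hA0 : 0 < A := by positivity
  have hc₀ := hD.c₀_pos
  set M : ℝ := (R + A / p + 1) / c₀ with hM
  have hM0 : 0 < M := by positivity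
  refine ⟨M / Real.log (1 / ρ), max N₁ N₂, fun n hn t ht => ?_⟩
  obtain ⟨hn1, hlog⟩ := hN₂ n (le_trans (le_max_right _ _) hn)
  have hn0 : (0 : ℝ) < n := by exact_mod_cast hn1
  have hsn : 0 < √(n : ℝ) := Real.sqrt_pos.2 hn0
  have ht' : (t : ℝ) ≤ √n := by
    have : 0 ≤ M / Real.log (1 / ρ) := by positivity
    linarith
  have hpow := exp_div_sqrt_le_pow hρ hρ1 hn1 ht
  rw [mul_div_cancel₀ _ hl.ne'] at hpow
  have hpow' : M / √n ≤ ρ ^ t := by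
    refine le_trans (div_le_div_of_nonneg_right ?_ hsn.le) hpow
    linarith [Real.add_one_le_exp M]
  have hgap : (F q β)^[t] 1 - A / √n / p > a + R / √n := by
    have h1 := hD.iter_ge t
    have h2 : c₀ * (M / √n) ≤ c₀ * ρ ^ t := mul_le_mul_of_nonneg_left hpow' hc₀.le
    have h3 : c₀ * (M / √n) = R / √n + A / √n / p + 1 / √n := by
      rw [hM]; field_simp
    have h4 : 0 < 1 / √(n : ℝ) := by positivity
    linarith
  let σ : Conf n q := fun _ => 0
  refine ⟨σ, ?_⟩
  have hE := Pop_iterate_isExp (n := n) hβ0.le t σ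
  have hd : dd σ 1 = 0 := dd_const hn1 _
  have htrack := hY.track hq hβ0 hD (by linarith [hY.η_pos]) hn1 t σ (y := 1)
    ⟨by linarith [hD.a_lt, hY.η_pos], le_rfl⟩ (by rw [hd]; exact hY.η_pos.le)
  rw [hd, mul_zero, zero_add] at htrack
  have hmean : (Pop β)^[t] (fun τ => dd τ ((F q β)^[t] 1)) σ ≤ A / √n := by
    refine htrack.trans ?_
    have h1 : (t : ℝ) * (K' / n) ≤ K' / √n := by
      calc (t : ℝ) * (K' / n) ≤ √n * (K' / n) := mul_le_mul_of_nonneg_right ht' (by positivity)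
        _ = K' * (√n / n) := by ring
        _ = K' / √n := by rw [Real.sqrt_div_self]; ring
    have h2 : K' / (1 - ρ') / √n ≤ |K' / (1 - ρ')| / √n :=
      div_le_div_of_nonneg_right (le_abs_self _) hsn.le
    have h3 : 0 ≤ 1 / √(n : ℝ) := by positivity
    rw [hA, add_div, add_div]
    linarith
  have hmarkov : (Pop β)^[t] (fun τ => ind (A / √n / p ≤ dd τ ((F q β)^[t] 1))) σ ≤ p := by
    refine (hE.markov (fun τ _ => dd_nonneg _ _) (by positivity)).trans ?_
    rw [div_le_iff₀ (by positivity), mul_div_cancel₀ _ hp0.ne']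
    exact hmean
  let B : Conf n q → Prop := fun τ => ∃ i, a + R / √n < cntFrac τ i
  have hlow : 1 - p ≤ (Pop β)^[t] (fun τ => ind (B τ)) σ := by
    have h1 : (Pop β)^[t] (fun τ => 1 - ind (A / √n / p ≤ dd τ ((F q β)^[t] 1))) σ ≤
        (Pop β)^[t] (fun τ => ind (B τ)) σ := hE.mono _ _ fun τ _ => by
      rw [← ind_not]
      refine ind_mono fun h => ?_
      obtain ⟨i, hi⟩ := le_cntFrac_of_dd_le τ (not_le.1 h).le
      exact ⟨i, by linarith⟩
    rw [hE.sub, hE.one] at h1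
    linarith
  have hup : potts β (fun τ : Conf n q => ind (B τ)) ≤ 2 * p := by
    refine le_trans (potts_isExp.mono _ _ fun τ _ => ind_mono fun hB h => ?_)
      (hpot n (le_trans (le_max_left _ _) hn))
    obtain ⟨i, hi⟩ := hB
    obtain ⟨J, hJ⟩ := exists_dd_eq τ a
    have h1 := norm_le_pi_norm (cntFrac τ - kap q J a) i
    rw [hJ, Pi.sub_apply, Real.norm_eq_abs] at h1
    have h2 : kap q J a i ≤ a := by
      unfold kap
      split_ifs
      · exact le_rfl
      · have h3 := hD.a_gt
        rw [div_lt_iff₀ (by linarith)] at h3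
        rw [div_le_iff₀ (by linarith)]
        linarith
    linarith [le_abs_self (cntFrac τ i - kap q J a i)]
  have htv := sub_le_tvDist (β := β) t σ (f := fun τ => 2 * ind (B τ) - 1) fun τ => by
    have h1 := ind_nonneg (B τ)
    have h2 := ind_le_one (B τ)
    rw [_root_.abs_le]
    constructor <;> linarith
  rw [hE.sub, hE.smul, hE.one, potts_isExp.sub, potts_isExp.smul, potts_isExp.one] at htv
  linarith

end cutoff

end SW

/-- Theorem 1: for `q ≥ 2` and `β > q`, the mean-field SW dynamics
exhibits cutoff at `c(β,q) log n` with an `Θ(1)` cutoff window: for every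
`ε ∈ (0,1)` there is a constant `C(ε) > 0` with
`c(β,q) log n - C ≤ τ_mix(ε) ≤ c(β,q) log n + C` for all large `n`. -/
theorem sw_cutoff (q : ℕ) (hq : 2 ≤ q) (β : ℝ) (hβ : (q : ℝ) < β)
    (ε : ℝ) (hε : ε ∈ Set.Ioo (0 : ℝ) 1) :
    ∃ C : ℝ, 0 < C ∧ ∃ N : ℕ, ∀ n : ℕ, N ≤ n →
      cConst q β * Real.log n - C ≤ (mixingTime n q β ε : ℝ) ∧
      (mixingTime n q β ε : ℝ) ≤ cConst q β * Real.log n + C := by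
  obtain ⟨e, c, hC⟩ := SW.exists_consts hq hβ
  obtain ⟨ρ, ρ', δ, K, c₀, hD, hderiv, hb⟩ := SW.exists_drift hq hβ hC
  obtain ⟨η, K', -, hηδ, hY⟩ := SW.exists_dyn hq hβ hC hD hb one_pos
  have hρ : 0 < ρ := (SW.Drift.ρ'_nonneg hq hD).1
  have hρ1 : ρ < 1 := hD.ρ_le.trans_lt hD.ρ'_lt
  obtain ⟨C₁, N₁, hup⟩ := SW.mixingTime_upper hq hβ hC hD hY hηδ hρ hρ1 hε.1
  obtain ⟨C₂, N₂, hlow⟩ := SW.mixingTime_lower hq hβ hC hD hY hηδ hρ hρ1 hε.2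
  have hc : cConst q β = (2 * Real.log (1 / ρ))⁻¹ := by rw [cConst, hderiv.deriv]
  refine ⟨|C₁| + |C₂| + 1, by positivity, max N₁ N₂, fun n hn => ?_⟩
  obtain ⟨t, ht, hmem⟩ := hup n (le_trans (le_max_left _ _) hn)
  have hC₁ := le_abs_self C₁
  have hC₂ := le_abs_self C₂
  have hC₁' := abs_nonneg C₁
  have hC₂' := abs_nonneg C₂
  rw [hc]
  constructor
  · by_contra! hlt
    obtain ⟨σ, hσ⟩ := hlow n (le_trans (le_max_right _ _) hn) (mixingTime n q β ε) (by linarith)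
    exact absurd (Nat.sInf_mem (s := {t : ℕ | ∀ σ : Conf n q,
      tvDist (swProb n q β t σ) (pottsProb n q β) ≤ ε}) ⟨t, hmem⟩ σ) (not_le.2 hσ)
  · have h1 : (mixingTime n q β ε : ℝ) ≤ t := by
      exact_mod_cast Nat.sInf_le (s := {t : ℕ | ∀ σ : Conf n q,
        tvDist (swProb n q β t σ) (pottsProb n q β) ≤ ε}) hmem
    linarith
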